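/- There exist constants C, c > 0 such that for all ε ∈ (0, 1]: sup_{θ⋆ ∈ F_4(ξ)} P( sup_{λ ∈ [λ_min, λ_max]} W₂(μ̂_{(θ̂^d_λ, θ⋆)}, μ^{(d)}_λ) ≥ ε ) ≤ (C/ε^{11}) e^{−c N ε^{17}}. -/

import Mathlib

open MeasureTheory ProbabilityTheory
open scoped ENNReal NNReal

noncomputable section

/-- Standard Gaussian density φ. -/
def gphi (x : ℝ) : ℝ := Real.exp (-x ^ 2 / 2) / Real.sqrt (2 * Real.pi)

/-- Standard Gaussian CDF Φ. -/
def gPhi (x : ℝ) : ℝ := ∫ t in Set.Iic x, gphi t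

/-- Soft thresholding η(x; b) = sign(x)(|x| − b)₊. -/
def eta (x b : ℝ) : ℝ := Real.sign x * max (|x| - b) 0

/-- Derivative in x of soft thresholding: η′(x; b) = 1_{|x| > b}. -/
def eta' (x b : ℝ) : ℝ := if b < |x| then 1 else 0

/-- The ℓ_p ball F_p(ξ) = {x : (1/N) ∑ |xᵢ|^p ≤ ξ^p}. -/
def Fball (N : ℕ) (p ξ : ℝ) : Set (Fin N → ℝ) :=
  {x | (1 / (N : ℝ)) * ∑ i, |x i| ^ p ≤ ξ ^ p}

/-- Number of nonzero entries ‖x‖₀. -/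
def l0 {N : ℕ} (x : Fin N → ℝ) : ℕ := (Finset.univ.filter fun i => x i ≠ 0).card

/-- The ℓ₀ ball F_0(s) = {x : ‖x‖₀ ≤ sN}. -/
def F0ball (N : ℕ) (s : ℝ) : Set (Fin N → ℝ) := {x | (l0 x : ℝ) ≤ s * N}

/-- The critical sparsity s_max(δ). -/
def smax (δ : ℝ) : ℝ :=
  δ * sSup ((fun α : ℝ =>
      (1 - (2 / δ) * ((1 + α ^ 2) * gPhi (-α) - α * gphi α)) /
      (1 + α ^ 2 - 2 * ((1 + α ^ 2) * gPhi (-α) - α * gphi α))) '' Set.Ici 0)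

/-- Empirical distribution of the entries of a vector. -/
def empDist {N : ℕ} (θ : Fin N → ℝ) : Measure ℝ :=
  ((N : ℝ≥0∞))⁻¹ • ∑ i : Fin N, Measure.dirac (θ i)

/-- Empirical distribution of pairs of entries of two vectors. -/
def empDist2 {N : ℕ} (u v : Fin N → ℝ) : Measure (ℝ × ℝ) :=
  ((N : ℝ≥0∞))⁻¹ • ∑ i : Fin N, Measure.dirac (u i, v i)

/-- Squared order-2 Wasserstein distance between measures on ℝ². -/
def W2sq (μ ν : Measure (ℝ × ℝ)) : ℝ :=
  sInf {r : ℝ | ∃ γ : Measure ((ℝ × ℝ) × (ℝ × ℝ)),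
    γ.map Prod.fst = μ ∧ γ.map Prod.snd = ν ∧
    r = ∫ q, ((q.1.1 - q.2.1) ^ 2 + (q.1.2 - q.2.2) ^ 2) ∂γ}

/-- Order-2 Wasserstein distance. -/
def W2 (μ ν : Measure (ℝ × ℝ)) : ℝ := Real.sqrt (W2sq μ ν)

/-- Standard Gaussian measure on ℝ. -/
def stdG : Measure ℝ := gaussianReal 0 1

/-- The state-evolution fixed point equations (for (Θ,Z) ∼ μ ⊗ N(0,1)),
together with positivity of (β, τ). -/
def StateEvo (δ σ : ℝ) (μ : Measure ℝ) (lam β τ : ℝ) : Prop :=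
  0 < β ∧ 0 < τ ∧
  τ ^ 2 = σ ^ 2 + (1 / δ) *
    ∫ q : ℝ × ℝ, (eta (q.1 + τ * q.2) (τ * lam / β) - q.1) ^ 2 ∂(μ.prod stdG) ∧
  β = τ * (1 - (1 / δ) *
    ∫ q : ℝ × ℝ, eta' (q.1 + τ * q.2) (τ * lam / β) ∂(μ.prod stdG))

/-- s⋆ = P(|Θ + τZ| ≥ ατ) for (Θ,Z) ∼ μ ⊗ N(0,1). -/
def sStar (μ : Measure ℝ) (τ α : ℝ) : ℝ :=
  ((μ.prod stdG) {q : ℝ × ℝ | α * τ ≤ |q.1 + τ * q.2|}).toReal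

/-- The limit law μ⋆: law of (η(Θ + τZ; ατ), Θ) for (Θ,Z) ∼ μ ⊗ N(0,1). -/
def muStar (μ : Measure ℝ) (τ α : ℝ) : Measure (ℝ × ℝ) :=
  (μ.prod stdG).map (fun q => (eta (q.1 + τ * q.2) (α * τ), q.1))

/-- The limit law for the debiased Lasso: law of (Θ + τZ, Θ). -/
def muStarD (μ : Measure ℝ) (τ : ℝ) : Measure (ℝ × ℝ) :=
  (μ.prod stdG).map (fun q => (q.1 + τ * q.2, q.1))

/-- Law of the design matrix: i.i.d. N(0, 1/n) entries. -/
def PX (n N : ℕ) : Measure (Fin n → Fin N → ℝ) :=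
  Measure.pi fun _ => Measure.pi fun _ => gaussianReal 0 ((n : ℝ≥0))⁻¹

/-- Law of the noise: i.i.d. standard Gaussian entries. -/
def Pz (n : ℕ) : Measure (Fin n → ℝ) :=
  Measure.pi fun _ => gaussianReal 0 1

/-- Joint law of (X, z). -/
def Pmodel (n N : ℕ) : Measure ((Fin n → Fin N → ℝ) × (Fin n → ℝ)) :=
  (PX n N).prod (Pz n)

/-- The response y = Xθ⋆ + σz. -/
def yvec {n N : ℕ} (σ : ℝ) (θstar : Fin N → ℝ) (X : Fin n → Fin N → ℝ)
    (z : Fin n → ℝ) : Fin n → ℝ :=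
  fun i => (∑ j, X i j * θstar j) + σ * z i

/-- The Lasso cost (1/(2n))‖y − Xθ‖² + (λ/n)‖θ‖₁. -/
def lassoCost {n N : ℕ} (X : Fin n → Fin N → ℝ) (y : Fin n → ℝ) (lam : ℝ)
    (θ : Fin N → ℝ) : ℝ :=
  (1 / (2 * (n : ℝ))) * ∑ i, (y i - ∑ j, X i j * θ j) ^ 2
    + (lam / (n : ℝ)) * ∑ j, |θ j|

/-- The uniformity class: D is either an ℓ_p ball F_p(ξ) or an ℓ₀ ball F_0(s) with
s below the critical sparsity, with the corresponding exponent q. -/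
def DFamSpec (δ : ℝ) (Dfam : (M : ℕ) → Set (Fin M → ℝ)) (q : ℝ) : Prop :=
  (∃ p ξ : ℝ, 0 < p ∧ 0 < ξ ∧ (∀ M, Dfam M = Fball M p ξ) ∧ q = max (1 / p - 1) 0) ∨
  (∃ s : ℝ, 0 ≤ s ∧ s < smax δ ∧ (∀ M, Dfam M = F0ball M s) ∧ q = 0)

/-- The debiased Lasso estimator θ̂ᵈ = θ̂ + Xᵀ(y − Xθ̂)/(1 − ‖θ̂‖₀/n). -/
def debiased {n N : ℕ} (X : Fin n → Fin N → ℝ) (y : Fin n → ℝ)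
    (θ : Fin N → ℝ) : Fin N → ℝ :=
  fun j => θ j + (∑ i, X i j * (y i - ∑ j', X i j' * θ j')) / (1 - (l0 θ : ℝ) / (n : ℝ))

/-- Standard Gaussian measure on `ι → ℝ`. -/
abbrev stdPi (ι : Type*) [Fintype ι] : Measure (ι → ℝ) :=
  Measure.pi fun _ => gaussianReal 0 1

/-- The function `exp (x² / 4)` is integrable for the standard Gaussian. -/
lemma integrable_exp_sq_div_four :
    Integrable (fun x : ℝ => Real.exp (x ^ 2 / 4)) (gaussianReal 0 1) := by
  rw [gaussianReal_of_var_ne_zero _ one_ne_zero,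
    integrable_withDensity_iff (measurable_gaussianPDF 0 1)
      (Filter.Eventually.of_forall fun x => gaussianPDF_lt_top)]
  have h := (integrable_exp_neg_mul_sq (b := 1 / 4) (by norm_num)).const_mul
    ((Real.sqrt (2 * Real.pi))⁻¹)
  refine h.congr (Filter.Eventually.of_forall fun x => ?_)
  simp only [toReal_gaussianPDF, gaussianPDFReal]
  rw [mul_left_comm, ← Real.exp_add]
  simp
  left
  ring_nf

lemma three_abs_le (x : ℝ) : 3 * |x| ≤ 9 + x ^ 2 / 4 := by
  have := sq_nonneg (|x| / 2 - 3)
  have h2 : |x| ^ 2 = x ^ 2 := sq_abs x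
  nlinarith

/-- Sub-quadratic-exponential domination gives Gaussian integrability. -/
lemma integrable_gaussian_of_le {f : ℝ → ℝ} (hf : AEStronglyMeasurable f (gaussianReal 0 1))
    (A : ℝ) (h : ∀ x, |f x| ≤ A * Real.exp (x ^ 2 / 4)) : Integrable f (gaussianReal 0 1) :=
  (integrable_exp_sq_div_four.const_mul A).mono' hf (Filter.Eventually.of_forall h)

lemma integrable_gaussian_of_le_sq {f : ℝ → ℝ} (hf : AEStronglyMeasurable f (gaussianReal 0 1))
    (A : ℝ) (h : ∀ x, |f x| ≤ A * (1 + x ^ 2)) : Integrable f (gaussianReal 0 1) := by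
  have hA : 0 ≤ A := by
    have := (abs_nonneg _).trans (h 0); simpa using this
  refine integrable_gaussian_of_le hf (4 * A) fun x => (h x).trans ?_
  have := Real.add_one_le_exp (x ^ 2 / 4)
  nlinarith [sq_nonneg x]

/-- One-dimensional Cameron–Martin formula. -/
lemma integral_gaussian_shift (f : ℝ → ℝ) (t : ℝ) :
    ∫ x, f (x + t) ∂(gaussianReal 0 1) =
      ∫ x, f x * Real.exp (t * x - t ^ 2 / 2) ∂(gaussianReal 0 1) := by
  rw [integral_gaussianReal_eq_integral_smul one_ne_zero,
    integral_gaussianReal_eq_integral_smul one_ne_zero,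
    ← integral_sub_right_eq_self _ t]
  congr 1
  ext x
  simp only [gaussianPDFReal, smul_eq_mul, sub_add_cancel]
  have : Real.exp (-(x - t - 0) ^ 2 / (2 * ((1 : ℝ≥0) : ℝ))) =
      Real.exp (-(x - 0) ^ 2 / (2 * ((1 : ℝ≥0) : ℝ))) * Real.exp (t * x - t ^ 2 / 2) := by
    rw [← Real.exp_add]; congr 1; push_cast; ring
  rw [this]; ring

/-- Stein's identity for Lipschitz functions that are differentiable almost everywhere. -/
theorem stein_lipschitz {f f' : ℝ → ℝ} {K : ℝ≥0} (hf : LipschitzWith K f)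
    (hf' : ∀ᵐ x ∂(gaussianReal 0 1), HasDerivAt f (f' x) x)
    (hm : AEStronglyMeasurable f' (gaussianReal 0 1)) :
    ∫ x, x * f x ∂(gaussianReal 0 1) = ∫ x, f' x ∂(gaussianReal 0 1) := by
  have hfb : ∀ x, |f x| ≤ (|f 0| + K) * Real.exp |x| := by
    intro x
    have h1 : |f x - f 0| ≤ K * |x| := by
      have := hf.dist_le_mul x 0
      simpa [Real.dist_eq] using this
    have h2 : |f x| ≤ |f 0| + K * |x| := by
      have := abs_sub_abs_le_abs_sub (f x) (f 0); linarith
    have h3 := Real.add_one_le_exp |x|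
    have h4 : (1 : ℝ) ≤ Real.exp |x| := Real.one_le_exp (abs_nonneg x)
    have h5 : (0 : ℝ) ≤ K := K.2
    nlinarith [abs_nonneg (f 0), abs_nonneg x]
  have hfint : Integrable f (gaussianReal 0 1) := by
    refine integrable_gaussian_of_le hf.continuous.aestronglyMeasurable
      ((|f 0| + K) * Real.exp 9) fun x => (hfb x).trans ?_
    have h0 : 0 ≤ |f 0| + (K : ℝ) := add_nonneg (abs_nonneg _) K.2
    rw [mul_assoc, ← Real.exp_add]
    refine mul_le_mul_of_nonneg_left (Real.exp_le_exp.2 ?_) h0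
    linarith [three_abs_le x, abs_nonneg x]
  have h1 : HasDerivAt (fun t => ∫ x, f (x + t) ∂(gaussianReal 0 1))
      (∫ x, f' x ∂(gaussianReal 0 1)) 0 := by
    refine (hasDerivAt_integral_of_dominated_loc_of_lip (F := fun t x => f (x + t))
      (bound := fun _ => (K : ℝ)) (s := Set.univ) Filter.univ_mem
      (Filter.Eventually.of_forall fun t => ?_) (by simpa using hfint) hm
      (Filter.Eventually.of_forall fun x => ?_) (integrable_const _) ?_).2
    · exact (hf.continuous.comp (continuous_id.add continuous_const)).aestronglyMeasurable
    · have : LipschitzWith K (fun t => f (x + t)) :=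
        LipschitzWith.of_dist_le_mul fun a b => by
          simpa using hf.dist_le_mul (x + a) (x + b)
      simpa [lipschitzOnWith_univ] using this
    · filter_upwards [hf'] with x hx
      have : HasDerivAt f (f' x) (x + 0) := by simpa using hx
      simpa using this.comp_const_add x 0
  have h2 : HasDerivAt (fun t => ∫ x, f x * Real.exp (t * x - t ^ 2 / 2) ∂(gaussianReal 0 1))
      (∫ x, f x * (Real.exp (0 * x - 0 ^ 2 / 2) * (x - 0)) ∂(gaussianReal 0 1)) 0 := by
    refine (hasDerivAt_integral_of_dominated_loc_of_deriv_le
      (F' := fun t x => f x * (Real.exp (t * x - t ^ 2 / 2) * (x - t)))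
      (bound := fun x => (|f 0| + K) * Real.exp 10 * Real.exp (x ^ 2 / 4))
      (s := Metric.ball 0 1) (Metric.ball_mem_nhds _ one_pos)
      (Filter.Eventually.of_forall fun t => ?_) ?_ ?_
      (Filter.Eventually.of_forall fun x t ht => ?_)
      (integrable_exp_sq_div_four.const_mul _)
      (Filter.Eventually.of_forall fun x t ht => ?_)).2
    · exact (hf.continuous.mul (by fun_prop)).aestronglyMeasurable
    · simpa using hfint
    · exact (hf.continuous.mul (by fun_prop)).aestronglyMeasurable
    · rw [Metric.mem_ball, dist_zero_right, Real.norm_eq_abs] at ht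
      rw [Real.norm_eq_abs, abs_mul, abs_mul, abs_of_pos (Real.exp_pos _)]
      have e1 : Real.exp (t * x - t ^ 2 / 2) ≤ Real.exp |x| := by
        refine Real.exp_le_exp.2 ?_
        have : t * x ≤ |t| * |x| := by rw [← abs_mul]; exact le_abs_self _
        nlinarith [sq_nonneg t, abs_nonneg x]
      have e2 : |x - t| ≤ Real.exp |x| := by
        have := abs_sub x t
        have h3 := Real.add_one_le_exp |x|
        linarith
      have h0 : 0 ≤ |f 0| + (K : ℝ) := add_nonneg (abs_nonneg _) K.2
      calc |f x| * (Real.exp (t * x - t ^ 2 / 2) * |x - t|)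
          ≤ ((|f 0| + K) * Real.exp |x|) * (Real.exp |x| * Real.exp |x|) := by
            gcongr; exact hfb x
        _ = (|f 0| + K) * Real.exp (3 * |x|) := by
            rw [← Real.exp_add, mul_assoc, ← Real.exp_add]; ring_nf
        _ ≤ (|f 0| + K) * Real.exp (10 + x ^ 2 / 4) := by
            refine mul_le_mul_of_nonneg_left (Real.exp_le_exp.2 ?_) h0
            linarith [three_abs_le x]
        _ = _ := by rw [Real.exp_add, mul_assoc]
    · have h : HasDerivAt (fun t : ℝ => t * x - t ^ 2 / 2) (x - t) t := by
        refine HasDerivAt.congr_deriv (f' := 1 * x - (2 * t) / 2) ?_ (by ring)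
        refine ((hasDerivAt_id' t).mul_const x).sub (HasDerivAt.div_const ?_ 2)
        simpa using hasDerivAt_pow 2 t
      exact (h.exp).const_mul (f x)
  have h3 : (fun t => ∫ x, f (x + t) ∂(gaussianReal 0 1)) =
      fun t => ∫ x, f x * Real.exp (t * x - t ^ 2 / 2) ∂(gaussianReal 0 1) :=
    funext fun t => integral_gaussian_shift f t
  rw [h3] at h1
  rw [h1.unique h2]
  congr 1; ext x; simp [mul_comm]

/-- Resampling one coordinate preserves a product measure. -/
lemma measurePreserving_update {ι : Type*} [Fintype ι] [DecidableEq ι] (μ : Measure ℝ)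
    [IsProbabilityMeasure μ] (k : ι) :
    MeasurePreserving (fun p : (ι → ℝ) × ℝ => Function.update p.1 k p.2)
      ((Measure.pi fun _ : ι => μ).prod μ) (Measure.pi fun _ : ι => μ) := by
  have hm : Measurable fun p : (ι → ℝ) × ℝ => Function.update p.1 k p.2 := by
    refine measurable_pi_lambda _ fun j => ?_
    by_cases h : j = k
    · subst h; simpa using measurable_snd
    · simp only [Function.update_of_ne h]; fun_prop
  refine ⟨hm, ?_⟩
  symm
  refine Measure.pi_eq fun s hs => ?_
  rw [Measure.map_apply hm (MeasurableSet.univ_pi hs)]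
  have : (fun p : (ι → ℝ) × ℝ => Function.update p.1 k p.2) ⁻¹' (Set.univ.pi s) =
      (Set.univ.pi (Function.update s k Set.univ)) ×ˢ (s k) := by
    ext p
    simp only [Set.mem_preimage, Set.mem_pi, Set.mem_univ, true_implies, Set.mem_prod]
    constructor
    · intro h
      refine ⟨fun i => ?_, by simpa using h k⟩
      by_cases hi : i = k
      · subst hi; simp
      · simpa [Function.update_of_ne hi] using h i
    · rintro ⟨h1, h2⟩ i
      by_cases hi : i = k
      · subst hi; simpa using h2
      · simpa [Function.update_of_ne hi] using h1 i
  rw [this, Measure.prod_prod, Measure.pi_pi,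
    ← Finset.mul_prod_erase Finset.univ (fun i => μ (s i)) (Finset.mem_univ k),
    ← Finset.mul_prod_erase Finset.univ _ (Finset.mem_univ k)]
  simp only [Function.update_self, measure_univ, one_mul]
  rw [mul_comm]
  congr 1
  refine Finset.prod_congr rfl fun i hi => ?_
  rw [Function.update_of_ne (Finset.ne_of_mem_erase hi)]

/-- Gaussian integration by parts along a coordinate, for bounded functions with bounded
partial derivative. -/
theorem stdPi_integral_by_parts {ι : Type*} [Fintype ι] [DecidableEq ι] (k : ι)
    {H H' : (ι → ℝ) → ℝ} (hH : Continuous H) (hH' : Continuous H') {A B : ℝ}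
    (hA : ∀ x, |H x| ≤ A) (hB : ∀ x, |H' x| ≤ B)
    (hd : ∀ x : ι → ℝ, ∀ y : ℝ, HasDerivAt (fun y => H (Function.update x k y))
      (H' (Function.update x k y)) y) :
    ∫ x, x k * H x ∂(stdPi ι) = ∫ x, H' x ∂(stdPi ι) := by
  have mp := measurePreserving_update (gaussianReal 0 1) k
  have hxk : Integrable (fun x : ι → ℝ => x k) (stdPi ι) := by
    have := (measurePreserving_eval (fun _ : ι => gaussianReal 0 1) k).integrable_comp
      (g := id) (by fun_prop)
    exact this.2 (memLp_one_iff_integrable.1 (memLp_id_gaussianReal 1))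
  have hi1 : Integrable (fun x => x k * H x) (stdPi ι) :=
    hxk.mul_bdd (c := A) hH.aestronglyMeasurable (Filter.Eventually.of_forall hA)
  have hi2 : Integrable H' (stdPi ι) :=
    (integrable_const B).mono' hH'.aestronglyMeasurable (Filter.Eventually.of_forall hB)
  have hB0 : 0 ≤ B := (abs_nonneg _).trans (hB 0)
  have e1 : ∀ F : (ι → ℝ) → ℝ, Integrable F (stdPi ι) → ∫ x, F x ∂(stdPi ι) =
      ∫ x, ∫ y, F (Function.update x k y) ∂(gaussianReal 0 1) ∂(stdPi ι) := by
    intro F hF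
    have h1 : ∫ x, F x ∂(stdPi ι) =
        ∫ p, F (Function.update p.1 k p.2) ∂((stdPi ι).prod (gaussianReal 0 1)) := by
      conv_lhs => rw [stdPi, ← mp.map_eq]
      rw [integral_map mp.measurable.aemeasurable]
      rw [mp.map_eq]; exact hF.aestronglyMeasurable
    rw [h1, integral_prod]
    exact (mp.integrable_comp hF.aestronglyMeasurable).2 hF
  rw [e1 _ hi1, e1 _ hi2]
  congr 1
  ext x
  simp only [Function.update_self]
  refine stein_lipschitz (K := ⟨B, hB0⟩) ?_ (Filter.Eventually.of_forall (hd x)) ?_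
  · refine lipschitzWith_of_nnnorm_deriv_le (fun y => (hd x y).differentiableAt) fun y => ?_
    rw [(hd x y).deriv]
    exact hB _
  · exact (hH'.comp (by fun_prop)).aestronglyMeasurable

/-- `F` satisfies the chain rule along differentiable curves with partial derivatives `F1`. -/
def HasPartials {P : Type*} [Fintype P] (F : (P → ℝ) → ℝ) (F1 : P → (P → ℝ) → ℝ) : Prop :=
  ∀ (c : ℝ → P → ℝ) (c' : P → ℝ) (t : ℝ), (∀ a, HasDerivAt (fun t => c t a) (c' a) t) →
    HasDerivAt (fun t => F (c t)) (∑ a, F1 a (c t) * c' a) t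

lemma HasPartials.mul {P : Type*} [Fintype P] {F G : (P → ℝ) → ℝ} {F1 G1 : P → (P → ℝ) → ℝ}
    (hF : HasPartials F F1) (hG : HasPartials G G1) :
    HasPartials (fun x => F x * G x) (fun a x => F1 a x * G x + F x * G1 a x) := by
  intro c c' t h
  refine ((hF c c' t h).mul (hG c c' t h)).congr_deriv ?_
  simp only [Finset.sum_mul, Finset.mul_sum, ← Finset.sum_add_distrib]
  exact Finset.sum_congr rfl fun a _ => by ring

lemma hasPartials_mvPolynomial {P : Type*} [Fintype P] [DecidableEq P] (p : MvPolynomial P ℝ) :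
    HasPartials (fun x => MvPolynomial.eval x p)
      (fun a x => MvPolynomial.eval x (MvPolynomial.pderiv a p)) := by
  intro c c' t h
  induction p using MvPolynomial.induction_on with
  | C r => simpa using hasDerivAt_const t r
  | add p q hp hq =>
    simp only [map_add, add_mul, Finset.sum_add_distrib]
    exact hp.add hq
  | mul_X p i hp =>
    simp only [map_mul, MvPolynomial.eval_X]
    refine (hp.mul (h i)).congr_deriv ?_
    simp only [Derivation.leibniz, MvPolynomial.pderiv_X, smul_eq_mul, map_add, map_mul,
      MvPolynomial.eval_X, add_mul, Finset.sum_add_distrib]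
    rw [add_comm, Finset.sum_mul]
    congr 1
    · rw [Finset.sum_eq_single i]
      · simp
      · intro b _ hb; simp [hb.symm]
      · simp
    · exact Finset.sum_congr rfl fun a _ => by ring

lemma HasPartials.comp_coord {P : Type*} [Fintype P] {F : (P → ℝ) → ℝ}
    {F1 : P → (P → ℝ) → ℝ} (hF : HasPartials F F1) {h h' : P → ℝ → ℝ}
    (hh : ∀ a x, HasDerivAt (h a) (h' a x) x) :
    HasPartials (fun x => F (fun a => h a (x a)))
      (fun a x => F1 a (fun a => h a (x a)) * h' a (x a)) := by
  intro c c' t hc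
  have := hF (fun t a => h a (c t a)) (fun a => h' a (c t a) * c' a) t
    fun a => (hh a (c t a)).comp t (hc a)
  refine this.congr_deriv (Finset.sum_congr rfl fun a _ => by ring)

lemma hasPartials_coord {P : Type*} [Fintype P] [DecidableEq P] {h h' : ℝ → ℝ} (a : P)
    (hh : ∀ x, HasDerivAt h (h' x) x) :
    HasPartials (fun x : P → ℝ => h (x a)) (fun b x => if b = a then h' (x a) else 0) := by
  intro c c' t hc
  refine ((hh _).comp t (hc a)).congr_deriv ?_
  simp

/-- Gaussian interpolation: derivative of the expectation along the rotation path. -/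
lemma hasDerivAt_interpolation {P K : Type*} [Fintype P] [Fintype K] [DecidableEq K]
    {F : (P → ℝ) → ℝ} {F1 : P → (P → ℝ) → ℝ} {F2 : P → P → (P → ℝ) → ℝ}
    (h1 : HasPartials F F1) (h2 : ∀ a, HasPartials (F1 a) (F2 a))
    (c0 : Continuous F) (c1 : ∀ a, Continuous (F1 a)) (c2 : ∀ a b, Continuous (F2 a b))
    {A : ℝ} (b0 : ∀ x, |F x| ≤ A) (b1 : ∀ a x, |F1 a x| ≤ A) (b2 : ∀ a b x, |F2 a b x| ≤ A)
    (u v : P → K → ℝ) (huv : ∀ a b, ∑ k, u a k * v b k = 0) (s : ℝ) :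
    HasDerivAt (fun s => ∫ ω, F (fun a => ∑ k, (Real.cos s * u a k + Real.sin s * v a k) * ω k)
        ∂(stdPi K))
      (Real.sin s * Real.cos s * ∑ a, ∑ b, (∑ k, v a k * v b k - ∑ k, u a k * u b k) *
        ∫ ω, F2 a b (fun a => ∑ k, (Real.cos s * u a k + Real.sin s * v a k) * ω k)
          ∂(stdPi K)) s := by
  classical
  set Z : ℝ → (K → ℝ) → P → ℝ :=
    fun s ω a => ∑ k, (Real.cos s * u a k + Real.sin s * v a k) * ω k with hZ
  have cZ : ∀ s, Continuous (Z s) := fun s => by fun_prop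
  have hA : 0 ≤ A := (abs_nonneg _).trans (b0 0)
  have hZd : ∀ s ω a, HasDerivAt (fun s => Z s ω a)
      (∑ k, (-Real.sin s * u a k + Real.cos s * v a k) * ω k) s := by
    intro s ω a
    refine HasDerivAt.fun_sum fun k _ => HasDerivAt.mul_const ?_ _
    exact ((Real.hasDerivAt_cos s).mul_const _).add ((Real.hasDerivAt_sin s).mul_const _)
  have hxk : ∀ k : K, Integrable (fun x : K → ℝ => x k) (stdPi K) := fun k => by
    have := (measurePreserving_eval (fun _ : K => gaussianReal 0 1) k).integrable_comp
      (g := id) (by fun_prop)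
    exact this.2 (memLp_one_iff_integrable.1 (memLp_id_gaussianReal 1))
  have hF1i : ∀ a k s, Integrable (fun ω => ω k * F1 a (Z s ω)) (stdPi K) := fun a k s =>
    (hxk k).mul_bdd (c := A) ((c1 a).comp (cZ s)).aestronglyMeasurable
      (Filter.Eventually.of_forall fun ω => b1 a _)
  have hF2i : ∀ a b s, Integrable (fun ω => F2 a b (Z s ω)) (stdPi K) := fun a b s =>
    (integrable_const A).mono' ((c2 a b).comp (cZ s)).aestronglyMeasurable
      (Filter.Eventually.of_forall fun ω => b2 a b _)
  have ibp : ∀ a k, ∫ ω, ω k * F1 a (Z s ω) ∂(stdPi K) =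
      ∑ b, (Real.cos s * u b k + Real.sin s * v b k) * ∫ ω, F2 a b (Z s ω) ∂(stdPi K) := by
    intro a k
    rw [stdPi_integral_by_parts k (H := fun ω => F1 a (Z s ω))
      (H' := fun ω => ∑ b, (Real.cos s * u b k + Real.sin s * v b k) * F2 a b (Z s ω))
      ((c1 a).comp (cZ s)) (continuous_finsetSum _ fun b _ =>
        continuous_const.mul ((c2 a b).comp (cZ s))) (A := A)
      (B := ∑ b, |Real.cos s * u b k + Real.sin s * v b k| * A) (fun ω => b1 a _)
      (fun ω => (Finset.abs_sum_le_sum_abs _ _).trans (Finset.sum_le_sum fun b _ => by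
        rw [abs_mul]; exact mul_le_mul_of_nonneg_left (b2 a b _) (abs_nonneg _))) ?_]
    · rw [integral_finsetSum _ fun b _ => (hF2i a b s).const_mul _]
      exact Finset.sum_congr rfl fun b _ => integral_const_mul _ _
    · intro x y
      refine (h2 a (fun y => Z s (Function.update x k y))
        (fun b => Real.cos s * u b k + Real.sin s * v b k) y fun b => ?_).congr_deriv
        (Finset.sum_congr rfl fun b _ => by ring)
      have : ∀ j, HasDerivAt (fun y => (Real.cos s * u b j + Real.sin s * v b j) *
          Function.update x k y j)
          (if j = k then (Real.cos s * u b j + Real.sin s * v b j) else 0) y := by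
        intro j
        by_cases hj : j = k
        · subst hj; simpa using (hasDerivAt_id y).const_mul (Real.cos s * u b j + Real.sin s * v b j)
        · simp only [Function.update_of_ne hj, hj, if_false]
          exact hasDerivAt_const _ _
      simpa using HasDerivAt.fun_sum (u := Finset.univ) fun j _ => this j
  have key : HasDerivAt (fun s => ∫ ω, F (Z s ω) ∂(stdPi K))
      (∫ ω, ∑ a, F1 a (Z s ω) * ∑ k, (-Real.sin s * u a k + Real.cos s * v a k) * ω k
        ∂(stdPi K)) s := by
    refine (hasDerivAt_integral_of_dominated_loc_of_deriv_le
      (F' := fun s ω => ∑ a, F1 a (Z s ω) *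
        ∑ k, (-Real.sin s * u a k + Real.cos s * v a k) * ω k)
      (bound := fun ω => ∑ a, A * ∑ k, (|u a k| + |v a k|) * |ω k|)
      (s := Set.univ) Filter.univ_mem
      (Filter.Eventually.of_forall fun t => (c0.comp (cZ t)).aestronglyMeasurable)
      ((integrable_const A).mono' (c0.comp (cZ s)).aestronglyMeasurable
      (Filter.Eventually.of_forall fun ω => b0 _)) ?_
      (Filter.Eventually.of_forall fun ω t _ => ?_) ?_
      (Filter.Eventually.of_forall fun ω t _ => ?_)).2
    · refine Continuous.aestronglyMeasurable (continuous_finsetSum _ fun a _ => ?_)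
      exact ((c1 a).comp (cZ s)).mul (by fun_prop)
    · refine (Finset.abs_sum_le_sum_abs _ _).trans (Finset.sum_le_sum fun a _ => ?_)
      rw [abs_mul]
      refine mul_le_mul (b1 a _) ?_ (abs_nonneg _) hA
      refine (Finset.abs_sum_le_sum_abs _ _).trans (Finset.sum_le_sum fun k _ => ?_)
      rw [abs_mul]
      refine mul_le_mul_of_nonneg_right ((abs_add_le _ _).trans ?_) (abs_nonneg _)
      rw [abs_mul, abs_mul, abs_neg]
      have := Real.abs_sin_le_one t
      have := Real.abs_cos_le_one t
      have := abs_nonneg (u a k)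
      have := abs_nonneg (v a k)
      nlinarith
    · exact integrable_finsetSum _ fun a _ => (integrable_finsetSum _ fun k _ =>
        (hxk k).abs.const_mul _).const_mul _
    · exact h1 (fun t => Z t ω) _ t fun a => hZd t ω a
  refine key.congr_deriv ?_
  have e : ∀ ω, ∑ a, F1 a (Z s ω) * ∑ k, (-Real.sin s * u a k + Real.cos s * v a k) * ω k =
      ∑ a, ∑ k, (-Real.sin s * u a k + Real.cos s * v a k) * (ω k * F1 a (Z s ω)) := by
    intro ω
    refine Finset.sum_congr rfl fun a _ => ?_
    rw [Finset.mul_sum]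
    exact Finset.sum_congr rfl fun k _ => by ring
  simp_rw [e]
  rw [integral_finsetSum _ fun a _ => integrable_finsetSum _ fun k _ => (hF1i a k s).const_mul _]
  rw [Finset.mul_sum]
  refine Finset.sum_congr rfl fun a _ => ?_
  rw [integral_finsetSum _ fun k _ => (hF1i a k s).const_mul _]
  simp_rw [integral_const_mul, ibp, Finset.mul_sum]
  rw [Finset.sum_comm]
  refine Finset.sum_congr rfl fun b _ => ?_
  simp_rw [← mul_assoc, ← Finset.sum_mul]
  congr 1
  have e2 : ∀ k, (-Real.sin s * u a k + Real.cos s * v a k) *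
      (Real.cos s * u b k + Real.sin s * v b k) =
      Real.sin s * Real.cos s * (v a k * v b k) - Real.sin s * Real.cos s * (u a k * u b k)
      - Real.sin s ^ 2 * (u a k * v b k) + Real.cos s ^ 2 * (u b k * v a k) := fun k => by ring
  simp_rw [e2, Finset.sum_add_distrib, Finset.sum_sub_distrib, ← Finset.mul_sum, huv]
  ring

/-- A twice continuously differentiable step function. -/
lemma exists_smooth_step : ∃ (S S' S'' : ℝ → ℝ) (B : ℝ), (∀ x, HasDerivAt S (S' x) x) ∧
    (∀ x, HasDerivAt S' (S'' x) x) ∧ Continuous S'' ∧ (∀ x, S x ∈ Set.Icc (0 : ℝ) 1) ∧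
    (∀ x ≤ 0, S x = 0) ∧ (∀ x, 1 ≤ x → S x = 1) ∧ (∀ x, 0 ≤ S' x) ∧ (∀ x, |S' x| ≤ B) ∧
    (∀ x, |S'' x| ≤ B) := by
  have hc : ContDiff ℝ 3 Real.smoothTransition := Real.smoothTransition.contDiff
  have hmono : Monotone Real.smoothTransition := Real.smoothTransition.monotone
  have hc1 : ContDiff ℝ 2 (deriv Real.smoothTransition) :=
    hc.iterate_deriv' 2 1
  have hc2 : ContDiff ℝ 1 (deriv (deriv Real.smoothTransition)) :=
    hc.iterate_deriv' 1 2
  have z1 : ∀ x, x ∉ Set.Icc (0 : ℝ) 1 → deriv Real.smoothTransition x = 0 := by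
    intro x hx
    rw [Set.mem_Icc, not_and_or, not_le, not_le] at hx
    rcases hx with hx | hx
    · rw [Filter.EventuallyEq.deriv_eq (f := fun _ => (0 : ℝ)), deriv_const]
      filter_upwards [gt_mem_nhds hx] with y hy
      exact Real.smoothTransition.zero_of_nonpos (le_of_lt hy)
    · rw [Filter.EventuallyEq.deriv_eq (f := fun _ => (1 : ℝ)), deriv_const]
      filter_upwards [lt_mem_nhds hx] with y hy
      exact Real.smoothTransition.one_of_one_le (le_of_lt hy)
  have z2 : ∀ x, x ∉ Set.Icc (0 : ℝ) 1 → deriv (deriv Real.smoothTransition) x = 0 := by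
    intro x hx
    rw [Filter.EventuallyEq.deriv_eq (f := fun _ => (0 : ℝ)), deriv_const]
    filter_upwards [isClosed_Icc.isOpen_compl.mem_nhds hx] with y hy using z1 y hy
  have bdd : ∀ f : ℝ → ℝ, Continuous f → (∀ x, x ∉ Set.Icc (0 : ℝ) 1 → f x = 0) →
      ∃ B, ∀ x, |f x| ≤ B := by
    intro f hf hz
    obtain ⟨B, hB⟩ := isCompact_Icc.exists_bound_of_continuousOn (s := Set.Icc (0 : ℝ) 1)
      hf.continuousOn
    refine ⟨B, fun x => ?_⟩
    by_cases hx : x ∈ Set.Icc (0 : ℝ) 1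
    · exact hB x hx
    · rw [hz x hx, abs_zero]; exact (norm_nonneg _).trans (hB 0 (by simp))
  obtain ⟨B1, h1⟩ := bdd _ hc1.continuous z1
  obtain ⟨B2, h2⟩ := bdd _ hc2.continuous z2
  exact ⟨Real.smoothTransition, deriv Real.smoothTransition,
    deriv (deriv Real.smoothTransition), max B1 B2,
    fun x => (hc.differentiable (by norm_num) x).hasDerivAt,
    fun x => (hc1.differentiable (by norm_num) x).hasDerivAt, hc2.continuous,
    fun x => ⟨Real.smoothTransition.nonneg x, Real.smoothTransition.le_one x⟩,
    fun x hx => Real.smoothTransition.zero_of_nonpos hx,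
    fun x hx => Real.smoothTransition.one_of_one_le hx, fun x => hmono.deriv_nonneg,
    fun x => (h1 x).trans (le_max_left _ _), fun x => (h2 x).trans (le_max_right _ _)⟩

open MvPolynomial in
/-- The multi-affine polynomial `∏ i, (1 - ∏ j, X (i, j))`. -/
def gordonPoly (I J : Type*) [Fintype I] [Fintype J] : MvPolynomial (I × J) ℝ :=
  ∏ i : I, (1 - ∏ j : J, X (i, j))

lemma derivation_leibniz_prod {R A α : Type*} [CommRing R] [CommRing A] [Algebra R A]
    [DecidableEq α] (D : Derivation R A A) (s : Finset α) (f : α → A) :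
    D (∏ i ∈ s, f i) = ∑ i ∈ s, (∏ j ∈ s.erase i, f j) * D (f i) := by
  induction s using Finset.induction_on with
  | empty => simp
  | insert a s ha ih =>
    rw [Finset.prod_insert ha, Derivation.leibniz, ih, Finset.sum_insert ha,
      Finset.erase_insert ha, smul_eq_mul, smul_eq_mul, Finset.mul_sum, add_comm]
    congr 1
    refine Finset.sum_congr rfl fun i hi => ?_
    have : a ≠ i := fun h => ha (h ▸ hi)
    rw [Finset.erase_insert_of_ne this, Finset.prod_insert fun h => ha (Finset.mem_of_mem_erase h)]
    ring

lemma pderiv_prod_X_same {I J : Type*} [Fintype I] [Fintype J] [DecidableEq I] [DecidableEq J]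
    (i : I) (j : J) : MvPolynomial.pderiv (R := ℝ) (i, j) (∏ j' : J, MvPolynomial.X (i, j')) =
      ∏ j' ∈ Finset.univ.erase j, MvPolynomial.X (i, j') := by
  rw [derivation_leibniz_prod, Finset.sum_eq_single j]
  · simp
  · intro b _ hb
    simp [MvPolynomial.pderiv_X, hb]
  · simp

lemma pderiv_prod_X_ne {I J : Type*} [Fintype I] [Fintype J] [DecidableEq I] [DecidableEq J]
    {i i' : I} (h : i' ≠ i) (j : J) (s : Finset J) :
    MvPolynomial.pderiv (R := ℝ) (i, j) (∏ j' ∈ s, MvPolynomial.X (i', j')) = 0 := by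
  rw [derivation_leibniz_prod]
  refine Finset.sum_eq_zero fun b _ => ?_
  simp [MvPolynomial.pderiv_X, h]

lemma pderiv_gordonPoly {I J : Type*} [Fintype I] [Fintype J] [DecidableEq I] [DecidableEq J]
    (i : I) (j : J) : MvPolynomial.pderiv (i, j) (gordonPoly I J) =
      -((∏ i' ∈ Finset.univ.erase i, (1 - ∏ j' : J, MvPolynomial.X (i', j'))) *
        ∏ j' ∈ Finset.univ.erase j, MvPolynomial.X (i, j')) := by
  rw [gordonPoly, derivation_leibniz_prod, Finset.sum_eq_single i]
  · rw [map_sub, pderiv_prod_X_same]; simp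
  · intro b _ hb
    rw [map_sub, pderiv_prod_X_ne hb]; simp
  · simp

lemma pderiv_pderiv_gordonPoly {I J : Type*} [Fintype I] [Fintype J] [DecidableEq I]
    [DecidableEq J] {i i' : I} (h : i ≠ i') (j j' : J) :
    MvPolynomial.pderiv (i', j') (MvPolynomial.pderiv (i, j) (gordonPoly I J)) =
      (∏ l ∈ (Finset.univ.erase i).erase i', (1 - ∏ m : J, MvPolynomial.X (l, m))) *
        (∏ m ∈ Finset.univ.erase j', MvPolynomial.X (i', m)) *
        ∏ m ∈ Finset.univ.erase j, MvPolynomial.X (i, m) := by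
  rw [pderiv_gordonPoly, map_neg, Derivation.leibniz, pderiv_prod_X_ne h,
    derivation_leibniz_prod, Finset.sum_eq_single i']
  · rw [map_sub, pderiv_prod_X_same]
    simp
    ring
  · intro b _ hb
    rw [map_sub, pderiv_prod_X_ne hb]; simp
  · intro hh; exact absurd (by simp [h.symm]) hh

lemma eval_prod_X_mem {P : Type*} [Fintype P] {α : Type*} (s : Finset α) (f : α → P) {x : P → ℝ}
    (hx : ∀ a, x a ∈ Set.Icc (0 : ℝ) 1) :
    MvPolynomial.eval x (∏ a ∈ s, MvPolynomial.X (f a)) ∈ Set.Icc (0 : ℝ) 1 := by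
  rw [map_prod]
  simp only [MvPolynomial.eval_X]
  exact ⟨Finset.prod_nonneg fun a _ => (hx _).1, Finset.prod_le_one (fun a _ => (hx _).1)
    fun a _ => (hx _).2⟩

lemma eval_pderiv_pderiv_gordonPoly_nonneg {I J : Type*} [Fintype I] [Fintype J] [DecidableEq I]
    [DecidableEq J] {i i' : I} (h : i ≠ i') (j j' : J) {x : I × J → ℝ}
    (hx : ∀ a, x a ∈ Set.Icc (0 : ℝ) 1) :
    0 ≤ MvPolynomial.eval x
      (MvPolynomial.pderiv (i', j') (MvPolynomial.pderiv (i, j) (gordonPoly I J))) := by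
  rw [pderiv_pderiv_gordonPoly h, map_mul, map_mul]
  refine mul_nonneg (mul_nonneg ?_ (eval_prod_X_mem _ _ hx).1) (eval_prod_X_mem _ _ hx).1
  rw [map_prod]
  refine Finset.prod_nonneg fun l _ => ?_
  rw [map_sub, map_one]
  linarith [(eval_prod_X_mem Finset.univ (fun m : J => (l, m)) hx).2]

lemma stdPi_map_inl {K L : Type*} [Fintype K] [Fintype L] :
    (stdPi (K ⊕ L)).map (fun ω k => ω (Sum.inl k)) = stdPi K := by
  have h := (measurePreserving_sumPiEquivProdPi (fun _ : K ⊕ L => gaussianReal 0 1))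
  have := (measurePreserving_fst (μ := stdPi K) (ν := stdPi L)).comp h
  exact this.map_eq

lemma stdPi_map_inr {K L : Type*} [Fintype K] [Fintype L] :
    (stdPi (K ⊕ L)).map (fun ω k => ω (Sum.inr k)) = stdPi L := by
  have h := (measurePreserving_sumPiEquivProdPi (fun _ : K ⊕ L => gaussianReal 0 1))
  have := (measurePreserving_snd (μ := stdPi K) (ν := stdPi L)).comp h
  exact this.map_eq

set_option maxHeartbeats 1000000 in
/-- Gordon's comparison inequality for linear Gaussian processes. -/
theorem gordon_comparison {I J K L : Type*} [Fintype I] [Fintype J] [Fintype K] [Fintype L]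
    (a : I → J → K → ℝ) (b : I → J → L → ℝ)
    (hsame : ∀ i j j', ∑ k, a i j k * a i j' k = ∑ l, b i j l * b i j' l)
    (hdiff : ∀ i i', i ≠ i' → ∀ j j', ∑ l, b i j l * b i' j' l ≤ ∑ k, a i j k * a i' j' k)
    (t : I → J → ℝ) {κ : ℝ} (hκ : 0 < κ) :
    (stdPi K).real {ω | ∃ i, ∀ j, ∑ k, a i j k * ω k ≤ t i j} ≤
      (stdPi L).real {ω | ∃ i, ∀ j, ∑ l, b i j l * ω l ≤ t i j + κ} := by
  classical
  obtain ⟨S, S', S'', B, dS, dS', cS'', mS, S0, S1, pS', bS', bS''⟩ := exists_smooth_step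
  have cS : Continuous S := continuous_iff_continuousAt.2 fun x => (dS x).continuousAt
  have cS' : Continuous S' := continuous_iff_continuousAt.2 fun x => (dS' x).continuousAt
  set h : I × J → ℝ → ℝ := fun p x => 1 - S ((x - t p.1 p.2) / κ) with hh
  set h' : I × J → ℝ → ℝ := fun p x => -(S' ((x - t p.1 p.2) / κ) * (1 / κ)) with hh'
  set h'' : I × J → ℝ → ℝ := fun p x => -(S'' ((x - t p.1 p.2) / κ) * (1 / κ) * (1 / κ)) with hh''
  have dh : ∀ p x, HasDerivAt (h p) (h' p x) x := fun p x =>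
    ((dS _).comp x (((hasDerivAt_id x).sub_const _).div_const κ)).const_sub 1
  have dh' : ∀ p x, HasDerivAt (h' p) (h'' p x) x := fun p x =>
    (((dS' _).comp x (((hasDerivAt_id x).sub_const _).div_const κ)).mul_const _).neg
  have ch : ∀ p, Continuous (h p) := fun p => by fun_prop
  have ch' : ∀ p, Continuous (h' p) := fun p => by fun_prop
  have ch'' : ∀ p, Continuous (h'' p) := fun p => by fun_prop
  have mh : ∀ p x, h p x ∈ Set.Icc (0 : ℝ) 1 := fun p x => by
    have := mS ((x - t p.1 p.2) / κ)
    simp only [hh, Set.mem_Icc] at this ⊢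
    constructor <;> linarith
  have ph' : ∀ p x, h' p x ≤ 0 := fun p x => by
    have := pS' ((x - t p.1 p.2) / κ)
    simp only [hh', neg_nonpos]
    positivity
  have hB : 0 ≤ B := (abs_nonneg _).trans (bS' 0)
  set B' := B * (1 / κ) + B * (1 / κ) * (1 / κ) with hB'
  have bh' : ∀ p x, |h' p x| ≤ B' := fun p x => by
    simp only [hh', abs_neg, abs_mul, abs_of_pos (one_div_pos.2 hκ)]
    have := mul_le_mul_of_nonneg_right (bS' ((x - t p.1 p.2) / κ)) (one_div_pos.2 hκ).le
    have : 0 ≤ B * (1 / κ) * (1 / κ) := by positivity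
    linarith
  have bh'' : ∀ p x, |h'' p x| ≤ B' := fun p x => by
    simp only [hh'', abs_neg, abs_mul, abs_of_pos (one_div_pos.2 hκ)]
    have := mul_le_mul_of_nonneg_right (mul_le_mul_of_nonneg_right
      (bS'' ((x - t p.1 p.2) / κ)) (one_div_pos.2 hκ).le) (one_div_pos.2 hκ).le
    have : 0 ≤ B * (1 / κ) := by positivity
    linarith
  have hB'0 : 0 ≤ B' := by positivity
  have bpoly : ∀ p : MvPolynomial (I × J) ℝ, ∃ C, ∀ x : I × J → ℝ,
      (∀ a, x a ∈ Set.Icc (0 : ℝ) 1) → |MvPolynomial.eval x p| ≤ C := by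
    intro p
    obtain ⟨C, hC⟩ := (isCompact_univ_pi fun _ : I × J => isCompact_Icc
      (a := (0 : ℝ)) (b := 1)).exists_bound_of_continuousOn
      (f := fun x => MvPolynomial.eval x p) (MvPolynomial.continuous_eval p).continuousOn
    exact ⟨C, fun x hx => hC x fun a _ => hx a⟩
  set p := gordonPoly I J with hp
  set H : (I × J → ℝ) → (I × J → ℝ) := fun x a => h a (x a) with hH
  have cH : Continuous H := continuous_pi fun a => (ch a).comp (continuous_apply a)
  have mH : ∀ x a, H x a ∈ Set.Icc (0 : ℝ) 1 := fun x a => mh _ _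
  set F : (I × J → ℝ) → ℝ := fun x => MvPolynomial.eval (H x) p with hF
  set F1 : I × J → (I × J → ℝ) → ℝ := fun a x =>
    MvPolynomial.eval (H x) (MvPolynomial.pderiv a p) * h' a (x a) with hF1
  set F2 : I × J → I × J → (I × J → ℝ) → ℝ := fun a b x =>
    MvPolynomial.eval (H x) (MvPolynomial.pderiv b (MvPolynomial.pderiv a p)) * h' b (x b)
      * h' a (x a) + MvPolynomial.eval (H x) (MvPolynomial.pderiv a p) *
      (if b = a then h'' a (x a) else 0) with hF2
  have hp1 : HasPartials F F1 := (hasPartials_mvPolynomial p).comp_coord dh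
  have hp2 : ∀ a, HasPartials (F1 a) (F2 a) := fun a =>
    ((hasPartials_mvPolynomial (MvPolynomial.pderiv a p)).comp_coord dh).mul
      (hasPartials_coord a (dh' a))
  have cpoly : ∀ q : MvPolynomial (I × J) ℝ, Continuous fun x => MvPolynomial.eval (H x) q :=
    fun q => (MvPolynomial.continuous_eval q).comp cH
  have c1 : ∀ a, Continuous (F1 a) := fun a =>
    (cpoly _).mul ((ch' a).comp (continuous_apply a))
  have c2 : ∀ a b, Continuous (F2 a b) := fun a b => by
    refine (((cpoly _).mul ((ch' b).comp (continuous_apply b))).mul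
      ((ch' a).comp (continuous_apply a))).add ((cpoly _).mul ?_)
    split_ifs
    · exact (ch'' a).comp (continuous_apply a)
    · exact continuous_const
  choose Cp hCp using bpoly
  have hCp0 : ∀ q, 0 ≤ Cp q := fun q =>
    (abs_nonneg _).trans (hCp q (fun _ => 0) fun _ => by simp)
  set A : ℝ := Cp p + ∑ a, Cp (MvPolynomial.pderiv a p) * B' +
    ∑ a, ∑ b, Cp (MvPolynomial.pderiv b (MvPolynomial.pderiv a p)) * B' * B' with hA
  have s1 : 0 ≤ ∑ a, Cp (MvPolynomial.pderiv a p) * B' :=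
    Finset.sum_nonneg fun a _ => mul_nonneg (hCp0 _) hB'0
  have s2 : 0 ≤ ∑ a, ∑ b, Cp (MvPolynomial.pderiv b (MvPolynomial.pderiv a p)) * B' * B' :=
    Finset.sum_nonneg fun a _ => Finset.sum_nonneg fun b _ =>
      mul_nonneg (mul_nonneg (hCp0 _) hB'0) hB'0
  have b0 : ∀ x, |F x| ≤ A := fun x => by
    have := hCp p (H x) (mH x)
    simp only [hF, hA]; linarith
  have s1' : ∀ a, Cp (MvPolynomial.pderiv a p) * B' ≤ ∑ a, Cp (MvPolynomial.pderiv a p) * B' :=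
    fun a => Finset.single_le_sum (f := fun a => Cp (MvPolynomial.pderiv a p) * B')
      (fun a _ => mul_nonneg (hCp0 _) hB'0) (Finset.mem_univ a)
  have b1 : ∀ a x, |F1 a x| ≤ A := fun a x => by
    have h1 : |F1 a x| ≤ Cp (MvPolynomial.pderiv a p) * B' := by
      simp only [hF1, abs_mul]
      exact mul_le_mul (hCp _ _ (mH x)) (bh' _ _) (abs_nonneg _) (hCp0 _)
    have := s1' a
    have := hCp0 p
    linarith
  have b2 : ∀ a b x, |F2 a b x| ≤ A := fun a b x => by
    have h1 : |MvPolynomial.eval (H x) (MvPolynomial.pderiv b (MvPolynomial.pderiv a p)) *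
        h' b (x b) * h' a (x a)| ≤
        Cp (MvPolynomial.pderiv b (MvPolynomial.pderiv a p)) * B' * B' := by
      rw [abs_mul, abs_mul]
      exact mul_le_mul (mul_le_mul (hCp _ _ (mH x)) (bh' _ _) (abs_nonneg _) (hCp0 _))
        (bh' _ _) (abs_nonneg _) (mul_nonneg (hCp0 _) hB'0)
    have h2 : |MvPolynomial.eval (H x) (MvPolynomial.pderiv a p) *
        (if b = a then h'' a (x a) else 0)| ≤ Cp (MvPolynomial.pderiv a p) * B' := by
      rw [abs_mul]
      refine mul_le_mul (hCp _ _ (mH x)) ?_ (abs_nonneg _) (hCp0 _)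
      split_ifs
      · exact bh'' _ _
      · simpa using hB'0
    have h3 := s1' a
    have h4 : Cp (MvPolynomial.pderiv b (MvPolynomial.pderiv a p)) * B' * B' ≤
        ∑ a, ∑ b, Cp (MvPolynomial.pderiv b (MvPolynomial.pderiv a p)) * B' * B' :=
      (Finset.single_le_sum (f := fun b => Cp (MvPolynomial.pderiv b (MvPolynomial.pderiv a p))
        * B' * B') (fun b _ => mul_nonneg (mul_nonneg (hCp0 _) hB'0) hB'0)
        (Finset.mem_univ b)).trans
      (Finset.single_le_sum (f := fun a => ∑ b, Cp (MvPolynomial.pderiv b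
        (MvPolynomial.pderiv a p)) * B' * B') (fun a _ => Finset.sum_nonneg fun b _ =>
        mul_nonneg (mul_nonneg (hCp0 _) hB'0) hB'0) (Finset.mem_univ a))
    have := hCp0 p
    have := abs_add_le (MvPolynomial.eval (H x) (MvPolynomial.pderiv b
      (MvPolynomial.pderiv a p)) * h' b (x b) * h' a (x a))
      (MvPolynomial.eval (H x) (MvPolynomial.pderiv a p) * (if b = a then h'' a (x a) else 0))
    simp only [hF2]
    linarith
  -- the two independent processes on the sum space
  set v : I × J → K ⊕ L → ℝ := fun p => Sum.elim (a p.1 p.2) 0 with hv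
  set u : I × J → K ⊕ L → ℝ := fun p => Sum.elim 0 (b p.1 p.2) with hu
  have huv : ∀ p q, ∑ k, u p k * v q k = 0 := fun p q => by simp [hu, hv]
  have hvv : ∀ p q, ∑ k, v p k * v q k = ∑ k, a p.1 p.2 k * a q.1 q.2 k := fun p q => by
    simp [hv]
  have huu : ∀ p q, ∑ k, u p k * u q k = ∑ k, b p.1 p.2 k * b q.1 q.2 k := fun p q => by
    simp [hu]
  set φ : ℝ → ℝ := fun s => ∫ ω, F (fun a => ∑ k, (Real.cos s * u a k + Real.sin s * v a k) * ω k)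
        ∂(stdPi (K ⊕ L)) with hφ
  have hd := hasDerivAt_interpolation hp1 hp2 (cpoly p) c1 c2 b0 b1 b2 u v huv
  have hmono : φ 0 ≤ φ (Real.pi / 2) := by
    refine monotoneOn_of_deriv_nonneg (convex_Icc 0 (Real.pi / 2)) (f := φ)
      (fun s _ => (hd s).continuousAt.continuousWithinAt)
      (fun s _ => (hd s).differentiableAt.differentiableWithinAt) (fun s hs => ?_)
      ⟨le_rfl, Real.pi_div_two_pos.le⟩ ⟨Real.pi_div_two_pos.le, le_rfl⟩ Real.pi_div_two_pos.le
    rw [interior_Icc] at hs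
    rw [(hd s).deriv]
    have hs1 : 0 ≤ Real.sin s := Real.sin_nonneg_of_nonneg_of_le_pi hs.1.le
      (by linarith [hs.2, Real.pi_pos])
    have hs2 : 0 ≤ Real.cos s := Real.cos_nonneg_of_neg_pi_div_two_le_of_le
      (by linarith [hs.1, Real.pi_pos]) hs.2.le
    refine mul_nonneg (mul_nonneg hs1 hs2) (Finset.sum_nonneg fun p' _ =>
      Finset.sum_nonneg fun q' _ => ?_)
    rw [hvv, huu]
    by_cases hpq : p'.1 = q'.1
    · have := hsame p'.1 p'.2 q'.2
      rw [← hpq, this]; simp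
    · refine mul_nonneg (sub_nonneg.2 (hdiff _ _ hpq _ _)) (integral_nonneg fun ω => ?_)
      simp only [hF2, Pi.zero_apply]
      have hne : q' ≠ p' := fun e => hpq (by rw [e])
      rw [if_neg hne, mul_zero, add_zero, mul_assoc]
      exact mul_nonneg (eval_pderiv_pderiv_gordonPoly_nonneg hpq p'.2 q'.2 (mH _))
        (mul_nonneg_of_nonpos_of_nonpos (ph' _ _) (ph' _ _))
  have hFe : ∀ x, F x = ∏ i : I, (1 - ∏ j : J, h (i, j) (x (i, j))) := fun x => by
    simp [hF, hp, gordonPoly, hH]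
  have hprod : ∀ (x : I × J → ℝ) i, ∏ j : J, h (i, j) (x (i, j)) ∈ Set.Icc (0 : ℝ) 1 :=
    fun x i => ⟨Finset.prod_nonneg fun j _ => (mh _ _).1,
      Finset.prod_le_one (fun j _ => (mh _ _).1) fun j _ => (mh _ _).2⟩
  have hF01 : ∀ x, F x ∈ Set.Icc (0 : ℝ) 1 := fun x => by
    rw [hFe]
    exact ⟨Finset.prod_nonneg fun i _ => sub_nonneg.2 (hprod _ i).2,
      Finset.prod_le_one (fun i _ => sub_nonneg.2 (hprod _ i).2)
        fun i _ => by linarith [(hprod x i).1]⟩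
  have e0 : φ 0 = ∫ ω, F (fun p => ∑ l, b p.1 p.2 l * ω l) ∂(stdPi L) := by
    have hc : Continuous fun ω : L → ℝ => F (fun p => ∑ l, b p.1 p.2 l * ω l) :=
      (cpoly p).comp (by fun_prop)
    rw [← stdPi_map_inr (K := K), integral_map (measurable_pi_lambda _ fun _ => measurable_pi_apply _).aemeasurable
      hc.aestronglyMeasurable]
    simp [hφ, hu, hv]
  have e1 : φ (Real.pi / 2) = ∫ ω, F (fun p => ∑ k, a p.1 p.2 k * ω k) ∂(stdPi K) := by
    have hc : Continuous fun ω : K → ℝ => F (fun p => ∑ l, a p.1 p.2 l * ω l) :=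
      (cpoly p).comp (by fun_prop)
    rw [← stdPi_map_inl (L := L), integral_map (measurable_pi_lambda _ fun _ => measurable_pi_apply _).aemeasurable
      hc.aestronglyMeasurable]
    simp [hφ, hu, hv]
  rw [e0, e1] at hmono
  have mX : MeasurableSet {ω : K → ℝ | ∃ i, ∀ j, ∑ k, a i j k * ω k ≤ t i j} := by
    simp only [Set.ofPred_exists, Set.ofPred_forall]
    exact MeasurableSet.iUnion fun i => MeasurableSet.iInter fun j =>
      measurableSet_le (by fun_prop) measurable_const
  have mY : MeasurableSet {ω : L → ℝ | ∃ i, ∀ j, ∑ l, b i j l * ω l ≤ t i j + κ} := by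
    simp only [Set.ofPred_exists, Set.ofPred_forall]
    exact MeasurableSet.iUnion fun i => MeasurableSet.iInter fun j =>
      measurableSet_le (by fun_prop) measurable_const
  have iX : Integrable (fun ω => F (fun p => ∑ k, a p.1 p.2 k * ω k)) (stdPi K) :=
    (integrable_const A).mono' ((cpoly p).comp (by fun_prop)).aestronglyMeasurable
      (Filter.Eventually.of_forall fun ω => b0 _)
  have iY : Integrable (fun ω => F (fun p => ∑ k, b p.1 p.2 k * ω k)) (stdPi L) :=
    (integrable_const A).mono' ((cpoly p).comp (by fun_prop)).aestronglyMeasurable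
      (Filter.Eventually.of_forall fun ω => b0 _)
  have l1 : ∫ ω, F (fun p => ∑ k, a p.1 p.2 k * ω k) ∂(stdPi K) ≤
      1 - (stdPi K).real {ω | ∃ i, ∀ j, ∑ k, a i j k * ω k ≤ t i j} := by
    rw [← probReal_compl_eq_one_sub mX, ← integral_indicator_one mX.compl]
    refine integral_mono iX ((integrable_const (1 : ℝ)).indicator mX.compl) fun ω => ?_
    by_cases hω : ω ∈ {ω : K → ℝ | ∃ i, ∀ j, ∑ k, a i j k * ω k ≤ t i j}
    · rw [Set.indicator_of_notMem (by simpa using hω)]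
      obtain ⟨i, hi⟩ := hω
      simp only [hFe]
      refine (Finset.prod_eq_zero (Finset.mem_univ i) ?_).le
      rw [Finset.prod_eq_one, sub_self]
      intro j _
      simp only [hh]
      rw [S0 _ (div_nonpos_of_nonpos_of_nonneg (by linarith [hi j]) hκ.le), sub_zero]
    · rw [Set.indicator_of_mem (by simpa using hω)]
      exact (hF01 _).2
  have l2 : 1 - (stdPi L).real {ω | ∃ i, ∀ j, ∑ l, b i j l * ω l ≤ t i j + κ} ≤
      ∫ ω, F (fun p => ∑ l, b p.1 p.2 l * ω l) ∂(stdPi L) := by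
    rw [← probReal_compl_eq_one_sub mY, ← integral_indicator_one mY.compl]
    refine integral_mono ((integrable_const (1 : ℝ)).indicator mY.compl) iY fun ω => ?_
    by_cases hω : ω ∈ {ω : L → ℝ | ∃ i, ∀ j, ∑ l, b i j l * ω l ≤ t i j + κ}
    · rw [Set.indicator_of_notMem (by simpa using hω)]
      exact (hF01 _).1
    · rw [Set.indicator_of_mem (by simpa using hω)]
      simp only [Set.mem_ofPred_eq, not_exists, not_forall, not_le] at hω
      rw [hFe]
      refine (Finset.prod_eq_one fun i _ => ?_).ge
      obtain ⟨j, hj⟩ := hω i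
      rw [Finset.prod_eq_zero (Finset.mem_univ j), sub_zero]
      simp only [hh]
      rw [S1 _ ((le_div_iff₀ hκ).2 (by linarith)), sub_self]
  linarith

/-- Euclidean norm of a tuple. -/
def l2 {ι : Type*} [Fintype ι] (v : ι → ℝ) : ℝ := Real.sqrt (∑ i, v i ^ 2)

/-- Effective noise level `√(σ² + ‖w‖²/n)`. -/
def qf (σ : ℝ) (n : ℕ) {N : ℕ} (w : Fin N → ℝ) : ℝ := Real.sqrt (σ ^ 2 + (∑ j, w j ^ 2) / n)

lemma l2_nonneg {ι : Type*} [Fintype ι] (v : ι → ℝ) : 0 ≤ l2 v := Real.sqrt_nonneg _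

lemma l2_sq {ι : Type*} [Fintype ι] (v : ι → ℝ) : l2 v ^ 2 = ∑ i, v i ^ 2 :=
  Real.sq_sqrt (Finset.sum_nonneg fun _ _ => sq_nonneg _)

lemma qf_nonneg (σ : ℝ) (n : ℕ) {N : ℕ} (w : Fin N → ℝ) : 0 ≤ qf σ n w := Real.sqrt_nonneg _

lemma qf_sq (σ : ℝ) (n : ℕ) {N : ℕ} (w : Fin N → ℝ) :
    qf σ n w ^ 2 = σ ^ 2 + (∑ j, w j ^ 2) / n :=
  Real.sq_sqrt (add_nonneg (sq_nonneg _) (div_nonneg (Finset.sum_nonneg fun _ _ => sq_nonneg _)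
    (Nat.cast_nonneg _)))

lemma sum_mul_le_l2 {ι : Type*} [Fintype ι] (u v : ι → ℝ) : ∑ i, u i * v i ≤ l2 u * l2 v :=
  Real.sum_mul_le_sqrt_mul_sqrt _ _ _

lemma continuous_l2 {ι : Type*} [Fintype ι] : Continuous (l2 : (ι → ℝ) → ℝ) := by
  unfold l2; fun_prop

lemma continuous_qf (σ : ℝ) (n : ℕ) {N : ℕ} : Continuous (qf σ n : (Fin N → ℝ) → ℝ) := by
  unfold qf; fun_prop

/-- Cauchy–Schwarz for the lifted vectors `(w/√n, σ)`. -/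
lemma lifted_inner_le (σ : ℝ) (n : ℕ) {N : ℕ} (w w' : Fin N → ℝ) :
    (∑ j, w j * w' j) / n + σ ^ 2 ≤ qf σ n w * qf σ n w' := by
  rw [qf, qf, ← Real.sqrt_mul (by positivity)]
  refine Real.le_sqrt_of_sq_le ?_
  have h := Finset.sum_mul_sq_le_sq_mul_sq Finset.univ w w'
  have h0 := sum_mul_le_l2 w w'
  have h1 : 0 ≤ ∑ j, w j ^ 2 := Finset.sum_nonneg fun _ _ => sq_nonneg _
  have h2 : 0 ≤ ∑ j, w' j ^ 2 := Finset.sum_nonneg fun _ _ => sq_nonneg _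
  rcases Nat.eq_zero_or_pos n with hn | hn
  · subst hn; simp; nlinarith
  have hn' : (0 : ℝ) < n := by exact_mod_cast hn
  set A := ∑ j, w j ^ 2
  set B := ∑ j, w' j ^ 2
  set D := ∑ j, w j * w' j
  have h3 : 2 * D ≤ A + B := by
    have : 0 ≤ ∑ j, (w j - w' j) ^ 2 := Finset.sum_nonneg fun _ _ => sq_nonneg _
    have e : ∑ j, (w j - w' j) ^ 2 = A + B - 2 * D := by
      simp only [A, B, D, Finset.mul_sum, ← Finset.sum_add_distrib, ← Finset.sum_sub_distrib]
      exact Finset.sum_congr rfl fun _ _ => by ring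
    linarith
  have e1 : (D / n) ^ 2 ≤ (A / n) * (B / n) := by
    rw [div_pow, div_mul_div_comm, ← sq]; gcongr
  have e2 : 2 * (D / n) ≤ A / n + B / n := by
    rw [← add_div, ← mul_div_assoc]; gcongr
  nlinarith [mul_le_mul_of_nonneg_left e2 (sq_nonneg σ)]

lemma gaussianReal_Iic_zero : (1 : ℝ) / 2 ≤ (gaussianReal 0 1).real (Set.Iic 0) := by
  have h : (gaussianReal 0 1).real (Set.Ici 0) = (gaussianReal 0 1).real (Set.Iic 0) := by
    have e : (gaussianReal 0 1).map (fun x => -x) = gaussianReal 0 1 := by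
      rw [gaussianReal_map_neg]; simp
    conv_lhs => rw [← e]
    rw [measureReal_def, Measure.map_apply measurable_neg measurableSet_Ici]
    simp [measureReal_def]
  have h2 : (gaussianReal 0 1).real Set.univ ≤ (gaussianReal 0 1).real (Set.Iic 0) +
      (gaussianReal 0 1).real (Set.Ici 0) := by
    rw [← Set.Iic_union_Ici (a := (0 : ℝ))]
    exact measureReal_union_le _ _
  rw [probReal_univ, h] at h2
  linarith

/-- Gordon comparison with an extra nonnegative multiple of an independent Gaussian. -/
lemma gordon_comparison_extra {I J K L : Type*} [Fintype I] [Fintype J] [Fintype K] [Fintype L]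
    (a : I → J → K → ℝ) (c : I → J → ℝ) (hc : ∀ i j, 0 ≤ c i j) (b : I → J → L → ℝ)
    (hsame : ∀ i j j', ∑ k, a i j k * a i j' k + c i j * c i j' = ∑ l, b i j l * b i j' l)
    (hdiff : ∀ i i', ∀ j j',
      ∑ l, b i j l * b i' j' l ≤ ∑ k, a i j k * a i' j' k + c i j * c i' j')
    (t : I → J → ℝ) {κ : ℝ} (hκ : 0 < κ) :
    (stdPi K).real {ω | ∃ i, ∀ j, ∑ k, a i j k * ω k ≤ t i j} ≤
      2 * (stdPi L).real {ω | ∃ i, ∀ j, ∑ l, b i j l * ω l ≤ t i j + κ} := by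
  have h := gordon_comparison (K := K ⊕ Unit) (fun i j => Sum.elim (a i j) fun _ => c i j) b
    (by simpa using hsame) (fun i i' _ j j' => by simpa using hdiff i i' j j') t hκ
  set E := {ω : K → ℝ | ∃ i, ∀ j, ∑ k, a i j k * ω k ≤ t i j} with hE
  have mE : MeasurableSet E := by
    simp only [hE, Set.ofPred_exists, Set.ofPred_forall]
    exact MeasurableSet.iUnion fun i => MeasurableSet.iInter fun j =>
      measurableSet_le (by fun_prop) measurable_const
  have mp := measurePreserving_sumPiEquivProdPi (fun _ : K ⊕ Unit => gaussianReal 0 1)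
  have mS : MeasurableSet {x : Unit → ℝ | x () ≤ 0} :=
    measurableSet_le (by fun_prop) measurable_const
  have hS : (stdPi Unit).real {x : Unit → ℝ | x () ≤ 0} = (gaussianReal 0 1).real (Set.Iic 0) := by
    have := (measurePreserving_eval (fun _ : Unit => gaussianReal 0 1) ()).measure_preimage
      measurableSet_Iic.nullMeasurableSet (s := Set.Iic 0)
    rw [measureReal_def, measureReal_def, ← this]; rfl
  have h2 : (stdPi K).real E * (gaussianReal 0 1).real (Set.Iic 0) ≤ (stdPi (K ⊕ Unit)).real
      {ω | ∃ i, ∀ j, ∑ k, Sum.elim (a i j) (fun _ => c i j) k * ω k ≤ t i j} := by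
    rw [← hS, ← measureReal_prod_prod]
    have e := mp.measure_preimage (mE.prod mS).nullMeasurableSet
    rw [measureReal_def, ← e, ← measureReal_def]
    refine measureReal_mono ?_
    rintro ω ⟨⟨i, hi⟩, h0⟩
    refine ⟨i, fun j => ?_⟩
    have h0' : ω (Sum.inr ()) ≤ 0 := h0
    have hi' := hi j
    simp only [Fintype.sum_sum_type, Sum.elim_inl, Sum.elim_inr, Finset.univ_unique,
      Finset.sum_singleton]
    have : c i j * ω (Sum.inr default) ≤ 0 := mul_nonpos_of_nonneg_of_nonpos (hc i j) h0'
    have e3 : ∑ k, a i j k * ω (Sum.inl k) ≤ t i j := hi'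
    linarith
  have := gaussianReal_Iic_zero
  have := measureReal_nonneg (μ := stdPi K) (s := E)
  nlinarith

/-- The Gaussian vector `(h, g, g₀)` of the auxiliary process. -/
abbrev GIdx (n N : ℕ) := Fin n ⊕ (Fin N ⊕ Unit)

/-- Auxiliary bilinear process. -/
def auxProc (σ : ℝ) {n N : ℕ} (ω : GIdx n N → ℝ) (w : Fin N → ℝ) (u : Fin n → ℝ) : ℝ :=
  qf σ n w * ∑ k, ω (Sum.inl k) * u k - l2 u *
    ((∑ j, ω (Sum.inr (Sum.inl j)) * w j) / Real.sqrt n - σ * ω (Sum.inr (Sum.inr ())))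

/-- Model bilinear process `⟨u, Xw - σz⟩`. -/
def modProc (σ : ℝ) {n N : ℕ} (ω : (Fin n → Fin N → ℝ) × (Fin n → ℝ)) (w : Fin N → ℝ)
    (u : Fin n → ℝ) : ℝ :=
  ∑ k, u k * (∑ j, ω.1 k j * w j - σ * ω.2 k)

lemma Pmodel_eq_map (n N : ℕ) : Pmodel n N = (stdPi ((Fin n × Fin N) ⊕ Fin n)).map
    (fun ω => ((fun i j => (Real.sqrt n)⁻¹ * ω (Sum.inl (i, j))), fun i => ω (Sum.inr i))) := by
  have mp := measurePreserving_sumPiEquivProdPi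
    (fun _ : (Fin n × Fin N) ⊕ Fin n => gaussianReal 0 1)
  have hg : (gaussianReal 0 1).map (fun x => (Real.sqrt n)⁻¹ * x) =
      gaussianReal 0 ((n : ℝ≥0))⁻¹ := by
    rw [gaussianReal_map_const_mul]
    congr 1
    · simp
    · ext; simp
  have h1 : MeasurePreserving (fun (ω : Fin n × Fin N → ℝ) (i : Fin n) (j : Fin N) =>
      (Real.sqrt n)⁻¹ * ω (i, j)) (stdPi (Fin n × Fin N)) (PX n N) := by
    refine ⟨by fun_prop, ?_⟩
    have c := Measure.infinitePi_map_curry (fun (_ : Fin n) (_ : Fin N) => gaussianReal 0 1)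
    simp only [Measure.infinitePi_eq_pi] at c
    have p : PX n N = (Measure.pi fun _ : Fin n => Measure.pi fun _ : Fin N =>
        gaussianReal 0 1).map (fun x i j => (Real.sqrt n)⁻¹ * x i j) := by
      have q : (Measure.pi fun _ : Fin N => gaussianReal 0 1).map
          (fun x j => (Real.sqrt n)⁻¹ * x j) = Measure.pi fun _ : Fin N =>
          gaussianReal 0 ((n : ℝ≥0))⁻¹ := by
        have := Measure.pi_map_pi (μ := fun _ : Fin N => gaussianReal 0 1)
          (f := fun _ x => (Real.sqrt n)⁻¹ * x) (fun _ => by fun_prop)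
          (hμ := fun _ => by rw [hg]; infer_instance)
        rw [this, hg]
      have := Measure.pi_map_pi (μ := fun _ : Fin n => Measure.pi fun _ : Fin N =>
          gaussianReal 0 1) (f := fun _ x j => (Real.sqrt n)⁻¹ * x j)
          (fun _ => Measurable.aemeasurable (by fun_prop))
          (hμ := fun _ => by rw [q]; infer_instance)
      rw [this, q, PX]
    rw [p, ← c, Measure.map_map (by fun_prop) (by fun_prop)]
    rfl
  have h2 : MeasurePreserving (id : (Fin n → ℝ) → _) (stdPi (Fin n)) (Pz n) :=
    MeasurePreserving.id _
  exact ((h1.prod h2).comp mp).map_eq.symm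

/-- Gordon comparison for the linear model, finite index sets. -/
theorem gordon_model {I J : Type*} [Fintype I] [Fintype J] (σ : ℝ) (n N : ℕ)
    (w : I → J → Fin N → ℝ) (u : I → J → Fin n → ℝ) (s : ℝ) (hs : s ^ 2 = 1)
    (hsame : ∀ i j j', w i j = w i j' ∨ u i j = u i j') (t : I → J → ℝ) {κ : ℝ} (hκ : 0 < κ) :
    (Pmodel n N).real {ω | ∃ i, ∀ j, s * modProc σ ω (w i j) (u i j) ≤ t i j} ≤
      2 * (stdPi (GIdx n N)).real
        {ω | ∃ i, ∀ j, s * auxProc σ ω (w i j) (u i j) ≤ t i j + κ} := by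
  have mS : MeasurableSet {ω : (Fin n → Fin N → ℝ) × (Fin n → ℝ) |
      ∃ i, ∀ j, s * modProc σ ω (w i j) (u i j) ≤ t i j} := by
    simp only [Set.ofPred_exists, Set.ofPred_forall]
    exact MeasurableSet.iUnion fun i => MeasurableSet.iInter fun j =>
      measurableSet_le (by unfold modProc; fun_prop) measurable_const
  have h := gordon_comparison_extra (K := (Fin n × Fin N) ⊕ Fin n) (L := GIdx n N)
    (fun i j => Sum.elim (fun p => s * (u i j p.1 * ((Real.sqrt n)⁻¹ * w i j p.2)))
      fun k => -(s * (σ * u i j k)))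
    (fun i j => l2 (u i j) * qf σ n (w i j))
    (fun i j => mul_nonneg (l2_nonneg _) (qf_nonneg _ _ _))
    (fun i j => Sum.elim (fun k => s * (qf σ n (w i j) * u i j k))
      (Sum.elim (fun l => -(s * (l2 (u i j) * ((Real.sqrt n)⁻¹ * w i j l))))
        fun _ => s * (l2 (u i j) * σ))) ?_ ?_ t hκ
  · convert h using 2
    · rw [Pmodel_eq_map, measureReal_def, Measure.map_apply (by fun_prop) mS, measureReal_def]
      congr 2
      ext ω
      simp only [Set.mem_preimage, Set.mem_ofPred_eq]
      refine exists_congr fun i => forall_congr' fun j => ?_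
      rw [modProc, Fintype.sum_sum_type, Fintype.sum_prod_type]
      simp only [Sum.elim_inl, Sum.elim_inr]
      have : s * ∑ k, u i j k * (∑ j_1, (Real.sqrt n)⁻¹ * ω (Sum.inl (k, j_1)) * w i j j_1 -
          σ * ω (Sum.inr k)) =
          ∑ x, ∑ x_1, s * (u i j x * ((Real.sqrt n)⁻¹ * w i j x_1)) * ω (Sum.inl (x, x_1)) +
          ∑ x, -(s * (σ * u i j x)) * ω (Sum.inr x) := by
        rw [← Finset.sum_add_distrib, Finset.mul_sum]
        refine Finset.sum_congr rfl fun k _ => ?_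
        rw [mul_sub, mul_sub, Finset.mul_sum, Finset.mul_sum, sub_eq_add_neg]
        congr 1
        · exact Finset.sum_congr rfl fun _ _ => by ring
        · ring
      rw [this]
    · congr 1
      ext ω
      simp only [Set.mem_ofPred_eq]
      refine exists_congr fun i => forall_congr' fun j => ?_
      rw [auxProc]
      simp only [Fintype.sum_sum_type, Sum.elim_inl, Sum.elim_inr, Finset.univ_unique,
        Finset.sum_singleton]
      have : s * (qf σ n (w i j) * ∑ k, ω (Sum.inl k) * u i j k - l2 (u i j) *
          ((∑ l, ω (Sum.inr (Sum.inl l)) * w i j l) / Real.sqrt n - σ * ω (Sum.inr (Sum.inr ()))))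
          = ∑ k, s * (qf σ n (w i j) * u i j k) * ω (Sum.inl k) +
          (∑ l, -(s * (l2 (u i j) * ((Real.sqrt n)⁻¹ * w i j l))) * ω (Sum.inr (Sum.inl l)) +
          s * (l2 (u i j) * σ) * ω (Sum.inr (Sum.inr ()))) := by
        have e1 : ∑ k, s * (qf σ n (w i j) * u i j k) * ω (Sum.inl k) =
            s * (qf σ n (w i j) * ∑ k, ω (Sum.inl k) * u i j k) := by
          simp only [Finset.mul_sum]; exact Finset.sum_congr rfl fun _ _ => by ring
        have e2 : ∑ l, -(s * (l2 (u i j) * ((Real.sqrt n)⁻¹ * w i j l))) *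
            ω (Sum.inr (Sum.inl l)) = -(s * (l2 (u i j) *
            ((∑ l, ω (Sum.inr (Sum.inl l)) * w i j l) / Real.sqrt n))) := by
          rw [div_eq_mul_inv, Finset.sum_mul, Finset.mul_sum, Finset.mul_sum,
            ← Finset.sum_neg_distrib]
          exact Finset.sum_congr rfl fun _ _ => by ring
        rw [e1, e2]; ring
      rw [this]
  all_goals
    have cov : ∀ i i' j j',
        (∑ k : (Fin n × Fin N) ⊕ Fin n, Sum.elim (fun p => s * (u i j p.1 * ((Real.sqrt n)⁻¹ *
          w i j p.2))) (fun k => -(s * (σ * u i j k))) k *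
          Sum.elim (fun p => s * (u i' j' p.1 * ((Real.sqrt n)⁻¹ *
          w i' j' p.2))) (fun k => -(s * (σ * u i' j' k))) k) =
        (∑ k, u i j k * u i' j' k) * ((∑ l, w i j l * w i' j' l) / n + σ ^ 2) := by
      intro i i' j j'
      rw [Fintype.sum_sum_type, Fintype.sum_prod_type]
      simp only [Sum.elim_inl, Sum.elim_inr]
      rw [mul_add]
      congr 1
      · rw [Finset.sum_mul]
        refine Finset.sum_congr rfl fun k _ => ?_
        rw [div_eq_mul_inv, Finset.sum_mul, Finset.mul_sum]
        refine Finset.sum_congr rfl fun l _ => ?_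
        have : (Real.sqrt n)⁻¹ * (Real.sqrt n)⁻¹ = ((n : ℝ))⁻¹ := by
          rw [← mul_inv, Real.mul_self_sqrt (Nat.cast_nonneg n)]
        calc _ = s ^ 2 * (u i j k * u i' j' k * (w i j l * w i' j' l)) *
              ((Real.sqrt n)⁻¹ * (Real.sqrt n)⁻¹) := by ring
          _ = _ := by rw [this, hs]; ring
      · rw [Finset.sum_mul]
        refine Finset.sum_congr rfl fun k _ => ?_
        calc _ = s ^ 2 * (u i j k * u i' j' k * σ ^ 2) := by ring
          _ = _ := by rw [hs]; ring
    have cov2 : ∀ i i' j j',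
        (∑ l : GIdx n N, Sum.elim (fun k => s * (qf σ n (w i j) * u i j k))
          (Sum.elim (fun l => -(s * (l2 (u i j) * ((Real.sqrt n)⁻¹ * w i j l))))
          fun _ => s * (l2 (u i j) * σ)) l *
          Sum.elim (fun k => s * (qf σ n (w i' j') * u i' j' k))
          (Sum.elim (fun l => -(s * (l2 (u i' j') * ((Real.sqrt n)⁻¹ * w i' j' l))))
          fun _ => s * (l2 (u i' j') * σ)) l) =
        qf σ n (w i j) * qf σ n (w i' j') * (∑ k, u i j k * u i' j' k) +
          l2 (u i j) * l2 (u i' j') * ((∑ l, w i j l * w i' j' l) / n + σ ^ 2) := by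
      intro i i' j j'
      simp only [Fintype.sum_sum_type, Sum.elim_inl, Sum.elim_inr, Finset.univ_unique,
        Finset.sum_singleton]
      congr 1
      · rw [Finset.mul_sum]
        refine Finset.sum_congr rfl fun k _ => ?_
        calc _ = s ^ 2 * (qf σ n (w i j) * qf σ n (w i' j') * (u i j k * u i' j' k)) := by ring
          _ = _ := by rw [hs]; ring
      · rw [mul_add]
        congr 1
        · rw [div_eq_mul_inv, Finset.sum_mul, Finset.mul_sum]
          refine Finset.sum_congr rfl fun l _ => ?_
          have : (Real.sqrt n)⁻¹ * (Real.sqrt n)⁻¹ = ((n : ℝ))⁻¹ := by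
            rw [← mul_inv, Real.mul_self_sqrt (Nat.cast_nonneg n)]
          calc _ = s ^ 2 * (l2 (u i j) * l2 (u i' j') * (w i j l * w i' j' l)) *
                ((Real.sqrt n)⁻¹ * (Real.sqrt n)⁻¹) := by ring
            _ = _ := by rw [this, hs]; ring
        · calc _ = s ^ 2 * (l2 (u i j) * l2 (u i' j') * σ ^ 2) := by ring
            _ = _ := by rw [hs]; ring
  · intro i j j'
    rw [cov, cov2]
    rcases hsame i j j' with h | h
    · rw [← h]
      have e : (∑ l, w i j l * w i j l) / n + σ ^ 2 = qf σ n (w i j) * qf σ n (w i j) := by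
        rw [← sq (qf σ n (w i j)), qf_sq, add_comm]
        simp only [sq]
      rw [e]; ring
    · rw [← h]
      have e : ∑ k, u i j k * u i j k = l2 (u i j) * l2 (u i j) := by
        rw [← sq (l2 (u i j)), l2_sq]; simp only [sq]
      rw [e]; ring
  · intro i i' j j'
    rw [cov, cov2]
    have h1 := lifted_inner_le σ n (w i j) (w i' j')
    have h2 := sum_mul_le_l2 (u i j) (u i' j')
    nlinarith [mul_nonneg (sub_nonneg.2 h1) (sub_nonneg.2 h2)]

lemma exists_closedBall_compl_le {Ω : Type*} [PseudoMetricSpace Ω] [MeasurableSpace Ω]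
    [OpensMeasurableSpace Ω] (P : Measure Ω) [IsFiniteMeasure P] (x : Ω) {e : ℝ≥0∞} (he : 0 < e) :
    ∃ R : ℕ, P (Metric.closedBall x R)ᶜ ≤ e := by
  have h := tendsto_measure_iInter_atTop (μ := P) (s := fun R : ℕ => (Metric.closedBall x (R : ℝ))ᶜ)
    (fun R => (Metric.isClosed_closedBall.measurableSet.compl).nullMeasurableSet)
    (fun a b hab => Set.compl_subset_compl.2
      (Metric.closedBall_subset_closedBall (by exact_mod_cast hab))) ⟨0, measure_ne_top _ _⟩
  have h0 : (⋂ R : ℕ, (Metric.closedBall x (R : ℝ))ᶜ) = ∅ := by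
    rw [← Set.compl_iUnion, Metric.iUnion_closedBall_nat, Set.compl_univ]
  rw [h0, measure_empty] at h
  obtain ⟨R, hR⟩ := (h.eventually (gt_mem_nhds he)).exists
  exact ⟨R, hR.le⟩

lemma exists_uniform_mesh {Ω E1 E2 : Type*} [PseudoMetricSpace Ω] [PseudoMetricSpace E1]
    [PseudoMetricSpace E2] {f : Ω → E1 → E2 → ℝ}
    (hf : Continuous fun p : Ω × E1 × E2 => f p.1 p.2.1 p.2.2) {A : Set Ω} {B : Set E1}
    {C : Set E2} (hA : IsCompact A) (hB : IsCompact B) (hC : IsCompact C) {e : ℝ} (he : 0 < e) :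
    ∃ d > 0, ∀ ω ∈ A, ∀ w ∈ B, ∀ w' ∈ B, ∀ u ∈ C, ∀ u' ∈ C, dist w w' < d → dist u u' < d →
      f ω w u ≤ f ω w' u' + e := by
  have h := (hA.prod (hB.prod hC)).uniformContinuousOn_of_continuous hf.continuousOn
  rw [Metric.uniformContinuousOn_iff] at h
  obtain ⟨d, hd, h⟩ := h e he
  refine ⟨d, hd, fun ω hω w hw w' hw' u hu u' hu' h1 h2 => ?_⟩
  have := h (ω, w, u) ⟨hω, hw, hu⟩ (ω, w', u') ⟨hω, hw', hu'⟩ (by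
    simp [Prod.dist_eq, h1, h2])
  rw [Real.dist_eq] at this
  linarith [(abs_lt.1 this).2]

lemma TotallyBounded.exists_finset_net {E : Type*} [PseudoMetricSpace E] {s : Set E}
    (hs : TotallyBounded s) {d : ℝ} (hd : 0 < d) :
    ∃ V : Finset E, (V : Set E) ⊆ s ∧ ∀ y ∈ s, ∃ z ∈ V, dist y z < d := by
  obtain ⟨V, hV, hVf, hc⟩ := hs.exists_subset (Metric.dist_mem_uniformity hd)
  refine ⟨hVf.toFinset, by simpa using hV, fun y hy => ?_⟩
  obtain ⟨z, hz, hyz⟩ := Set.mem_iUnion₂.1 (hc hy)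
  exact ⟨z, by simpa using hz, hyz⟩

/-- A comparison inequality for min-max events over finite sets extends to arbitrary sets. -/
theorem comparison_of_finite {Ω Ω' E1 E2 : Type*}
    [PseudoMetricSpace Ω] [ProperSpace Ω] [MeasurableSpace Ω] [OpensMeasurableSpace Ω]
    [PseudoMetricSpace Ω'] [ProperSpace Ω'] [MeasurableSpace Ω'] [OpensMeasurableSpace Ω']
    [PseudoMetricSpace E1] [ProperSpace E1] [PseudoMetricSpace E2] [ProperSpace E2]
    [Nonempty Ω] [Nonempty Ω'] [Nonempty E1]
    (P : Measure Ω) (P' : Measure Ω') [IsFiniteMeasure P']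
    {f : Ω → E1 → E2 → ℝ} {g : Ω' → E1 → E2 → ℝ}
    (hf : Continuous fun p : Ω × E1 × E2 => f p.1 p.2.1 p.2.2)
    (hg : Continuous fun p : Ω' × E1 × E2 => g p.1 p.2.1 p.2.2)
    {D : Set E1} {U : Set E2} (hU : Bornology.IsBounded U)
    (hfin : ∀ (W : Finset E1) (V : Finset E2), (W : Set E1) ⊆ D → (V : Set E2) ⊆ U →
      ∀ t κ : ℝ, 0 < κ → P {ω | ∃ w ∈ W, ∀ u ∈ V, f ω w u ≤ t} ≤
        2 * P' {ω | ∃ w ∈ W, ∀ u ∈ V, g ω w u ≤ t + κ})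
    (t : ℝ) {err : ℝ} (herr : 0 < err) :
    P {ω | ∃ w ∈ D, ∀ u ∈ U, f ω w u ≤ t} ≤
      2 * P' {ω | ∃ w ∈ D, ∀ u ∈ U, g ω w u ≤ t + err} := by
  obtain ⟨x⟩ := ‹Nonempty Ω›
  obtain ⟨x'⟩ := ‹Nonempty Ω'›
  obtain ⟨w0⟩ := ‹Nonempty E1›
  have hUc : IsCompact (closure U) := hU.isCompact_closure
  refine ENNReal.le_of_forall_pos_le_add fun ε hε _ => ?_
  set E : ℕ → Set Ω := fun R => {ω | ω ∈ Metric.closedBall x (R : ℝ) ∧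
    ∃ w ∈ D ∩ Metric.closedBall w0 (R : ℝ), ∀ u ∈ U, f ω w u ≤ t} with hE
  have hmono : Monotone E := by
    intro a b hab ω hω
    have hab' : (a : ℝ) ≤ b := by exact_mod_cast hab
    obtain ⟨h1, w, ⟨hw, hw'⟩, h2⟩ := hω
    exact ⟨Metric.closedBall_subset_closedBall hab' h1, w,
      ⟨hw, Metric.closedBall_subset_closedBall hab' hw'⟩, h2⟩
  have hlim := tendsto_measure_iUnion_atTop (μ := P) hmono
  have hun : {ω | ∃ w ∈ D, ∀ u ∈ U, f ω w u ≤ t} ⊆ ⋃ R, E R := by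
    rintro ω ⟨w, hw, h⟩
    obtain ⟨R, hR⟩ := exists_nat_ge (max (dist ω x) (dist w w0))
    exact Set.mem_iUnion.2 ⟨R, Metric.mem_closedBall.2 ((le_max_left _ _).trans hR), w,
      ⟨hw, Metric.mem_closedBall.2 ((le_max_right _ _).trans hR)⟩, h⟩
  refine (measure_mono hun).trans (le_of_tendsto' hlim fun R => ?_)
  obtain ⟨R', hR'⟩ := exists_closedBall_compl_le P' x' (e := (ε : ℝ≥0∞) / 2)
    (ENNReal.half_pos (by simpa using hε.ne'))
  have he : 0 < err / 4 := by positivity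
  obtain ⟨d1, hd1, H1⟩ := exists_uniform_mesh hf (isCompact_closedBall x (R : ℝ))
    (isCompact_closedBall w0 (R : ℝ)) hUc he
  obtain ⟨d2, hd2, H2⟩ := exists_uniform_mesh hg (isCompact_closedBall x' (R' : ℝ))
    (isCompact_closedBall w0 (R : ℝ)) hUc he
  obtain ⟨W, hW, hWn⟩ := TotallyBounded.exists_finset_net
    (s := D ∩ Metric.closedBall w0 (R : ℝ))
    ((isCompact_closedBall w0 (R : ℝ)).totallyBounded.subset Set.inter_subset_right)
    (lt_min hd1 hd2)
  obtain ⟨V, hV, hVn⟩ := TotallyBounded.exists_finset_net (s := U)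
    (hUc.totallyBounded.subset subset_closure) (lt_min hd1 hd2)
  have s1 : E R ⊆ {ω | ∃ w ∈ W, ∀ u ∈ V, f ω w u ≤ t + err / 4} := by
    rintro ω ⟨h1, w, hw, h2⟩
    obtain ⟨w', hw', hd⟩ := hWn w hw
    refine ⟨w', hw', fun u hu => ?_⟩
    have := H1 ω h1 w' (hW hw').2 w hw.2 u (subset_closure (hV hu)) u (subset_closure (hV hu))
      (by rw [dist_comm]; exact hd.trans_le (min_le_left _ _)) (by simpa using hd1)
    linarith [h2 u (hV hu)]
  have s2 : {ω | ∃ w ∈ W, ∀ u ∈ V, g ω w u ≤ t + err / 4 + err / 4} ⊆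
      {ω | ∃ w ∈ D, ∀ u ∈ U, g ω w u ≤ t + err} ∪ (Metric.closedBall x' (R' : ℝ))ᶜ := by
    rintro ω ⟨w, hw, h⟩
    by_cases hω : ω ∈ Metric.closedBall x' (R' : ℝ)
    · refine Or.inl ⟨w, (hW hw).1, fun u hu => ?_⟩
      obtain ⟨u', hu', hd⟩ := hVn u hu
      have := H2 ω hω w (hW hw).2 w (hW hw).2 u (subset_closure hu) u' (subset_closure (hV hu'))
        (by simpa using hd2) (hd.trans_le (min_le_right _ _))
      linarith [h u' hu']
    · exact Or.inr hω
  calc P (E R) ≤ _ := measure_mono s1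
    _ ≤ _ := hfin W V (hW.trans Set.inter_subset_left) hV _ _ he
    _ ≤ 2 * (P' {ω | ∃ w ∈ D, ∀ u ∈ U, g ω w u ≤ t + err} + (ε : ℝ≥0∞) / 2) := by
      gcongr
      exact (measure_mono s2).trans ((measure_union_le _ _).trans (by gcongr))
    _ = _ := by
      rw [mul_add, ENNReal.mul_div_cancel (by simp) (by simp)]

instance (n N : ℕ) : IsProbabilityMeasure (Pmodel n N) := by
  unfold Pmodel PX Pz; infer_instance

/-- Gordon comparison for the linear model over arbitrary index sets, the inner one bounded. -/
theorem gordon_model_sets {E1 E2 : Type*} [PseudoMetricSpace E1] [ProperSpace E1]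
    [PseudoMetricSpace E2] [ProperSpace E2] [Nonempty E1] (σ : ℝ) (n N : ℕ)
    {w : E1 → E2 → Fin N → ℝ} {u : E1 → E2 → Fin n → ℝ} {Q : E1 → E2 → ℝ}
    (hw : Continuous fun p : E1 × E2 => w p.1 p.2) (hu : Continuous fun p : E1 × E2 => u p.1 p.2)
    (hQ : Continuous fun p : E1 × E2 => Q p.1 p.2) (s : ℝ) (hs : s ^ 2 = 1)
    (hsame : ∀ i j j', w i j = w i j' ∨ u i j = u i j')
    (D : Set E1) {U : Set E2} (hU : Bornology.IsBounded U) (t : ℝ) {err : ℝ} (herr : 0 < err) :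
    Pmodel n N {ω | ∃ i ∈ D, ∀ j ∈ U, s * modProc σ ω (w i j) (u i j) + Q i j ≤ t} ≤
      2 * stdPi (GIdx n N)
        {ω | ∃ i ∈ D, ∀ j ∈ U, s * auxProc σ ω (w i j) (u i j) + Q i j ≤ t + err} := by
  have hw2 : ∀ {Ω : Type} [TopologicalSpace Ω], Continuous fun p : Ω × E1 × E2 => w p.2.1 p.2.2 :=
    hw.comp continuous_snd
  have hu2 : ∀ {Ω : Type} [TopologicalSpace Ω], Continuous fun p : Ω × E1 × E2 => u p.2.1 p.2.2 :=
    hu.comp continuous_snd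
  have hQ2 : ∀ {Ω : Type} [TopologicalSpace Ω], Continuous fun p : Ω × E1 × E2 => Q p.2.1 p.2.2 :=
    hQ.comp continuous_snd
  refine comparison_of_finite (f := fun ω i j => s * modProc σ ω (w i j) (u i j) + Q i j)
    (g := fun ω i j => s * auxProc σ ω (w i j) (u i j) + Q i j) (Pmodel n N) (stdPi (GIdx n N))
    ?_ ?_ hU ?_ t herr
  · refine (Continuous.mul continuous_const ?_).add hQ2
    unfold modProc
    refine continuous_finsetSum _ fun k _ => ?_
    refine ((continuous_apply k).comp hu2).mul (Continuous.sub ?_ (by fun_prop))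
    exact continuous_finsetSum _ fun j _ =>
      Continuous.mul (by fun_prop) ((continuous_apply j).comp hw2)
  · refine (Continuous.mul continuous_const ?_).add hQ2
    unfold auxProc
    have c1 := (continuous_qf σ (n := n) (N := N)).comp (hw2 (Ω := GIdx n N → ℝ))
    have c2 := (continuous_l2 (ι := Fin n)).comp (hu2 (Ω := GIdx n N → ℝ))
    refine Continuous.sub (Continuous.mul c1 ?_) (Continuous.mul c2 (Continuous.sub
      (Continuous.div_const ?_ _) (by fun_prop)))
    · exact continuous_finsetSum _ fun k _ =>
        Continuous.mul (by fun_prop) ((continuous_apply k).comp hu2)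
    · exact continuous_finsetSum _ fun k _ =>
        Continuous.mul (by fun_prop) ((continuous_apply k).comp hw2)
  · intro W V _ _ t κ hκ
    have h := gordon_model σ n N (fun (i : W) (j : V) => w i j) (fun i j => u i j) s hs
      (fun i j j' => hsame _ _ _) (fun i j => t - Q i j) hκ
    have e1 : {ω : (Fin n → Fin N → ℝ) × (Fin n → ℝ) |
        ∃ i ∈ W, ∀ j ∈ V, s * modProc σ ω (w i j) (u i j) + Q i j ≤ t} =
        {ω | ∃ i : W, ∀ j : V, s * modProc σ ω (w i j) (u i j) ≤ t - Q i j} := by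
      ext ω
      simp [le_sub_iff_add_le]
    have e2 : {ω : GIdx n N → ℝ |
        ∃ i ∈ W, ∀ j ∈ V, s * auxProc σ ω (w i j) (u i j) + Q i j ≤ t + κ} =
        {ω | ∃ i : W, ∀ j : V, s * auxProc σ ω (w i j) (u i j) ≤ t - Q i j + κ} := by
      ext ω
      simp only [Set.mem_ofPred_eq, Subtype.exists, Subtype.forall, exists_prop]
      refine exists_congr fun i => and_congr_right fun _ => forall₂_congr fun j _ => ?_
      constructor <;> intro h <;> linarith
    rw [e1, e2, ← ofReal_measureReal, ← ofReal_measureReal,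
      show (2 : ℝ≥0∞) = ENNReal.ofReal 2 by simp, ← ENNReal.ofReal_mul (by norm_num)]
    exact ENNReal.ofReal_le_ofReal h

/-- Primal form of the comparison. -/
theorem gordon_primal (σ : ℝ) (n N : ℕ) {Q : (Fin N → ℝ) → (Fin n → ℝ) → ℝ}
    (hQ : Continuous fun p : (Fin N → ℝ) × (Fin n → ℝ) => Q p.1 p.2)
    (D : Set (Fin N → ℝ)) {U : Set (Fin n → ℝ)} (hU : Bornology.IsBounded U) (t : ℝ) {err : ℝ}
    (herr : 0 < err) :
    Pmodel n N {ω | ∃ w ∈ D, ∀ u ∈ U, modProc σ ω w u + Q w u ≤ t} ≤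
      2 * stdPi (GIdx n N) {ω | ∃ w ∈ D, ∀ u ∈ U, auxProc σ ω w u + Q w u ≤ t + err} := by
  have := gordon_model_sets σ n N (E1 := Fin N → ℝ) (E2 := Fin n → ℝ) (w := fun w _ => w)
    (u := fun _ u => u) (Q := Q) continuous_fst continuous_snd hQ 1 (by norm_num)
    (fun _ _ _ => Or.inl rfl) D hU t herr
  simpa using this

/-- Dual form of the comparison. -/
theorem gordon_dual (σ : ℝ) (n N : ℕ) {Q : (Fin n → ℝ) × (Fin N → ℝ) → (Fin N → ℝ) → ℝ}
    (hQ : Continuous fun p : ((Fin n → ℝ) × (Fin N → ℝ)) × (Fin N → ℝ) => Q p.1 p.2)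
    (D : Set ((Fin n → ℝ) × (Fin N → ℝ))) {B : Set (Fin N → ℝ)} (hB : Bornology.IsBounded B)
    (t : ℝ) {err : ℝ} (herr : 0 < err) :
    Pmodel n N {ω | ∃ p ∈ D, ∀ w ∈ B, t ≤ modProc σ ω w p.1 + Q p w} ≤
      2 * stdPi (GIdx n N) {ω | ∃ p ∈ D, ∀ w ∈ B, t - err ≤ auxProc σ ω w p.1 + Q p w} := by
  have := gordon_model_sets σ n N (E1 := (Fin n → ℝ) × (Fin N → ℝ)) (E2 := Fin N → ℝ)
    (w := fun _ w => w)
    (u := fun p _ => p.1) (Q := fun p w => - Q p w) continuous_snd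
    (continuous_fst.comp continuous_fst) hQ.neg (-1) (by norm_num)
    (fun _ _ _ => Or.inr rfl) D hB (-t) herr
  convert this using 3
  · ext ω
    refine exists_congr fun i => and_congr_right fun _ => forall₂_congr fun j _ => ?_
    constructor <;> intro h <;> linarith
  · congr 1
    ext ω
    refine exists_congr fun i => and_congr_right fun _ => forall₂_congr fun j _ => ?_
    constructor <;> intro h <;> linarith

lemma abs_sub_le_of_sq {a t e lo : ℝ} (ha : 0 ≤ a) (hlo : 0 < lo) (ht : lo ≤ t)
    (h : |a ^ 2 - t ^ 2| ≤ e) : |a - t| ≤ e / lo := by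
  rw [le_div_iff₀ hlo]
  calc |a - t| * lo ≤ |a - t| * |a + t| := by
        gcongr; rw [abs_of_nonneg (by linarith)]; linarith
    _ = |a ^ 2 - t ^ 2| := by rw [← abs_mul]; congr 1; ring
    _ ≤ e := h

set_option maxHeartbeats 1000000 in
lemma primal_scalar {lo hi : ℝ} (hlo : 0 < lo) (hlh : lo ≤ hi) :
    ∃ C c : ℝ, 0 < C ∧ 0 < c ∧ ∀ β τ σ e q q' k d x G L g0 m : ℝ,
      lo ≤ β → β ≤ hi → lo ≤ τ → τ ≤ hi → lo ≤ σ → σ ≤ hi → 0 ≤ e → e ≤ 1 → 0 ≤ d →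
      0 < q → q ≤ q' + d → 0 < q' → |q' ^ 2 - τ ^ 2| ≤ e → |k - 1| ≤ e →
      |G - (τ - β)| ≤ e → |L - m| ≤ e → |g0| ≤ e → σ ^ 2 * d ^ 2 / (2 * (q * q')) ≤ x →
      β ^ 2 / 2 + m - C * e * (1 + d) + c * (d ^ 2 / (1 + d)) ≤
        β * q * (k - q' / τ) + β / τ * q' ^ 2 + β / τ * x - β * G + L + β * σ * g0 - β ^ 2 / 2 := by
  have hhi : 0 < hi := hlo.trans_le hlh
  refine ⟨hi * (hi + 1) * (1 + 1 / lo ^ 2) + hi / lo + hi + 1 + hi ^ 2,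
    lo / hi * (lo ^ 2 / (2 * (hi + 1) ^ 2)), by positivity, by positivity, ?_⟩
  intro β τ σ e q q' k d x G L g0 m hβ hβ' hτ hτ' hσ hσ' he he1 hd hq hq2 hq' h1 h2 h3 h4 h5 h6
  have hβ0 : 0 < β := hlo.trans_le hβ
  have hτ0 : 0 < τ := hlo.trans_le hτ
  have hσ0 : 0 < σ := hlo.trans_le hσ
  have b1 := abs_sub_le_of_sq hq'.le hlo hτ h1
  have q'le : q' ≤ hi + 1 := by
    have := (abs_le.1 h1).2
    nlinarith
  have qle : q ≤ (hi + 1) * (1 + d) := by nlinarith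
  have kk : -(e * (1 + 1 / lo ^ 2)) ≤ k - q' / τ := by
    have e1 : q' / τ ≤ 1 + e / lo ^ 2 := by
      rw [div_le_iff₀ hτ0]
      have : q' ≤ τ + e / lo := by linarith [(abs_le.1 b1).2]
      have : e / lo ≤ e / lo ^ 2 * τ := by
        rw [show e / lo = e / lo ^ 2 * lo by field_simp]
        gcongr
      linarith
    have := (abs_le.1 h2).1
    have : e * (1 + 1 / lo ^ 2) = e + e / lo ^ 2 := by ring
    linarith
  have t1 : -(hi * (hi + 1) * (1 + 1 / lo ^ 2) * e * (1 + d)) ≤ β * q * (k - q' / τ) := by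
    have : β * q * (e * (1 + 1 / lo ^ 2)) ≤ hi * ((hi + 1) * (1 + d)) * (e * (1 + 1 / lo ^ 2)) := by
      gcongr
    nlinarith [mul_le_mul_of_nonneg_left kk (mul_nonneg hβ0.le hq.le)]
  have bt : β / τ ≤ hi / lo := by gcongr
  have bt0 : 0 < β / τ := by positivity
  have t2 : β * τ - hi / lo * e ≤ β / τ * q' ^ 2 := by
    have : β / τ * (τ ^ 2 - e) ≤ β / τ * q' ^ 2 := by
      gcongr; linarith [(abs_le.1 h1).1]
    have e2 : β / τ * τ ^ 2 = β * τ := by field_simp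
    nlinarith [mul_le_mul_of_nonneg_right bt he]
  have t3 : -(β * (τ - β)) - hi * e ≤ - (β * G) := by
    nlinarith [(abs_le.1 h3).2, mul_le_mul_of_nonneg_right hβ' he]
  have t5 : - (hi ^ 2 * e) ≤ β * σ * g0 := by
    have : β * σ * e ≤ hi * hi * e := by gcongr
    have := mul_le_mul_of_nonneg_left (abs_le.1 h5).1 (mul_nonneg hβ0.le hσ0.le)
    linarith
  have t6 : lo / hi * (lo ^ 2 / (2 * (hi + 1) ^ 2)) * (d ^ 2 / (1 + d)) ≤ β / τ * x := by
    have : lo / hi ≤ β / τ := by gcongr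
    have : lo ^ 2 * d ^ 2 / (2 * ((hi + 1) * (1 + d) * (hi + 1))) ≤ x := by
      refine le_trans ?_ h6
      gcongr
    calc _ = lo / hi * (lo ^ 2 * d ^ 2 / (2 * ((hi + 1) * (1 + d) * (hi + 1)))) := by
          field_simp
      _ ≤ _ := by gcongr
  have hde : e ≤ e * (1 + d) := by nlinarith
  have a1 : (hi / lo + hi + 1 + hi ^ 2) * e ≤ (hi / lo + hi + 1 + hi ^ 2) * (e * (1 + d)) := by
    gcongr
  have h4' := (abs_le.1 h4).1
  have e3 : (hi * (hi + 1) * (1 + 1 / lo ^ 2) + hi / lo + hi + 1 + hi ^ 2) * e * (1 + d) =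
    hi * (hi + 1) * (1 + 1 / lo ^ 2) * e * (1 + d) +
      (hi / lo + hi + 1 + hi ^ 2) * (e * (1 + d)) := by ring
  rw [e3]
  linarith

set_option maxHeartbeats 1000000 in
/-- Lower bound for the primal auxiliary objective. -/
lemma primal_lower {lo hi : ℝ} (hlo : 0 < lo) (hlh : lo ≤ hi) :
    ∃ C c : ℝ, 0 < C ∧ 0 < c ∧ ∀ (n N : ℕ) (β τ σ lam e k g0 m : ℝ) (θ g w' v w : Fin N → ℝ),
      0 < n → lo ≤ β → β ≤ hi → lo ≤ τ → τ ≤ hi → lo ≤ σ → σ ≤ hi → 0 ≤ e → e ≤ 1 →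
      (∀ i, v i = β * g i - β / τ * w' i) → (∀ i, |v i| ≤ lam) →
      (∀ i, v i * (θ i + w' i) = lam * |θ i + w' i|) →
      |(∑ i, w' i ^ 2) / n - (τ ^ 2 - σ ^ 2)| ≤ e → |k - 1| ≤ e →
      |(∑ i, g i * w' i) / n - (τ - β)| ≤ e → |lam / n * ∑ i, |θ i + w' i| - m| ≤ e → |g0| ≤ e →
      β ^ 2 / 2 + m - C * e * (1 + l2 (w - w') / √n) +
        c * ((l2 (w - w') / √n) ^ 2 / (1 + l2 (w - w') / √n)) ≤
      β * (qf σ n w * k - (∑ i, g i * w i) / n + σ * g0) - β ^ 2 / 2 +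
        lam / n * ∑ i, |θ i + w i| := by
  obtain ⟨C, c, hC, hc, H⟩ := primal_scalar hlo hlh
  refine ⟨C, c, hC, hc, ?_⟩
  intro n N β τ σ lam e k g0 m θ g w' v w hn hβ hβ' hτ hτ' hσ hσ' he he1 hv hvl hvs h1 h2 h3 h4 h5
  have hn' : (0 : ℝ) < n := by exact_mod_cast hn
  have hβ0 : 0 < β := hlo.trans_le hβ
  have hτ0 : 0 < τ := hlo.trans_le hτ
  have hσ0 : 0 < σ := hlo.trans_le hσ
  set d := l2 (w - w') / √n with hd
  have hd0 : 0 ≤ d := div_nonneg (l2_nonneg _) (Real.sqrt_nonneg _)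
  set q := qf σ n w
  set q' := qf σ n w'
  have hq2 : q ^ 2 = σ ^ 2 + (∑ i, w i ^ 2) / n := qf_sq _ _ _
  have hq'2 : q' ^ 2 = σ ^ 2 + (∑ i, w' i ^ 2) / n := qf_sq _ _ _
  have hd2 : d ^ 2 = (∑ i, (w i - w' i) ^ 2) / n := by
    rw [hd, div_pow, l2_sq, Real.sq_sqrt hn'.le]; simp
  have hA : 0 ≤ (∑ i, w i ^ 2) / n := by positivity
  have hA' : 0 ≤ (∑ i, w' i ^ 2) / n := by positivity
  have hq : 0 < q := by
    refine lt_of_le_of_ne (qf_nonneg _ _ _) fun h => ?_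
    rw [← h] at hq2; nlinarith
  have hq' : 0 < q' := by
    refine lt_of_le_of_ne (qf_nonneg _ _ _) fun h => ?_
    rw [← h] at hq'2; nlinarith
  set I := (∑ i, w i * w' i) / n with hI
  have hexp : d ^ 2 = (∑ i, w i ^ 2) / n - 2 * I + (∑ i, w' i ^ 2) / n := by
    rw [hd2, hI, ← mul_div_assoc, ← sub_div, ← add_div, Finset.mul_sum, ← Finset.sum_sub_distrib,
      ← Finset.sum_add_distrib]
    congr 1; exact Finset.sum_congr rfl fun i _ => by ring
  have hCS : I ^ 2 ≤ (∑ i, w i ^ 2) / n * ((∑ i, w' i ^ 2) / n) := by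
    have := Finset.sum_mul_sq_le_sq_mul_sq Finset.univ w w'
    rw [hI, div_pow, div_mul_div_comm, ← sq]
    gcongr
  set A := (∑ i, w i ^ 2) / n
  set A' := (∑ i, w' i ^ 2) / n
  have key : (σ ^ 2 + I) ^ 2 + σ ^ 2 * d ^ 2 ≤ (q * q') ^ 2 := by
    rw [mul_pow, hq2, hq'2, hexp]; nlinarith
  have hqq : σ ^ 2 + I ≤ q * q' := by
    refine (abs_le.1 (abs_le_of_sq_le_sq ?_ (mul_pos hq hq').le)).2
    linarith [mul_nonneg (sq_nonneg σ) (sq_nonneg d)]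
  have hqd : q ≤ q' + d := by
    refine (abs_le.1 (abs_le_of_sq_le_sq ?_ (add_nonneg hq'.le hd0))).2
    have : I - A' ≤ q' * d := by
      refine (abs_le.1 (abs_le_of_sq_le_sq ?_ (mul_nonneg hq'.le hd0))).2
      have e4 : (q' * d) ^ 2 = σ ^ 2 * d ^ 2 + A' * (A - 2 * I + A') := by
        rw [mul_pow, hq'2, ← hexp]; ring
      rw [e4]
      have := mul_nonneg (sq_nonneg σ) (sq_nonneg d)
      linarith
    have e5 : (q' + d) ^ 2 = q' ^ 2 + 2 * (q' * d) + d ^ 2 := by ring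
    rw [e5, hq2, hq'2, hexp]
    linarith
  have hx : σ ^ 2 * d ^ 2 / (2 * (q * q')) ≤ q * q' - (σ ^ 2 + I) := by
    rw [div_le_iff₀ (by positivity)]
    nlinarith [mul_pos hq hq']
  have h1' : |q' ^ 2 - τ ^ 2| ≤ e := by
    rw [hq'2, show σ ^ 2 + A' - τ ^ 2 = A' - (τ ^ 2 - σ ^ 2) by ring]; exact h1
  have := H β τ σ e q q' k d (q * q' - (σ ^ 2 + I)) ((∑ i, g i * w' i) / n)
    (lam / n * ∑ i, |θ i + w' i|) g0 m hβ hβ' hτ hτ' hσ hσ' he he1 hd0 hq hqd hq' h1' h2 h3 h4 h5 hx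
  refine this.trans ?_
  have hlin : lam / n * ∑ i, |θ i + w' i| + β * ((∑ i, g i * w i) / n) -
      β * ((∑ i, g i * w' i) / n) - β / τ * (I - A') ≤ lam / n * ∑ i, |θ i + w i| := by
    have : ∀ i, lam * |θ i + w' i| + β * (g i * w i) - β * (g i * w' i) -
        β / τ * (w i * w' i - w' i ^ 2) ≤ lam * |θ i + w i| := by
      intro i
      have a1 : v i * (θ i + w i) ≤ lam * |θ i + w i| := by
        calc v i * (θ i + w i) ≤ |v i * (θ i + w i)| := le_abs_self _
          _ ≤ _ := by rw [abs_mul]; gcongr; exact hvl i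
      rw [← hvs i]
      refine le_trans (le_of_eq ?_) a1
      rw [hv i]; ring
    have hs := Finset.sum_le_sum fun i (_ : i ∈ Finset.univ) => this i
    simp only [Finset.sum_sub_distrib, Finset.sum_add_distrib, ← Finset.mul_sum] at hs
    have hs' := div_le_div_of_nonneg_right hs hn'.le
    refine le_trans (le_of_eq ?_) (hs'.trans (le_of_eq ?_))
    · simp only [hI, A']; ring
    · ring
  have e1 : β / τ * q' ^ 2 + β / τ * (q * q' - (σ ^ 2 + I)) + β * q * (k - q' / τ) =
      β * q * k - β / τ * (I - A') := by
    rw [hq'2]; field_simp; ring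
  linarith

lemma dual_step {lo hi D : ℝ} (hlo : 0 < lo) (hlh : lo ≤ hi) (hD : 0 ≤ D)
    {β τ σ e q q' k d X Y G g0 s : ℝ}
    (hβ : lo ≤ β) (hτ : lo ≤ τ) (hσ : lo ≤ σ) (hσ' : σ ≤ hi) (hτ' : τ ≤ hi)
    (he : 0 ≤ e) (he1 : e ≤ 1) (hd : 0 ≤ d) (hdD : d ≤ D) (hs : 0 ≤ s) (hs1 : s ≤ 1)
    (hq : 0 ≤ q) (hqq : q ^ 2 = q' ^ 2 + 2 * s * Y + s ^ 2 * d ^ 2) (hq' : lo ≤ q')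
    (hY : |Y| ≤ q' * d)
    (h1 : |q' ^ 2 - τ ^ 2| ≤ e) (h2 : |k - 1| ≤ e) (h3 : |G - (τ - β)| ≤ e) (h5 : |g0| ≤ e) :
    q * k - (G + s * (Y / τ + X / β)) + σ * g0 ≤ β - s * X / β + s ^ 2 * d ^ 2 / (2 * lo) +
      (1 / lo + D / lo ^ 2 + (hi + 1 + D) + 1 + hi) * e := by
  have hβ0 : 0 < β := hlo.trans_le hβ
  have hτ0 : 0 < τ := hlo.trans_le hτ
  have hσ0 : 0 < σ := hlo.trans_le hσ
  have hq0 : 0 < q' := hlo.trans_le hq'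
  have b1 := abs_sub_le_of_sq hq0.le hlo hτ h1
  have q'le : q' ≤ hi + 1 := by
    have := (abs_le.1 h1).2
    refine (abs_le.1 (abs_le_of_sq_le_sq (b := hi + 1) ?_ (by linarith))).2
    nlinarith
  set z := (2 * s * Y + s ^ 2 * d ^ 2) / (2 * q') with hz
  have hz' : q ^ 2 = q' ^ 2 + 2 * q' * z := by rw [hqq, hz]; field_simp; ring
  have hq1 : q ≤ q' + z := by
    have : 0 ≤ q' + z := by
      by_contra hc
      have : q' * (q' + z) < 0 := mul_neg_of_pos_of_neg hq0 (not_le.1 hc)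
      nlinarith [sq_nonneg q, sq_nonneg q']
    refine (abs_le.1 (abs_le_of_sq_le_sq ?_ this)).2
    nlinarith [sq_nonneg z]
  have hq2 : q ≤ hi + 1 + D := by
    have : q ≤ q' + d := by
      refine (abs_le.1 (abs_le_of_sq_le_sq ?_ (by positivity))).2
      have a1 : s * Y ≤ q' * d := by
        calc s * Y ≤ s * |Y| := by gcongr; exact le_abs_self _
          _ ≤ 1 * (q' * d) := by gcongr
          _ = _ := one_mul _
      have a2 : s ^ 2 * d ^ 2 ≤ 1 * d ^ 2 := by gcongr; exact pow_le_one₀ hs hs1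
      rw [hqq]; linarith [show (q' + d) ^ 2 = q' ^ 2 + 2 * (q' * d) + d ^ 2 by ring]
    linarith
  have t1 : q * k ≤ q + (hi + 1 + D) * e := by
    have a1 : q * (k - 1) ≤ q * e := by gcongr; exact (abs_le.1 h2).2
    have a2 : q * e ≤ (hi + 1 + D) * e := by gcongr
    linarith
  have t2 : z - s * (Y / τ) ≤ D / lo ^ 2 * e + s ^ 2 * d ^ 2 / (2 * lo) := by
    have e1 : z = s * Y / q' + s ^ 2 * d ^ 2 / (2 * q') := by rw [hz]; field_simp
    have e2 : s ^ 2 * d ^ 2 / (2 * q') ≤ s ^ 2 * d ^ 2 / (2 * lo) := by gcongr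
    have e3 : s * Y / q' - s * (Y / τ) = s * (Y / q') * ((τ - q') / τ) := by field_simp
    have e4 : s * (Y / q') * ((τ - q') / τ) ≤ 1 * D * (e / lo / lo) := by
      refine (le_abs_self _).trans ?_
      rw [abs_mul, abs_mul, abs_of_nonneg hs, abs_div, abs_div, abs_of_pos hq0, abs_of_pos hτ0,
        abs_sub_comm]
      gcongr
      rw [div_le_iff₀ hq0]
      exact hY.trans (by rw [mul_comm]; gcongr)
    have e5 : 1 * D * (e / lo / lo) = D / lo ^ 2 * e := by field_simp
    linarith
  have t3 : q' ≤ τ + 1 / lo * e := by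
    have := (abs_le.1 b1).2
    have e5 : e / lo = 1 / lo * e := by ring
    linarith
  have t4 := (abs_le.1 h3).1
  have t5 : σ * g0 ≤ hi * e := by
    calc σ * g0 ≤ σ * e := by gcongr; exact (abs_le.1 h5).2
      _ ≤ _ := by gcongr
  have e6 : s * (Y / τ + X / β) = s * (Y / τ) + s * X / β := by ring
  rw [e6]
  linarith

lemma dual_scalar {lo hi D C1 C2 : ℝ} (hlo : 0 < lo) (hlh : lo ≤ hi)
    (hC1 : 0 ≤ C1) (hC2 : C2 = hi / (2 * lo) + 3 / 2 * (hi ^ 3 / lo ^ 2 + D ^ 2 / (4 * lo ^ 2)))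
    {β e d X s A L m a R : ℝ}
    (hβ : lo ≤ β) (hβ' : β ≤ hi) (he : 0 ≤ e) (he1 : e ≤ 1) (hd : 0 ≤ d) (hdD : d ≤ D)
    (hs : s = 1 / (2 * (C2 + 1))) (hX : X ^ 2 ≤ hi ^ 3 * d ^ 2)
    (hA : A ≤ β - s * X / β + s ^ 2 * d ^ 2 / (2 * lo) + C1 * e) (ha : 0 ≤ a)
    (hL : L ≤ m + e) (hR : R ≤ L + s * X - s * d ^ 2) :
    a * A - a ^ 2 / 2 + R ≤ β ^ 2 / 2 + m + (1 + hi * C1 + 3 / 2 * C1 ^ 2) * e - s / 2 * d ^ 2 := by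
  have hhi : 0 < hi := hlo.trans_le hlh
  have hβ0 : 0 < β := hlo.trans_le hβ
  have hC20 : 0 ≤ C2 := by rw [hC2]; positivity
  have hs0 : 0 < s := by rw [hs]; positivity
  have hs1 : s ≤ 1 := by
    rw [hs, div_le_one (by positivity)]; linarith
  set r1 := s * X / β
  set r2 := s ^ 2 * d ^ 2 / (2 * lo)
  set r3 := C1 * e
  have s1 : a * A - a ^ 2 / 2 ≤ (β - r1 + r2 + r3) ^ 2 / 2 := by
    have : a * A ≤ a * (β - r1 + r2 + r3) := by gcongr
    nlinarith [sq_nonneg (a - (β - r1 + r2 + r3))]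
  have s2 : (β - r1 + r2 + r3) ^ 2 ≤ β ^ 2 + 2 * β * (-r1 + r2 + r3) +
      3 * (r1 ^ 2 + r2 ^ 2 + r3 ^ 2) := by
    nlinarith [sq_nonneg (r1 + r2), sq_nonneg (r1 + r3), sq_nonneg (r2 - r3)]
  have s3 : β * r1 = s * X := by simp only [r1]; field_simp
  have s4 : β * r2 ≤ hi / (2 * lo) * (s ^ 2 * d ^ 2) := by
    calc β * r2 ≤ hi * r2 := by gcongr
      _ = _ := by simp only [r2]; ring
  have s5 : β * r3 ≤ hi * C1 * e := by
    calc β * r3 ≤ hi * r3 := by gcongr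
      _ = _ := by simp only [r3]; ring
  have s6 : r1 ^ 2 ≤ hi ^ 3 / lo ^ 2 * (s ^ 2 * d ^ 2) := by
    calc r1 ^ 2 = s ^ 2 * X ^ 2 / β ^ 2 := by simp only [r1]; ring
      _ ≤ s ^ 2 * (hi ^ 3 * d ^ 2) / lo ^ 2 := by gcongr
      _ = _ := by ring
  have s7 : r2 ^ 2 ≤ D ^ 2 / (4 * lo ^ 2) * (s ^ 2 * d ^ 2) := by
    calc r2 ^ 2 = s ^ 2 * d ^ 2 * (s ^ 2 * d ^ 2) / (4 * lo ^ 2) := by simp only [r2]; ring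
      _ ≤ 1 * D ^ 2 * (s ^ 2 * d ^ 2) / (4 * lo ^ 2) := by
        gcongr
        exact pow_le_one₀ hs0.le hs1
      _ = _ := by ring
  have s8 : r3 ^ 2 ≤ C1 ^ 2 * e := by
    calc r3 ^ 2 = C1 ^ 2 * (e * e) := by simp only [r3]; ring
      _ ≤ C1 ^ 2 * (e * 1) := by gcongr
      _ = _ := by ring
  have s9 : C2 * (s ^ 2 * d ^ 2) ≤ s / 2 * d ^ 2 := by
    have : C2 * s ≤ 1 / 2 := by
      rw [hs, mul_one_div, div_le_div_iff₀ (by positivity) (by positivity)]; linarith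
    calc C2 * (s ^ 2 * d ^ 2) = C2 * s * (s * d ^ 2) := by ring
      _ ≤ 1 / 2 * (s * d ^ 2) := by gcongr
      _ = _ := by ring
  have s10 : C2 * (s ^ 2 * d ^ 2) = hi / (2 * lo) * (s ^ 2 * d ^ 2) +
      3 / 2 * (hi ^ 3 / lo ^ 2 * (s ^ 2 * d ^ 2)) +
      3 / 2 * (D ^ 2 / (4 * lo ^ 2) * (s ^ 2 * d ^ 2)) := by rw [hC2]; ring
  linarith

set_option maxHeartbeats 1000000 in
/-- Upper bound for the dual auxiliary objective at an explicit primal point. -/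
lemma dual_upper {lo hi : ℝ} (hlo : 0 < lo) (hlh : lo ≤ hi) :
    ∃ C c s B : ℝ, 0 < C ∧ 0 < c ∧
      ∀ (n N : ℕ) (β τ σ lam e k g0 m : ℝ) (θ g w' v ν w : Fin N → ℝ),
      0 < n → (N : ℝ) ≤ hi * n → lam ≤ hi →
      lo ≤ β → β ≤ hi → lo ≤ τ → τ ≤ hi → lo ≤ σ → σ ≤ hi → 0 ≤ e → e ≤ 1 →
      (∀ i, v i = β * g i - β / τ * w' i) → (∀ i, |v i| ≤ lam) →
      (∀ i, v i * (θ i + w' i) = lam * |θ i + w' i|) →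
      |(∑ i, w' i ^ 2) / n - (τ ^ 2 - σ ^ 2)| ≤ e → |k - 1| ≤ e →
      |(∑ i, g i * w' i) / n - (τ - β)| ≤ e → |lam / n * ∑ i, |θ i + w' i| - m| ≤ e → |g0| ≤ e →
      (∀ i, |ν i| ≤ lam) → (∀ i, w i = w' i + s * (v i - ν i)) →
      (∑ i, w i ^ 2) / n ≤ B ∧ ∀ a : ℝ, 0 ≤ a →
        a * (qf σ n w * k - (∑ i, g i * w i) / n + σ * g0) - a ^ 2 / 2 +
          (∑ i, ν i * (θ i + w i)) / n ≤
        β ^ 2 / 2 + m + C * e - c * (l2 (ν - v) / √n) ^ 2 := by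
  have hhi : 0 < hi := hlo.trans_le hlh
  set D := 4 * hi ^ 3 + 1 with hD
  have hD0 : 0 < D := by positivity
  set C1 := 1 / lo + D / lo ^ 2 + (hi + 1 + D) + 1 + hi with hC1
  have hC10 : 0 < C1 := by positivity
  set C2 := hi / (2 * lo) + 3 / 2 * (hi ^ 3 / lo ^ 2 + D ^ 2 / (4 * lo ^ 2)) with hC2
  have hC20 : 0 < C2 := by positivity
  set s := 1 / (2 * (C2 + 1)) with hs
  have hs0 : 0 < s := by positivity
  have hs1 : s ≤ 1 := by
    rw [hs, div_le_one (by positivity)]; linarith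
  refine ⟨1 + hi * C1 + 3 / 2 * C1 ^ 2, s / 2, s, 2 * (2 * hi ^ 2 + 1) + 2 * D, by positivity,
    by positivity, ?_⟩
  clear_value s C1 C2 D
  intro n N β τ σ lam e k g0 m θ g w' v ν w hn hN hlam hβ hβ' hτ hτ' hσ hσ' he he1 hv hvl hvs
    h1 h2 h3 h4 h5 hν hw
  have hn' : (0 : ℝ) < n := by exact_mod_cast hn
  have hβ0 : 0 < β := hlo.trans_le hβ
  have hτ0 : 0 < τ := hlo.trans_le hτ
  have hσ0 : 0 < σ := hlo.trans_le hσ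
  set d := l2 (ν - v) / √n with hd
  have hd0 : 0 ≤ d := div_nonneg (l2_nonneg _) (Real.sqrt_nonneg _)
  have hd2 : d ^ 2 = (∑ i, (v i - ν i) ^ 2) / n := by
    rw [hd, div_pow, l2_sq, Real.sq_sqrt hn'.le]
    congr 1; exact Finset.sum_congr rfl fun i _ => by simp only [Pi.sub_apply]; ring
  have cnt : ∀ f : Fin N → ℝ, ∀ c : ℝ, (0 ≤ c) → (∀ i, f i ≤ c * hi ^ 2) →
      (∑ i, f i) / n ≤ c * hi ^ 3 := by
    intro f c hc hf
    rw [div_le_iff₀ hn']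
    calc ∑ i, f i ≤ ∑ i : Fin N, c * hi ^ 2 := Finset.sum_le_sum fun i _ => hf i
      _ = c * hi ^ 2 * N := by simp [mul_comm]
      _ ≤ c * hi ^ 2 * (hi * n) := by gcongr
      _ = _ := by ring
  have hd4 : d ^ 2 ≤ 4 * hi ^ 3 := by
    rw [hd2]
    refine cnt _ 4 (by norm_num) fun i => ?_
    have a1 : |v i - ν i| ≤ 2 * hi := by
      refine (abs_sub _ _).trans ?_
      linarith [hvl i, hν i]
    calc (v i - ν i) ^ 2 = |v i - ν i| ^ 2 := (sq_abs _).symm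
      _ ≤ (2 * hi) ^ 2 := by gcongr
      _ = _ := by ring
  have hdD : d ≤ D := by nlinarith [sq_nonneg (d - 1)]
  set q := qf σ n w
  set q' := qf σ n w'
  have hq2 : q ^ 2 = σ ^ 2 + (∑ i, w i ^ 2) / n := qf_sq _ _ _
  have hq'2 : q' ^ 2 = σ ^ 2 + (∑ i, w' i ^ 2) / n := qf_sq _ _ _
  set X := (∑ i, v i * (v i - ν i)) / n with hX
  set Y := (∑ i, w' i * (v i - ν i)) / n with hY
  set A' := (∑ i, w' i ^ 2) / n with hA'
  have hA'0 : 0 ≤ A' := by positivity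
  have sumw : (∑ i, w i ^ 2) / n = A' + 2 * s * Y + s ^ 2 * d ^ 2 := by
    rw [hd2, hA', hY, mul_div_assoc', mul_div_assoc', ← add_div, ← add_div]
    congr 1
    rw [Finset.mul_sum, Finset.mul_sum, ← Finset.sum_add_distrib, ← Finset.sum_add_distrib]
    exact Finset.sum_congr rfl fun i _ => by rw [hw i]; ring
  have hq' : lo ≤ q' := by
    refine (abs_le.1 (abs_le_of_sq_le_sq (a := lo) (b := q') ?_ (qf_nonneg _ _ _))).2
    rw [hq'2]
    have : lo ^ 2 ≤ σ ^ 2 := by gcongr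
    linarith
  have CS : ∀ x : Fin N → ℝ, ((∑ i, x i * (v i - ν i)) / n) ^ 2 ≤ (∑ i, x i ^ 2) / n * d ^ 2 := by
    intro x
    have := Finset.sum_mul_sq_le_sq_mul_sq Finset.univ x (fun i => v i - ν i)
    rw [hd2, div_pow, div_mul_div_comm, ← sq (n : ℝ)]
    gcongr
  have hYb : |Y| ≤ q' * d := by
    refine abs_le_of_sq_le_sq ?_ (mul_nonneg (qf_nonneg _ _ _) hd0)
    refine (CS w').trans ?_
    rw [mul_pow, hq'2]
    gcongr
    linarith [sq_nonneg σ]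
  have hXb : X ^ 2 ≤ hi ^ 3 * d ^ 2 := by
    refine (CS v).trans ?_
    gcongr
    have := cnt (fun i => v i ^ 2) 1 (by norm_num) fun i => by
      rw [one_mul, ← sq_abs]
      have := (hvl i).trans hlam
      gcongr
    linarith
  have h1' : |q' ^ 2 - τ ^ 2| ≤ e := by
    rw [hq'2, show σ ^ 2 + A' - τ ^ 2 = A' - (τ ^ 2 - σ ^ 2) by ring]; exact h1
  have hqq : q ^ 2 = q' ^ 2 + 2 * s * Y + s ^ 2 * d ^ 2 := by rw [hq2, hq'2, sumw]; ring
  have st := dual_step (X := X) hlo hlh hD0.le hβ hτ hσ hσ' hτ' he he1 hd0 hdD hs0.le hs1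
    (qf_nonneg _ _ _) hqq hq' hYb h1' h2 h3 h5
  have hG : (∑ i, g i * w i) / n = (∑ i, g i * w' i) / n + s * (Y / τ + X / β) := by
    rw [hX, hY, div_div, div_div]
    have : ∀ i, g i * w i = g i * w' i + (s / τ * (w' i * (v i - ν i)) +
        s / β * (v i * (v i - ν i))) := by
      intro i
      have : g i = w' i / τ + v i / β := by rw [hv i]; field_simp; ring
      rw [hw i, this]; ring
    rw [Finset.sum_congr rfl fun i _ => this i, Finset.sum_add_distrib, Finset.sum_add_distrib,
      ← Finset.mul_sum, ← Finset.mul_sum]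
    field_simp
  constructor
  · rw [sumw]
    have a1 : A' ≤ 2 * hi ^ 2 + 1 := by
      have := (abs_le.1 h1).2
      have : τ ^ 2 ≤ hi ^ 2 := by gcongr
      have := sq_pos_of_pos hσ0
      have : σ ^ 2 ≤ hi ^ 2 := by gcongr
      linarith
    have a2 : 2 * s * Y ≤ A' + s ^ 2 * d ^ 2 := by
      have hY2 := CS w'
      rw [← hY, ← hA'] at hY2
      have : (s * Y) ^ 2 ≤ A' * (s ^ 2 * d ^ 2) := by
        rw [mul_pow]
        linarith [mul_le_mul_of_nonneg_left hY2 (sq_nonneg s)]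
      have : |2 * (s * Y)| ≤ A' + s ^ 2 * d ^ 2 := by
        refine abs_le_of_sq_le_sq ?_ (by positivity)
        linarith [sq_nonneg (A' - s ^ 2 * d ^ 2)]
      linarith [le_abs_self (2 * (s * Y))]
    have a3 : s ^ 2 * d ^ 2 ≤ 1 * (4 * hi ^ 3) := by
      gcongr
      exact pow_le_one₀ hs0.le hs1
    linarith
  intro a ha
  rw [hG]
  rw [← hC1] at st
  refine dual_scalar (L := lam / n * ∑ i, |θ i + w' i|) (X := X) hlo hlh hC10.le hC2 hβ hβ' he he1
    hd0 hdD hs hXb st ha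
    (by linarith [(abs_le.1 h4).2]) ?_
  rw [hX, hd2, mul_div_assoc', mul_div_assoc', div_mul_eq_mul_div, ← add_div, ← sub_div]
  refine div_le_div_of_nonneg_right ?_ hn'.le
  rw [Finset.mul_sum, Finset.mul_sum, Finset.mul_sum, ← Finset.sum_add_distrib,
    ← Finset.sum_sub_distrib]
  refine Finset.sum_le_sum fun i _ => ?_
  have a1 : ν i * (θ i + w' i) ≤ lam * |θ i + w' i| := by
    calc ν i * (θ i + w' i) ≤ |ν i * (θ i + w' i)| := le_abs_self _
      _ ≤ _ := by rw [abs_mul]; gcongr; exact hν i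
  rw [hw i]
  linarith [show ν i * (θ i + (w' i + s * (v i - ν i))) = ν i * (θ i + w' i) +
    s * (v i * (v i - ν i)) - s * (v i - ν i) ^ 2 by ring]

/-- Clipping to `[-b, b]`. -/
def clipf (b x : ℝ) : ℝ := max (-b) (min b x)

lemma eta_eq_sub_clipf {b : ℝ} (hb : 0 ≤ b) (x : ℝ) : eta x b = x - clipf b x := by
  unfold eta clipf
  rcases lt_trichotomy x 0 with h | h | h
  · rw [Real.sign_of_neg h, abs_of_neg h, min_eq_right (by linarith)]
    rcases le_total (-x) b with h1 | h1
    · rw [max_eq_right (by linarith), max_eq_right (by linarith)]; ring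
    · rw [max_eq_left (by linarith), max_eq_left (by linarith)]; ring
  · subst h
    simp [hb]
  · rw [Real.sign_of_pos h, abs_of_pos h]
    rcases le_total x b with h1 | h1
    · rw [max_eq_right (by linarith), min_eq_right h1, max_eq_right (by linarith)]; ring
    · rw [max_eq_left (by linarith), min_eq_left h1, max_eq_right (by linarith)]; ring

lemma abs_clipf_le {b : ℝ} (hb : 0 ≤ b) (x : ℝ) : |clipf b x| ≤ b := by
  unfold clipf
  rw [abs_le]
  exact ⟨le_max_left _ _, max_le (by linarith) (min_le_left _ _)⟩

lemma clipf_mul_sub {b : ℝ} (hb : 0 ≤ b) (x : ℝ) :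
    clipf b x * (x - clipf b x) = b * |x - clipf b x| := by
  unfold clipf
  rcases le_total x b with h | h
  · rw [min_eq_right h]
    rcases le_total (-b) x with h1 | h1
    · rw [max_eq_right h1]; simp
    · rw [max_eq_left h1, abs_of_nonpos (by linarith)]; ring
  · rw [min_eq_left h, max_eq_right (by linarith), abs_of_nonneg (by linarith)]

lemma abs_clipf_sub_le (b x y : ℝ) : |clipf b x - clipf b y| ≤ |x - y| := by
  unfold clipf
  calc |max (-b) (min b x) - max (-b) (min b y)| ≤ |min b x - min b y| := by
        simpa using abs_max_sub_max_le_max (-b) (min b x) (-b) (min b y)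
    _ ≤ |x - y| := by simpa using abs_min_sub_min_le_max b x b y

/-- Error vector of the limiting problem. -/
def wv {N : ℕ} (θ : Fin N → ℝ) (τ b : ℝ) (g : Fin N → ℝ) : Fin N → ℝ :=
  fun i => eta (θ i + τ * g i) b - θ i

/-- Dual vector of the limiting problem. -/
def nv {N : ℕ} (θ : Fin N → ℝ) (τ b β : ℝ) (g : Fin N → ℝ) : Fin N → ℝ :=
  fun i => β / τ * clipf b (θ i + τ * g i)

lemma nv_eq {N : ℕ} {θ : Fin N → ℝ} {τ b β : ℝ} (hτ : 0 < τ) (hb : 0 ≤ b) (g : Fin N → ℝ)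
    (i : Fin N) : nv θ τ b β g i = β * g i - β / τ * wv θ τ b g i := by
  unfold nv wv
  rw [eta_eq_sub_clipf hb]
  field_simp; ring

lemma abs_nv_le {N : ℕ} {θ : Fin N → ℝ} {τ β lam : ℝ} (hτ : 0 < τ) (hβ : 0 < β) (hl : 0 ≤ lam)
    (g : Fin N → ℝ) (i : Fin N) : |nv θ τ (τ * lam / β) β g i| ≤ lam := by
  unfold nv
  rw [abs_mul, abs_of_pos (by positivity)]
  calc β / τ * |clipf _ _| ≤ β / τ * (τ * lam / β) := by
        gcongr; exact abs_clipf_le (by positivity) _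
    _ = lam := by field_simp

lemma nv_mul {N : ℕ} {θ : Fin N → ℝ} {τ β lam : ℝ} (hτ : 0 < τ) (hβ : 0 < β) (hl : 0 ≤ lam)
    (g : Fin N → ℝ) (i : Fin N) : nv θ τ (τ * lam / β) β g i * (θ i + wv θ τ (τ * lam / β) g i) =
      lam * |θ i + wv θ τ (τ * lam / β) g i| := by
  have hb : 0 ≤ τ * lam / β := by positivity
  unfold nv wv
  rw [eta_eq_sub_clipf hb, add_sub_cancel, mul_assoc, clipf_mul_sub hb]
  field_simp

/-- The correlation of the columns of the design with the residual. -/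
def resCorr {n N : ℕ} (X : Fin n → Fin N → ℝ) (y : Fin n → ℝ) (θ : Fin N → ℝ) : Fin N → ℝ :=
  fun j => ∑ i, X i j * (y i - ∑ j', X i j' * θ j')

lemma lassoCost_update {n N : ℕ} (hn : 0 < n) (X : Fin n → Fin N → ℝ) (y : Fin n → ℝ) (lam : ℝ)
    (θ : Fin N → ℝ) (j : Fin N) (t : ℝ) :
    n * (lassoCost X y lam (Function.update θ j (θ j + t)) - lassoCost X y lam θ) =
      -(t * resCorr X y θ j) + t ^ 2 * ((∑ i, X i j ^ 2) / 2) + lam * (|θ j + t| - |θ j|) := by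
  have hn' : (n : ℝ) ≠ 0 := by exact_mod_cast hn.ne'
  have e1 : ∀ i, ∑ j', X i j' * Function.update θ j (θ j + t) j' =
      ∑ j', X i j' * θ j' + t * X i j := by
    intro i
    rw [← sub_eq_iff_eq_add', ← Finset.sum_sub_distrib, Finset.sum_eq_single j]
    · simp; ring
    · intro b _ hb; simp [Function.update_of_ne hb]
    · simp
  have e2 : ∑ j', |Function.update θ j (θ j + t) j'| = ∑ j', |θ j'| + (|θ j + t| - |θ j|) := by
    rw [← sub_eq_iff_eq_add', ← Finset.sum_sub_distrib, Finset.sum_eq_single j]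
    · simp
    · intro b _ hb; simp [Function.update_of_ne hb]
    · simp
  have e3 : ∑ i, (y i - ∑ j', X i j' * Function.update θ j (θ j + t) j') ^ 2 =
      ∑ i, (y i - ∑ j', X i j' * θ j') ^ 2 - 2 * t * resCorr X y θ j + t ^ 2 * ∑ i, X i j ^ 2 := by
    unfold resCorr
    rw [Finset.mul_sum, Finset.mul_sum, ← Finset.sum_sub_distrib, ← Finset.sum_add_distrib]
    refine Finset.sum_congr rfl fun i _ => ?_
    rw [e1]; ring
  unfold lassoCost
  rw [e2, e3]
  field_simp
  ring

lemma nonneg_of_forall_quadratic {a K : ℝ} (h : ∀ t : ℝ, 0 < t → t ≤ 1 → 0 ≤ t * a + t ^ 2 * K) :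
    0 ≤ a := by
  by_contra hc
  have ha : a < 0 := not_le.1 hc
  have hK : 0 < |K| + 1 := by positivity
  set t := min 1 (-a / (2 * (|K| + 1)))
  have ht : 0 < t := lt_min one_pos (div_pos (by linarith) (by positivity))
  have h1 := h t ht (min_le_left _ _)
  have h2 : t * (|K| + 1) ≤ -a / 2 := by
    have : t ≤ -a / (2 * (|K| + 1)) := min_le_right _ _
    calc t * (|K| + 1) ≤ -a / (2 * (|K| + 1)) * (|K| + 1) := by gcongr
      _ = -a / 2 := by field_simp
  have h3 : 0 ≤ a + t * K := by
    by_contra hc2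
    have := mul_neg_of_pos_of_neg ht (not_le.1 hc2)
    nlinarith
  nlinarith [le_abs_self K]

/-- KKT conditions for the Lasso. -/
lemma lasso_kkt {n N : ℕ} (hn : 0 < n) {X : Fin n → Fin N → ℝ} {y : Fin n → ℝ} {lam : ℝ}
    (hl : 0 ≤ lam) {θ : Fin N → ℝ} (h : IsMinOn (lassoCost X y lam) Set.univ θ) (j : Fin N) :
    |resCorr X y θ j| ≤ lam ∧ resCorr X y θ j * θ j = lam * |θ j| := by
  have hn' : (0 : ℝ) < n := by exact_mod_cast hn
  have key : ∀ t, 0 ≤ -(t * resCorr X y θ j) + t ^ 2 * ((∑ i, X i j ^ 2) / 2) +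
      lam * (|θ j + t| - |θ j|) := by
    intro t
    rw [← lassoCost_update hn]
    exact mul_nonneg hn'.le (sub_nonneg.2 (h (Set.mem_univ _)))
  have h1 : |resCorr X y θ j| ≤ lam := by
    rw [abs_le]
    constructor
    · have : 0 ≤ resCorr X y θ j + lam := by
        refine nonneg_of_forall_quadratic (K := (∑ i, X i j ^ 2) / 2) fun t ht _ => ?_
        have a := key (-t)
        have : lam * (|θ j + -t| - |θ j|) ≤ lam * t := by
          gcongr
          have := abs_add_le (θ j) (-t)
          rw [abs_neg, abs_of_pos ht] at this
          linarith
        linarith [show (-t) ^ 2 * ((∑ i, X i j ^ 2) / 2) =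
          t ^ 2 * ((∑ i, X i j ^ 2) / 2) by ring]
      linarith
    · have : 0 ≤ -resCorr X y θ j + lam := by
        refine nonneg_of_forall_quadratic (K := (∑ i, X i j ^ 2) / 2) fun t ht _ => ?_
        have a := key t
        have : lam * (|θ j + t| - |θ j|) ≤ lam * t := by
          gcongr
          have := abs_add_le (θ j) t
          rw [abs_of_pos ht] at this
          linarith
        linarith
      linarith
  refine ⟨h1, le_antisymm ?_ ?_⟩
  · calc resCorr X y θ j * θ j ≤ |resCorr X y θ j * θ j| := le_abs_self _
      _ ≤ _ := by rw [abs_mul]; gcongr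
  · have : 0 ≤ resCorr X y θ j * θ j - lam * |θ j| := by
      refine nonneg_of_forall_quadratic (K := θ j ^ 2 * ((∑ i, X i j ^ 2) / 2)) fun t ht ht1 => ?_
      have a := key (-(t * θ j))
      have e : |θ j + -(t * θ j)| = (1 - t) * |θ j| := by
        rw [show θ j + -(t * θ j) = (1 - t) * θ j by ring, abs_mul, abs_of_nonneg (by linarith)]
      rw [e] at a
      linarith
    linarith

/-- Typical event for the auxiliary Gaussian variables. -/
def GoodEv (σ : ℝ) (n : ℕ) {N : ℕ} (θ : Fin N → ℝ) (lam β τ m e : ℝ) : Set (GIdx n N → ℝ) :=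
  {ω | |l2 (fun k => ω (Sum.inl k)) / √n - 1| ≤ e ∧ |ω (Sum.inr (Sum.inr ())) / √n| ≤ e ∧
    |(∑ i, wv θ τ (τ * lam / β) (fun j => ω (Sum.inr (Sum.inl j))) i ^ 2) / n -
      (τ ^ 2 - σ ^ 2)| ≤ e ∧
    |(∑ i, ω (Sum.inr (Sum.inl i)) *
      wv θ τ (τ * lam / β) (fun j => ω (Sum.inr (Sum.inl j))) i) / n - (τ - β)| ≤ e ∧
    |lam / n * ∑ i, |θ i + wv θ τ (τ * lam / β) (fun j => ω (Sum.inr (Sum.inl j))) i| - m| ≤ e}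

lemma growth_bound {C c c4 e η d κ : ℝ} (hη : 0 < η) (hη1 : η ≤ 1) (hκ : κ = c4 * η ^ 2)
    (hc4 : 0 < c4) (hc : 100 * c4 ≤ c) (he : 2 * C * e ≤ κ) (hd : 0 ≤ d) :
    -κ ≤ -(C * e * (1 + d)) + c * (d ^ 2 / (1 + d)) ∧
    (η < d → 25 * κ ≤ -(C * e * (1 + d)) + c * (d ^ 2 / (1 + d))) := by
  have hκ0 : 0 < κ := by rw [hκ]; positivity
  have hκ4 : κ ≤ c4 := by
    rw [hκ]; exact mul_le_of_le_one_right hc4.le (pow_le_one₀ hη.le hη1)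
  rcases le_total d 1 with h | h
  · have h1 : d ^ 2 / 2 ≤ d ^ 2 / (1 + d) := by gcongr; linarith
    have h2 : C * e * (1 + d) ≤ κ := by nlinarith
    have h3 : 100 * c4 * (d ^ 2 / 2) ≤ c * (d ^ 2 / (1 + d)) := by gcongr; linarith
    refine ⟨by have := mul_nonneg hc4.le (sq_nonneg d); linarith, fun h4 => ?_⟩
    have : c4 * η ^ 2 ≤ c4 * d ^ 2 := by gcongr
    linarith
  · have h1 : d / 2 ≤ d ^ 2 / (1 + d) := by
      rw [div_le_div_iff₀ (by norm_num) (by linarith)]; nlinarith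
    have h2 : C * e * (1 + d) ≤ κ * d := by nlinarith
    have h3 : 100 * c4 * (d / 2) ≤ c * (d ^ 2 / (1 + d)) := by gcongr; linarith
    have h4 : κ * d ≤ c4 * d := by gcongr
    have h5 : c4 ≤ c4 * d := by nlinarith
    exact ⟨by linarith, fun _ => by linarith⟩

lemma le_l2 {ι : Type*} [Fintype ι] (u : ι → ℝ) (i : ι) : |u i| ≤ l2 u := by
  unfold l2
  refine Real.abs_le_sqrt (Finset.single_le_sum (f := fun i => u i ^ 2) (fun _ _ => sq_nonneg _)
    (Finset.mem_univ i))

lemma isBounded_l2_le {ι : Type*} [Fintype ι] (r : ℝ) :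
    Bornology.IsBounded {u : ι → ℝ | l2 u ≤ r} := by
  rcases lt_or_ge r 0 with h | h
  · refine Bornology.IsBounded.subset (Metric.isBounded_closedBall (x := (0 : ι → ℝ)) (r := 0))
      fun u hu => ?_
    have hu' : l2 u ≤ r := hu
    linarith [l2_nonneg u]
  refine Bornology.IsBounded.subset (Metric.isBounded_closedBall (x := (0 : ι → ℝ)) (r := r))
    fun u hu => ?_
  rw [Metric.mem_closedBall, dist_zero_right, pi_norm_le_iff_of_nonneg h]
  exact fun i => (le_l2 u i).trans hu

lemma l2_smul {ι : Type*} [Fintype ι] {c : ℝ} (hc : 0 ≤ c) (u : ι → ℝ) :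
    l2 (fun i => c * u i) = c * l2 u := by
  unfold l2
  simp_rw [mul_pow, ← Finset.mul_sum]
  rw [Real.sqrt_mul (sq_nonneg c), Real.sqrt_sq hc]

/-- Primal potential. -/
def primalQ (lam : ℝ) {n N : ℕ} (θ : Fin N → ℝ) (w : Fin N → ℝ) (u : Fin n → ℝ) : ℝ :=
  -((∑ i, u i ^ 2) / 2) + lam * ∑ i, |θ i + w i|

/-- Dual potential. -/
def dualQ {n N : ℕ} (θ : Fin N → ℝ) (p : (Fin n → ℝ) × (Fin N → ℝ)) (w : Fin N → ℝ) : ℝ :=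
  -((∑ i, p.1 i ^ 2) / 2) + ∑ i, p.2 i * (θ i + w i)

lemma primal_aux {lo hi : ℝ} (hlo : 0 < lo) (hlh : lo ≤ hi) :
    ∃ C c : ℝ, 0 < C ∧ 0 < c ∧ ∀ (n N : ℕ) (β τ σ lam e m : ℝ) (θ w : Fin N → ℝ)
      (ω : GIdx n N → ℝ), 0 < n → 0 ≤ lam →
      lo ≤ β → β ≤ hi → lo ≤ τ → τ ≤ hi → lo ≤ σ → σ ≤ hi → 0 ≤ e → e < 1 →
      ω ∈ GoodEv σ n θ lam β τ m e → ∃ u : Fin n → ℝ, l2 u ≤ β * √n ∧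
      ∀ d, d = l2 (w - wv θ τ (τ * lam / β) (fun j => ω (Sum.inr (Sum.inl j)))) / √n →
      n * (β ^ 2 / 2 + m + (-(C * e * (1 + d)) + c * (d ^ 2 / (1 + d)))) ≤
        auxProc σ ω w u + primalQ lam θ w u := by
  obtain ⟨C, c, hC, hc, H⟩ := primal_lower hlo hlh
  refine ⟨C, c, hC, hc, ?_⟩
  intro n N β τ σ lam e m θ w ω hn hl hβ hβ' hτ hτ' hσ hσ' he he1 ⟨h1, h2, h3, h4, h5⟩
  have hβ0 : 0 < β := hlo.trans_le hβ
  have hτ0 : 0 < τ := hlo.trans_le hτ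
  have hb : 0 ≤ τ * lam / β := by positivity
  have hn' : (0 : ℝ) < n := by exact_mod_cast hn
  have hsn : 0 < √(n : ℝ) := Real.sqrt_pos.2 hn'
  set h : Fin n → ℝ := fun k => ω (Sum.inl k) with hh
  set g : Fin N → ℝ := fun j => ω (Sum.inr (Sum.inl j)) with hg
  set g0 := ω (Sum.inr (Sum.inr ())) with hg0
  have hh0 : 0 < l2 h := by
    by_contra hc
    have : l2 h = 0 := le_antisymm (not_lt.1 hc) (l2_nonneg _)
    rw [this, zero_div] at h1
    norm_num at h1; linarith
  have := H n N β τ σ lam e (l2 h / √n) (g0 / √n) m θ g (wv θ τ (τ * lam / β) g)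
    (nv θ τ (τ * lam / β) β g) w hn hβ hβ' hτ hτ' hσ hσ' he he1.le
    (fun i => nv_eq hτ0 hb g i) (fun i => abs_nv_le hτ0 hβ0 hl g i)
    (fun i => nv_mul hτ0 hβ0 hl g i) h3 h1 h4 h5 h2
  have hl2u : l2 (fun k => β * √n / l2 h * h k) = β * √n := by
    rw [l2_smul (by positivity)]; field_simp
  refine ⟨fun k => β * √n / l2 h * h k, hl2u.le, ?_⟩
  intro d hd
  rw [← hd] at this
  have hu2 : ∑ i, (β * √n / l2 h * h i) ^ 2 = β ^ 2 * n := by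
    rw [← l2_sq, hl2u, mul_pow, Real.sq_sqrt hn'.le]
  have hhu : ∑ k, ω (Sum.inl k) * (β * √n / l2 h * h k) = β * √n * l2 h := by
    have : ∀ k, ω (Sum.inl k) * (β * √n / l2 h * h k) = β * √n / l2 h * h k ^ 2 := by
      intro k; simp only [hh]; ring
    rw [Finset.sum_congr rfl fun k _ => this k, ← Finset.mul_sum, ← l2_sq]
    field_simp
  unfold auxProc primalQ
  rw [hl2u, hu2, hhu]
  have hss : √(n : ℝ) * √n = n := Real.mul_self_sqrt hn'.le
  have e1 : n * (β * (qf σ n w * (l2 h / √n) - (∑ i, g i * w i) / n + σ * (g0 / √n)) - β ^ 2 / 2 +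
      lam / n * ∑ i, |θ i + w i|) = qf σ n w * (β * √n * l2 h) -
      β * √n * ((∑ l, ω (Sum.inr (Sum.inl l)) * w l) / √n - σ * ω (Sum.inr (Sum.inr ()))) +
      (-(β ^ 2 * n / 2) + lam * ∑ i, |θ i + w i|) := by
    have a0 : (n : ℝ) / √n = √n := by rw [div_eq_iff hsn.ne', hss]
    have a1 : (n : ℝ) * (l2 h / √n) = √n * l2 h := by linear_combination l2 h * a0
    have a2 : (n : ℝ) * (g0 / √n) = √n * g0 := by linear_combination g0 * a0
    have a3 : √(n : ℝ) * ((∑ l, ω (Sum.inr (Sum.inl l)) * w l) / √n) =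
      ∑ l, ω (Sum.inr (Sum.inl l)) * w l := by field_simp
    have a4 : (n : ℝ) * ((∑ i, g i * w i) / n) = ∑ l, ω (Sum.inr (Sum.inl l)) * w l := by
      field_simp; rfl
    have a5 : (n : ℝ) * (lam / n * ∑ i, |θ i + w i|) = lam * ∑ i, |θ i + w i| := by field_simp
    linear_combination β * qf σ n w * a1 + β * σ * a2 + a5 - β * a4 + β * a3
  rw [← e1]
  refine mul_le_mul_of_nonneg_left ?_ hn'.le
  linarith

lemma dual_aux {lo hi : ℝ} (hlo : 0 < lo) (hlh : lo ≤ hi) :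
    ∃ C c B : ℝ, 0 < C ∧ 0 < c ∧ ∀ (n N : ℕ) (β τ σ lam e m : ℝ) (θ : Fin N → ℝ)
      (p : (Fin n → ℝ) × (Fin N → ℝ))
      (ω : GIdx n N → ℝ), 0 < n → (N : ℝ) ≤ hi * n → 0 ≤ lam → lam ≤ hi →
      lo ≤ β → β ≤ hi → lo ≤ τ → τ ≤ hi → lo ≤ σ → σ ≤ hi → 0 ≤ e → e < 1 →
      ω ∈ GoodEv σ n θ lam β τ m e → (∀ i, |p.2 i| ≤ lam) →
      ∃ w : Fin N → ℝ, l2 w ≤ √(B * n) ∧ auxProc σ ω w p.1 + dualQ θ p w ≤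
      n * (β ^ 2 / 2 + m + C * e -
        c * (l2 (p.2 - nv θ τ (τ * lam / β) β (fun j => ω (Sum.inr (Sum.inl j)))) / √n) ^ 2) := by
  obtain ⟨C, c, s, B, hC, hc, H⟩ := dual_upper hlo hlh
  refine ⟨C, c, B, hC, hc, ?_⟩
  intro n N β τ σ lam e m θ ⟨u, ν⟩ ω hn hN hl hlhi hβ hβ' hτ hτ' hσ hσ' he he1
    ⟨h1, h2, h3, h4, h5⟩ hν
  have hβ0 : 0 < β := hlo.trans_le hβ
  have hτ0 : 0 < τ := hlo.trans_le hτ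
  have hb : 0 ≤ τ * lam / β := by positivity
  have hn' : (0 : ℝ) < n := by exact_mod_cast hn
  have hsn : 0 < √(n : ℝ) := Real.sqrt_pos.2 hn'
  set h : Fin n → ℝ := fun k => ω (Sum.inl k) with hh
  set g : Fin N → ℝ := fun j => ω (Sum.inr (Sum.inl j)) with hg
  set g0 := ω (Sum.inr (Sum.inr ())) with hg0
  set w : Fin N → ℝ := fun i => wv θ τ (τ * lam / β) g i +
    s * (nv θ τ (τ * lam / β) β g i - ν i) with hw
  obtain ⟨hB, hmain⟩ := H n N β τ σ lam e (l2 h / √n) (g0 / √n) m θ g (wv θ τ (τ * lam / β) g)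
    (nv θ τ (τ * lam / β) β g) ν w hn hN hlhi hβ hβ' hτ hτ' hσ hσ' he he1.le
    (fun i => nv_eq hτ0 hb g i) (fun i => abs_nv_le hτ0 hβ0 hl g i)
    (fun i => nv_mul hτ0 hβ0 hl g i) h3 h1 h4 h5 h2 hν (fun i => rfl)
  refine ⟨w, ?_, ?_⟩
  · unfold l2
    refine Real.sqrt_le_sqrt ?_
    rwa [div_le_iff₀ hn'] at hB
  have := hmain (l2 u / √n) (div_nonneg (l2_nonneg _) hsn.le)
  refine le_trans ?_ (mul_le_mul_of_nonneg_left this hn'.le)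
  unfold auxProc dualQ
  have hss : √(n : ℝ) * √n = n := Real.mul_self_sqrt hn'.le
  have a1 : (n : ℝ) * (l2 u / √n * (l2 h / √n)) = l2 u * l2 h := by
    rw [div_mul_div_comm, hss]; field_simp
  have a2 : (n : ℝ) * (l2 u / √n * (g0 / √n)) = l2 u * g0 := by
    rw [div_mul_div_comm, hss]; field_simp
  have a3 : (n : ℝ) * (l2 u / √n * ((∑ i, g i * w i) / n)) = l2 u * ((∑ i, g i * w i) / √n) := by
    field_simp
  have a4 : (n : ℝ) * ((l2 u / √n) ^ 2 / 2) = (∑ i, u i ^ 2) / 2 := by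
    rw [div_pow, l2_sq, Real.sq_sqrt hn'.le]; field_simp
  have a5 : (n : ℝ) * ((∑ i, ν i * (θ i + w i)) / n) = ∑ i, ν i * (θ i + w i) := by field_simp
  have a6 : qf σ n w * ∑ k, ω (Sum.inl k) * u k ≤ qf σ n w * (l2 h * l2 u) := by
    gcongr
    · exact qf_nonneg _ _ _
    · exact sum_mul_le_l2 h u
  refine (add_le_add_left (sub_le_sub_right a6 _) _).trans (le_of_eq ?_)
  linear_combination -(qf σ n w) * a1 - σ * a2 + a3 + a4 - a5

lemma lassoCost_eq {n N : ℕ} (hn : 0 < n) (X : Fin n → Fin N → ℝ) (z : Fin n → ℝ) (σ lam : ℝ)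
    (θ θ' : Fin N → ℝ) : n * lassoCost X (yvec σ θ X z) lam θ' =
      (∑ k, (∑ j, X k j * (θ' - θ) j - σ * z k) ^ 2) / 2 + lam * ∑ j, |θ' j| := by
  have hn' : (0 : ℝ) < n := by exact_mod_cast hn
  have : ∀ k, (yvec σ θ X z k - ∑ j, X k j * θ' j) ^ 2 =
      (∑ j, X k j * (θ' - θ) j - σ * z k) ^ 2 := by
    intro k
    simp only [yvec, Pi.sub_apply, mul_sub, Finset.sum_sub_distrib]
    ring
  unfold lassoCost
  simp_rw [this]
  field_simp

lemma modProc_add_primalQ_le {n N : ℕ} (hn : 0 < n)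
    (ω : (Fin n → Fin N → ℝ) × (Fin n → ℝ)) (σ lam : ℝ) (θ θ' : Fin N → ℝ) (u : Fin n → ℝ) :
    modProc σ ω (θ' - θ) u + primalQ lam θ (θ' - θ) u ≤
      n * lassoCost ω.1 (yvec σ θ ω.1 ω.2) lam θ' := by
  rw [lassoCost_eq hn]
  unfold modProc primalQ
  have h : ∀ j, θ j + (θ' - θ) j = θ' j := fun j => by simp
  simp_rw [h]
  set v : Fin n → ℝ := fun k => ∑ j, ω.1 k j * (θ' - θ) j - σ * ω.2 k with hv
  have : 0 ≤ ∑ k, (u k - v k) ^ 2 := Finset.sum_nonneg fun _ _ => sq_nonneg _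
  have e : ∑ k, (u k - v k) ^ 2 = ∑ k, u k ^ 2 + ∑ k, v k ^ 2 - 2 * ∑ k, u k * v k := by
    rw [Finset.mul_sum, ← Finset.sum_add_distrib, ← Finset.sum_sub_distrib]
    exact Finset.sum_congr rfl fun k _ => by ring
  simp only [hv] at e this
  linarith

lemma modProc_add_dualQ_eq {n N : ℕ} (hn : 0 < n)
    (ω : (Fin n → Fin N → ℝ) × (Fin n → ℝ)) {σ lam : ℝ} {θ θ' : Fin N → ℝ} (w : Fin N → ℝ)
    (hk : ∀ j, resCorr ω.1 (yvec σ θ ω.1 ω.2) θ' j * θ' j = lam * |θ' j|) :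
    modProc σ ω w (fun k => ∑ j, ω.1 k j * (θ' - θ) j - σ * ω.2 k) +
      dualQ θ ((fun k => ∑ j, ω.1 k j * (θ' - θ) j - σ * ω.2 k),
        resCorr ω.1 (yvec σ θ ω.1 ω.2) θ') w =
      n * lassoCost ω.1 (yvec σ θ ω.1 ω.2) lam θ' := by
  rw [lassoCost_eq hn]
  unfold modProc dualQ
  set v : Fin n → ℝ := fun k => ∑ j, ω.1 k j * (θ' - θ) j - σ * ω.2 k with hv
  set r := resCorr ω.1 (yvec σ θ ω.1 ω.2) θ' with hr
  have hrv : ∀ j, r j = - ∑ k, ω.1 k j * v k := by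
    intro j
    rw [hr, resCorr, ← Finset.sum_neg_distrib]
    refine Finset.sum_congr rfl fun k _ => ?_
    simp only [hv, yvec, Pi.sub_apply, mul_sub, Finset.sum_sub_distrib]
    ring
  have h1 : ∀ x : Fin N → ℝ, ∑ j, r j * x j = - ∑ k, v k * ∑ j, ω.1 k j * x j := by
    intro x
    simp_rw [hrv, neg_mul, Finset.sum_neg_distrib, Finset.sum_mul, Finset.mul_sum]
    rw [Finset.sum_comm]
    congr 1
    refine Finset.sum_congr rfl fun k _ => Finset.sum_congr rfl fun j _ => by ring
  have h2 : lam * ∑ j, |θ' j| = ∑ j, r j * θ' j := by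
    rw [Finset.mul_sum]; exact Finset.sum_congr rfl fun j _ => (hk j).symm
  have h3 : ∑ k, v k ^ 2 = ∑ k, v k * (∑ j, ω.1 k j * θ' j) - ∑ k, v k * (∑ j, ω.1 k j * θ j) -
      ∑ k, v k * (σ * ω.2 k) := by
    rw [← Finset.sum_sub_distrib, ← Finset.sum_sub_distrib]
    refine Finset.sum_congr rfl fun k _ => ?_
    rw [sq]
    nth_rw 2 [hv]
    simp only [Pi.sub_apply, mul_sub, Finset.sum_sub_distrib]
  have h4 : ∑ k, v k * (∑ j, ω.1 k j * w j - σ * ω.2 k) =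
      ∑ k, v k * (∑ j, ω.1 k j * w j) - ∑ k, v k * (σ * ω.2 k) := by
    simp only [mul_sub, Finset.sum_sub_distrib]
  have h5 : ∑ j, r j * (θ j + w j) = ∑ j, r j * θ j + ∑ j, r j * w j := by
    simp only [mul_add, Finset.sum_add_distrib]
  rw [h2]
  change ∑ k, v k * (∑ j, ω.1 k j * w j - σ * ω.2 k) + (-((∑ i, v i ^ 2) / 2) +
    ∑ j, r j * (θ j + w j)) = (∑ k, v k ^ 2) / 2 + ∑ j, r j * θ' j
  rw [h4, h5, h1, h1, h1]
  linarith

lemma continuous_primalQ (lam : ℝ) {n N : ℕ} (θ : Fin N → ℝ) :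
    Continuous fun p : (Fin N → ℝ) × (Fin n → ℝ) => primalQ lam θ p.1 p.2 := by
  unfold primalQ; fun_prop

lemma continuous_dualQ {n N : ℕ} (θ : Fin N → ℝ) :
    Continuous fun p : ((Fin n → ℝ) × (Fin N → ℝ)) × (Fin N → ℝ) => dualQ θ p.1 p.2 := by
  unfold dualQ; fun_prop

lemma four_union_le {α β : Type*} [MeasurableSpace α] [MeasurableSpace β] (μ : Measure α)
    (ν : Measure β) {S A B C D : Set α} {E : Set β} (hS : S ⊆ (A ∪ B) ∪ (C ∪ D))
    (hA : μ A ≤ 2 * ν E) (hB : μ B ≤ 2 * ν E) (hC : μ C ≤ 2 * ν E) (hD : μ D ≤ 2 * ν E) :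
    μ S ≤ 8 * ν E := by
  calc μ S ≤ μ ((A ∪ B) ∪ (C ∪ D)) := measure_mono hS
    _ ≤ (μ A + μ B) + (μ C + μ D) := (measure_union_le _ _).trans
        (add_le_add (measure_union_le _ _) (measure_union_le _ _))
    _ ≤ (2 * ν E + 2 * ν E) + (2 * ν E + 2 * ν E) := by gcongr
    _ = 8 * ν E := by ring

set_option maxHeartbeats 1000000 in
theorem model_typical {lo hi : ℝ} (hlo : 0 < lo) (hlh : lo ≤ hi) :
    ∃ c2 c3 : ℝ, 0 < c2 ∧ c2 < 1 ∧ 0 < c3 ∧ ∀ (n N : ℕ) (β τ σ lam m η : ℝ) (θ : Fin N → ℝ),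
      0 < n → (N : ℝ) ≤ hi * n → lo ≤ lam → lam ≤ hi →
      lo ≤ β → β ≤ hi → lo ≤ τ → τ ≤ hi → lo ≤ σ → σ ≤ hi → m ≤ hi → 0 < η → η ≤ 1 →
      (∀ (X : Fin n → Fin N → ℝ) (z : Fin n → ℝ), ∃ θ', IsMinOn (lassoCost X (yvec σ θ X z) lam)
        Set.univ θ') → ∀ T : Set (Fin N → ℝ),
      Pmodel n N {ω | ∃ l θ', lo ≤ l ∧ l ≤ lam ∧ lam ≤ l + c3 * η ^ 2 ∧
        IsMinOn (lassoCost ω.1 (yvec σ θ ω.1 ω.2) l) Set.univ θ' ∧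
        ¬ ((∃ g ∈ T, l2 (θ' - θ - wv θ τ (τ * lam / β) g) ≤ η * √n) ∧
          (∃ g ∈ T, l2 (resCorr ω.1 (yvec σ θ ω.1 ω.2) θ' - nv θ τ (τ * lam / β) β g) ≤
            η * √n))} ≤
      8 * stdPi (GIdx n N) {ω | ω ∉ GoodEv σ n θ lam β τ m (c2 * η ^ 2) ∨
        (fun j => ω (Sum.inr (Sum.inl j))) ∉ T} := by
  obtain ⟨Cp, cp, hCp, hcp, HP⟩ := primal_aux hlo hlh
  obtain ⟨Cd, cd, B, hCd, hcd, HD⟩ := dual_aux hlo hlh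
  have hhi : 0 < hi := hlo.trans_le hlh
  obtain ⟨c4, hc4, hc4p, hc4d, hc41⟩ : ∃ c4 : ℝ, 0 < c4 ∧ 100 * c4 ≤ cp ∧ 100 * c4 ≤ cd ∧
      2 * c4 ≤ 1 := by
    refine ⟨min (min cp cd / 100) (1/2), by positivity, ?_, ?_, ?_⟩
    · have := min_le_left (min cp cd / 100) (1/2); have := min_le_left cp cd; linarith
    · have := min_le_left (min cp cd / 100) (1/2); have := min_le_right cp cd; linarith
    · have := min_le_right (min cp cd / 100) (1/2); linarith
  obtain ⟨c2, hc2, hc21, hc2p, hc2d⟩ : ∃ c2 : ℝ, 0 < c2 ∧ c2 < 1 ∧ 2 * Cp * c2 ≤ c4 ∧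
      Cd * c2 ≤ c4 := by
    refine ⟨min (1/2) (c4 / (2 * Cp + Cd)), by positivity, ?_, ?_, ?_⟩
    · exact (min_le_left _ _).trans_lt (by norm_num)
    · calc 2 * Cp * min (1/2) (c4 / (2 * Cp + Cd)) ≤ (2 * Cp + Cd) * (c4 / (2 * Cp + Cd)) := by
            gcongr
            · linarith
            · exact min_le_right _ _
        _ = c4 := by field_simp
    · calc Cd * min (1/2) (c4 / (2 * Cp + Cd)) ≤ (2 * Cp + Cd) * (c4 / (2 * Cp + Cd)) := by
            gcongr
            · linarith
            · exact min_le_right _ _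
        _ = c4 := by field_simp
  refine ⟨c2, c4 * lo / (hi ^ 2 + hi + 1), hc2, hc21, by positivity, ?_⟩
  intro n N β τ σ lam m η θ hn hN hlam hlam' hβ hβ' hτ hτ' hσ hσ' hm hη hη1 hmin T
  obtain ⟨κ, hκ⟩ : ∃ κ, κ = c4 * η ^ 2 := ⟨_, rfl⟩
  obtain ⟨e, he⟩ : ∃ e, e = c2 * η ^ 2 := ⟨_, rfl⟩
  obtain ⟨ψ, hψ⟩ : ∃ ψ, ψ = β ^ 2 / 2 + m := ⟨_, rfl⟩
  have hn' : (0 : ℝ) < n := by exact_mod_cast hn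
  have hsn : 0 < √(n : ℝ) := Real.sqrt_pos.2 hn'
  have hκ0 : 0 < κ := by rw [hκ]; positivity
  have he0 : 0 ≤ e := by rw [he]; positivity
  have hη2 : η ^ 2 ≤ 1 := pow_le_one₀ hη.le hη1
  have he1 : e < 1 := by
    rw [he]; exact (mul_le_of_le_one_right hc2.le hη2).trans_lt hc21
  have hκ1 : 2 * κ ≤ 1 := by
    rw [hκ]; have := mul_le_of_le_one_right hc4.le hη2; linarith
  have hep : 2 * Cp * e ≤ κ := by
    rw [hκ, he]; have := mul_le_mul_of_nonneg_right hc2p (sq_nonneg η); linarith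
  have hed : Cd * e ≤ κ := by
    rw [hκ, he]; have := mul_le_mul_of_nonneg_right hc2d (sq_nonneg η); linarith
  have hlam0 : 0 ≤ lam := hlo.le.trans hlam
  rw [← he]
  set Bad : Set (GIdx n N → ℝ) := {ω | ω ∉ GoodEv σ n θ lam β τ m e ∨
        (fun j => ω (Sum.inr (Sum.inl j))) ∉ T} with hBad
  set U : Set (Fin n → ℝ) := {u | l2 u ≤ β * √n} with hU
  set BB : Set (Fin N → ℝ) := {w | l2 w ≤ √(B * n)} with hBB
  set D3 : Set (Fin N → ℝ) := {w | ∀ g ∈ T, η * √n < l2 (w - wv θ τ (τ * lam / β) g)} with hD3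
  set D2 : Set ((Fin n → ℝ) × (Fin N → ℝ)) := {p | ∀ i, |p.2 i| ≤ lam} with hD2
  set D4 : Set ((Fin n → ℝ) × (Fin N → ℝ)) := {p | (∀ i, |p.2 i| ≤ lam) ∧
    ∀ g ∈ T, η * √n < l2 (p.2 - nv θ τ (τ * lam / β) β g)} with hD4
  have herr : 0 < n * κ / 2 := by positivity
  have A1 := gordon_primal σ n N (continuous_primalQ lam θ) Set.univ
    (isBounded_l2_le (β * √n) : Bornology.IsBounded U) (n * (ψ - 2 * κ)) herr
  have A3 := gordon_primal σ n N (continuous_primalQ lam θ) D3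
    (isBounded_l2_le (β * √n) : Bornology.IsBounded U) (n * (ψ + 10 * κ)) herr
  have A2 := gordon_dual σ n N (continuous_dualQ θ) D2
    (isBounded_l2_le (√(B * n)) : Bornology.IsBounded BB) (n * (ψ + 2 * κ)) herr
  have A4 := gordon_dual σ n N (continuous_dualQ θ) D4
    (isBounded_l2_le (√(B * n)) : Bornology.IsBounded BB) (n * (ψ - 10 * κ)) herr
  refine four_union_le (Pmodel n N) (stdPi (GIdx n N)) ?_
    (A1.trans ?_) (A2.trans ?_) (A3.trans ?_) (A4.trans ?_)
  · rintro ω ⟨l, θ', hl, hll, hl3, hmin', hnot⟩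
    by_contra hcon
    simp only [Set.mem_union, not_or] at hcon
    obtain ⟨⟨n1, n2⟩, n3, n4⟩ := hcon
    simp only [Set.mem_ofPred_eq, not_exists, not_and, not_forall, not_le, Set.mem_univ,
      forall_const] at n1 n2 n3 n4
    obtain ⟨θ0, hθ0⟩ := hmin ω.1 ω.2
    have hl0 : 0 ≤ l := hlo.le.trans hl
    obtain ⟨k1, k2⟩ := forall_and.1 (lasso_kkt hn hl0 hmin')
    obtain ⟨q1, q2⟩ := forall_and.1 (lasso_kkt hn hlam0 hθ0)
    -- upper bound on the optimal cost
    have up : lassoCost ω.1 (yvec σ θ ω.1 ω.2) lam θ0 ≤ ψ + 2 * κ := by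
      obtain ⟨w, hw, h⟩ := n2 ((fun k => ∑ j, ω.1 k j * (θ0 - θ) j - σ * ω.2 k),
        resCorr ω.1 (yvec σ θ ω.1 ω.2) θ0) q1
      rw [modProc_add_dualQ_eq hn ω w q2] at h
      exact (lt_of_mul_lt_mul_left h hn'.le).le
    have mono : ∀ t, lassoCost ω.1 (yvec σ θ ω.1 ω.2) lam t =
        lassoCost ω.1 (yvec σ θ ω.1 ω.2) l t + (lam - l) * ((∑ j, |t j|) / n) := by
      intro t; unfold lassoCost; ring
    have nn : ∀ t : Fin N → ℝ, 0 ≤ (∑ j, |t j|) / n := fun t => by positivity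
    have up1 : lassoCost ω.1 (yvec σ θ ω.1 ω.2) l θ' ≤ ψ + 2 * κ := by
      have a := isMinOn_iff.1 hmin' θ0 (Set.mem_univ _)
      have b := mono θ0
      have := mul_nonneg (sub_nonneg.2 hll) (nn θ0)
      linarith
    have l1b : (∑ j, |θ' j|) / n ≤ (ψ + 1) / lo := by
      have : lo * ((∑ j, |θ' j|) / n) ≤ lassoCost ω.1 (yvec σ θ ω.1 ω.2) l θ' := by
        have e : lassoCost ω.1 (yvec σ θ ω.1 ω.2) l θ' = (1 / (2 * (n : ℝ))) *
          ∑ i, (yvec σ θ ω.1 ω.2 i - ∑ j, ω.1 i j * θ' j) ^ 2 + l * ((∑ j, |θ' j|) / n) := by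
          unfold lassoCost; ring
        rw [e]
        have h1 := mul_le_mul_of_nonneg_right hl (nn θ')
        have h2 : 0 ≤ (1 / (2 * (n : ℝ))) *
          ∑ i, (yvec σ θ ω.1 ω.2 i - ∑ j, ω.1 i j * θ' j) ^ 2 := by positivity
        linarith
      rw [le_div_iff₀ hlo]
      linarith
    have ψhi : ψ + 1 ≤ hi ^ 2 + hi + 1 := by
      have : β ^ 2 ≤ hi ^ 2 := by
        have : 0 ≤ β := hlo.le.trans hβ
        gcongr
      have := sq_nonneg β
      rw [hψ]; linarith
    have slack : (lam - l) * ((∑ j, |θ' j|) / n) ≤ κ := by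
      calc (lam - l) * ((∑ j, |θ' j|) / n) ≤
          (c4 * lo / (hi ^ 2 + hi + 1) * η ^ 2) * ((hi ^ 2 + hi + 1) / lo) := by
            refine mul_le_mul (by linarith) (l1b.trans (by gcongr)) (nn _) (by positivity)
        _ = κ := by rw [hκ]; field_simp
    have up2 : lassoCost ω.1 (yvec σ θ ω.1 ω.2) lam θ' ≤ ψ + 3 * κ := by
      rw [mono]; linarith
    have low : ψ - 2 * κ ≤ lassoCost ω.1 (yvec σ θ ω.1 ω.2) lam θ0 := by
      obtain ⟨u, hu, h⟩ := n1 (θ0 - θ)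
      have := h.trans_le (modProc_add_primalQ_le hn ω σ lam θ θ0 u)
      exact (lt_of_mul_lt_mul_left this hn'.le).le
    have low2 : ψ - 3 * κ ≤ lassoCost ω.1 (yvec σ θ ω.1 ω.2) l θ' := by
      have a := isMinOn_iff.1 hθ0 θ' (Set.mem_univ _)
      have := mono θ'
      linarith
    refine hnot ⟨?_, ?_⟩
    · by_contra hD
      have hD : (θ' - θ) ∈ D3 := fun g hg => by
        by_contra h; exact hD ⟨g, hg, not_lt.1 h⟩
      obtain ⟨u, hu, h⟩ := n3 _ hD
      have := h.trans_le (modProc_add_primalQ_le hn ω σ lam θ θ' u)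
      have := lt_of_mul_lt_mul_left this hn'.le
      linarith
    · by_contra hD
      have hD : ((fun k => ∑ j, ω.1 k j * (θ' - θ) j - σ * ω.2 k),
          resCorr ω.1 (yvec σ θ ω.1 ω.2) θ') ∈ D4 :=
        ⟨fun i => (k1 i).trans hll, fun g hg => by
          by_contra h; exact hD ⟨g, hg, not_lt.1 h⟩⟩
      obtain ⟨w, hw, h⟩ := n4 _ hD
      rw [modProc_add_dualQ_eq hn ω w k2] at h
      have := lt_of_mul_lt_mul_left h hn'.le
      linarith
  · gcongr
    rintro ω ⟨w, -, h⟩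
    by_contra hb
    simp only [hBad, Set.mem_ofPred_eq, not_or, not_not] at hb
    obtain ⟨u, hu, hm'⟩ := HP n N β τ σ lam e m θ w ω hn hlam0 hβ hβ' hτ hτ' hσ hσ' he0 he1 hb.1
    have a := (hm' _ rfl).trans (h u hu)
    obtain ⟨g1, -⟩ := growth_bound (C := Cp) (c := cp) hη hη1 hκ hc4 hc4p hep
      (div_nonneg (l2_nonneg (w - wv θ τ (τ * lam / β) fun j => ω (Sum.inr (Sum.inl j)))) hsn.le)
    have := mul_le_mul_of_nonneg_left g1 hn'.le
    have hp := mul_pos hn' hκ0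
    rw [← hψ, mul_add] at a
    linarith
  · gcongr
    rintro ω ⟨p, hp, h⟩
    by_contra hb
    simp only [hBad, Set.mem_ofPred_eq, not_or, not_not] at hb
    obtain ⟨w, hw, hm'⟩ := HD n N β τ σ lam e m θ p ω hn hN hlam0 hlam' hβ hβ' hτ hτ' hσ hσ'
      he0 he1 hb.1 hp
    have a := (h w hw).trans hm'
    have hp := mul_pos hn' hκ0
    have h1 := mul_le_mul_of_nonneg_left hed hn'.le
    have h2 : 0 ≤ n * (cd * (l2 (p.2 - nv θ τ (τ * lam / β) β
      (fun j => ω (Sum.inr (Sum.inl j)))) / √n) ^ 2) := by positivity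
    rw [← hψ] at a
    linarith
  · gcongr
    rintro ω ⟨w, hwD, h⟩
    by_contra hb
    simp only [hBad, Set.mem_ofPred_eq, not_or, not_not] at hb
    obtain ⟨u, hu, hm'⟩ := HP n N β τ σ lam e m θ w ω hn hlam0 hβ hβ' hτ hτ' hσ hσ' he0 he1 hb.1
    have a := (hm' _ rfl).trans (h u hu)
    obtain ⟨-, g1⟩ := growth_bound (C := Cp) (c := cp) hη hη1 hκ hc4 hc4p hep
      (div_nonneg (l2_nonneg (w - wv θ τ (τ * lam / β) fun j => ω (Sum.inr (Sum.inl j)))) hsn.le)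
    have g1 := g1 (by rw [lt_div_iff₀ hsn]; exact hwD _ hb.2)
    have := mul_le_mul_of_nonneg_left g1 hn'.le
    have hp := mul_pos hn' hκ0
    rw [← hψ, mul_add] at a
    linarith
  · gcongr
    rintro ω ⟨p, ⟨hp, hp4⟩, h⟩
    by_contra hb
    simp only [hBad, Set.mem_ofPred_eq, not_or, not_not] at hb
    obtain ⟨w, hw, hm'⟩ := HD n N β τ σ lam e m θ p ω hn hN hlam0 hlam' hβ hβ' hτ hτ' hσ hσ'
      he0 he1 hb.1 hp
    have a := (h w hw).trans hm'
    have h1 := mul_le_mul_of_nonneg_left hed hn'.le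
    have hd := hp4 _ hb.2
    rw [← lt_div_iff₀ hsn] at hd
    have h2 : 100 * κ ≤ cd * (l2 (p.2 - nv θ τ (τ * lam / β) β
      (fun j => ω (Sum.inr (Sum.inl j)))) / √n) ^ 2 := by
      rw [hκ, ← mul_assoc]
      gcongr
    have hp := mul_pos hn' hκ0
    have := mul_le_mul_of_nonneg_left h2 hn'.le
    rw [← hψ] at a
    linarith

lemma exp_le_one_add_sq_mul_exp_abs (y : ℝ) : Real.exp y ≤ 1 + y + y ^ 2 * Real.exp |y| := by
  rcases le_or_gt |y| 1 with h | h
  · have h1 := (abs_le.1 (Real.abs_exp_sub_one_sub_id_le h)).2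
    have : y ^ 2 * 1 ≤ y ^ 2 * Real.exp |y| := by
      gcongr; exact Real.one_le_exp (abs_nonneg y)
    linarith
  · have h1 : 1 < y ^ 2 := by rw [← sq_abs]; nlinarith
    have h2 := Real.add_one_le_exp |y|
    rcases le_total 0 y with h0 | h0
    · rw [abs_of_nonneg h0] at *
      have := Real.exp_pos y
      nlinarith
    · have h3 : Real.exp y ≤ 1 := Real.exp_le_one_iff.2 h0
      have h4 : 1 * Real.exp |y| ≤ y ^ 2 * Real.exp |y| := by gcongr
      rw [abs_of_nonpos h0] at *
      linarith

lemma exp_mul_le_of_abs_le {A s x X : ℝ} (hA : 0 < A) (hX : |X| ≤ A * (1 + x ^ 2))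
    (hs : |s| ≤ 1 / (16 * A)) : Real.exp (s * X) ≤ 1 + s * X +
      s ^ 2 * (2 * (16 * A) ^ 2 * Real.exp 1) * Real.exp (x ^ 2 / 4) := by
  refine (exp_le_one_add_sq_mul_exp_abs (s * X)).trans ?_
  have hu : |s * X| ≤ |X| / (16 * A) := by
    rw [abs_mul]
    calc |s| * |X| ≤ 1 / (16 * A) * |X| := by gcongr
      _ = _ := by ring
  set u := |X| / (16 * A) with hu'
  have hu0 : 0 ≤ u := by positivity
  have h1 : u ^ 2 ≤ 2 * Real.exp u := by
    have := Real.quadratic_le_exp_of_nonneg hu0; linarith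
  have h2 : u ≤ (1 + x ^ 2) / 16 := by
    rw [hu', div_le_iff₀ (by positivity)]
    linarith
  have h3 : u ^ 2 * Real.exp u ≤ 2 * Real.exp 1 * Real.exp (x ^ 2 / 4) := by
    calc u ^ 2 * Real.exp u ≤ 2 * Real.exp u * Real.exp u := by gcongr
      _ = 2 * Real.exp (u + u) := by rw [Real.exp_add]; ring
      _ ≤ 2 * Real.exp (1 + x ^ 2 / 4) := by
        refine mul_le_mul_of_nonneg_left (Real.exp_le_exp.2 ?_) (by norm_num)
        linarith [sq_nonneg x]
      _ = _ := by rw [Real.exp_add]; ring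
  have h4 : (s * X) ^ 2 = s ^ 2 * (16 * A) ^ 2 * u ^ 2 := by
    rw [hu', div_pow, sq_abs]; field_simp
  calc 1 + s * X + (s * X) ^ 2 * Real.exp |s * X| ≤
      1 + s * X + s ^ 2 * (16 * A) ^ 2 * u ^ 2 * Real.exp u := by rw [h4]; gcongr
    _ = 1 + s * X + s ^ 2 * (16 * A) ^ 2 * (u ^ 2 * Real.exp u) := by ring
    _ ≤ 1 + s * X + s ^ 2 * (16 * A) ^ 2 * (2 * Real.exp 1 * Real.exp (x ^ 2 / 4)) := by gcongr
    _ = _ := by ring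

lemma integral_sq_gaussian : ∫ x, x ^ 2 ∂(gaussianReal 0 1) = 1 := by
  have h := variance_id_gaussianReal (μ := 0) (v := 1)
  rw [variance_eq_integral measurable_id.aemeasurable] at h
  simpa using h

lemma integrable_sq_gaussian : Integrable (fun x : ℝ => x ^ 2) (gaussianReal 0 1) :=
  integrable_gaussian_of_le_sq (by fun_prop) 1 fun x => by
    rw [abs_of_nonneg (sq_nonneg x)]; linarith

lemma abs_integral_gaussian_le {Y : ℝ → ℝ} {A : ℝ} (hY : ∀ x, |Y x| ≤ A * (1 + x ^ 2)) :
    |∫ x, Y x ∂(gaussianReal 0 1)| ≤ 2 * A := by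
  have hi : Integrable (fun x : ℝ => A * (1 + x ^ 2)) (gaussianReal 0 1) :=
    ((integrable_const 1).add integrable_sq_gaussian).const_mul A
  have := norm_integral_le_of_norm_le hi (Filter.Eventually.of_forall fun x => by
    rw [Real.norm_eq_abs]; exact hY x)
  rw [integral_const_mul, integral_add (integrable_const _) integrable_sq_gaussian,
    integral_sq_gaussian] at this
  simp only [integral_const, probReal_univ, one_smul, Real.norm_eq_abs] at this
  linarith

lemma mgf_le_of_abs_le {A : ℝ} (hA : 0 < A) : ∃ C : ℝ, 0 < C ∧ ∀ (X : ℝ → ℝ), Measurable X →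
    (∀ x, |X x| ≤ A * (1 + x ^ 2)) → ∫ x, X x ∂(gaussianReal 0 1) = 0 →
    ∀ s : ℝ, |s| ≤ 1 / (16 * A) →
      Integrable (fun x => Real.exp (s * X x)) (gaussianReal 0 1) ∧
      ∫ x, Real.exp (s * X x) ∂(gaussianReal 0 1) ≤ Real.exp (C * s ^ 2) := by
  set G := ∫ x : ℝ, Real.exp (x ^ 2 / 4) ∂(gaussianReal 0 1) with hG
  have hG0 : 0 ≤ G := integral_nonneg fun _ => (Real.exp_pos _).le
  refine ⟨(2 * (16 * A) ^ 2 * Real.exp 1) * (G + 1), by positivity, ?_⟩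
  intro X hXm hX hX0 s hs
  have hXi : Integrable X (gaussianReal 0 1) :=
    integrable_gaussian_of_le_sq hXm.aestronglyMeasurable A hX
  have hi : Integrable (fun x => 1 + s * X x +
      s ^ 2 * (2 * (16 * A) ^ 2 * Real.exp 1) * Real.exp (x ^ 2 / 4)) (gaussianReal 0 1) :=
    ((integrable_const 1).add (hXi.const_mul s)).add (integrable_exp_sq_div_four.const_mul _)
  have hle : ∀ x, Real.exp (s * X x) ≤ 1 + s * X x +
      s ^ 2 * (2 * (16 * A) ^ 2 * Real.exp 1) * Real.exp (x ^ 2 / 4) :=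
    fun x => exp_mul_le_of_abs_le hA (hX x) hs
  have hint : Integrable (fun x => Real.exp (s * X x)) (gaussianReal 0 1) := by
    refine hi.mono' (by fun_prop) (Filter.Eventually.of_forall fun x => ?_)
    rw [Real.norm_eq_abs, abs_of_pos (Real.exp_pos _)]
    exact hle x
  refine ⟨hint, (integral_mono hint hi hle).trans ?_⟩
  have hi1 : Integrable (fun x => 1 + s * X x) (gaussianReal 0 1) :=
    (integrable_const 1).add (hXi.const_mul s)
  rw [integral_add hi1
    (integrable_exp_sq_div_four.const_mul _), integral_add (integrable_const 1)
    (hXi.const_mul s), integral_const_mul, integral_const_mul, hX0, ← hG]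
  simp only [integral_const, probReal_univ, one_smul, mul_zero, add_zero]
  refine le_trans ?_ (Real.add_one_le_exp _)
  have : 0 ≤ s ^ 2 * (2 * (16 * A) ^ 2 * Real.exp 1) := by positivity
  nlinarith

lemma upper_tail_le {A : ℝ} (hA : 0 < A) : ∃ c : ℝ, 0 < c ∧ ∀ (ι : Type) [Fintype ι]
    (X : ι → ℝ → ℝ), (∀ i, Measurable (X i)) → (∀ i x, |X i x| ≤ A * (1 + x ^ 2)) →
    (∀ i, ∫ x, X i x ∂(gaussianReal 0 1) = 0) → ∀ t : ℝ, 0 < t → t ≤ 1 →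
      stdPi ι {g | t * Fintype.card ι ≤ ∑ i, X i (g i)} ≤
        ENNReal.ofReal (Real.exp (-c * Fintype.card ι * t ^ 2)) := by
  obtain ⟨C, hC, H⟩ := mgf_le_of_abs_le hA
  set a : ℝ := min (1 / (16 * A)) (1 / (2 * C)) with ha
  have ha0 : 0 < a := by positivity
  refine ⟨a / 2, by positivity, ?_⟩
  intro ι _ X hXm hX hX0 t ht ht1
  set s := a * t with hs
  have hs0 : 0 < s := by positivity
  have hsa : |s| ≤ 1 / (16 * A) := by
    rw [abs_of_pos hs0, hs]
    exact (mul_le_of_le_one_right ha0.le ht1).trans (min_le_left _ _)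
  have hCs : C * s ^ 2 ≤ s * t / 2 := by
    have : C * a ≤ 1 / 2 := by
      calc C * a ≤ C * (1 / (2 * C)) := by gcongr; exact min_le_right _ _
        _ = 1 / 2 := by field_simp
    have h2 : 0 ≤ s * t := by positivity
    calc C * s ^ 2 = (C * a) * (s * t) := by rw [hs]; ring
      _ ≤ 1 / 2 * (s * t) := by gcongr
      _ = _ := by ring
  have hprod : ∫ g, ∏ i, Real.exp (s * X i (g i)) ∂(stdPi ι) ≤
      Real.exp (Fintype.card ι * (s * t / 2)) := by
    rw [integral_fintype_prod_eq_prod (fun i x => Real.exp (s * X i x))]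
    calc ∏ i, ∫ x, Real.exp (s * X i x) ∂(gaussianReal 0 1)
        ≤ ∏ _i : ι, Real.exp (s * t / 2) := by
          refine Finset.prod_le_prod (fun i _ => integral_nonneg fun _ => (Real.exp_pos _).le)
            fun i _ => ?_
          exact ((H (X i) (hXm i) (hX i) (hX0 i) s hsa).2).trans (Real.exp_le_exp.2 hCs)
      _ = _ := by rw [Finset.prod_const, Finset.card_univ, ← Real.exp_nat_mul]
  have hint : Integrable (fun g : ι → ℝ => ∏ i, Real.exp (s * X i (g i))) (stdPi ι) :=
    Integrable.fintype_prod fun i => (H (X i) (hXm i) (hX i) (hX0 i) s hsa).1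
  have hmk := mul_meas_ge_le_integral_of_nonneg (μ := stdPi ι)
    (Filter.Eventually.of_forall fun g => Finset.prod_nonneg fun i _ => (Real.exp_pos _).le) hint
    (Real.exp (s * (t * Fintype.card ι)))
  rw [← ofReal_measureReal]
  refine ENNReal.ofReal_le_ofReal ?_
  have hset : {g : ι → ℝ | t * Fintype.card ι ≤ ∑ i, X i (g i)} =
      {g | Real.exp (s * (t * Fintype.card ι)) ≤ ∏ i, Real.exp (s * X i (g i))} := by
    ext g
    simp only [Set.mem_ofPred_eq]
    rw [← Real.exp_sum, Real.exp_le_exp, ← Finset.mul_sum, mul_le_mul_iff_right₀ hs0]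
  rw [hset]
  have h3 := hmk.trans hprod
  rw [mul_comm, ← le_div_iff₀ (Real.exp_pos _), ← Real.exp_sub] at h3
  refine h3.trans (Real.exp_le_exp.2 (le_of_eq ?_))
  rw [hs]; ring

/-- Bernstein-type inequality for quadratically bounded functions of Gaussians. -/
theorem gaussian_bernstein {A : ℝ} (hA : 0 < A) : ∃ c : ℝ, 0 < c ∧ ∀ (ι : Type) [Fintype ι]
    (Y : ι → ℝ → ℝ), (∀ i, Measurable (Y i)) → (∀ i x, |Y i x| ≤ A * (1 + x ^ 2)) →
    ∀ t : ℝ, 0 < t → t ≤ 1 →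
      stdPi ι {g | t * Fintype.card ι ≤ |∑ i, Y i (g i) - ∑ i, ∫ x, Y i x ∂(gaussianReal 0 1)|} ≤
        ENNReal.ofReal (2 * Real.exp (-c * Fintype.card ι * t ^ 2)) := by
  obtain ⟨c, hc, H⟩ := upper_tail_le (A := 3 * A) (by positivity)
  refine ⟨c, hc, ?_⟩
  intro ι _ Y hYm hY t ht ht1
  set X : ι → ℝ → ℝ := fun i x => Y i x - ∫ x, Y i x ∂(gaussianReal 0 1) with hX
  have hXm : ∀ i, Measurable (X i) := fun i => (hYm i).sub_const _
  have hXb : ∀ i x, |X i x| ≤ 3 * A * (1 + x ^ 2) := by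
    intro i x
    have h1 := abs_sub (Y i x) (∫ x, Y i x ∂(gaussianReal 0 1))
    have h2 := abs_integral_gaussian_le (hY i)
    have h3 := hY i x
    have : 0 ≤ A * x ^ 2 := by positivity
    simp only [hX]
    linarith
  have hX0 : ∀ i, ∫ x, X i x ∂(gaussianReal 0 1) = 0 := by
    intro i
    simp only [hX]
    rw [integral_sub (integrable_gaussian_of_le_sq (hYm i).aestronglyMeasurable A (hY i))
      (integrable_const _)]
    simp
  have h1 := H ι X hXm hXb hX0 t ht ht1
  have h2 := H ι (fun i x => -X i x) (fun i => (hXm i).neg)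
    (fun i x => by rw [abs_neg]; exact hXb i x)
    (fun i => by rw [integral_neg, hX0 i, neg_zero]) t ht ht1
  have hs : ∀ g : ι → ℝ, ∑ i, Y i (g i) - ∑ i, ∫ x, Y i x ∂(gaussianReal 0 1) =
      ∑ i, X i (g i) := fun g => by simp only [hX, Finset.sum_sub_distrib]
  calc stdPi ι {g | t * Fintype.card ι ≤
        |∑ i, Y i (g i) - ∑ i, ∫ x, Y i x ∂(gaussianReal 0 1)|}
      ≤ stdPi ι ({g | t * Fintype.card ι ≤ ∑ i, X i (g i)} ∪
          {g | t * Fintype.card ι ≤ ∑ i, -X i (g i)}) := by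
        refine measure_mono fun g hg => ?_
        simp only [Set.mem_ofPred_eq, hs] at hg
        rcases le_abs'.1 hg with h | h
        · right
          simp only [Set.mem_ofPred_eq, Finset.sum_neg_distrib]; linarith
        · exact Or.inl h
    _ ≤ _ := (measure_union_le _ _).trans (add_le_add h1 h2)
    _ = _ := by rw [← ENNReal.ofReal_add (Real.exp_pos _).le (Real.exp_pos _).le, two_mul]

lemma gaussian_tail : ∃ C : ℝ, 0 < C ∧ ∀ s : ℝ, 0 ≤ s →
    gaussianReal 0 1 {x | s ≤ |x|} ≤ ENNReal.ofReal (C * Real.exp (-(s ^ 2 / 4))) := by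
  set G := ∫ x : ℝ, Real.exp (x ^ 2 / 4) ∂(gaussianReal 0 1) with hG
  have hG0 : 0 ≤ G := integral_nonneg fun _ => (Real.exp_pos _).le
  refine ⟨G + 1, by positivity, fun s hs => ?_⟩
  have := mul_meas_ge_le_integral_of_nonneg (μ := gaussianReal 0 1)
    (Filter.Eventually.of_forall fun g => (Real.exp_pos _).le) integrable_exp_sq_div_four
    (Real.exp (s ^ 2 / 4))
  rw [← ofReal_measureReal]
  refine ENNReal.ofReal_le_ofReal ?_
  have hset : {x : ℝ | s ≤ |x|} = {x | Real.exp (s ^ 2 / 4) ≤ Real.exp (x ^ 2 / 4)} := by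
    ext x
    simp only [Set.mem_ofPred_eq]
    rw [Real.exp_le_exp, div_le_div_iff_of_pos_right (by norm_num), sq_le_sq, abs_of_nonneg hs]
  rw [hset]
  rw [mul_comm, ← le_div_iff₀ (Real.exp_pos _)] at this
  refine this.trans ?_
  rw [← hG, Real.exp_neg, ← div_eq_mul_inv]
  gcongr
  linarith

/-- Scalar error of soft thresholding. -/
def ew (t τ b x : ℝ) : ℝ := eta (t + τ * x) b - t

lemma continuous_clipf (b : ℝ) : Continuous (clipf b) := by unfold clipf; fun_prop

lemma continuous_eta {b : ℝ} (hb : 0 ≤ b) : Continuous fun y => eta y b := by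
  simp_rw [eta_eq_sub_clipf hb]
  exact continuous_id.sub (continuous_clipf b)

lemma continuous_ew (t τ : ℝ) {b : ℝ} (hb : 0 ≤ b) : Continuous (ew t τ b) := by
  unfold ew
  exact ((continuous_eta hb).comp (by fun_prop)).sub continuous_const

lemma ew_eq (t τ : ℝ) {b : ℝ} (hb : 0 ≤ b) (x : ℝ) :
    ew t τ b x = τ * x - clipf b (t + τ * x) := by
  unfold ew; rw [eta_eq_sub_clipf hb]; ring

lemma abs_ew_le {t τ b : ℝ} (hτ : 0 ≤ τ) (hb : 0 ≤ b) (x : ℝ) : |ew t τ b x| ≤ τ * |x| + b := by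
  rw [ew_eq t τ hb]
  refine (abs_sub _ _).trans (add_le_add (le_of_eq ?_) (abs_clipf_le hb _))
  rw [abs_mul, abs_of_nonneg hτ]

lemma measurable_eta' (b : ℝ) : Measurable fun y => eta' y b := by
  unfold eta'
  exact Measurable.ite (measurableSet_lt measurable_const (by fun_prop)) measurable_const
    measurable_const

lemma eta'_nonneg (y b : ℝ) : 0 ≤ eta' y b := by unfold eta'; split_ifs <;> norm_num

lemma eta'_le_one (y b : ℝ) : eta' y b ≤ 1 := by unfold eta'; split_ifs <;> norm_num

lemma hasDerivAt_eta {y b : ℝ} (hb : 0 ≤ b) (h : |y| ≠ b) :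
    HasDerivAt (fun y => eta y b) (eta' y b) y := by
  unfold eta'
  rcases lt_or_gt_of_ne h with h | h
  · rw [if_neg (not_lt.2 h.le)]
    refine (hasDerivAt_const y (0 : ℝ)).congr_of_eventuallyEq ?_
    have : {x : ℝ | |x| < b} ∈ nhds y := (isOpen_lt continuous_abs continuous_const).mem_nhds h
    filter_upwards [this] with x hx
    have hx : |x| < b := hx
    rw [eta, max_eq_right (by linarith), mul_zero]
  · rw [if_pos h]
    rcases le_total 0 y with hy | hy
    · rw [abs_of_nonneg hy] at h
      refine ((hasDerivAt_id y).sub_const b).congr_of_eventuallyEq ?_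
      filter_upwards [isOpen_Ioi.mem_nhds h] with x hx
      have hx : b < x := hx
      rw [eta, Real.sign_of_pos (hb.trans_lt hx), abs_of_pos (hb.trans_lt hx),
        max_eq_left (by linarith)]
      simp
    · rw [abs_of_nonpos hy] at h
      refine ((hasDerivAt_id y).add_const b).congr_of_eventuallyEq ?_
      filter_upwards [isOpen_Iio.mem_nhds (show y < -b by linarith)] with x hx
      have hx : x < -b := hx
      have hx0 : x < 0 := by linarith
      rw [eta, Real.sign_of_neg hx0, abs_of_neg hx0,
        max_eq_left (by linarith)]
      simp; ring

lemma abs_eta_sub_le {b : ℝ} (hb : 0 ≤ b) (x y : ℝ) : |eta x b - eta y b| ≤ 2 * |x - y| := by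
  rw [eta_eq_sub_clipf hb, eta_eq_sub_clipf hb]
  have h1 := abs_clipf_sub_le b x y
  have h2 := abs_sub (x - y) (clipf b x - clipf b y)
  rw [show x - clipf b x - (y - clipf b y) = x - y - (clipf b x - clipf b y) by ring]
  linarith

lemma integral_mul_ew {t τ b : ℝ} (hτ : 0 < τ) (hb : 0 ≤ b) :
    ∫ x, x * ew t τ b x ∂(gaussianReal 0 1) =
      τ * ∫ x, eta' (t + τ * x) b ∂(gaussianReal 0 1) := by
  rw [← integral_const_mul]
  refine stein_lipschitz (K := ⟨2 * τ, by positivity⟩) (f' := fun x => τ * eta' (t + τ * x) b)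
    ?_ ?_ ?_
  · refine LipschitzWith.of_dist_le_mul fun x y => ?_
    rw [Real.dist_eq, Real.dist_eq]
    unfold ew
    have := abs_eta_sub_le hb (t + τ * x) (t + τ * y)
    rw [show t + τ * x - (t + τ * y) = τ * (x - y) by ring, abs_mul, abs_of_pos hτ] at this
    rw [show eta (t + τ * x) b - t - (eta (t + τ * y) b - t) =
      eta (t + τ * x) b - eta (t + τ * y) b by ring]
    refine this.trans (le_of_eq ?_)
    change 2 * (τ * |x - y|) = (2 * τ) * |x - y|
    ring
  · have hfin : ({(b - t) / τ, (-b - t) / τ} : Set ℝ).Finite := by simp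
    have h0 : gaussianReal 0 1 ({(b - t) / τ, (-b - t) / τ} : Set ℝ) = 0 := by
      have := nullSingletonClass_gaussianReal (μ := 0) (v := 1) one_ne_zero
      exact hfin.measure_zero _
    rw [ae_iff]
    refine measure_mono_null (fun x hx => ?_) h0
    by_contra hx2
    refine hx ?_
    have hne : |t + τ * x| ≠ b := by
      intro h
      apply hx2
      rcases abs_eq hb |>.1 h with h | h
      · left; rw [eq_div_iff hτ.ne']; linarith
      · right; simp only [Set.mem_singleton_iff]; rw [eq_div_iff hτ.ne']; linarith
    have h1 := hasDerivAt_eta hb hne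
    have h2 : HasDerivAt (fun x => t + τ * x) τ x := by
      simpa using ((hasDerivAt_id x).const_mul τ).const_add t
    have h3 := (h1.comp x h2).sub_const t
    rw [mul_comm] at h3
    exact h3
  · exact ((measurable_eta' b).comp (by fun_prop)).aestronglyMeasurable.const_mul τ

lemma empDist_prod {N : ℕ} (θ : Fin N → ℝ) (ν : Measure ℝ) [IsProbabilityMeasure ν] :
    (empDist θ).prod ν = ((N : ℝ≥0∞))⁻¹ • ∑ i, ν.map (Prod.mk (θ i)) := by
  have hfin : IsFiniteMeasure (∑ i : Fin N, Measure.dirac (θ i)) := inferInstance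
  ext s hs
  rw [empDist, Measure.prod_apply hs, lintegral_smul_measure, lintegral_finsetSum_measure,
    Measure.smul_apply, Measure.finsetSum_apply]
  congr 1
  refine Finset.sum_congr rfl fun i _ => ?_
  rw [lintegral_dirac, Measure.map_apply measurable_prodMk_left hs]

lemma integral_empDist_prod {N : ℕ} (θ : Fin N → ℝ) (ν : Measure ℝ) [IsProbabilityMeasure ν]
    {f : ℝ × ℝ → ℝ} (hf : Measurable f) (hi : ∀ i, Integrable (fun x => f (θ i, x)) ν) :
    ∫ q, f q ∂((empDist θ).prod ν) = (N : ℝ)⁻¹ * ∑ i, ∫ x, f (θ i, x) ∂ν := by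
  rw [empDist_prod, integral_smul_measure, integral_finsetSum_measure]
  · simp only [ENNReal.toReal_inv, ENNReal.toReal_natCast, smul_eq_mul]
    congr 1
    refine Finset.sum_congr rfl fun i _ => ?_
    rw [integral_map measurable_prodMk_left.aemeasurable hf.aestronglyMeasurable]
  · intro i _
    rw [integrable_map_measure hf.aestronglyMeasurable measurable_prodMk_left.aemeasurable]
    exact hi i

lemma integrable_of_abs_le_lin {f : ℝ → ℝ} (hf : Measurable f) {a c : ℝ}
    (h : ∀ x, |f x| ≤ a * |x| + c) : Integrable f (gaussianReal 0 1) := by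
  refine integrable_gaussian_of_le_sq hf.aestronglyMeasurable (|a| + |c|) fun x => (h x).trans ?_
  have h1 : |x| ≤ 1 + x ^ 2 := by
    rw [← sq_abs]; nlinarith [abs_nonneg x]
  have h2 : a * |x| ≤ |a| * (1 + x ^ 2) := by
    calc a * |x| ≤ |a| * |x| := by gcongr; exact le_abs_self a
      _ ≤ _ := by gcongr
  have h3 : c ≤ |c| * (1 + x ^ 2) := by
    have := le_abs_self c
    nlinarith [mul_nonneg (abs_nonneg c) (sq_nonneg x)]
  linarith

lemma integrable_sq_of_abs_le_lin {f : ℝ → ℝ} (hf : Measurable f) {a c : ℝ}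
    (h : ∀ x, |f x| ≤ a * |x| + c) : Integrable (fun x => f x ^ 2) (gaussianReal 0 1) := by
  refine integrable_gaussian_of_le_sq (hf.pow_const 2).aestronglyMeasurable
    (2 * a ^ 2 + 2 * c ^ 2) fun x => ?_
  rw [abs_of_nonneg (sq_nonneg _), ← sq_abs]
  have h1 : |f x| ^ 2 ≤ (a * |x| + c) ^ 2 := by gcongr; exact h x
  have h2 : |x| ^ 2 = x ^ 2 := sq_abs x
  nlinarith [sq_nonneg (a * |x| - c), sq_nonneg a, mul_nonneg (sq_nonneg c) (sq_nonneg x)]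

lemma integrable_mul_of_abs_le_lin {f : ℝ → ℝ} (hf : Measurable f) {a c : ℝ}
    (h : ∀ x, |f x| ≤ a * |x| + c) : Integrable (fun x => x * f x) (gaussianReal 0 1) := by
  refine integrable_gaussian_of_le_sq (measurable_id.mul hf).aestronglyMeasurable
    (|a| + |c|) fun x => ?_
  rw [abs_mul]
  have h1 : |x| * |f x| ≤ |x| * (|a| * |x| + |c|) := by
    gcongr
    refine (h x).trans ?_
    gcongr
    · exact le_abs_self a
    · exact le_abs_self c
  have h2 : |x| ^ 2 = x ^ 2 := sq_abs x
  have h3 : |x| ≤ 1 + x ^ 2 := by rw [← h2]; nlinarith [abs_nonneg x]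
  nlinarith [mul_le_mul_of_nonneg_left h3 (abs_nonneg c), abs_nonneg a]

lemma state_evo_means {N n : ℕ} {δ σ lam β τ : ℝ} (hN : 0 < N) (hδ : 0 < δ)
    (hn : (n : ℝ) = δ * N) (hl : 0 ≤ lam) {θ : Fin N → ℝ}
    (h : StateEvo δ σ (empDist θ) lam β τ) :
    ∑ i, ∫ x, ew (θ i) τ (τ * lam / β) x ^ 2 ∂(gaussianReal 0 1) = n * (τ ^ 2 - σ ^ 2) ∧
    ∑ i, ∫ x, x * ew (θ i) τ (τ * lam / β) x ∂(gaussianReal 0 1) = n * (τ - β) ∧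
    ∑ i, ∫ x, eta' (θ i + τ * x) (τ * lam / β) ∂(gaussianReal 0 1) = n * (1 - β / τ) := by
  obtain ⟨hβ, hτ, h1, h2⟩ := h
  have hb : 0 ≤ τ * lam / β := by positivity
  have hN' : (0 : ℝ) < N := by exact_mod_cast hN
  have c3 : ∑ i, ∫ x, eta' (θ i + τ * x) (τ * lam / β) ∂(gaussianReal 0 1) =
      n * (1 - β / τ) := by
    unfold stdG at h2
    rw [integral_empDist_prod θ (gaussianReal 0 1) (f := fun q : ℝ × ℝ =>
      eta' (q.1 + τ * q.2) (τ * lam / β)) ((measurable_eta' _).comp (by fun_prop))] at h2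
    · rw [hn]
      have : β / τ = 1 - 1 / δ * ((N : ℝ)⁻¹ *
        ∑ i, ∫ x, eta' (θ i + τ * x) (τ * lam / β) ∂(gaussianReal 0 1)) := by
        rw [div_eq_iff hτ.ne']
        linarith
      rw [this]
      field_simp
      ring
    · intro i
      refine integrable_of_abs_le_lin (a := 0) (c := 1) ((measurable_eta' _).comp (by fun_prop))
        fun x => ?_
      rw [abs_of_nonneg (eta'_nonneg _ _)]
      have := eta'_le_one (θ i + τ * x) (τ * lam / β)
      linarith
  refine ⟨?_, ?_, c3⟩
  · unfold stdG at h1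
    rw [integral_empDist_prod θ (gaussianReal 0 1) (f := fun q : ℝ × ℝ =>
      (eta (q.1 + τ * q.2) (τ * lam / β) - q.1) ^ 2)] at h1
    · have : ∑ i, ∫ x, ew (θ i) τ (τ * lam / β) x ^ 2 ∂(gaussianReal 0 1) =
        δ * N * (1 / δ * ((N : ℝ)⁻¹ * ∑ i, ∫ x,
          (eta (θ i + τ * x) (τ * lam / β) - θ i) ^ 2 ∂(gaussianReal 0 1))) := by
        unfold ew; field_simp
      rw [this, hn]
      congr 1
      linarith
    · have : Continuous fun q : ℝ × ℝ => (eta (q.1 + τ * q.2) (τ * lam / β) - q.1) ^ 2 :=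
        (((continuous_eta hb).comp (by fun_prop)).sub continuous_fst).pow 2
      exact this.measurable
    · intro i
      exact integrable_sq_of_abs_le_lin (continuous_ew (θ i) τ hb).measurable
        (fun x => abs_ew_le hτ.le hb x)
  · simp_rw [integral_mul_ew hτ hb]
    rw [← Finset.mul_sum, c3]
    field_simp

lemma gaussian_le_volume (s : Set ℝ) : gaussianReal 0 1 s ≤ volume s := by
  rw [gaussianReal_apply 0 one_ne_zero]
  calc ∫⁻ x in s, gaussianPDF 0 1 x ≤ ∫⁻ _ in s, 1 := by
        refine lintegral_mono fun x => ?_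
        rw [gaussianPDF, ← ENNReal.ofReal_one]
        refine ENNReal.ofReal_le_ofReal ?_
        rw [gaussianPDFReal_def]
        have h1 : (√(2 * Real.pi * ((1 : ℝ≥0) : ℝ)))⁻¹ ≤ 1 := by
          refine inv_le_one_of_one_le₀ ?_
          rw [Real.one_le_sqrt]
          have := Real.pi_gt_three
          simp; linarith
        have h2 : Real.exp (-(x - 0) ^ 2 / (2 * ((1 : ℝ≥0) : ℝ))) ≤ 1 := by
          rw [Real.exp_le_one_iff, neg_div, neg_nonpos]
          positivity
        exact mul_le_one₀ h1 (Real.exp_pos _).le h2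
    _ = volume s := by simp

/-- The event that the modulus of an affine Gaussian lies in an interval. -/
def strip (t τ b r : ℝ) : Set ℝ := {x | b ≤ |t + τ * x| ∧ |t + τ * x| ≤ b + r}

lemma measurableSet_strip (t τ b r : ℝ) : MeasurableSet (strip t τ b r) :=
  ((isClosed_le continuous_const (by fun_prop : Continuous fun x => |t + τ * x|)).inter
    (isClosed_le (by fun_prop : Continuous fun x => |t + τ * x|)
      continuous_const)).measurableSet

lemma gaussian_strip_le (t b : ℝ) {τ r : ℝ} (hτ : 0 < τ) (hr : 0 ≤ r) :
    (gaussianReal 0 1).real (strip t τ b r) ≤ 2 * r / τ := by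
  have hsub : strip t τ b r ⊆ Set.Icc ((b - t) / τ) ((b + r - t) / τ) ∪
      Set.Icc ((-b - r - t) / τ) ((-b - t) / τ) := by
    rintro x ⟨h1, h2⟩
    rcases le_total 0 (t + τ * x) with h | h
    · rw [abs_of_nonneg h] at h1 h2
      left
      constructor
      · rw [div_le_iff₀ hτ]; linarith
      · rw [le_div_iff₀ hτ]; linarith
    · rw [abs_of_nonpos h] at h1 h2
      right
      constructor
      · rw [div_le_iff₀ hτ]; linarith
      · rw [le_div_iff₀ hτ]; linarith
  have h3 : gaussianReal 0 1 (strip t τ b r) ≤ ENNReal.ofReal (2 * r / τ) := by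
    refine (gaussian_le_volume _).trans ((measure_mono hsub).trans
      ((measure_union_le _ _).trans ?_))
    rw [Real.volume_Icc, Real.volume_Icc, ← ENNReal.ofReal_add]
    · refine ENNReal.ofReal_le_ofReal (le_of_eq ?_)
      field_simp; ring
    · rw [← sub_div]; apply div_nonneg _ hτ.le; linarith
    · rw [← sub_div]; apply div_nonneg _ hτ.le; linarith
  exact ENNReal.toReal_le_of_le_ofReal (by positivity) h3

lemma add_ew (t τ b x : ℝ) : t + ew t τ b x = eta (t + τ * x) b := by unfold ew; ring

lemma abs_eta {b : ℝ} (hb : 0 ≤ b) (y : ℝ) : |eta y b| = max (|y| - b) 0 := by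
  unfold eta
  rw [abs_mul, abs_of_nonneg (le_max_right (|y| - b) 0)]
  rcases lt_trichotomy y 0 with h | h | h
  · rw [Real.sign_of_neg h]; simp
  · subst h; simp [hb]
  · rw [Real.sign_of_pos h]; simp

lemma integrable_eta' (t τ b : ℝ) :
    Integrable (fun x => eta' (t + τ * x) b) (gaussianReal 0 1) :=
  integrable_of_abs_le_lin (a := 0) (c := 1) ((measurable_eta' _).comp (by fun_prop))
    fun x => by
      rw [abs_of_nonneg (eta'_nonneg _ _)]
      have := eta'_le_one (t + τ * x) b
      linarith

lemma integrable_abs_add_ew (t : ℝ) {τ b : ℝ} (hτ : 0 ≤ τ) (hb : 0 ≤ b) :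
    Integrable (fun x => |t + ew t τ b x|) (gaussianReal 0 1) :=
  integrable_of_abs_le_lin (a := τ) (c := |t| + b)
    ((continuous_const.add (continuous_ew t τ hb)).abs.measurable) fun x => by
      rw [abs_abs]
      have := abs_add_le t (ew t τ b x)
      have := abs_ew_le (t := t) hτ hb x
      linarith

lemma integral_eta'_le_strip (t : ℝ) {τ b r : ℝ} (hτ : 0 < τ) (hb : 0 ≤ b) (hr : 0 < r) :
    ∫ x, eta' (t + τ * x) b ∂(gaussianReal 0 1) ≤
      (∫ x, |t + ew t τ b x| ∂(gaussianReal 0 1)) / r + 2 * r / τ := by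
  have hi1 := (integrable_abs_add_ew t hτ.le hb).div_const r
  have hi2 : Integrable ((strip t τ b r).indicator (1 : ℝ → ℝ)) (gaussianReal 0 1) :=
    (integrable_indicator_iff (measurableSet_strip _ _ _ _)).2 (integrable_const _).integrableOn
  calc ∫ x, eta' (t + τ * x) b ∂(gaussianReal 0 1)
      ≤ ∫ x, (|t + ew t τ b x| / r + (strip t τ b r).indicator (1 : ℝ → ℝ) x)
          ∂(gaussianReal 0 1) := by
        refine integral_mono (integrable_eta' t τ b) (hi1.add hi2) fun x => ?_
        change _ ≤ |t + ew t τ b x| / r + (strip t τ b r).indicator (1 : ℝ → ℝ) x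
        rw [add_ew, abs_eta hb]
        unfold eta'
        have h0 : 0 ≤ max (|t + τ * x| - b) 0 / r := div_nonneg (le_max_right _ _) hr.le
        have h1 : (0 : ℝ) ≤ (strip t τ b r).indicator (1 : ℝ → ℝ) x :=
          Set.indicator_nonneg (fun _ _ => zero_le_one) _
        split_ifs with h
        · by_cases h2 : |t + τ * x| ≤ b + r
          · rw [Set.indicator_of_mem (show x ∈ strip t τ b r from ⟨h.le, h2⟩)]
            simp only [Pi.one_apply]; linarith
          · have : 1 ≤ max (|t + τ * x| - b) 0 / r := by
              rw [le_div_iff₀ hr]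
              refine le_max_of_le_left ?_
              linarith [not_le.1 h2]
            linarith
        · linarith
    _ = (∫ x, |t + ew t τ b x| ∂(gaussianReal 0 1)) / r +
          (gaussianReal 0 1).real (strip t τ b r) := by
        rw [integral_add hi1 hi2, integral_div, integral_indicator_one (measurableSet_strip _ _ _ _)]
    _ ≤ _ := by gcongr; exact gaussian_strip_le t b hτ hr.le

lemma integral_eta'_le_sq (t : ℝ) {τ b : ℝ} (hb : 0 < b) :
    ∫ x, eta' (t + τ * x) b ∂(gaussianReal 0 1) ≤ (2 * t ^ 2 + 2 * τ ^ 2) / b ^ 2 := by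
  have hi1 : Integrable (fun x => 2 * t ^ 2 + 2 * τ ^ 2 * x ^ 2) (gaussianReal 0 1) :=
    (integrable_const _).add (integrable_sq_gaussian.const_mul _)
  calc ∫ x, eta' (t + τ * x) b ∂(gaussianReal 0 1)
      ≤ ∫ x, (2 * t ^ 2 + 2 * τ ^ 2 * x ^ 2) / b ^ 2 ∂(gaussianReal 0 1) := by
        refine integral_mono (integrable_eta' t τ b) (hi1.div_const _) fun x => ?_
        change _ ≤ (2 * t ^ 2 + 2 * τ ^ 2 * x ^ 2) / b ^ 2
        unfold eta'
        split_ifs with h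
        · rw [le_div_iff₀ (by positivity), one_mul]
          have h1 : b ^ 2 ≤ |t + τ * x| ^ 2 := by gcongr
          rw [sq_abs] at h1
          nlinarith [sq_nonneg (t - τ * x)]
        · positivity
    _ = _ := by
        rw [integral_div]
        congr 1
        rw [integral_add (integrable_const _) (integrable_sq_gaussian.const_mul _),
          integral_const, integral_const_mul (2 * τ ^ 2), integral_sq_gaussian]
        simp

lemma integral_abs_add_ew_le (t : ℝ) {τ β lam : ℝ} (hτ : 0 < τ) (hβ : 0 < β) (hl : 0 ≤ lam) :
    lam * ∫ x, |t + ew t τ (τ * lam / β) x| ∂(gaussianReal 0 1) ≤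
      lam * |t| + β * ∫ x, x * ew t τ (τ * lam / β) x ∂(gaussianReal 0 1)
        - β / τ * ∫ x, ew t τ (τ * lam / β) x ^ 2 ∂(gaussianReal 0 1) := by
  have hb : 0 ≤ τ * lam / β := by positivity
  set b := τ * lam / β with hbdef
  have hm := (continuous_ew t τ hb).measurable
  have hl1 := fun x => abs_ew_le (t := t) hτ.le hb x
  have i1 := (integrable_mul_of_abs_le_lin hm hl1).const_mul β
  have i2 := (integrable_sq_of_abs_le_lin hm hl1).const_mul (β / τ)
  have i0 : Integrable (fun _ : ℝ => lam * |t|) (gaussianReal 0 1) := integrable_const _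
  have i3 : Integrable (fun x => lam * |t| + β * (x * ew t τ b x)) (gaussianReal 0 1) := i0.add i1
  calc lam * ∫ x, |t + ew t τ b x| ∂(gaussianReal 0 1)
      = ∫ x, lam * |t + ew t τ b x| ∂(gaussianReal 0 1) := (integral_const_mul _ _).symm
    _ ≤ ∫ x, (lam * |t| + β * (x * ew t τ b x) - β / τ * ew t τ b x ^ 2)
          ∂(gaussianReal 0 1) := by
        refine integral_mono ((integrable_abs_add_ew t hτ.le hb).const_mul lam) (i3.sub i2)
          fun x => ?_
        change _ ≤ lam * |t| + β * (x * ew t τ b x) - β / τ * ew t τ b x ^ 2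
        have h1 := clipf_mul_sub hb (t + τ * x)
        have h2 := abs_clipf_le hb (t + τ * x)
        have h3 := ew_eq t τ hb x
        set v := clipf b (t + τ * x)
        set e := ew t τ b x
        have h4 : t + τ * x - v = t + e := by rw [h3]; ring
        rw [h4] at h1
        have h5 : lam = β / τ * b := by rw [hbdef]; field_simp
        have h6 : v * t ≤ b * |t| := by
          calc v * t ≤ |v * t| := le_abs_self _
            _ = |v| * |t| := abs_mul _ _
            _ ≤ _ := by gcongr
        have h7 : β * (x * e) = β / τ * ((v + e) * e) := by
          rw [h3]; field_simp; ring
        rw [h7]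
        have : lam * |t + e| = β / τ * (v * (t + e)) := by rw [h1, h5]; ring
        change lam * |t + e| ≤ _
        rw [this, h5]
        have := mul_le_mul_of_nonneg_left h6 (show 0 ≤ β / τ by positivity)
        nlinarith
    _ = _ := by
        rw [integral_sub i3 i2, integral_add i0 i1, integral_const, integral_const_mul β,
          integral_const_mul (β / τ)]
        simp

lemma Fball_four {N : ℕ} {ξ : ℝ} {θ : Fin N → ℝ} (hN : 0 < N) (h : θ ∈ Fball N 4 ξ) :
    ∑ i, θ i ^ 4 ≤ ξ ^ 4 * N := by
  have hN' : (0 : ℝ) < N := by exact_mod_cast hN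
  have h1 : 1 / (N : ℝ) * ∑ i, |θ i| ^ (4 : ℝ) ≤ ξ ^ (4 : ℝ) := h
  have h2 : ∀ x : ℝ, |x| ^ (4 : ℝ) = x ^ 4 := fun x => by
    rw [show (4 : ℝ) = ((4 : ℕ) : ℝ) by norm_num, Real.rpow_natCast, pow_abs, abs_of_nonneg]
    positivity
  have h3 : ξ ^ (4 : ℝ) = ξ ^ 4 := by
    rw [show (4 : ℝ) = ((4 : ℕ) : ℝ) by norm_num, Real.rpow_natCast]
  simp_rw [h2] at h1
  rw [h3, one_div, inv_mul_le_iff₀ hN'] at h1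
  linarith

lemma Fball_two {N : ℕ} {ξ : ℝ} {θ : Fin N → ℝ} (hN : 0 < N) (h : θ ∈ Fball N 4 ξ) :
    ∑ i, θ i ^ 2 ≤ (1 + ξ ^ 4) * N := by
  have h1 := Fball_four hN h
  have h2 : ∑ i, θ i ^ 2 ≤ ∑ i, (1 + θ i ^ 4) :=
    Finset.sum_le_sum fun i _ => by nlinarith [sq_nonneg (θ i ^ 2 - 1), sq_nonneg (θ i ^ 2)]
  rw [Finset.sum_add_distrib] at h2
  simp at h2
  linarith

lemma Fball_one {N : ℕ} {ξ : ℝ} {θ : Fin N → ℝ} (hN : 0 < N) (h : θ ∈ Fball N 4 ξ) :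
    ∑ i, |θ i| ≤ (2 + ξ ^ 4) * N := by
  have h1 := Fball_two hN h
  have h2 : ∑ i, |θ i| ≤ ∑ i, (1 + θ i ^ 2) :=
    Finset.sum_le_sum fun i _ => by rw [← sq_abs]; nlinarith [abs_nonneg (θ i)]
  rw [Finset.sum_add_distrib] at h2
  simp at h2
  linarith

/-- The normalized limiting `ℓ₁` penalty. -/
def penMean {N : ℕ} (n : ℕ) (θ : Fin N → ℝ) (lam β τ : ℝ) : ℝ :=
  lam / n * ∑ i, ∫ x, |θ i + ew (θ i) τ (τ * lam / β) x| ∂(gaussianReal 0 1)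

lemma state_evo_bounds_aux {N n : ℕ} {δ σ lam β τ ξ : ℝ} (hN : 0 < N) (hδ : 0 < δ) (hσ : 0 < σ)
    (hn : (n : ℝ) = δ * N) (hl : 0 < lam) {θ : Fin N → ℝ} (hθ : θ ∈ Fball N 4 ξ)
    (h : StateEvo δ σ (empDist θ) lam β τ) :
    σ ≤ τ ∧ β ≤ τ ∧ 0 < β ∧
    penMean n θ lam β τ + β ^ 2 ≤ lam * (2 + ξ ^ 4) / δ + σ ^ 2 ∧
    (β ≤ τ / 2 → δ * lam ^ 2 * σ ^ 2 ≤ 4 * (1 + ξ ^ 4 + σ ^ 2) * β ^ 2) ∧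
    (β ≤ τ / 2 → lam * τ * δ / 32 ≤ penMean n θ lam β τ) := by
  obtain ⟨h1, h2, h3⟩ := state_evo_means hN hδ hn hl.le h
  obtain ⟨hβ, hτ, -, -⟩ := h
  have hb : 0 < τ * lam / β := by positivity
  have hN' : (0 : ℝ) < N := by exact_mod_cast hN
  have hn' : (0 : ℝ) < n := by rw [hn]; positivity
  have hστ : σ ≤ τ := by
    have : 0 ≤ (n : ℝ) * (τ ^ 2 - σ ^ 2) := by
      rw [← h1]
      exact Finset.sum_nonneg fun i _ => integral_nonneg fun x => sq_nonneg _
    have := nonneg_of_mul_nonneg_right this hn'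
    exact le_of_sq_le_sq (by linarith) hτ.le
  have hβτ : β ≤ τ := by
    have : 0 ≤ (n : ℝ) * (1 - β / τ) := by
      rw [← h3]
      exact Finset.sum_nonneg fun i _ => integral_nonneg fun x => eta'_nonneg _ _
    have := nonneg_of_mul_nonneg_right this hn'
    rw [sub_nonneg, div_le_one hτ] at this
    exact this
  have hhalf : β ≤ τ / 2 → (n : ℝ) / 2 ≤ n * (1 - β / τ) := fun hh => by
    have : β / τ ≤ 1 / 2 := by rw [div_le_iff₀ hτ]; linarith
    nlinarith
  refine ⟨hστ, hβτ, hβ, ?_, fun hh => ?_, fun hh => ?_⟩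
  · have hs : ∑ i, lam * ∫ x, |θ i + ew (θ i) τ (τ * lam / β) x| ∂(gaussianReal 0 1) ≤
        ∑ i, (lam * |θ i| + β * ∫ x, x * ew (θ i) τ (τ * lam / β) x ∂(gaussianReal 0 1)
        - β / τ * ∫ x, ew (θ i) τ (τ * lam / β) x ^ 2 ∂(gaussianReal 0 1)) :=
      Finset.sum_le_sum fun i _ => integral_abs_add_ew_le (θ i) hτ hβ hl.le
    rw [Finset.sum_sub_distrib, Finset.sum_add_distrib, ← Finset.mul_sum, ← Finset.mul_sum,
      ← Finset.mul_sum, ← Finset.mul_sum, h1, h2] at hs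
    have h4 := mul_le_mul_of_nonneg_left (Fball_one hN hθ) hl.le
    have h5 : β / τ * ((n : ℝ) * (τ ^ 2 - σ ^ 2)) = n * (β * τ) - n * (β / τ * σ ^ 2) := by
      field_simp
    have h6 : β / τ * σ ^ 2 ≤ σ ^ 2 := by
      have : β / τ ≤ 1 := (div_le_one hτ).2 hβτ
      nlinarith [sq_nonneg σ]
    have h7 := mul_le_mul_of_nonneg_left h6 hn'.le
    unfold penMean
    rw [div_mul_eq_mul_div]
    have h8 : lam * ∑ i, ∫ x, |θ i + ew (θ i) τ (τ * lam / β) x| ∂(gaussianReal 0 1) ≤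
        (lam * (2 + ξ ^ 4) / δ + σ ^ 2 - β ^ 2) * n := by
      have : lam * (2 + ξ ^ 4) / δ * n = lam * ((2 + ξ ^ 4) * N) := by rw [hn]; field_simp
      rw [sub_mul, add_mul, this]
      linarith
    have := (div_le_iff₀ hn').2 h8
    linarith
  · have hs := Finset.sum_le_sum fun i (_ : i ∈ Finset.univ) =>
      integral_eta'_le_sq (θ i) (τ := τ) hb
    rw [h3] at hs
    have h4 := (hhalf hh).trans hs
    rw [← Finset.sum_div, le_div_iff₀ (by positivity), Finset.sum_add_distrib,
      ← Finset.mul_sum, Finset.sum_const, Finset.card_univ, Fintype.card_fin, nsmul_eq_mul] at h4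
    have h5 := Fball_two hN hθ
    have h6 : (n : ℝ) / 2 * (τ * lam / β) ^ 2 ≤ 2 * N * ((1 + ξ ^ 4) + τ ^ 2) := by linarith
    rw [hn] at h6
    have h7 : δ * (τ ^ 2 * lam ^ 2) ≤ 4 * ((1 + ξ ^ 4) + τ ^ 2) * β ^ 2 := by
      have e : δ * N / 2 * (τ * lam / β) ^ 2 = δ * (τ ^ 2 * lam ^ 2) / β ^ 2 * (N / 2) := by
        field_simp
      rw [e, show 2 * (N : ℝ) * ((1 + ξ ^ 4) + τ ^ 2) = 4 * ((1 + ξ ^ 4) + τ ^ 2) * (N / 2) by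
        ring] at h6
      have := le_of_mul_le_mul_right h6 (by positivity)
      rwa [div_le_iff₀ (by positivity)] at this
    have h8 : σ ^ 2 ≤ τ ^ 2 := by gcongr
    have h9 : σ ^ 2 * ((1 + ξ ^ 4) + τ ^ 2) ≤ τ ^ 2 * ((1 + ξ ^ 4) + σ ^ 2) := by
      nlinarith [mul_le_mul_of_nonneg_left h8 (show 0 ≤ 1 + ξ ^ 4 by positivity)]
    have h10 := mul_le_mul_of_nonneg_left h7 (sq_nonneg σ)
    have h11 := mul_le_mul_of_nonneg_right h9 (show 0 ≤ 4 * β ^ 2 by positivity)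
    have h12 : τ ^ 2 * (δ * lam ^ 2 * σ ^ 2) ≤ τ ^ 2 * (4 * (1 + ξ ^ 4 + σ ^ 2) * β ^ 2) := by
      linarith
    exact le_of_mul_le_mul_left h12 (by positivity)
  · have hr : 0 < τ * δ / 8 := by positivity
    have hs := Finset.sum_le_sum fun i (_ : i ∈ Finset.univ) =>
      integral_eta'_le_strip (θ i) hτ hb.le hr
    rw [h3, Finset.sum_add_distrib, ← Finset.sum_div, Finset.sum_const, Finset.card_univ,
      Fintype.card_fin, nsmul_eq_mul] at hs
    have h4 := (hhalf hh).trans hs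
    have h5 : (N : ℝ) * (2 * (τ * δ / 8) / τ) = n / 4 := by rw [hn]; field_simp; ring
    rw [h5] at h4
    have h6 : (n : ℝ) / 4 ≤ (∑ i, ∫ x, |θ i + ew (θ i) τ (τ * lam / β) x| ∂(gaussianReal 0 1)) /
      (τ * δ / 8) := by linarith
    rw [le_div_iff₀ hr] at h6
    have h7 := mul_le_mul_of_nonneg_left h6 (show 0 ≤ lam / n by positivity)
    unfold penMean
    refine le_trans (le_of_eq ?_) h7
    field_simp; ring

lemma state_evo_bounds {δ σ lmin lmax ξ : ℝ} (hδ : 0 < δ) (hσ : 0 < σ) (hl : 0 < lmin)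
    (hll : lmin ≤ lmax) : ∃ lo hi : ℝ, 0 < lo ∧ lo ≤ hi ∧ lo ≤ σ ∧ σ ≤ hi ∧ lo ≤ lmin ∧
      lmax ≤ hi ∧ 1 ≤ hi * δ ∧ 1 ≤ hi ∧ lo ≤ 1 ∧ lo ≤ δ ∧
      ∀ (N n : ℕ) (θ : Fin N → ℝ) (lam β τ : ℝ), 0 < N → (n : ℝ) = δ * N → θ ∈ Fball N 4 ξ →
        lmin ≤ lam → lam ≤ lmax → StateEvo δ σ (empDist θ) lam β τ →
        lo ≤ β ∧ lo ≤ τ ∧ β ≤ hi ∧ τ ≤ hi ∧ penMean n θ lam β τ ≤ hi ∧ β ≤ τ := by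
  set B := lmax * (2 + ξ ^ 4) / δ + σ ^ 2 with hB
  have hlmax : 0 < lmax := hl.trans_le hll
  have hB0 : 0 < B := by positivity
  set q := δ * lmin ^ 2 * σ ^ 2 / (4 * (1 + ξ ^ 4 + σ ^ 2)) with hq
  have hq0 : 0 < q := by positivity
  set H := 32 * B / (lmin * δ) with hH
  have hH0 : 0 < H := by positivity
  have hsq : 0 < √q := Real.sqrt_pos.2 hq0
  refine ⟨min (min (σ / 2) √q) (min (min lmin 1) δ), σ + lmax + 1 / δ + 1 + B + 2 * (B + 1) + H,
    by positivity, ?_, ?_, ?_, ?_, ?_, ?_, ?_, ?_, ?_, ?_⟩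
  · refine (min_le_left _ _).trans ((min_le_left _ _).trans ?_)
    have : 0 < 1 / δ := by positivity
    linarith
  · refine (min_le_left _ _).trans ((min_le_left _ _).trans ?_)
    linarith
  · have : 0 < 1 / δ := by positivity
    linarith
  · exact (min_le_right _ _).trans ((min_le_left _ _).trans (min_le_left _ _))
  · have : 0 < 1 / δ := by positivity
    linarith
  · have h1 : (1 / δ) * δ = 1 := by field_simp
    have : 0 ≤ (σ + lmax + 1 + B + 2 * (B + 1) + H) * δ := by positivity
    linarith
  · have : 0 < 1 / δ := by positivity
    linarith
  · exact (min_le_right _ _).trans ((min_le_left _ _).trans (min_le_right _ _))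
  · exact (min_le_right _ _).trans (min_le_right _ _)
  intro N n θ lam β τ hN hn hθ h1 h2 h
  obtain ⟨a1, a2, a3, a4, a5, a6⟩ :=
    state_evo_bounds_aux hN hδ hσ hn (hl.trans_le h1) hθ h
  have hlam : 0 < lam := hl.trans_le h1
  have hτ : 0 < τ := hσ.trans_le a1
  have hdδ : 0 < 1 / δ := by positivity
  have hB1 : penMean n θ lam β τ + β ^ 2 ≤ B := by
    refine a4.trans ?_
    rw [hB]; gcongr
  have hm : 0 ≤ penMean n θ lam β τ :=
    mul_nonneg (by positivity) (Finset.sum_nonneg fun i _ => integral_nonneg fun x => abs_nonneg _)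
  have hβB : β ≤ B + 1 := by
    have h3 : β ^ 2 ≤ B := by linarith
    nlinarith [sq_nonneg (β - 1)]
  have hβlo : min (σ / 2) √q ≤ β := by
    rcases le_total β (τ / 2) with hh | hh
    · refine (min_le_right _ _).trans (Real.sqrt_le_iff.2 ⟨a3.le, ?_⟩)
      rw [hq, div_le_iff₀ (by positivity)]
      have h3 := a5 hh
      have : δ * lmin ^ 2 * σ ^ 2 ≤ δ * lam ^ 2 * σ ^ 2 := by gcongr
      linarith
    · refine (min_le_left _ _).trans ?_
      linarith
  refine ⟨(min_le_left _ _).trans hβlo,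
    (min_le_left _ _).trans ((min_le_left _ _).trans (by linarith)), by linarith, ?_, ?_, a2⟩
  · rcases le_total β (τ / 2) with hh | hh
    · have h3 := a6 hh
      have h4 : τ ≤ H := by
        rw [hH, le_div_iff₀ (by positivity)]
        have h5 : lmin * τ * δ ≤ lam * τ * δ := by gcongr
        have h6 : lam * τ * δ / 32 ≤ B := by linarith [sq_nonneg β]
        linarith
      linarith
    · linarith
  · linarith [sq_nonneg β]

/-- Vectors for which all the empirical test averages are close to their Gaussian means. -/
def typ {N : ℕ} {ι : Type} (F : ι → Fin N → ℝ → ℝ) (t : ℝ) : Set (Fin N → ℝ) :=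
  {g | ∀ a, |∑ i, F a i (g i) - ∑ i, ∫ x, F a i x ∂(gaussianReal 0 1)| ≤ t * N}

lemma stdPi_typ_compl_le {A : ℝ} (hA : 0 < A) : ∃ c : ℝ, 0 < c ∧ ∀ (N : ℕ) (ι : Type) [Fintype ι]
    (F : ι → Fin N → ℝ → ℝ), (∀ a i, Measurable (F a i)) →
    (∀ a i x, |F a i x| ≤ A * (1 + x ^ 2)) → ∀ t : ℝ, 0 < t → t ≤ 1 →
    stdPi (Fin N) (typ F t)ᶜ ≤
      ENNReal.ofReal (Fintype.card ι * (2 * Real.exp (-c * N * t ^ 2))) := by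
  obtain ⟨c, hc, H⟩ := gaussian_bernstein hA
  refine ⟨c, hc, fun N ι _ F hm hF t ht ht1 => ?_⟩
  have hsub : (typ F t)ᶜ ⊆ ⋃ a, {g : Fin N → ℝ | t * Fintype.card (Fin N) ≤
      |∑ i, F a i (g i) - ∑ i, ∫ x, F a i x ∂(gaussianReal 0 1)|} := by
    intro g hg
    simp only [typ, Set.mem_compl_iff, Set.mem_ofPred_eq, not_forall, not_le] at hg
    obtain ⟨a, ha⟩ := hg
    refine Set.mem_iUnion.2 ⟨a, ?_⟩
    simpa using ha.le
  refine (measure_mono hsub).trans ((measure_iUnion_fintype_le _ _).trans ?_)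
  calc _ ≤ ∑ _ : ι, ENNReal.ofReal (2 * Real.exp (-c * N * t ^ 2)) := by
        refine Finset.sum_le_sum fun a _ => ?_
        have := H (Fin N) (F a) (hm a) (hF a) t ht ht1
        simpa using this
    _ = _ := by
        rw [Finset.sum_const, Finset.card_univ, nsmul_eq_mul,
          ENNReal.ofReal_mul (p := (Fintype.card ι : ℝ)) (Nat.cast_nonneg _),
          ENNReal.ofReal_natCast]

lemma stdPi_map_eval {K : Type*} [Fintype K] (k : K) :
    (stdPi K).map (fun ω => ω k) = gaussianReal 0 1 :=
  (measurePreserving_eval (fun _ : K => gaussianReal 0 1) k).map_eq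

lemma abs_l2_div_sub_one_le {n : ℕ} (hn : 0 < n) {e : ℝ} (h : Fin n → ℝ)
    (hh : |∑ i, h i ^ 2 - n| ≤ e * n) : |l2 h / √n - 1| ≤ e := by
  have hn' : (0 : ℝ) < n := by exact_mod_cast hn
  have hs : 0 < √(n : ℝ) := Real.sqrt_pos.2 hn'
  have h0 : 0 ≤ l2 h / √n := div_nonneg (l2_nonneg h) hs.le
  have h1 : (l2 h / √n) ^ 2 = (∑ i, h i ^ 2) / n := by
    rw [div_pow, l2_sq, Real.sq_sqrt hn'.le]
  set a := l2 h / √n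
  have h2 : |a ^ 2 - 1| ≤ e := by
    rw [h1, div_sub_one hn'.ne', abs_div, abs_of_pos hn', div_le_iff₀ hn']
    exact hh
  have h3 : |a ^ 2 - 1| = |a - 1| * (a + 1) := by
    rw [show a ^ 2 - 1 = (a - 1) * (a + 1) by ring, abs_mul, abs_of_nonneg (by linarith : 0 ≤ a + 1)]
  nlinarith [abs_nonneg (a - 1)]

lemma stdPi_good_compl_le {A δ ct : ℝ} (hA : 0 < A) (hδ : 0 < δ) (hct : 0 < ct) (hct1 : ct ≤ 1) :
    ∃ C c : ℝ, 0 < C ∧ 0 < c ∧ ∀ (n N : ℕ), 0 < n → (n : ℝ) = δ * N → ∀ (ι : Type) [Fintype ι]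
    (F : ι → Fin N → ℝ → ℝ), (∀ a i, Measurable (F a i)) →
    (∀ a i x, |F a i x| ≤ A * (1 + x ^ 2)) → ∀ e : ℝ, 0 < e → e ≤ 1 →
    stdPi (GIdx n N) {ω | ¬ (|l2 (fun k => ω (Sum.inl k)) / √n - 1| ≤ e ∧
      |ω (Sum.inr (Sum.inr ())) / √n| ≤ e) ∨
      (fun j => ω (Sum.inr (Sum.inl j))) ∉ typ F (ct * e)} ≤
      ENNReal.ofReal (C * (1 + Fintype.card ι) * Real.exp (-c * N * e ^ 2)) := by
  obtain ⟨c1, hc1, H1⟩ := gaussian_bernstein one_pos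
  obtain ⟨C2, hC2, H2⟩ := gaussian_tail
  obtain ⟨c3, hc3, H3⟩ := stdPi_typ_compl_le hA
  set c := min (min (c1 * δ) (δ / 4)) (c3 * ct ^ 2) with hc
  have hc0 : 0 < c := by positivity
  have hca : c ≤ c1 * δ := (min_le_left _ _).trans (min_le_left _ _)
  have hcb : c ≤ δ / 4 := (min_le_left _ _).trans (min_le_right _ _)
  have hcc : c ≤ c3 * ct ^ 2 := min_le_right _ _
  refine ⟨2 + C2, c, by positivity, hc0, fun n N hn hnN ι _ F hm hF e he he1 => ?_⟩
  have hn' : (0 : ℝ) < n := by exact_mod_cast hn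
  have hs : 0 < √(n : ℝ) := Real.sqrt_pos.2 hn'
  set E := Real.exp (-c * N * e ^ 2) with hE
  have hexp : ∀ u, c * (N * e ^ 2) ≤ u → Real.exp (-u) ≤ E := fun u hu => by
    rw [hE]; refine Real.exp_le_exp.2 ?_; linarith
  have hNe : 0 ≤ N * e ^ 2 := by positivity
  have hsub : {ω : GIdx n N → ℝ | ¬ (|l2 (fun k => ω (Sum.inl k)) / √n - 1| ≤ e ∧
      |ω (Sum.inr (Sum.inr ())) / √n| ≤ e) ∨
      (fun j => ω (Sum.inr (Sum.inl j))) ∉ typ F (ct * e)} ⊆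
      ((fun ω k => ω (Sum.inl k)) ⁻¹' {h : Fin n → ℝ | e * n ≤ |∑ i, h i ^ 2 - n|} ∪
      (fun ω => ω (Sum.inr (Sum.inr ()))) ⁻¹' {x : ℝ | e * √n ≤ |x|}) ∪
      (fun ω k => ω (Sum.inr k)) ⁻¹' ((fun ω k => ω (Sum.inl k)) ⁻¹' (typ F (ct * e))ᶜ) := by
    rintro ω (h | h)
    · left
      by_cases h1 : |l2 (fun k => ω (Sum.inl k)) / √n - 1| ≤ e
      · right
        have : ¬ |ω (Sum.inr (Sum.inr ())) / √n| ≤ e := fun h2 => h ⟨h1, h2⟩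
        rw [abs_div, abs_of_pos hs, div_le_iff₀ hs, not_le] at this
        exact this.le
      · left
        by_contra h2
        exact h1 (abs_l2_div_sub_one_le hn _ (not_le.1 h2).le)
    · right; exact h
  refine (measure_mono hsub).trans ((measure_union_le _ _).trans
    ((add_le_add_left (measure_union_le _ _) _).trans ?_))
  have b1 : stdPi (GIdx n N) ((fun ω k => ω (Sum.inl k)) ⁻¹'
      {h : Fin n → ℝ | e * n ≤ |∑ i, h i ^ 2 - n|}) ≤ ENNReal.ofReal (2 * E) := by
    have hms : Measurable (fun (ω : GIdx n N → ℝ) (k : Fin n) => ω (Sum.inl k)) := by fun_prop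
    refine (Measure.le_map_apply hms.aemeasurable _).trans ?_
    rw [stdPi_map_inl]
    have := H1 (Fin n) (fun _ x => x ^ 2) (fun _ => by fun_prop)
      (fun _ x => by rw [abs_of_nonneg (sq_nonneg x)]; linarith) e he he1
    simp only [Fintype.card_fin, integral_sq_gaussian, Finset.sum_const, Finset.card_univ,
      nsmul_eq_mul, mul_one] at this
    refine this.trans (ENNReal.ofReal_le_ofReal ?_)
    have h5 := hexp (c1 * n * e ^ 2) (by
      rw [hnN]; have := mul_le_mul_of_nonneg_right hca hNe; linarith)
    rw [show -(c1 * n * e ^ 2) = -c1 * n * e ^ 2 by ring] at h5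
    linarith
  have b2 : stdPi (GIdx n N) ((fun ω => ω (Sum.inr (Sum.inr ()))) ⁻¹' {x : ℝ | e * √n ≤ |x|}) ≤
      ENNReal.ofReal (C2 * E) := by
    have hms : Measurable (fun (ω : GIdx n N → ℝ) => ω (Sum.inr (Sum.inr ()))) :=
      measurable_pi_apply _
    refine (Measure.le_map_apply hms.aemeasurable _).trans ?_
    rw [stdPi_map_eval]
    refine (H2 (e * √n) (by positivity)).trans (ENNReal.ofReal_le_ofReal ?_)
    gcongr
    refine hexp _ ?_
    rw [mul_pow, Real.sq_sqrt hn'.le, hnN]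
    have := mul_le_mul_of_nonneg_right hcb hNe; linarith
  have b3 : stdPi (GIdx n N) ((fun ω k => ω (Sum.inr k)) ⁻¹'
      ((fun ω k => ω (Sum.inl k)) ⁻¹' (typ F (ct * e))ᶜ)) ≤
      ENNReal.ofReal (Fintype.card ι * (2 * E)) := by
    have hms : Measurable (fun (ω : GIdx n N → ℝ) (k : Fin N ⊕ Unit) => ω (Sum.inr k)) := by
      fun_prop
    have hms2 : Measurable (fun (ω : Fin N ⊕ Unit → ℝ) (k : Fin N) => ω (Sum.inl k)) := by fun_prop
    refine (Measure.le_map_apply hms.aemeasurable _).trans ?_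
    rw [stdPi_map_inr]
    refine (Measure.le_map_apply hms2.aemeasurable _).trans ?_
    rw [stdPi_map_inl]
    refine (H3 N ι F hm hF (ct * e) (by positivity) (mul_le_one₀ hct1 he.le he1)).trans
      (ENNReal.ofReal_le_ofReal ?_)
    gcongr
    have h5 := hexp (c3 * N * (ct * e) ^ 2) (by
      have := mul_le_mul_of_nonneg_right hcc hNe; nlinarith)
    rw [show -(c3 * N * (ct * e) ^ 2) = -c3 * N * (ct * e) ^ 2 by ring] at h5
    exact h5
  have hE0 : 0 < E := Real.exp_pos _
  refine (add_le_add (add_le_add b1 b2) b3).trans ?_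
  rw [← ENNReal.ofReal_add (by positivity) (by positivity),
    ← ENNReal.ofReal_add (by positivity) (by positivity)]
  refine ENNReal.ofReal_le_ofReal ?_
  have : 0 ≤ (Fintype.card ι : ℝ) * (C2 * E) := by positivity
  linarith

/-- The scalar functions whose averages enter the definition of `GoodEv`. -/
def baseTest {N : ℕ} (θ : Fin N → ℝ) (τ b : ℝ) : Fin 3 → Fin N → ℝ → ℝ :=
  ![fun i x => ew (θ i) τ b x ^ 2, fun i x => x * ew (θ i) τ b x,
    fun i x => |θ i + ew (θ i) τ b x| - |eta (θ i) b|]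

lemma measurable_baseTest {N : ℕ} (θ : Fin N → ℝ) (τ : ℝ) {b : ℝ} (hb : 0 ≤ b) (a : Fin 3)
    (i : Fin N) : Measurable (baseTest θ τ b a i) := by
  have := (continuous_ew (θ i) τ hb).measurable
  fin_cases a
  · exact this.pow_const 2
  · exact measurable_id.mul this
  · exact (measurable_const.add this).abs.sub_const _

lemma abs_baseTest_le {N : ℕ} (θ : Fin N → ℝ) {τ b A : ℝ} (hτ : 0 ≤ τ) (hb : 0 ≤ b)
    (hA : 2 * τ ^ 2 + 2 * b ^ 2 + 2 * τ + b ≤ A) (a : Fin 3) (i : Fin N) (x : ℝ) :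
    |baseTest θ τ b a i x| ≤ A * (1 + x ^ 2) := by
  have h := abs_ew_le (t := θ i) hτ hb x
  have hx2 : |x| ^ 2 = x ^ 2 := sq_abs x
  have hx1 : |x| ≤ 1 + x ^ 2 := by rw [← hx2]; nlinarith [abs_nonneg x]
  have hAx := mul_le_mul_of_nonneg_right hA (show 0 ≤ 1 + x ^ 2 by positivity)
  refine le_trans ?_ hAx
  have p1 : 0 ≤ 2 * τ ^ 2 * (1 + x ^ 2) := by positivity
  have p2 : 0 ≤ 2 * b ^ 2 * (1 + x ^ 2) := by positivity
  have p3 : 0 ≤ 2 * τ * (1 + x ^ 2) := by positivity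
  have p4 : 0 ≤ b * (1 + x ^ 2) := by positivity
  fin_cases a
  · change |ew (θ i) τ b x ^ 2| ≤ _
    rw [abs_of_nonneg (sq_nonneg _), ← sq_abs]
    have h1 : |ew (θ i) τ b x| ^ 2 ≤ (τ * |x| + b) ^ 2 := by gcongr
    have h2 : (τ * |x| + b) ^ 2 ≤ 2 * τ ^ 2 * x ^ 2 + 2 * b ^ 2 := by
      rw [← hx2]; nlinarith [sq_nonneg (τ * |x| - b)]
    have h3 : 0 ≤ 2 * b ^ 2 * x ^ 2 := by positivity
    nlinarith [sq_nonneg τ]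
  · change |x * ew (θ i) τ b x| ≤ _
    rw [abs_mul]
    have h1 : |x| * |ew (θ i) τ b x| ≤ |x| * (τ * |x| + b) := by gcongr
    have h2 : |x| * (τ * |x| + b) = τ * x ^ 2 + b * |x| := by rw [← hx2]; ring
    have h3 : b * |x| ≤ b * (1 + x ^ 2) := by gcongr
    have h4 : 0 ≤ τ * x ^ 2 := by positivity
    linarith
  · change |(|θ i + ew (θ i) τ b x| - |eta (θ i) b|)| ≤ _
    rw [add_ew]
    have h1 := abs_abs_sub_abs_le (eta (θ i + τ * x) b) (eta (θ i) b)
    have h2 := abs_eta_sub_le hb (θ i + τ * x) (θ i)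
    rw [add_sub_cancel_left, abs_mul, abs_of_nonneg hτ] at h2
    have h3 : 2 * τ * |x| ≤ 2 * τ * (1 + x ^ 2) := by gcongr
    linarith

lemma mem_goodEv_of_typ {N n : ℕ} {δ σ lam β τ e t : ℝ} (hN : 0 < N) (hδ : 0 < δ)
    (hn : (n : ℝ) = δ * N) (hl : 0 ≤ lam) {θ : Fin N → ℝ}
    (h : StateEvo δ σ (empDist θ) lam β τ) (ht : t ≤ δ * e) (ht2 : lam * t ≤ δ * e)
    {ω : GIdx n N → ℝ} (h1 : |l2 (fun k => ω (Sum.inl k)) / √n - 1| ≤ e)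
    (h2 : |ω (Sum.inr (Sum.inr ())) / √n| ≤ e)
    (h3 : (fun j => ω (Sum.inr (Sum.inl j))) ∈ typ (baseTest θ τ (τ * lam / β)) t) :
    ω ∈ GoodEv σ n θ lam β τ (penMean n θ lam β τ) e := by
  obtain ⟨m1, m2, -⟩ := state_evo_means hN hδ hn hl h
  obtain ⟨hβ, hτ, -, -⟩ := h
  have hb : 0 ≤ τ * lam / β := by positivity
  have hN' : (0 : ℝ) < N := by exact_mod_cast hN
  have hn' : (0 : ℝ) < n := by rw [hn]; positivity
  have ht' : t * N ≤ e * n := by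
    rw [hn]; have := mul_le_mul_of_nonneg_right ht hN'.le; linarith
  set g : Fin N → ℝ := fun j => ω (Sum.inr (Sum.inl j)) with hg
  refine ⟨h1, h2, ?_, ?_, ?_⟩
  · have := h3 0
    change |∑ i, ew (θ i) τ (τ * lam / β) (g i) ^ 2 -
      ∑ i, ∫ x, ew (θ i) τ (τ * lam / β) x ^ 2 ∂(gaussianReal 0 1)| ≤ t * N at this
    rw [m1] at this
    change |(∑ i, ew (θ i) τ (τ * lam / β) (g i) ^ 2) / n - (τ ^ 2 - σ ^ 2)| ≤ e
    rw [div_sub' hn'.ne', abs_div, abs_of_pos hn', div_le_iff₀ hn']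
    linarith
  · have := h3 1
    change |∑ i, g i * ew (θ i) τ (τ * lam / β) (g i) -
      ∑ i, ∫ x, x * ew (θ i) τ (τ * lam / β) x ∂(gaussianReal 0 1)| ≤ t * N at this
    rw [m2] at this
    change |(∑ i, g i * ew (θ i) τ (τ * lam / β) (g i)) / n - (τ - β)| ≤ e
    rw [div_sub' hn'.ne', abs_div, abs_of_pos hn', div_le_iff₀ hn']
    linarith
  · have := h3 2
    change |∑ i, (|θ i + ew (θ i) τ (τ * lam / β) (g i)| - |eta (θ i) (τ * lam / β)|) -
      ∑ i, ∫ x, (|θ i + ew (θ i) τ (τ * lam / β) x| - |eta (θ i) (τ * lam / β)|)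
        ∂(gaussianReal 0 1)| ≤ t * N at this
    have hint : ∀ i, ∫ x, (|θ i + ew (θ i) τ (τ * lam / β) x| - |eta (θ i) (τ * lam / β)|)
        ∂(gaussianReal 0 1) = (∫ x, |θ i + ew (θ i) τ (τ * lam / β) x| ∂(gaussianReal 0 1)) -
        |eta (θ i) (τ * lam / β)| := fun i => by
      rw [integral_sub (integrable_abs_add_ew (θ i) hτ.le hb) (integrable_const _), integral_const]
      simp
    simp_rw [hint] at this
    rw [Finset.sum_sub_distrib, Finset.sum_sub_distrib, sub_sub_sub_cancel_right] at this
    change |lam / n * ∑ i, |θ i + ew (θ i) τ (τ * lam / β) (g i)| - penMean n θ lam β τ| ≤ e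
    unfold penMean
    rw [← mul_sub, abs_mul, abs_of_nonneg (by positivity), div_mul_eq_mul_div, div_le_iff₀ hn']
    calc _ ≤ lam * (t * N) := by gcongr
      _ = lam * t * N := by ring
      _ ≤ δ * e * N := by gcongr
      _ = e * n := by rw [hn]; ring

/-- The normalized product of two finite measures of equal mass. -/
def cpl {E F : Type*} [MeasurableSpace E] [MeasurableSpace F] (α : Measure E) (β : Measure F) :
    Measure (E × F) := (α Set.univ)⁻¹ • α.prod β

section
variable {E F : Type*} [MeasurableSpace E] [MeasurableSpace F]

lemma cpl_map_fst {α : Measure E} {β : Measure F} [IsFiniteMeasure α] [IsFiniteMeasure β]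
    (h : α Set.univ = β Set.univ) : (cpl α β).map Prod.fst = α := by
  rw [cpl, Measure.map_smul, Measure.map_fst_prod, smul_smul, ← h]
  rcases eq_or_ne (α Set.univ) 0 with h0 | h0
  · rw [Measure.measure_univ_eq_zero] at h0; simp [h0]
  · rw [ENNReal.inv_mul_cancel h0 (measure_ne_top _ _), one_smul]

lemma cpl_map_snd {α : Measure E} {β : Measure F} [IsFiniteMeasure α] [IsFiniteMeasure β]
    (h : α Set.univ = β Set.univ) : (cpl α β).map Prod.snd = β := by
  rw [cpl, Measure.map_smul, Measure.map_snd_prod, smul_smul]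
  rcases eq_or_ne (α Set.univ) 0 with h0 | h0
  · have h1 := h.symm.trans h0
    rw [Measure.measure_univ_eq_zero] at h1; simp [h1]
  · rw [ENNReal.inv_mul_cancel h0 (measure_ne_top _ _), one_smul]

lemma lintegral_cpl_le {α : Measure E} {β : Measure F} [IsFiniteMeasure α] [IsFiniteMeasure β]
    (h : α Set.univ = β Set.univ) {c : E × F → ℝ≥0∞} (hc : Measurable c) {A : E → ℝ≥0∞}
    {B : F → ℝ≥0∞} (hA : Measurable A) {P : E → Prop} {Q : F → Prop}
    (hP : ∀ᵐ x ∂α, P x) (hQ : ∀ᵐ y ∂β, Q y) (hcost : ∀ x y, P x → Q y → c (x, y) ≤ A x + B y) :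
    ∫⁻ q, c q ∂(cpl α β) ≤ ∫⁻ x, A x ∂α + ∫⁻ y, B y ∂β := by
  have h1 : ∫⁻ q, c q ∂(α.prod β) ≤ α Set.univ * (∫⁻ x, A x ∂α + ∫⁻ y, B y ∂β) := by
    rw [lintegral_prod _ hc.aemeasurable]
    calc ∫⁻ x, ∫⁻ y, c (x, y) ∂β ∂α ≤ ∫⁻ x, ∫⁻ y, (A x + B y) ∂β ∂α := by
          refine lintegral_mono_ae ?_
          filter_upwards [hP] with x hx
          refine lintegral_mono_ae ?_
          filter_upwards [hQ] with y hy
          exact hcost x y hx hy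
      _ = ∫⁻ x, (A x * α Set.univ + ∫⁻ y, B y ∂β) ∂α := by
          refine lintegral_congr fun x => ?_
          rw [lintegral_add_left measurable_const, lintegral_const, h]
      _ = _ := by
          rw [lintegral_add_right _ measurable_const, lintegral_mul_const _ hA, lintegral_const]
          ring
  rw [cpl, lintegral_smul_measure, smul_eq_mul]
  rcases eq_or_ne (α Set.univ) 0 with h0 | h0
  · rw [Measure.measure_univ_eq_zero] at h0; simp [h0]
  · calc _ ≤ (α Set.univ)⁻¹ * (α Set.univ * (∫⁻ x, A x ∂α + ∫⁻ y, B y ∂β)) := by gcongr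
      _ = _ := by rw [← mul_assoc, ENNReal.inv_mul_cancel h0 (measure_ne_top _ _), one_mul]

lemma min_div_mul_cancel {m p : ℝ≥0∞} (hm : m ≠ ∞) : min m p / m * m = min m p := by
  rcases eq_or_ne m 0 with h | h
  · simp [h]
  · exact ENNReal.div_mul_cancel h hm

lemma min_div_le_one {m p : ℝ≥0∞} : min m p / m ≤ 1 :=
  ENNReal.div_le_of_le_mul (by simp)

lemma lintegral_mul_le_tail {μ : Measure E} {A U : E → ℝ≥0∞} (hU : Measurable U)
    (hU1 : ∀ x, U x ≤ 1) (T : ℝ≥0∞) :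
    ∫⁻ x, A x * U x ∂μ ≤ T * ∫⁻ x, U x ∂μ + ∫⁻ x, (A x - T) ∂μ := by
  rw [← lintegral_const_mul _ hU, ← lintegral_add_left (hU.const_mul T)]
  refine lintegral_mono fun x => ?_
  calc A x * U x ≤ (T + (A x - T)) * U x := by gcongr; exact le_add_tsub
    _ = T * U x + (A x - T) * U x := add_mul _ _ _
    _ ≤ T * U x + (A x - T) := by
      gcongr; exact mul_le_of_le_one_right (zero_le) (hU1 x)

/-- The half of a partial matching living on one of the two spaces. -/
lemma partial_match {I J : Type*} (sA : Finset I) (sC : Finset J)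
    (μ : Measure E) [IsProbabilityMeasure μ] {u : I → E → ℝ≥0∞} {f : I → J → E → ℝ≥0∞}
    (hu : ∀ a, Measurable (u a)) (hf : ∀ a c, Measurable (f a c))
    (hfu : ∀ a x, ∑ c ∈ sC, f a c x ≤ u a x) (hu1 : ∀ x, ∑ a ∈ sA, u a x = 1)
    (hua : ∀ a x, u a x ≤ 1) (w : I → J → ℝ≥0∞)
    (hw : ∀ a, ∀ c ∈ sC, w a c ≤ ∫⁻ x, f a c x ∂μ) :
    ∃ (α : I → J → Measure E) (ρ : I → Measure E) (U : E → ℝ≥0∞),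
      (∀ a c, IsFiniteMeasure (α a c)) ∧ (∀ a, IsFiniteMeasure (ρ a)) ∧
      (∀ a, ∀ c ∈ sC, α a c Set.univ = w a c) ∧
      (∀ a, ρ a Set.univ = ∫⁻ x, u a x ∂μ - ∑ c ∈ sC, w a c) ∧
      (∀ a c, ∀ᵐ x ∂(α a c), f a c x ≠ 0) ∧ (∀ a, ∀ᵐ x ∂(ρ a), u a x ≠ 0) ∧
      ∑ a ∈ sA, (∑ c ∈ sC, α a c + ρ a) = μ ∧ Measurable U ∧ (∀ x, U x ≤ 1) ∧
      ∫⁻ x, U x ∂μ + ∑ a ∈ sA, ∑ c ∈ sC, w a c = 1 ∧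
      ∀ A : E → ℝ≥0∞, Measurable A → ∑ a ∈ sA, ∫⁻ x, A x ∂(ρ a) = ∫⁻ x, A x * U x ∂μ := by
  have hufin : ∀ a, ∫⁻ x, u a x ∂μ ≠ ∞ := fun a =>
    ne_top_of_le_ne_top ENNReal.one_ne_top
      ((lintegral_mono (hua a)).trans (by simp))
  have hfle : ∀ a, ∀ c ∈ sC, ∀ x, f a c x ≤ u a x := fun a c hc x =>
    (Finset.single_le_sum (f := fun c => f a c x) (fun _ _ => zero_le) hc).trans (hfu a x)
  have hffin : ∀ a, ∀ c ∈ sC, ∫⁻ x, f a c x ∂μ ≠ ∞ := fun a c hc =>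
    ne_top_of_le_ne_top (hufin a) (lintegral_mono (hfle a c hc))
  have hms : ∀ a, ∀ c ∈ sC, w a c = min (∫⁻ x, f a c x ∂μ) (w a c) := fun a c hc =>
    (min_eq_right (hw a c hc)).symm
  classical
  set s : I → J → ℝ≥0∞ := fun a c =>
    if c ∈ sC then min (∫⁻ x, f a c x ∂μ) (w a c) / ∫⁻ x, f a c x ∂μ else 0 with hs
  have hs1 : ∀ a c, s a c ≤ 1 := fun a c => by
    simp only [hs]; split_ifs
    · exact min_div_le_one
    · exact zero_le
  have hsf : ∀ a, ∀ c ∈ sC, ∫⁻ x, s a c * f a c x ∂μ = w a c := fun a c hc => by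
    rw [lintegral_const_mul _ (hf a c)]
    simp only [hs, if_pos hc]
    rw [min_div_mul_cancel (hffin a c hc), min_eq_right (hw a c hc)]
  have hsum : ∀ a x, ∑ c ∈ sC, s a c * f a c x ≤ u a x := fun a x =>
    (Finset.sum_le_sum fun c _ => mul_le_of_le_one_left (zero_le) (hs1 a c)).trans (hfu a x)
  have hmsum : ∀ a, Measurable fun x => ∑ c ∈ sC, s a c * f a c x := fun a =>
    Finset.measurable_sum _ fun c _ => (hf a c).const_mul _
  have hmr : ∀ a, Measurable fun x => u a x - ∑ c ∈ sC, s a c * f a c x := fun a =>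
    (hu a).sub (hmsum a)
  have hlsum : ∀ a, ∫⁻ x, ∑ c ∈ sC, s a c * f a c x ∂μ = ∑ c ∈ sC, w a c := fun a => by
    rw [lintegral_finsetSum _ fun c _ => (hf a c).const_mul _]
    exact Finset.sum_congr rfl fun c hc => hsf a c hc
  have hwfin : ∀ a, ∑ c ∈ sC, w a c ≠ ∞ := fun a => by
    rw [← hlsum]
    exact ne_top_of_le_ne_top (hufin a) (lintegral_mono (hsum a))
  have hru : ∀ a, ∫⁻ x, (u a x - ∑ c ∈ sC, s a c * f a c x) ∂μ =
      ∫⁻ x, u a x ∂μ - ∑ c ∈ sC, w a c := fun a => by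
    rw [lintegral_sub (hmsum a) (by rw [hlsum]; exact hwfin a)
      (Filter.Eventually.of_forall (hsum a)), hlsum]
  refine ⟨fun a c => μ.withDensity fun x => s a c * f a c x,
    fun a => μ.withDensity fun x => u a x - ∑ c ∈ sC, s a c * f a c x,
    fun x => ∑ a ∈ sA, (u a x - ∑ c ∈ sC, s a c * f a c x), ?_, ?_, ?_, ?_, ?_, ?_, ?_, ?_, ?_,
    ?_, ?_⟩
  · intro a c
    refine isFiniteMeasure_withDensity ?_
    by_cases hc : c ∈ sC
    · refine ne_top_of_le_ne_top (hffin a c hc) (lintegral_mono fun x => ?_)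
      exact mul_le_of_le_one_left (zero_le) (hs1 a c)
    · simp [hs, hc]
  · intro a
    refine isFiniteMeasure_withDensity ?_
    exact ne_top_of_le_ne_top (hufin a) (lintegral_mono fun x => tsub_le_self)
  · intro a c hc
    simp only [withDensity_apply _ MeasurableSet.univ, Measure.restrict_univ]
    exact hsf a c hc
  · intro a
    simp only [withDensity_apply _ MeasurableSet.univ, Measure.restrict_univ]
    exact hru a
  · intro a c
    rw [ae_withDensity_iff ((hf a c).const_mul _)]
    refine Filter.Eventually.of_forall fun x hx => right_ne_zero_of_mul hx
  · intro a
    rw [ae_withDensity_iff (hmr a)]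
    refine Filter.Eventually.of_forall fun x hx h0 => hx ?_
    simp [h0]
  · ext t ht
    simp only [Measure.finsetSum_apply, Measure.add_apply, withDensity_apply _ ht]
    calc _ = ∑ a ∈ sA, ∫⁻ x in t, u a x ∂μ := by
          refine Finset.sum_congr rfl fun a _ => ?_
          rw [← lintegral_finsetSum _ fun c _ => (hf a c).const_mul _,
            ← lintegral_add_left (hmsum a)]
          refine lintegral_congr fun x => ?_
          exact add_tsub_cancel_of_le (hsum a x)
      _ = ∫⁻ x in t, 1 ∂μ := by
          rw [← lintegral_finsetSum _ fun a _ => hu a]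
          exact lintegral_congr fun x => hu1 x
      _ = μ t := by simp
  · exact Finset.measurable_sum _ fun a _ => hmr a
  · intro x
    rw [← hu1 x]
    exact Finset.sum_le_sum fun a _ => tsub_le_self
  · rw [lintegral_finsetSum _ fun a _ => hmr a, ← Finset.sum_add_distrib]
    calc _ = ∑ a ∈ sA, ∫⁻ x, u a x ∂μ := by
          refine Finset.sum_congr rfl fun a _ => ?_
          rw [hru, ← hlsum]
          exact tsub_add_cancel_of_le (lintegral_mono (hsum a))
      _ = ∫⁻ x, 1 ∂μ := by
          rw [← lintegral_finsetSum _ fun a _ => hu a]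
          exact lintegral_congr fun x => hu1 x
      _ = 1 := by simp
  · intro A hA
    simp_rw [Finset.mul_sum]
    rw [lintegral_finsetSum sA (f := fun a x => A x * (u a x - ∑ c ∈ sC, s a c * f a c x))
      fun a _ => hA.mul (hmr a)]
    refine Finset.sum_congr rfl fun a _ => ?_
    rw [lintegral_withDensity_eq_lintegral_mul _ (hmr a) hA]
    refine lintegral_congr fun x => ?_
    simp [mul_comm]

lemma map_sum_add_sum {I J G : Type*} [MeasurableSpace G] {sA : Finset I} {sC : Finset J}
    {φ : E → G} (hφ : Measurable φ) {α : I → J → Measure E} {ρ : I → Measure E} :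
    (∑ a ∈ sA, (∑ k ∈ sC, α a k + ρ a)).map φ =
      ∑ a ∈ sA, (∑ k ∈ sC, (α a k).map φ + (ρ a).map φ) := by
  ext t ht
  simp only [Measure.map_apply hφ ht, Measure.finsetSum_apply, Measure.add_apply]

lemma exists_coupling_lintegral_le {I J : Type*} (sA : Finset I) (sC : Finset J)
    (μ : Measure E) [IsProbabilityMeasure μ] (ν : Measure F) [IsProbabilityMeasure ν]
    {u : I → E → ℝ≥0∞} {f : I → J → E → ℝ≥0∞} {v : I → F → ℝ≥0∞} {h : I → J → F → ℝ≥0∞}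
    (hu : ∀ a, Measurable (u a)) (hf : ∀ a c, Measurable (f a c))
    (hfu : ∀ a x, ∑ c ∈ sC, f a c x ≤ u a x) (hu1 : ∀ x, ∑ a ∈ sA, u a x = 1)
    (hua : ∀ a x, u a x ≤ 1)
    (hv : ∀ a, Measurable (v a)) (hh : ∀ a c, Measurable (h a c))
    (hhv : ∀ a y, ∑ c ∈ sC, h a c y ≤ v a y) (hv1 : ∀ y, ∑ a ∈ sA, v a y = 1)
    (hva : ∀ a y, v a y ≤ 1) (huv : ∀ a, ∫⁻ x, u a x ∂μ = ∫⁻ y, v a y ∂ν)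
    {c : E × F → ℝ≥0∞} (hc : Measurable c) {A : E → ℝ≥0∞} {B : F → ℝ≥0∞} {K : ℝ≥0∞}
    (hA : Measurable A) (hB : Measurable B)
    (h1 : ∀ a k x y, f a k x ≠ 0 → h a k y ≠ 0 → c (x, y) ≤ K)
    (h2 : ∀ a x y, u a x ≠ 0 → v a y ≠ 0 → c (x, y) ≤ A x + B y) (T : ℝ≥0∞) :
    ∃ γ : Measure (E × F), γ.map Prod.fst = μ ∧ γ.map Prod.snd = ν ∧
      ∫⁻ q, c q ∂γ ≤ K + 2 * T * (1 - ∑ a ∈ sA, ∑ k ∈ sC,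
        min (∫⁻ x, f a k x ∂μ) (∫⁻ y, h a k y ∂ν)) +
        ∫⁻ x, (A x - T) ∂μ + ∫⁻ y, (B y - T) ∂ν := by
  set w : I → J → ℝ≥0∞ := fun a k => min (∫⁻ x, f a k x ∂μ) (∫⁻ y, h a k y ∂ν) with hw
  obtain ⟨α, ρ, U, a1, a2, a3, a4, a5, a6, a7, a8, a9, a10, a11⟩ :=
    partial_match sA sC μ hu hf hfu hu1 hua w (fun a k _ => min_le_left _ _)
  obtain ⟨β, σ, V, b1, b2, b3, b4, b5, b6, b7, b8, b9, b10, b11⟩ :=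
    partial_match sA sC ν hv hh hhv hv1 hva w (fun a k _ => min_le_right _ _)
  have e1 : ∀ a, ∀ k ∈ sC, α a k Set.univ = β a k Set.univ := fun a k hk => by
    rw [a3 a k hk, b3 a k hk]
  have e2 : ∀ a, ρ a Set.univ = σ a Set.univ := fun a => by rw [a4, b4, huv]
  have hUle : ∫⁻ x, U x ∂μ ≤ 1 - ∑ a ∈ sA, ∑ k ∈ sC, w a k := by
    refine ENNReal.le_sub_of_add_le_right ?_ a10.le
    exact ne_top_of_le_ne_top ENNReal.one_ne_top (le_add_self.trans a10.le)
  have hVle : ∫⁻ x, V x ∂ν ≤ 1 - ∑ a ∈ sA, ∑ k ∈ sC, w a k := by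
    refine ENNReal.le_sub_of_add_le_right ?_ b10.le
    exact ne_top_of_le_ne_top ENNReal.one_ne_top (le_add_self.trans b10.le)
  refine ⟨∑ a ∈ sA, (∑ k ∈ sC, cpl (α a k) (β a k) + cpl (ρ a) (σ a)), ?_, ?_, ?_⟩
  · rw [map_sum_add_sum measurable_fst]
    refine Eq.trans (Finset.sum_congr rfl fun a _ => ?_) a7
    rw [cpl_map_fst (e2 a)]
    congr 1
    exact Finset.sum_congr rfl fun k hk => cpl_map_fst (e1 a k hk)
  · rw [map_sum_add_sum measurable_snd]
    refine Eq.trans (Finset.sum_congr rfl fun a _ => ?_) b7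
    rw [cpl_map_snd (e2 a)]
    congr 1
    exact Finset.sum_congr rfl fun k hk => cpl_map_snd (e1 a k hk)
  · rw [lintegral_finsetSum_measure]
    simp_rw [lintegral_add_measure, lintegral_finsetSum_measure]
    calc _ ≤ ∑ a ∈ sA, (∑ k ∈ sC, K * w a k + (∫⁻ x, A x ∂(ρ a) + ∫⁻ y, B y ∂(σ a))) := by
          refine Finset.sum_le_sum fun a _ => add_le_add (Finset.sum_le_sum fun k hk => ?_) ?_
          · refine (lintegral_cpl_le (e1 a k hk) hc (A := fun _ => K) (B := fun _ => 0)
              measurable_const (a5 a k) (b5 a k) fun x y hx hy => ?_).trans ?_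
            · rw [add_zero]; exact h1 a k x y hx hy
            · rw [lintegral_const, lintegral_const, zero_mul, add_zero, a3 a k hk]
          · exact lintegral_cpl_le (e2 a) hc hA (a6 a) (b6 a) fun x y hx hy => h2 a x y hx hy
      _ = K * ∑ a ∈ sA, ∑ k ∈ sC, w a k + (∫⁻ x, A x * U x ∂μ + ∫⁻ y, B y * V y ∂ν) := by
          rw [Finset.sum_add_distrib, Finset.sum_add_distrib, a11 A hA, b11 B hB]
          simp_rw [Finset.mul_sum]
      _ ≤ K * 1 + ((T * (1 - ∑ a ∈ sA, ∑ k ∈ sC, w a k) + ∫⁻ x, (A x - T) ∂μ) +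
            (T * (1 - ∑ a ∈ sA, ∑ k ∈ sC, w a k) + ∫⁻ y, (B y - T) ∂ν)) := by
          gcongr
          · exact le_add_self.trans a10.le
          · exact (lintegral_mul_le_tail a8 a9 T).trans (by gcongr)
          · exact (lintegral_mul_le_tail b8 b9 T).trans (by gcongr)
      _ = _ := by rw [mul_one]; ring

end

/-- The unit ramp: `0` on negatives, `1` above `1`. -/
def ramp (t : ℝ) : ℝ := max 0 (min 1 t)

lemma ramp_nonneg (t : ℝ) : 0 ≤ ramp t := le_max_left _ _

lemma ramp_le_one (t : ℝ) : ramp t ≤ 1 := max_le zero_le_one (min_le_left _ _)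

lemma ramp_mono : Monotone ramp := fun _ _ h => max_le_max le_rfl (min_le_min le_rfl h)

lemma continuous_ramp : Continuous ramp := by unfold ramp; fun_prop

lemma ramp_of_nonpos {t : ℝ} (h : t ≤ 0) : ramp t = 0 := by
  unfold ramp; rw [min_eq_right (by linarith), max_eq_left h]

lemma ramp_of_one_le {t : ℝ} (h : 1 ≤ t) : ramp t = 1 := by
  unfold ramp; rw [min_eq_left h, max_eq_right zero_le_one]

lemma abs_ramp_sub_le (s t : ℝ) : |ramp s - ramp t| ≤ |s - t| := by
  unfold ramp
  calc |max 0 (min 1 s) - max 0 (min 1 t)| ≤ |min 1 s - min 1 t| := by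
        simpa using abs_max_sub_max_le_max 0 (min 1 s) 0 (min 1 t)
    _ ≤ |s - t| := by simpa using abs_min_sub_min_le_max 1 s 1 t

lemma sum_ramp_sub (t : ℝ) (K : ℕ) :
    ∑ c ∈ Finset.range K, ramp (t - c) = max 0 (min (K : ℝ) t) := by
  induction K with
  | zero =>
    simp only [Finset.range_zero, Finset.sum_empty, Nat.cast_zero]
    rw [max_eq_left (min_le_left _ _)]
  | succ K ih =>
    rw [Finset.sum_range_succ, ih]
    have hK : (0 : ℝ) ≤ K := K.cast_nonneg
    push_cast
    rcases le_total t K with h | h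
    · rw [ramp_of_nonpos (by linarith), min_eq_right h, min_eq_right (by linarith), add_zero]
    · rw [min_eq_left h, max_eq_right hK]
      rcases le_total (t - K) 1 with h1 | h1
      · rw [min_eq_right (by linarith), max_eq_right (by linarith), ramp, min_eq_right h1,
          max_eq_right (by linarith)]
        ring
      · rw [min_eq_left (by linarith), max_eq_right (by linarith), ramp_of_one_le h1]

lemma sum_abs_ramp_sub_le (s t : ℝ) (K : ℕ) :
    ∑ c ∈ Finset.range K, |ramp (s - c) - ramp (t - c)| ≤ |s - t| := by
  wlog h : t ≤ s generalizing s t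
  · have := this t s (le_of_not_ge h)
    rw [abs_sub_comm s t]
    refine le_trans (le_of_eq ?_) this
    exact Finset.sum_congr rfl fun c _ => abs_sub_comm _ _
  calc _ = ∑ c ∈ Finset.range K, (ramp (s - c) - ramp (t - c)) :=
        Finset.sum_congr rfl fun c _ => abs_of_nonneg (sub_nonneg.2 (ramp_mono (by linarith)))
    _ = max 0 (min (K : ℝ) s) - max 0 (min (K : ℝ) t) := by
        rw [Finset.sum_sub_distrib, sum_ramp_sub, sum_ramp_sub]
    _ ≤ |max 0 (min (K : ℝ) s) - max 0 (min (K : ℝ) t)| := le_abs_self _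
    _ ≤ |min (K : ℝ) s - min (K : ℝ) t| := by
        simpa using abs_max_sub_max_le_max 0 (min (K : ℝ) s) 0 (min (K : ℝ) t)
    _ ≤ |s - t| := by simpa using abs_min_sub_min_le_max (K : ℝ) s (K : ℝ) t

/-- A bump function of width `2κ`; for varying `c` these form a partition of unity. -/
def hat (κ S : ℝ) (c : ℕ) (s : ℝ) : ℝ :=
  ramp ((s + S) / κ + 1 - c) - ramp ((s + S) / κ + 1 - (c + 1 : ℕ))

lemma hat_nonneg (κ S : ℝ) (c : ℕ) (s : ℝ) : 0 ≤ hat κ S c s :=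
  sub_nonneg.2 (ramp_mono (by push_cast; linarith))

lemma hat_le_one (κ S : ℝ) (c : ℕ) (s : ℝ) : hat κ S c s ≤ 1 := by
  have h1 := ramp_le_one ((s + S) / κ + 1 - c)
  have h2 := ramp_nonneg ((s + S) / κ + 1 - (c + 1 : ℕ))
  unfold hat; linarith

lemma continuous_hat (κ S : ℝ) (c : ℕ) : Continuous (hat κ S c) := by
  unfold hat
  exact (continuous_ramp.comp (by fun_prop)).sub (continuous_ramp.comp (by fun_prop))

lemma sum_hat (κ S : ℝ) (K : ℕ) (s : ℝ) :
    ∑ c ∈ Finset.range K, hat κ S c s =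
      ramp ((s + S) / κ + 1) - ramp ((s + S) / κ + 1 - K) := by
  unfold hat
  rw [Finset.sum_range_sub' (fun c : ℕ => ramp ((s + S) / κ + 1 - c))]
  simp

lemma sum_hat_le_one (κ S : ℝ) (K : ℕ) (s : ℝ) : ∑ c ∈ Finset.range K, hat κ S c s ≤ 1 := by
  rw [sum_hat]
  have h1 := ramp_le_one ((s + S) / κ + 1)
  have h2 := ramp_nonneg ((s + S) / κ + 1 - K)
  linarith

lemma sum_hat_eq_one {κ S : ℝ} (hκ : 0 < κ) {K : ℕ} (hK : 2 * S / κ + 1 ≤ K) {s : ℝ}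
    (hs : |s| ≤ S) : ∑ c ∈ Finset.range K, hat κ S c s = 1 := by
  obtain ⟨h1, h2⟩ := abs_le.1 hs
  have h3 : 0 ≤ (s + S) / κ := div_nonneg (by linarith) hκ.le
  have h4 : (s + S) / κ ≤ 2 * S / κ := by gcongr; linarith
  rw [sum_hat, ramp_of_one_le (by linarith), ramp_of_nonpos (by linarith), sub_zero]

lemma abs_sub_le_of_hat_ne_zero {κ S : ℝ} (hκ : 0 < κ) {c : ℕ} {s s' : ℝ} (h : hat κ S c s ≠ 0)
    (h' : hat κ S c s' ≠ 0) : |s - s'| ≤ 2 * κ := by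
  have key : ∀ s, hat κ S c s ≠ 0 → (c : ℝ) - 1 ≤ (s + S) / κ ∧ (s + S) / κ ≤ c + 1 := by
    intro s hs
    by_contra hcon
    apply hs
    unfold hat
    rcases not_and_or.1 hcon with h1 | h1
    · have := not_le.1 h1
      rw [ramp_of_nonpos (by linarith), ramp_of_nonpos (by push_cast; linarith), sub_zero]
    · have := not_le.1 h1
      rw [ramp_of_one_le (by linarith), ramp_of_one_le (by push_cast; linarith), sub_self]
  obtain ⟨h1, h2⟩ := key s h
  obtain ⟨h3, h4⟩ := key s' h'
  rw [div_le_iff₀ hκ] at h2 h4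
  rw [le_div_iff₀ hκ] at h1 h3
  rw [abs_le]; constructor <;> linarith

lemma sum_abs_hat_sub_le {κ : ℝ} (hκ : 0 < κ) (S : ℝ) (K : ℕ) (s s' : ℝ) :
    ∑ c ∈ Finset.range K, |hat κ S c s - hat κ S c s'| ≤ 2 / κ * |s - s'| := by
  have h1 := sum_abs_ramp_sub_le ((s + S) / κ + 1) ((s' + S) / κ + 1) K
  have h2 := sum_abs_ramp_sub_le ((s + S) / κ) ((s' + S) / κ) K
  rw [show (s + S) / κ + 1 - ((s' + S) / κ + 1) = (s - s') / κ by ring, abs_div,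
    abs_of_pos hκ] at h1
  rw [show (s + S) / κ - ((s' + S) / κ) = (s - s') / κ by ring, abs_div, abs_of_pos hκ] at h2
  have h3 : ∑ c ∈ Finset.range K, |hat κ S c s - hat κ S c s'| ≤
      ∑ c ∈ Finset.range K, (|ramp ((s + S) / κ + 1 - c) - ramp ((s' + S) / κ + 1 - c)| +
        |ramp ((s + S) / κ - c) - ramp ((s' + S) / κ - c)|) := by
    refine Finset.sum_le_sum fun c _ => ?_
    unfold hat
    have e : ∀ s : ℝ, (s + S) / κ + 1 - ((c + 1 : ℕ) : ℝ) = (s + S) / κ - c := fun s => by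
      push_cast; ring
    rw [e, e, sub_sub_sub_comm]
    exact abs_sub _ _
  rw [Finset.sum_add_distrib] at h3
  have : 2 / κ * |s - s'| = |s - s'| / κ + |s - s'| / κ := by ring
  linarith

/-- The uniform probability measure on `Fin N`. -/
def unifM (N : ℕ) : Measure (Fin N) := (N : ℝ≥0∞)⁻¹ • ∑ i : Fin N, Measure.dirac i

lemma lintegral_unifM {N : ℕ} (f : Fin N → ℝ≥0∞) :
    ∫⁻ i, f i ∂(unifM N) = (N : ℝ≥0∞)⁻¹ * ∑ i, f i := by
  unfold unifM
  rw [lintegral_smul_measure, lintegral_finsetSum_measure]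
  simp

lemma isProbabilityMeasure_unifM {N : ℕ} (hN : 0 < N) : IsProbabilityMeasure (unifM N) := by
  constructor
  rw [← lintegral_one, lintegral_unifM]
  simp only [Finset.sum_const, Finset.card_univ, Fintype.card_fin, nsmul_eq_mul, mul_one]
  exact ENNReal.inv_mul_cancel (by positivity) (by simp)

lemma unifM_map {N : ℕ} {E : Type*} [MeasurableSpace E] (g : Fin N → E) :
    (unifM N).map g = (N : ℝ≥0∞)⁻¹ • ∑ i : Fin N, Measure.dirac (g i) := by
  ext s hs
  rw [Measure.map_apply (measurable_of_finite g) hs]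
  simp only [unifM, Measure.smul_apply, Measure.finsetSum_apply, smul_eq_mul]
  congr 1
  refine Finset.sum_congr rfl fun i _ => ?_
  rw [Measure.dirac_apply' _ (measurable_of_finite g hs), Measure.dirac_apply' _ hs]
  rfl

lemma lintegral_unifM_ofReal {N : ℕ} (hN : 0 < N) {f : Fin N → ℝ} (hf : ∀ i, 0 ≤ f i) :
    ∫⁻ i, ENNReal.ofReal (f i) ∂(unifM N) = ENNReal.ofReal ((N : ℝ)⁻¹ * ∑ i, f i) := by
  rw [lintegral_unifM, ENNReal.ofReal_mul (by positivity),
    ENNReal.ofReal_sum_of_nonneg fun i _ => hf i, ENNReal.ofReal_inv_of_pos (by positivity),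
    ENNReal.ofReal_natCast]

instance : IsProbabilityMeasure stdG := by unfold stdG; infer_instance

/-- Upper bound for the transport cost between an empirical law and the state-evolution law,
in terms of the overlap of cell masses and truncated second moments. -/
lemma W2sq_le {N K : ℕ} (hN : 0 < N) {κ S τ τ' T R a a' : ℝ} (hκ : 0 < κ) (hT : 0 ≤ T)
    (hR0 : 0 ≤ R) (ha0 : 0 ≤ a) (ha0' : 0 ≤ a') (sB : Finset ℤ) (θ xh xd : Fin N → ℝ)
    (hR : 1 - R ≤ ∑ b ∈ sB, ∑ c ∈ Finset.range K,
      min ((N : ℝ)⁻¹ * ∑ i, if ⌊θ i / κ⌋ = b then hat κ S c (xh i) else 0)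
        ((N : ℝ)⁻¹ * ∑ i, if ⌊θ i / κ⌋ = b then ∫ z, hat κ S c (θ i + τ * z) ∂stdG else 0))
    (ha : (N : ℝ)⁻¹ * ∑ i, max (3 * (xh i - θ i) ^ 2 - T) 0 ≤ a)
    (ha' : ∫ z, max (3 * τ ^ 2 * z ^ 2 + 4 * κ ^ 2 - T) 0 ∂stdG ≤ a') :
    W2sq (empDist2 xd θ) (muStarD (empDist θ) τ') ≤
      3 * (5 * κ ^ 2 + 2 * T * R + a + a') + 3 * ((N : ℝ)⁻¹ * ∑ i, (xd i - xh i) ^ 2) +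
        3 * (τ' - τ) ^ 2 := by
  have := isProbabilityMeasure_unifM hN
  set bin : Fin N → ℤ := fun i => ⌊θ i / κ⌋ with hbin
  have hbinκ : ∀ i j, bin i = bin j → |θ i - θ j| ≤ κ := by
    intro i j hij
    have := (Int.abs_sub_lt_one_of_floor_eq_floor hij).le
    rw [← sub_div, abs_div, abs_of_pos hκ, div_le_one hκ] at this
    exact this
  set sA : Finset ℤ := sB ∪ Finset.univ.image bin with hsA
  set u : ℤ → Fin N → ℝ≥0∞ := fun b i => if bin i = b then 1 else 0 with hu
  set f : ℤ → ℕ → Fin N → ℝ≥0∞ :=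
    fun b c i => if bin i = b then ENNReal.ofReal (hat κ S c (xh i)) else 0 with hf
  set h : ℤ → ℕ → Fin N × ℝ → ℝ≥0∞ :=
    fun b c q => if bin q.1 = b then ENNReal.ofReal (hat κ S c (θ q.1 + τ * q.2)) else 0 with hh
  have hu1 : ∀ i, ∑ b ∈ sA, u b i = 1 := by
    intro i
    simp only [hu, Finset.sum_ite_eq, hsA]
    rw [if_pos (Finset.mem_union_right _ (Finset.mem_image_of_mem _ (Finset.mem_univ _)))]
  have hua : ∀ b i, u b i ≤ 1 := fun b i => by simp only [hu]; split_ifs <;> simp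
  have hsum : ∀ s, ∑ c ∈ Finset.range K, ENNReal.ofReal (hat κ S c s) ≤ 1 := by
    intro s
    rw [← ENNReal.ofReal_sum_of_nonneg fun c _ => hat_nonneg _ _ _ _]
    exact ENNReal.ofReal_le_one.2 (sum_hat_le_one κ S K s)
  have hθm : Measurable fun q : Fin N × ℝ => θ q.1 := (measurable_of_finite θ).comp measurable_fst
  have hxm : Measurable fun q : Fin N × ℝ => xh q.1 :=
    (measurable_of_finite xh).comp measurable_fst
  have hbm : ∀ b, MeasurableSet {q : Fin N × ℝ | bin q.1 = b} := fun b =>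
    measurableSet_eq_fun ((measurable_of_finite bin).comp measurable_fst) measurable_const
  have hvm : ∀ b, Measurable fun q : Fin N × ℝ => u b q.1 := fun b =>
    (measurable_of_finite (u b)).comp measurable_fst
  have hhm : ∀ b c, Measurable (h b c) := fun b c =>
    Measurable.ite (hbm b) (((continuous_hat κ S c).measurable.comp
      (hθm.add (measurable_snd.const_mul τ))).ennreal_ofReal) measurable_const
  have hfu : ∀ b i, ∑ c ∈ Finset.range K, f b c i ≤ u b i := by
    intro b i
    simp only [hf, hu]
    split_ifs
    · exact hsum _
    · simp
  have hhu : ∀ b (q : Fin N × ℝ), ∑ c ∈ Finset.range K, h b c q ≤ u b q.1 := by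
    intro b q
    simp only [hh, hu]
    split_ifs
    · exact hsum _
    · simp
  have huv : ∀ b, ∫⁻ i, u b i ∂(unifM N) = ∫⁻ q : Fin N × ℝ, u b q.1 ∂((unifM N).prod stdG) := by
    intro b
    rw [lintegral_prod _ (hvm b).aemeasurable]
    simp
  set c0 : Fin N × (Fin N × ℝ) → ℝ := fun q =>
    (xh q.1 - θ q.2.1 - τ * q.2.2) ^ 2 + (θ q.1 - θ q.2.1) ^ 2 with hc0
  have hθm1 : Measurable fun q : Fin N × (Fin N × ℝ) => θ q.1 :=
    (measurable_of_finite θ).comp measurable_fst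
  have hxm1 : Measurable fun q : Fin N × (Fin N × ℝ) => xh q.1 :=
    (measurable_of_finite xh).comp measurable_fst
  have hdm1 : Measurable fun q : Fin N × (Fin N × ℝ) => xd q.1 :=
    (measurable_of_finite xd).comp measurable_fst
  have hθm2 : Measurable fun q : Fin N × (Fin N × ℝ) => θ q.2.1 :=
    hθm.comp measurable_snd
  have hzm : Measurable fun q : Fin N × (Fin N × ℝ) => q.2.2 := measurable_snd.comp measurable_snd
  have hc0m : Measurable c0 :=
    (((hxm1.sub hθm2).sub (hzm.const_mul τ)).pow_const 2).add ((hθm1.sub hθm2).pow_const 2)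
  obtain ⟨γ, g1, g2, g3⟩ := exists_coupling_lintegral_le sA (Finset.range K) (unifM N)
    ((unifM N).prod stdG) (u := u) (f := f) (v := fun b q => u b q.1) (h := h)
    (fun b => measurable_of_finite _) (fun b c => measurable_of_finite _) hfu hu1 hua hvm hhm hhu
    (fun q => hu1 q.1) (fun b q => hua b q.1) huv
    (c := fun q => ENNReal.ofReal (c0 q)) hc0m.ennreal_ofReal
    (A := fun i => ENNReal.ofReal (3 * (xh i - θ i) ^ 2))
    (B := fun q => ENNReal.ofReal (3 * τ ^ 2 * q.2 ^ 2 + 4 * κ ^ 2))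
    (K := ENNReal.ofReal (5 * κ ^ 2)) (measurable_of_finite _)
    (Measurable.ennreal_ofReal (by fun_prop))
    (by
      intro b c i q hfi hhq
      simp only [hf, hh, ne_eq, ite_eq_right_iff, not_forall, ENNReal.ofReal_eq_zero, not_le] at *
      obtain ⟨e1, e2⟩ := hfi
      obtain ⟨e3, e4⟩ := hhq
      have k1 := abs_sub_le_of_hat_ne_zero hκ e2.ne' e4.ne'
      have k2 := hbinκ _ _ (e1.trans e3.symm)
      have k3 := sq_le_sq' (by linarith [abs_le.1 k1]) (abs_le.1 k1).2
      have k4 := sq_le_sq' (by linarith [abs_le.1 k2]) (abs_le.1 k2).2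
      apply ENNReal.ofReal_le_ofReal
      simp only [hc0]
      rw [show xh i - θ q.1 - τ * q.2 = xh i - (θ q.1 + τ * q.2) by ring]
      linarith)
    (by
      intro b i q hui huq
      simp only [hu, ne_eq, ite_eq_right_iff, not_forall, one_ne_zero, not_false_eq_true,
        exists_prop, and_true] at *
      have k2 := hbinκ _ _ (hui.trans huq.symm)
      have k4 := sq_le_sq' (by linarith [abs_le.1 k2]) (abs_le.1 k2).2
      rw [← ENNReal.ofReal_add (by positivity) (by positivity)]
      apply ENNReal.ofReal_le_ofReal
      simp only [hc0]
      have k5 : (xh i - θ q.1 - τ * q.2) ^ 2 ≤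
          3 * (xh i - θ i) ^ 2 + 3 * (θ i - θ q.1) ^ 2 + 3 * (τ * q.2) ^ 2 := by
        nlinarith [sq_nonneg ((xh i - θ i) - (θ i - θ q.1)), sq_nonneg ((xh i - θ i) + τ * q.2),
          sq_nonneg ((θ i - θ q.1) + τ * q.2)]
      rw [mul_pow] at k5
      linarith) (ENNReal.ofReal T)
  have hNr : (0 : ℝ) ≤ (N : ℝ)⁻¹ := by positivity
  have hI0 : ∀ c i, 0 ≤ ∫ z, hat κ S c (θ i + τ * z) ∂stdG := fun c i =>
    integral_nonneg fun z => hat_nonneg _ _ _ _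
  have ef : ∀ b c, ∫⁻ i, f b c i ∂(unifM N) = ENNReal.ofReal ((N : ℝ)⁻¹ *
      ∑ i, if bin i = b then hat κ S c (xh i) else 0) := by
    intro b c
    rw [← lintegral_unifM_ofReal hN fun i => by split_ifs <;> simp [hat_nonneg]]
    refine lintegral_congr fun i => ?_
    simp only [hf]; split_ifs <;> simp
  have eh : ∀ b c, ∫⁻ q, h b c q ∂((unifM N).prod stdG) = ENNReal.ofReal ((N : ℝ)⁻¹ *
      ∑ i, if bin i = b then ∫ z, hat κ S c (θ i + τ * z) ∂stdG else 0) := by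
    intro b c
    rw [← lintegral_unifM_ofReal hN fun i => by split_ifs <;> simp [hI0],
      lintegral_prod _ (hhm b c).aemeasurable]
    refine lintegral_congr fun i => ?_
    simp only [hh]
    split_ifs
    · refine (ofReal_integral_eq_lintegral_ofReal ?_ ?_).symm
      · refine Integrable.of_bound ((continuous_hat κ S c).comp
          (by fun_prop)).aestronglyMeasurable 1 (ae_of_all _ fun z => ?_)
        rw [Real.norm_eq_abs, abs_of_nonneg (hat_nonneg _ _ _ _)]
        exact hat_le_one _ _ _ _
      · exact ae_of_all _ fun z => hat_nonneg _ _ _ _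
    · simp
  have e1 : 1 - ∑ b ∈ sA, ∑ c ∈ Finset.range K,
      min (∫⁻ i, f b c i ∂(unifM N)) (∫⁻ q, h b c q ∂((unifM N).prod stdG)) ≤
        ENNReal.ofReal R := by
    have h0 : ∑ b ∈ sB, ∑ c ∈ Finset.range K,
        min (∫⁻ i, f b c i ∂(unifM N)) (∫⁻ q, h b c q ∂((unifM N).prod stdG)) ≤
        ∑ b ∈ sA, ∑ c ∈ Finset.range K,
        min (∫⁻ i, f b c i ∂(unifM N)) (∫⁻ q, h b c q ∂((unifM N).prod stdG)) :=
      Finset.sum_le_sum_of_subset Finset.subset_union_left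
    refine (tsub_le_tsub_left h0 1).trans ?_
    rw [tsub_le_iff_right]
    have hpos1 : ∀ b c, 0 ≤ (N : ℝ)⁻¹ * ∑ i, if bin i = b then hat κ S c (xh i) else 0 :=
      fun b c => mul_nonneg hNr (Finset.sum_nonneg fun i _ => by split_ifs <;> simp [hat_nonneg])
    have hpos2 : ∀ b c, 0 ≤ (N : ℝ)⁻¹ *
        ∑ i, if bin i = b then ∫ z, hat κ S c (θ i + τ * z) ∂stdG else 0 :=
      fun b c => mul_nonneg hNr (Finset.sum_nonneg fun i _ => by split_ifs <;> simp [hI0])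
    simp only [ef, eh, ← ENNReal.ofReal_min]
    rw [Finset.sum_congr rfl fun b _ => (ENNReal.ofReal_sum_of_nonneg
      fun c _ => le_min (hpos1 b c) (hpos2 b c)).symm,
      ← ENNReal.ofReal_sum_of_nonneg fun b _ => Finset.sum_nonneg
      fun c _ => le_min (hpos1 b c) (hpos2 b c), ← ENNReal.ofReal_add hR0
      (Finset.sum_nonneg fun b _ => Finset.sum_nonneg fun c _ => le_min (hpos1 b c) (hpos2 b c)),
      ENNReal.one_le_ofReal]
    linarith
  have e2 : ∫⁻ i, (ENNReal.ofReal (3 * (xh i - θ i) ^ 2) - ENNReal.ofReal T) ∂(unifM N) ≤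
      ENNReal.ofReal a := by
    refine le_trans (le_of_eq ?_) (ENNReal.ofReal_le_ofReal ha)
    rw [← lintegral_unifM_ofReal hN fun i => le_max_right _ _]
    refine lintegral_congr fun i => ?_
    rw [← ENNReal.ofReal_sub _ hT, ENNReal.ofReal_max, ENNReal.ofReal_zero, max_eq_left (zero_le)]
  have e3 : ∫⁻ q : Fin N × ℝ, (ENNReal.ofReal (3 * τ ^ 2 * q.2 ^ 2 + 4 * κ ^ 2) -
      ENNReal.ofReal T) ∂((unifM N).prod stdG) ≤ ENNReal.ofReal a' := by
    refine le_trans (le_of_eq ?_) (ENNReal.ofReal_le_ofReal ha')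
    rw [lintegral_prod _ (Measurable.aemeasurable (by fun_prop)),
      ofReal_integral_eq_lintegral_ofReal
        (f := fun z => max (3 * τ ^ 2 * z ^ 2 + 4 * κ ^ 2 - T) 0) ?_
        (ae_of_all _ fun z => le_max_right _ _)]
    · simp only [lintegral_const, measure_univ, mul_one]
      refine lintegral_congr fun z => ?_
      rw [← ENNReal.ofReal_sub _ hT, ENNReal.ofReal_max, ENNReal.ofReal_zero,
        max_eq_left (zero_le)]
    · have hi : Integrable (fun z : ℝ => 3 * τ ^ 2 * z ^ 2 + 4 * κ ^ 2) stdG :=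
        (Integrable.const_mul (show Integrable (fun z : ℝ => z ^ 2) stdG from
          (memLp_id_gaussianReal 2).integrable_sq) _).add (integrable_const _)
      refine hi.mono' (Continuous.aestronglyMeasurable (by fun_prop)) (ae_of_all _ fun z => ?_)
      rw [Real.norm_eq_abs, abs_of_nonneg (le_max_right _ _)]
      exact max_le (by linarith) (by positivity)
  have e4 : ∫⁻ q, ENNReal.ofReal (c0 q) ∂γ ≤
      ENNReal.ofReal (5 * κ ^ 2 + 2 * T * R + a + a') := by
    rw [ENNReal.ofReal_add (by positivity) ha0', ENNReal.ofReal_add (by positivity) ha0,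
      ENNReal.ofReal_add (by positivity) (by positivity),
      ENNReal.ofReal_mul (p := 2 * T) (by positivity),
      ENNReal.ofReal_mul (p := 2) (by positivity), ENNReal.ofReal_ofNat]
    refine g3.trans ?_
    gcongr
  set Φ : Fin N × (Fin N × ℝ) → (ℝ × ℝ) × (ℝ × ℝ) := fun q =>
    ((xd q.1, θ q.1), (θ q.2.1 + τ' * q.2.2, θ q.2.1)) with hΦ
  have hΦm : Measurable Φ :=
    (hdm1.prodMk hθm1).prodMk ((hθm2.add (hzm.const_mul τ')).prodMk hθm2)
  set cost : (ℝ × ℝ) × (ℝ × ℝ) → ℝ := fun q =>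
    (q.1.1 - q.2.1) ^ 2 + (q.1.2 - q.2.2) ^ 2 with hcost
  have hcostm : Measurable cost := by fun_prop
  have e5 : ∫⁻ q, ENNReal.ofReal (cost q) ∂(γ.map Φ) ≤
      ENNReal.ofReal (3 * (5 * κ ^ 2 + 2 * T * R + a + a') +
        3 * ((N : ℝ)⁻¹ * ∑ i, (xd i - xh i) ^ 2) + 3 * (τ' - τ) ^ 2) := by
    rw [lintegral_map hcostm.ennreal_ofReal hΦm]
    have hpt : ∀ q, ENNReal.ofReal (cost (Φ q)) ≤ 3 * ENNReal.ofReal (c0 q) +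
        ENNReal.ofReal (3 * (xd q.1 - xh q.1) ^ 2) +
        ENNReal.ofReal (3 * (τ' - τ) ^ 2 * q.2.2 ^ 2) := by
      intro q
      rw [show (3 : ℝ≥0∞) = ENNReal.ofReal 3 by simp, ← ENNReal.ofReal_mul (by norm_num),
        ← ENNReal.ofReal_add (by positivity) (by positivity),
        ← ENNReal.ofReal_add (by positivity) (by positivity)]
      apply ENNReal.ofReal_le_ofReal
      simp only [hcost, hΦ, hc0]
      have : (xd q.1 - (θ q.2.1 + τ' * q.2.2)) ^ 2 ≤ 3 * (xh q.1 - θ q.2.1 - τ * q.2.2) ^ 2 +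
          3 * (xd q.1 - xh q.1) ^ 2 + 3 * ((τ' - τ) * q.2.2) ^ 2 := by
        have e : xd q.1 - (θ q.2.1 + τ' * q.2.2) = (xh q.1 - θ q.2.1 - τ * q.2.2) +
          (xd q.1 - xh q.1) - (τ' - τ) * q.2.2 := by ring
        rw [e]
        generalize xh q.1 - θ q.2.1 - τ * q.2.2 = x
        generalize xd q.1 - xh q.1 = y
        generalize (τ' - τ) * q.2.2 = w
        nlinarith [sq_nonneg (x - y), sq_nonneg (x + w), sq_nonneg (y + w)]
      rw [mul_pow] at this
      nlinarith [sq_nonneg (θ q.1 - θ q.2.1)]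
    have hd1 : ∫⁻ q, ENNReal.ofReal (3 * (xd q.1 - xh q.1) ^ 2) ∂γ =
        ENNReal.ofReal (3 * ((N : ℝ)⁻¹ * ∑ i, (xd i - xh i) ^ 2)) := by
      rw [show 3 * ((N : ℝ)⁻¹ * ∑ i, (xd i - xh i) ^ 2) =
        (N : ℝ)⁻¹ * ∑ i, 3 * (xd i - xh i) ^ 2 by rw [← Finset.mul_sum]; ring,
        ← lintegral_unifM_ofReal hN (fun i => by positivity), ← g1,
        lintegral_map (measurable_of_finite _) measurable_fst]
    have hd2 : ∫⁻ q, ENNReal.ofReal (3 * (τ' - τ) ^ 2 * q.2.2 ^ 2) ∂γ =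
        ENNReal.ofReal (3 * (τ' - τ) ^ 2) := by
      have m1 : Measurable fun q : Fin N × ℝ =>
        ENNReal.ofReal (3 * (τ' - τ) ^ 2 * q.2 ^ 2) := by fun_prop
      have : ∫⁻ q, ENNReal.ofReal (3 * (τ' - τ) ^ 2 * q.2.2 ^ 2) ∂γ =
          ∫⁻ q, ENNReal.ofReal (3 * (τ' - τ) ^ 2 * q.2 ^ 2) ∂((unifM N).prod stdG) := by
        rw [← g2, lintegral_map m1 measurable_snd]
      have hi : Integrable (fun z : ℝ => z ^ 2) stdG := (memLp_id_gaussianReal 2).integrable_sq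
      have hi1 : ∫ z, z ^ 2 ∂stdG = 1 := by
        have h1 := variance_of_integral_eq_zero (X := id) (μ := gaussianReal 0 1)
          aemeasurable_id (by simp)
        rw [variance_id_gaussianReal] at h1
        simpa [stdG] using h1.symm
      rw [this, lintegral_prod _ m1.aemeasurable]
      simp only [lintegral_const, measure_univ, mul_one]
      rw [← ofReal_integral_eq_lintegral_ofReal (hi.const_mul _)
        (ae_of_all _ fun z => by positivity), integral_const_mul, hi1, mul_one]
    calc _ ≤ ∫⁻ q, (3 * ENNReal.ofReal (c0 q) + ENNReal.ofReal (3 * (xd q.1 - xh q.1) ^ 2) +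
        ENNReal.ofReal (3 * (τ' - τ) ^ 2 * q.2.2 ^ 2)) ∂γ := lintegral_mono hpt
      _ = 3 * ∫⁻ q, ENNReal.ofReal (c0 q) ∂γ + ENNReal.ofReal (3 * ((N : ℝ)⁻¹ *
          ∑ i, (xd i - xh i) ^ 2)) + ENNReal.ofReal (3 * (τ' - τ) ^ 2) := by
        rw [lintegral_add_right _ (Measurable.ennreal_ofReal ((hzm.pow_const 2).const_mul _)),
          lintegral_add_right _ (Measurable.ennreal_ofReal
            (f := fun q : Fin N × Fin N × ℝ => 3 * (xd q.1 - xh q.1) ^ 2)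
            (((hdm1.sub hxm1).pow_const 2).const_mul _)),
          lintegral_const_mul _ hc0m.ennreal_ofReal, hd1, hd2]
      _ ≤ _ := by
        rw [ENNReal.ofReal_add (by positivity) (by positivity),
          ENNReal.ofReal_add (by positivity) (by positivity),
          ENNReal.ofReal_mul (q := 5 * κ ^ 2 + 2 * T * R + a + a') (by norm_num),
          ENNReal.ofReal_ofNat]
        gcongr
  have e6 : ∫ q, cost q ∂(γ.map Φ) ≤ 3 * (5 * κ ^ 2 + 2 * T * R + a + a') +
      3 * ((N : ℝ)⁻¹ * ∑ i, (xd i - xh i) ^ 2) + 3 * (τ' - τ) ^ 2 := by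
    rw [integral_eq_lintegral_of_nonneg_ae (ae_of_all _ fun q => by positivity)
      hcostm.aestronglyMeasurable]
    exact ENNReal.toReal_le_of_le_ofReal (by positivity) e5
  refine le_trans (csInf_le ⟨0, ?_⟩ ⟨γ.map Φ, ?_, ?_, rfl⟩) e6
  · rintro r ⟨γ', -, -, rfl⟩
    exact integral_nonneg fun q => by positivity
  · rw [Measure.map_map measurable_fst hΦm]
    have : Prod.fst ∘ Φ = (fun i => (xd i, θ i)) ∘ Prod.fst := rfl
    rw [this, ← Measure.map_map (measurable_of_finite _) measurable_fst, g1, unifM_map]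
    rfl
  · have m2 : Measurable fun q : Fin N × ℝ => (θ q.1 + τ' * q.2, θ q.1) :=
      (hθm.add (measurable_snd.const_mul τ')).prodMk hθm
    rw [Measure.map_map measurable_snd hΦm]
    have : Prod.snd ∘ Φ = (fun q : Fin N × ℝ => (θ q.1 + τ' * q.2, θ q.1)) ∘ Prod.snd := rfl
    rw [this, ← Measure.map_map m2 measurable_snd, g2]
    have e7 : empDist θ = (unifM N).map θ := by rw [unifM_map]; rfl
    have e8 : (empDist θ).prod stdG = ((unifM N).prod stdG).map (Prod.map θ id) := by
      rw [e7, ← Measure.map_prod_map _ _ (measurable_of_finite θ) measurable_id, Measure.map_id]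
    unfold muStarD
    rw [e8, Measure.map_map (by fun_prop) ((measurable_of_finite θ).prodMap measurable_id)]
    rfl

/-- The part of `hat` seen through the soft-thresholded coordinate. -/
def psi (κ S b : ℝ) (c : ℕ) (y : ℝ) : ℝ :=
  hat κ S c (max y 0 + b) - hat κ S c b + (hat κ S c (min y 0 - b) - hat κ S c (-b))

lemma continuous_psi (κ S b : ℝ) (c : ℕ) : Continuous (psi κ S b c) := by
  unfold psi
  have := continuous_hat κ S c
  fun_prop

lemma abs_psi_le (κ S b : ℝ) (c : ℕ) (y : ℝ) : |psi κ S b c y| ≤ 2 := by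
  unfold psi
  have h : ∀ s, 0 ≤ hat κ S c s ∧ hat κ S c s ≤ 1 := fun s =>
    ⟨hat_nonneg _ _ _ _, hat_le_one _ _ _ _⟩
  have h1 := h (max y 0 + b)
  have h2 := h b
  have h3 := h (min y 0 - b)
  have h4 := h (-b)
  rw [abs_le]; constructor <;> linarith

lemma hat_eq_add_psi (κ S : ℝ) {b : ℝ} (hb : 0 ≤ b) (c : ℕ) (x : ℝ) :
    hat κ S c x = hat κ S c (clipf b x) + psi κ S b c (eta x b) := by
  rw [eta_eq_sub_clipf hb]
  unfold psi clipf
  rcases le_total x b with h | h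
  · rw [min_eq_right h]
    rcases le_total (-b) x with h' | h'
    · rw [max_eq_right h', sub_self, max_self, min_self, zero_add, zero_sub]; ring
    · rw [max_eq_left h', max_eq_right (by linarith), min_eq_left (by linarith), zero_add,
        show x - -b - b = x by ring]; ring
  · rw [min_eq_left h, max_eq_right (by linarith), max_eq_left (by linarith),
      min_eq_right (by linarith), zero_sub, sub_add_cancel]; ring

lemma sum_abs_psi_sub_le {κ : ℝ} (hκ : 0 < κ) (S b : ℝ) (K : ℕ) (y y' : ℝ) :
    ∑ c ∈ Finset.range K, |psi κ S b c y - psi κ S b c y'| ≤ 4 / κ * |y - y'| := by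
  have h1 := sum_abs_hat_sub_le hκ S K (max y 0 + b) (max y' 0 + b)
  have h2 := sum_abs_hat_sub_le hκ S K (min y 0 - b) (min y' 0 - b)
  rw [add_sub_add_right_eq_sub] at h1
  rw [sub_sub_sub_cancel_right] at h2
  have h3 : |max y 0 - max y' 0| ≤ |y - y'| := abs_max_sub_max_le_abs _ _ _
  have h4 : |min y 0 - min y' 0| ≤ |y - y'| := by simpa using abs_min_sub_min_le_max y 0 y' 0
  have h5 : ∑ c ∈ Finset.range K, |psi κ S b c y - psi κ S b c y'| ≤
      ∑ c ∈ Finset.range K, (|hat κ S c (max y 0 + b) - hat κ S c (max y' 0 + b)| +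
        |hat κ S c (min y 0 - b) - hat κ S c (min y' 0 - b)|) := by
    refine Finset.sum_le_sum fun c _ => ?_
    refine le_trans (le_of_eq ?_) (abs_add_le _ _)
    unfold psi; congr 1; ring
  rw [Finset.sum_add_distrib] at h5
  have h6 : 2 / κ * |max y 0 - max y' 0| ≤ 2 / κ * |y - y'| := by gcongr
  have h7 : 2 / κ * |min y 0 - min y' 0| ≤ 2 / κ * |y - y'| := by gcongr
  have : 4 / κ * |y - y'| = 2 / κ * |y - y'| + 2 / κ * |y - y'| := by ring
  linarith

/-- A pair `(u, y)` satisfying the optimality conditions at level `b'` is split by `hat` and `psi`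
at the nearby level `b`. -/
lemma sum_abs_hat_add_sub_le {κ : ℝ} (hκ : 0 < κ) (S : ℝ) (K : ℕ) {b b' u y : ℝ}
    (h : u * y = b' * |y|) :
    ∑ c ∈ Finset.range K, |hat κ S c (u + y) - hat κ S c u - psi κ S b c y| ≤
      4 / κ * |b - b'| := by
  have key : ∀ v w : ℝ, |v - w| = |b - b'| → ∀ v' w' : ℝ, |v' - w'| = |b - b'| →
      ∑ c ∈ Finset.range K, |hat κ S c v - hat κ S c v' - (hat κ S c w - hat κ S c w')| ≤
      4 / κ * |b - b'| := by
    intro v w hvw v' w' hvw'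
    have h1 := sum_abs_hat_sub_le hκ S K v w
    have h2 := sum_abs_hat_sub_le hκ S K v' w'
    rw [hvw] at h1
    rw [hvw'] at h2
    have h3 : ∑ c ∈ Finset.range K, |hat κ S c v - hat κ S c v' - (hat κ S c w - hat κ S c w')| ≤
        ∑ c ∈ Finset.range K, (|hat κ S c v - hat κ S c w| + |hat κ S c v' - hat κ S c w'|) := by
      refine Finset.sum_le_sum fun c _ => ?_
      rw [sub_sub_sub_comm]
      exact abs_sub _ _
    rw [Finset.sum_add_distrib] at h3
    have : 4 / κ * |b - b'| = 2 / κ * |b - b'| + 2 / κ * |b - b'| := by ring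
    linarith
  rcases lt_trichotomy y 0 with hy | hy | hy
  · have hu : u = -b' := by
      rw [abs_of_neg hy] at h
      exact mul_right_cancel₀ hy.ne (by linarith)
    have := key (-b' + y) (y - b) (by rw [abs_sub_comm]; rw [← abs_neg]; congr 1; ring) (-b') (-b)
      (by congr 1; ring)
    refine le_trans (le_of_eq ?_) this
    refine Finset.sum_congr rfl fun c _ => ?_
    unfold psi
    rw [hu, max_eq_right hy.le, min_eq_left hy.le, zero_add, sub_self, zero_add]
  · subst hy
    have : ∑ c ∈ Finset.range K, |hat κ S c (u + 0) - hat κ S c u - psi κ S b c 0| = 0 := by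
      refine Finset.sum_eq_zero fun c _ => ?_
      unfold psi
      simp
    rw [this]; positivity
  · have hu : u = b' := by
      rw [abs_of_pos hy] at h
      exact mul_right_cancel₀ hy.ne' h
    have := key (b' + y) (y + b) (by rw [abs_sub_comm]; congr 1; ring) b' b (abs_sub_comm _ _)
    refine le_trans (le_of_eq ?_) this
    refine Finset.sum_congr rfl fun c _ => ?_
    unfold psi
    rw [hu, max_eq_left hy.le, min_eq_right hy.le, zero_sub, sub_self, add_zero]

/-- The lower-thresholded test function localised to a bin. -/
def clipCell {N : ℕ} (θ : Fin N → ℝ) (τ b κ S : ℝ) (a : ℤ) (c : ℕ) (i : Fin N) (x : ℝ) : ℝ :=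
  if ⌊θ i / κ⌋ = a then hat κ S c (clipf b (θ i + τ * x)) else 0

/-- The soft-thresholded test function localised to a bin. -/
def etaCell {N : ℕ} (θ : Fin N → ℝ) (τ b κ S : ℝ) (a : ℤ) (c : ℕ) (i : Fin N) (x : ℝ) : ℝ :=
  if ⌊θ i / κ⌋ = a then psi κ S b c (eta (θ i + τ * x) b) else 0

lemma continuous_hat_clipf {t τ b κ S : ℝ} (c : ℕ) :
    Continuous fun x => hat κ S c (clipf b (t + τ * x)) :=
  (continuous_hat κ S c).comp ((continuous_clipf b).comp (by fun_prop))

lemma continuous_psi_eta {t τ b κ S : ℝ} (hb : 0 ≤ b) (c : ℕ) :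
    Continuous fun x => psi κ S b c (eta (t + τ * x) b) :=
  (continuous_psi κ S b c).comp
    ((continuous_eta hb).comp (show Continuous fun x => t + τ * x by fun_prop))

lemma measurable_clipCell {N : ℕ} (θ : Fin N → ℝ) (τ b κ S : ℝ) (a : ℤ) (c : ℕ) (i : Fin N) :
    Measurable (clipCell θ τ b κ S a c i) := by
  unfold clipCell
  split_ifs
  · exact (continuous_hat_clipf c).measurable
  · exact measurable_const

lemma measurable_etaCell {N : ℕ} (θ : Fin N → ℝ) (τ : ℝ) {b : ℝ} (hb : 0 ≤ b) (κ S : ℝ) (a : ℤ)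
    (c : ℕ) (i : Fin N) : Measurable (etaCell θ τ b κ S a c i) := by
  unfold etaCell
  split_ifs
  · exact (continuous_psi_eta hb c).measurable
  · exact measurable_const

lemma abs_clipCell_le {N : ℕ} (θ : Fin N → ℝ) (τ b κ S : ℝ) (a : ℤ) (c : ℕ) (i : Fin N) (x : ℝ) :
    |clipCell θ τ b κ S a c i x| ≤ 1 := by
  unfold clipCell
  split_ifs
  · rw [abs_of_nonneg (hat_nonneg _ _ _ _)]; exact hat_le_one _ _ _ _
  · simp

lemma abs_etaCell_le {N : ℕ} (θ : Fin N → ℝ) (τ b κ S : ℝ) (a : ℤ) (c : ℕ) (i : Fin N) (x : ℝ) :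
    |etaCell θ τ b κ S a c i x| ≤ 2 := by
  unfold etaCell
  split_ifs
  · exact abs_psi_le _ _ _ _ _
  · simp

lemma integrable_of_abs_le_const {f : ℝ → ℝ} (hf : Continuous f) {C : ℝ} (h : ∀ x, |f x| ≤ C) :
    Integrable f (gaussianReal 0 1) :=
  Integrable.of_bound hf.aestronglyMeasurable C (ae_of_all _ h)

lemma integrable_hat_affine (t τ κ S : ℝ) (c : ℕ) :
    Integrable (fun x => hat κ S c (t + τ * x)) (gaussianReal 0 1) :=
  integrable_of_abs_le_const ((continuous_hat κ S c).comp (by fun_prop)) fun x => by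
    rw [abs_of_nonneg (hat_nonneg _ _ _ _)]; exact hat_le_one _ _ _ _

lemma integral_clipCell_add_etaCell {N : ℕ} (θ : Fin N → ℝ) (τ : ℝ) {b : ℝ} (hb : 0 ≤ b)
    (κ S : ℝ) (a : ℤ) (c : ℕ) (i : Fin N) :
    ∫ x, clipCell θ τ b κ S a c i x ∂(gaussianReal 0 1) +
      ∫ x, etaCell θ τ b κ S a c i x ∂(gaussianReal 0 1) =
    if ⌊θ i / κ⌋ = a then ∫ x, hat κ S c (θ i + τ * x) ∂(gaussianReal 0 1) else 0 := by
  unfold clipCell etaCell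
  split_ifs
  · rw [← integral_add]
    · exact integral_congr_ae (ae_of_all _ fun x => (hat_eq_add_psi κ S hb c _).symm)
    · exact integrable_of_abs_le_const (continuous_hat_clipf c) (C := 1) fun x => by
        rw [abs_of_nonneg (hat_nonneg _ _ _ _)]; exact hat_le_one _ _ _ _
    · exact integrable_of_abs_le_const (continuous_psi_eta hb c) fun x => abs_psi_le _ _ _ _ _
  · simp

lemma integrable_pow_gaussian (k : ℕ) : Integrable (fun x : ℝ => x ^ k) (gaussianReal 0 1) := by
  rcases Nat.eq_zero_or_pos k with rfl | hk
  · simp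
  · have := (memLp_id_gaussianReal (μ := 0) (v := 1) (k : ℝ≥0)).integrable_norm_rpow
      (by simpa using hk.ne') (by simp)
    refine (integrable_norm_iff (by fun_prop)).1 ?_
    simpa using this

/-- The Gaussian cell masses inside a box sum to nearly one. -/
lemma one_sub_sum_cell_le {N K : ℕ} (hN : 0 < N) {κ M τ : ℝ} (hκ : 0 < κ) (hM : 0 < M)
    (θ : Fin N → ℝ) (sB : Finset ℤ) (hcov : ∀ i, |θ i| ≤ M → ⌊θ i / κ⌋ ∈ sB)
    (hK : 2 * M / κ + 1 ≤ K) :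
    1 - (9 * ((N : ℝ)⁻¹ * ∑ i, θ i ^ 4) + 8 * τ ^ 4 * ∫ x, x ^ 4 ∂(gaussianReal 0 1)) / M ^ 4 ≤
    ∑ a ∈ sB, ∑ c ∈ Finset.range K, (N : ℝ)⁻¹ * ∑ i,
      if ⌊θ i / κ⌋ = a then ∫ x, hat κ M c (θ i + τ * x) ∂(gaussianReal 0 1) else 0 := by
  have hN' : (0 : ℝ) < N := by exact_mod_cast hN
  have e1 : ∑ a ∈ sB, ∑ c ∈ Finset.range K, (N : ℝ)⁻¹ * ∑ i,
      (if ⌊θ i / κ⌋ = a then ∫ x, hat κ M c (θ i + τ * x) ∂(gaussianReal 0 1) else 0) =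
      (N : ℝ)⁻¹ * ∑ i, if ⌊θ i / κ⌋ ∈ sB then
        ∫ x, ∑ c ∈ Finset.range K, hat κ M c (θ i + τ * x) ∂(gaussianReal 0 1) else 0 := by
    simp only [← Finset.mul_sum]
    congr 1
    rw [Finset.sum_congr rfl fun a _ => Finset.sum_comm, Finset.sum_comm]
    refine Finset.sum_congr rfl fun i _ => ?_
    rw [integral_finsetSum _ fun c _ => integrable_hat_affine _ _ _ _ _,
      Finset.sum_comm]
    simp only [Finset.sum_ite_eq]
    split_ifs <;> simp
  have e2 : ∀ i, 1 - (9 * θ i ^ 4 + 8 * τ ^ 4 * ∫ x, x ^ 4 ∂(gaussianReal 0 1)) / M ^ 4 ≤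
      if ⌊θ i / κ⌋ ∈ sB then
        ∫ x, ∑ c ∈ Finset.range K, hat κ M c (θ i + τ * x) ∂(gaussianReal 0 1) else 0 := by
    intro i
    have hm4 : 0 ≤ ∫ x, x ^ 4 ∂(gaussianReal 0 1) := integral_nonneg fun x => by positivity
    by_cases hi : |θ i| ≤ M
    · rw [if_pos (hcov i hi)]
      have : ∫ x, (1 - (8 * θ i ^ 4 + 8 * τ ^ 4 * x ^ 4) / M ^ 4) ∂(gaussianReal 0 1) ≤
          ∫ x, ∑ c ∈ Finset.range K, hat κ M c (θ i + τ * x) ∂(gaussianReal 0 1) := by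
        refine integral_mono ?_ (integrable_finsetSum _ fun c _ => integrable_hat_affine _ _ _ _ _)
          fun x => ?_
        · exact (integrable_const _).sub (((integrable_const _).add
            ((integrable_pow_gaussian 4).const_mul _)).div_const _)
        · change _ ≤ ∑ c ∈ Finset.range K, hat κ M c (θ i + τ * x)
          by_cases hx : |θ i + τ * x| ≤ M
          · rw [sum_hat_eq_one hκ hK hx]
            have : 0 ≤ (8 * θ i ^ 4 + 8 * τ ^ 4 * x ^ 4) / M ^ 4 := by positivity
            linarith
          · refine le_trans ?_ (Finset.sum_nonneg fun c _ => hat_nonneg _ _ _ _)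
            have h1 : M ^ 4 ≤ |θ i + τ * x| ^ 4 := pow_le_pow_left₀ hM.le (not_le.1 hx).le 4
            have h2 : |θ i + τ * x| ^ 4 ≤ 8 * θ i ^ 4 + 8 * τ ^ 4 * x ^ 4 := by
              rw [pow_abs, abs_of_nonneg (by positivity), mul_assoc, ← mul_pow]
              generalize θ i = p
              generalize τ * x = q
              have h1 : (p + q) ^ 2 ≤ 2 * p ^ 2 + 2 * q ^ 2 := by nlinarith [sq_nonneg (p - q)]
              have h2 : (p + q) ^ 4 ≤ (2 * p ^ 2 + 2 * q ^ 2) ^ 2 := by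
                rw [show (p + q) ^ 4 = ((p + q) ^ 2) ^ 2 by ring]
                exact pow_le_pow_left₀ (sq_nonneg _) h1 2
              nlinarith [sq_nonneg (p ^ 2 - q ^ 2)]
            have h3 : 1 ≤ (8 * θ i ^ 4 + 8 * τ ^ 4 * x ^ 4) / M ^ 4 := by
              rw [one_le_div (by positivity)]; linarith
            linarith
      refine le_trans ?_ this
      have i1 : Integrable (fun x : ℝ => 8 * τ ^ 4 * x ^ 4) (gaussianReal 0 1) :=
        (integrable_pow_gaussian 4).const_mul _
      have i2 : Integrable (fun x : ℝ => 8 * θ i ^ 4 + 8 * τ ^ 4 * x ^ 4) (gaussianReal 0 1) :=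
        (integrable_const _).add i1
      rw [integral_sub (integrable_const _) (i2.div_const _), integral_div,
        integral_add (integrable_const _) i1, integral_const_mul (8 * τ ^ 4)]
      simp only [integral_const, probReal_univ, smul_eq_mul, one_mul]
      have : 0 ≤ θ i ^ 4 := by positivity
      gcongr
      linarith
    · have h1 : M ^ 4 ≤ |θ i| ^ 4 := pow_le_pow_left₀ hM.le (not_le.1 hi).le 4
      rw [pow_abs, abs_of_nonneg (by positivity)] at h1
      have h3 : 1 ≤ (9 * θ i ^ 4 + 8 * τ ^ 4 * ∫ x, x ^ 4 ∂(gaussianReal 0 1)) / M ^ 4 := by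
        rw [one_le_div (by positivity)]
        have : 0 ≤ 8 * τ ^ 4 * ∫ x, x ^ 4 ∂(gaussianReal 0 1) := by positivity
        have : 0 ≤ θ i ^ 4 := by positivity
        linarith
      have h4 : 0 ≤ if ⌊θ i / κ⌋ ∈ sB then
        ∫ x, ∑ c ∈ Finset.range K, hat κ M c (θ i + τ * x) ∂(gaussianReal 0 1) else 0 := by
        split_ifs
        · exact integral_nonneg fun x => Finset.sum_nonneg fun c _ => hat_nonneg _ _ _ _
        · exact le_rfl
      linarith
  rw [e1]
  have e3 := Finset.sum_le_sum fun i (_ : i ∈ Finset.univ) => e2 i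
  have e4 := mul_le_mul_of_nonneg_left e3 (inv_nonneg.2 hN'.le)
  refine le_trans (le_of_eq ?_) e4
  rw [Finset.sum_sub_distrib, ← Finset.sum_div, Finset.sum_add_distrib, ← Finset.mul_sum]
  simp only [Finset.sum_const, Finset.card_univ, Fintype.card_fin, nsmul_eq_mul]
  field_simp

lemma sum_cell_ite_le {N K : ℕ} (sB : Finset ℤ) (bin : Fin N → ℤ) {e : ℕ → Fin N → ℝ}
    (he : ∀ c i, 0 ≤ e c i) {f : Fin N → ℝ} (hf : ∀ i, ∑ c ∈ Finset.range K, e c i ≤ f i) :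
    ∑ a ∈ sB, ∑ c ∈ Finset.range K, ∑ i, (if bin i = a then e c i else 0) ≤ ∑ i, f i := by
  have e1 : ∑ a ∈ sB, ∑ c ∈ Finset.range K, ∑ i, (if bin i = a then e c i else 0) =
      ∑ i, ∑ c ∈ Finset.range K, ∑ a ∈ sB, (if bin i = a then e c i else 0) := by
    rw [Finset.sum_congr rfl fun a _ => Finset.sum_comm, Finset.sum_comm]
    exact Finset.sum_congr rfl fun i _ => Finset.sum_comm
  rw [e1]
  refine Finset.sum_le_sum fun i _ => le_trans (Finset.sum_le_sum fun c _ => ?_) (hf i)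
  rw [Finset.sum_ite_eq]
  split_ifs
  · exact le_rfl
  · exact he c i

/-- Cell masses of the empirical law of `u + y` overlap with those of the Gaussian mixture. -/
lemma cell_overlap {N K : ℕ} (hN : 0 < N) {κ M τ b t D0 D1 D2 : ℝ} (hκ : 0 < κ) (hM : 0 < M)
    (hb : 0 ≤ b) (θ u y g g' : Fin N → ℝ) (sB : Finset ℤ)
    (hcov : ∀ i, |θ i| ≤ M → ⌊θ i / κ⌋ ∈ sB) (hK : 2 * M / κ + 1 ≤ K)
    (h0 : ∀ i, ∑ c ∈ Finset.range K,
      |hat κ M c (u i + y i) - hat κ M c (u i) - psi κ M b c (y i)| ≤ D0)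
    (h1 : (N : ℝ)⁻¹ * ∑ i, |u i - clipf b (θ i + τ * g' i)| ≤ D1)
    (h2 : (N : ℝ)⁻¹ * ∑ i, |y i - eta (θ i + τ * g i) b| ≤ D2)
    (t1 : ∀ a ∈ sB, ∀ c ∈ Finset.range K, |∑ i, clipCell θ τ b κ M a c i (g' i) -
      ∑ i, ∫ x, clipCell θ τ b κ M a c i x ∂(gaussianReal 0 1)| ≤ t * N)
    (t2 : ∀ a ∈ sB, ∀ c ∈ Finset.range K, |∑ i, etaCell θ τ b κ M a c i (g i) -
      ∑ i, ∫ x, etaCell θ τ b κ M a c i x ∂(gaussianReal 0 1)| ≤ t * N) :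
    1 - ((9 * ((N : ℝ)⁻¹ * ∑ i, θ i ^ 4) +
        8 * τ ^ 4 * ∫ x, x ^ 4 ∂(gaussianReal 0 1)) / M ^ 4 +
        (D0 + 2 / κ * D1 + 4 / κ * D2 + 2 * (sB.card * (K * t)))) ≤
      ∑ a ∈ sB, ∑ c ∈ Finset.range K,
      min ((N : ℝ)⁻¹ * ∑ i, if ⌊θ i / κ⌋ = a then hat κ M c (u i + y i) else 0)
        ((N : ℝ)⁻¹ * ∑ i, if ⌊θ i / κ⌋ = a then
          ∫ z, hat κ M c (θ i + τ * z) ∂(gaussianReal 0 1) else 0) := by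
  have hN' : (0 : ℝ) < N := by exact_mod_cast hN
  set e : ℕ → Fin N → ℝ := fun c i =>
    |hat κ M c (u i + y i) - hat κ M c (u i) - psi κ M b c (y i)| +
    |hat κ M c (u i) - hat κ M c (clipf b (θ i + τ * g' i))| +
    |psi κ M b c (y i) - psi κ M b c (eta (θ i + τ * g i) b)| with he
  have key : ∀ a ∈ sB, ∀ c ∈ Finset.range K,
      (N : ℝ)⁻¹ * ∑ i, (if ⌊θ i / κ⌋ = a then
          ∫ z, hat κ M c (θ i + τ * z) ∂(gaussianReal 0 1) else 0) -
        (N : ℝ)⁻¹ * ∑ i, (if ⌊θ i / κ⌋ = a then e c i else 0) - 2 * t ≤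
      min ((N : ℝ)⁻¹ * ∑ i, if ⌊θ i / κ⌋ = a then hat κ M c (u i + y i) else 0)
        ((N : ℝ)⁻¹ * ∑ i, if ⌊θ i / κ⌋ = a then
          ∫ z, hat κ M c (θ i + τ * z) ∂(gaussianReal 0 1) else 0) := by
    intro a ha c hc
    have s1 := (abs_le.1 (t1 a ha c hc)).1
    have s2 := (abs_le.1 (t2 a ha c hc)).1
    have ht : 0 ≤ t := by
      have := (abs_nonneg _).trans (t1 a ha c hc)
      exact nonneg_of_mul_nonneg_left this hN'
    have s3 : 0 ≤ (N : ℝ)⁻¹ * ∑ i, (if ⌊θ i / κ⌋ = a then e c i else 0) :=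
      mul_nonneg (by positivity) (Finset.sum_nonneg fun i _ => by split_ifs <;> positivity)
    have s4 : ∑ i, (if ⌊θ i / κ⌋ = a then
          ∫ z, hat κ M c (θ i + τ * z) ∂(gaussianReal 0 1) else 0) =
        ∑ i, ∫ x, clipCell θ τ b κ M a c i x ∂(gaussianReal 0 1) +
          ∑ i, ∫ x, etaCell θ τ b κ M a c i x ∂(gaussianReal 0 1) := by
      rw [← Finset.sum_add_distrib]
      exact Finset.sum_congr rfl fun i _ => (integral_clipCell_add_etaCell θ τ hb κ M a c i).symm
    have s5 : ∑ i, clipCell θ τ b κ M a c i (g' i) + ∑ i, etaCell θ τ b κ M a c i (g i) ≤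
        ∑ i, (if ⌊θ i / κ⌋ = a then hat κ M c (u i + y i) else 0) +
          ∑ i, (if ⌊θ i / κ⌋ = a then e c i else 0) := by
      rw [← Finset.sum_add_distrib, ← Finset.sum_add_distrib]
      refine Finset.sum_le_sum fun i _ => ?_
      unfold clipCell etaCell
      split_ifs
      · simp only [he]
        have := neg_abs_le (hat κ M c (u i + y i) - hat κ M c (u i) - psi κ M b c (y i))
        have := neg_abs_le (hat κ M c (u i) - hat κ M c (clipf b (θ i + τ * g' i)))
        have := neg_abs_le (psi κ M b c (y i) - psi κ M b c (eta (θ i + τ * g i) b))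
        linarith
      · simp
    refine le_min ?_ (by linarith)
    rw [s4, ← mul_sub, sub_le_iff_le_add, ← div_eq_inv_mul, ← div_eq_inv_mul,
      div_add' _ _ _ hN'.ne', div_le_div_iff_of_pos_right hN']
    linarith
  have hsum := Finset.sum_le_sum fun a ha => Finset.sum_le_sum fun c hc => key a ha c hc
  refine le_trans ?_ hsum
  simp only [Finset.sum_sub_distrib]
  have p1 := one_sub_sum_cell_le (τ := τ) hN hκ hM θ sB hcov hK
  have p2 : ∑ a ∈ sB, ∑ c ∈ Finset.range K, ∑ i, (if ⌊θ i / κ⌋ = a then e c i else 0) ≤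
      ∑ i, (D0 + 2 / κ * |u i - clipf b (θ i + τ * g' i)| +
        4 / κ * |y i - eta (θ i + τ * g i) b|) := by
    refine sum_cell_ite_le sB _ (fun c i => by positivity) fun i => ?_
    simp only [he, Finset.sum_add_distrib]
    exact add_le_add (add_le_add (h0 i) (sum_abs_hat_sub_le hκ M K _ _))
      (sum_abs_psi_sub_le hκ M b K _ _)
  have p3 : ∑ a ∈ sB, ∑ c ∈ Finset.range K,
      (N : ℝ)⁻¹ * ∑ i, (if ⌊θ i / κ⌋ = a then e c i else 0) ≤
      D0 + 2 / κ * D1 + 4 / κ * D2 := by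
    simp only [← Finset.mul_sum]
    refine (mul_le_mul_of_nonneg_left p2 (by positivity)).trans ?_
    rw [Finset.sum_add_distrib, Finset.sum_add_distrib, ← Finset.mul_sum, ← Finset.mul_sum]
    have q1 := mul_le_mul_of_nonneg_left h1 (show 0 ≤ 2 / κ by positivity)
    have q2 := mul_le_mul_of_nonneg_left h2 (show 0 ≤ 4 / κ by positivity)
    have q3 : (N : ℝ)⁻¹ * ∑ _i : Fin N, D0 = D0 := by
      simp only [Finset.sum_const, Finset.card_univ, Fintype.card_fin, nsmul_eq_mul]
      field_simp
    rw [mul_add, mul_add, q3]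
    linarith
  have p4 : ∑ _a ∈ sB, ∑ _c ∈ Finset.range K, 2 * t = 2 * (sB.card * (K * t)) := by
    simp only [Finset.sum_const, Finset.card_range, nsmul_eq_mul]; ring
  rw [p4]
  linarith

/-- Excess over a level of a square. -/
def sqTail (T x : ℝ) : ℝ := max (x ^ 2 - T) 0

lemma continuous_sqTail (T : ℝ) : Continuous (sqTail T) := by unfold sqTail; fun_prop

lemma sqTail_nonneg (T x : ℝ) : 0 ≤ sqTail T x := le_max_right _ _

lemma abs_sqTail_le {T : ℝ} (hT : 0 ≤ T) (x : ℝ) : |sqTail T x| ≤ 1 + x ^ 2 := by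
  rw [abs_of_nonneg (sqTail_nonneg _ _)]
  exact max_le (by linarith) (by positivity)

lemma integrable_sqTail {T : ℝ} (hT : 0 ≤ T) : Integrable (sqTail T) (gaussianReal 0 1) := by
  refine ((integrable_const 1).add (integrable_pow_gaussian 2)).mono'
    (continuous_sqTail T).aestronglyMeasurable (ae_of_all _ fun x => ?_)
  exact abs_sqTail_le hT x

lemma integral_sqTail_le {T : ℝ} (hT : 0 < T) :
    ∫ x, sqTail T x ∂(gaussianReal 0 1) ≤ (∫ x, x ^ 6 ∂(gaussianReal 0 1)) / T ^ 2 := by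
  rw [← integral_div]
  refine integral_mono (integrable_sqTail hT.le) ((integrable_pow_gaussian 6).div_const _)
    fun x => ?_
  change max (x ^ 2 - T) 0 ≤ x ^ 6 / T ^ 2
  refine max_le ?_ (by positivity)
  rw [le_div_iff₀ (by positivity)]
  rcases le_total (x ^ 2) T with h | h
  · have : (x ^ 2 - T) * T ^ 2 ≤ 0 := mul_nonpos_of_nonpos_of_nonneg (by linarith) (by positivity)
    have : 0 ≤ x ^ 6 := by positivity
    linarith
  · have h1 : T ^ 2 ≤ (x ^ 2) ^ 2 := pow_le_pow_left₀ hT.le h 2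
    have h2 : x ^ 2 * T ^ 2 ≤ x ^ 2 * (x ^ 2) ^ 2 := by gcongr
    have h3 : 0 ≤ T * T ^ 2 := by positivity
    nlinarith

/-- Truncated second moment of the estimation error. -/
lemma tail_bound {N : ℕ} (hN : 0 < N) {τ b b' κ t T' D : ℝ} (hτ : 0 ≤ τ) (hb : 0 ≤ b)
    (hT' : 0 < T')
    (θ u y g : Fin N → ℝ) (hbb : b' ≤ b) (hu : ∀ i, |u i| ≤ b')
    (hD : (N : ℝ)⁻¹ * ∑ i, (y i - eta (θ i + τ * g i) b) ^ 2 ≤ D)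
    (ht : |∑ i, sqTail T' (g i) - ∑ _i : Fin N, ∫ x, sqTail T' x ∂(gaussianReal 0 1)| ≤ t * N) :
    (N : ℝ)⁻¹ * ∑ i, max (3 * (u i + y i - θ i) ^ 2 -
      (36 * b ^ 2 + 9 * τ ^ 2 * T' + 4 * κ ^ 2)) 0 ≤
      9 * D + 9 * τ ^ 2 * (t + (∫ x, x ^ 6 ∂(gaussianReal 0 1)) / T' ^ 2) := by
  have hN' : (0 : ℝ) < N := by exact_mod_cast hN
  have key : ∀ i, max (3 * (u i + y i - θ i) ^ 2 -
      (36 * b ^ 2 + 9 * τ ^ 2 * T' + 4 * κ ^ 2)) 0 ≤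
      9 * (y i - eta (θ i + τ * g i) b) ^ 2 + 9 * τ ^ 2 * sqTail T' (g i) := by
    intro i
    have hs := sqTail_nonneg T' (g i)
    refine max_le ?_ (by positivity)
    have hs' : g i ^ 2 - T' ≤ sqTail T' (g i) := le_max_left _ _
    have hw : |u i + (eta (θ i + τ * g i) b - θ i)| ≤ τ * |g i| + 2 * b := by
      have h1 := abs_ew_le (t := θ i) hτ hb (g i)
      have h2 := hu i
      have h3 := abs_add_le (u i) (ew (θ i) τ b (g i))
      unfold ew at *
      linarith
    have hw2 : (u i + (eta (θ i + τ * g i) b - θ i)) ^ 2 ≤ (τ * |g i| + 2 * b) ^ 2 := by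
      rw [← sq_abs]; gcongr
    set w := u i + (eta (θ i + τ * g i) b - θ i) with hwdef
    set d := y i - eta (θ i + τ * g i) b with hd
    have e : u i + y i - θ i = d + w := by rw [hd, hwdef]; ring
    rw [e]
    have h1 : (d + w) ^ 2 ≤ 3 * d ^ 2 + 3 / 2 * w ^ 2 := by nlinarith [sq_nonneg (2 * d - w)]
    have h2 : (τ * |g i| + 2 * b) ^ 2 ≤ 2 * (τ ^ 2 * g i ^ 2) + 8 * b ^ 2 := by
      rw [← sq_abs (g i)]
      nlinarith [sq_nonneg (τ * |g i| - 2 * b)]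
    have h3 : 9 * τ ^ 2 * (g i ^ 2 - T') ≤ 9 * τ ^ 2 * sqTail T' (g i) := by gcongr
    nlinarith [sq_nonneg κ]
  have h1 := mul_le_mul_of_nonneg_left (Finset.sum_le_sum fun i (_ : i ∈ Finset.univ) => key i)
    (inv_nonneg.2 hN'.le)
  refine h1.trans ?_
  rw [Finset.sum_add_distrib, ← Finset.mul_sum, ← Finset.mul_sum, mul_add]
  have h2 := (abs_le.1 ht).2
  simp only [Finset.sum_const, Finset.card_univ, Fintype.card_fin, nsmul_eq_mul] at h2
  have h3 := integral_sqTail_le hT'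
  have h4 : (N : ℝ)⁻¹ * ∑ i, sqTail T' (g i) ≤
      t + (∫ x, x ^ 6 ∂(gaussianReal 0 1)) / T' ^ 2 := by
    rw [← div_eq_inv_mul, div_le_iff₀ hN']
    nlinarith
  have h5 : 9 * τ ^ 2 * ((N : ℝ)⁻¹ * ∑ i, sqTail T' (g i)) ≤
      9 * τ ^ 2 * (t + (∫ x, x ^ 6 ∂(gaussianReal 0 1)) / T' ^ 2) := by gcongr
  linarith

lemma gaussian_tail_bound {τ b κ T' : ℝ} (hT' : 0 < T') :
    ∫ z, max (3 * τ ^ 2 * z ^ 2 + 4 * κ ^ 2 -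
      (36 * b ^ 2 + 9 * τ ^ 2 * T' + 4 * κ ^ 2)) 0 ∂(gaussianReal 0 1) ≤
    3 * τ ^ 2 * ((∫ x, x ^ 6 ∂(gaussianReal 0 1)) / T' ^ 2) := by
  have h1 : ∫ z, max (3 * τ ^ 2 * z ^ 2 + 4 * κ ^ 2 -
      (36 * b ^ 2 + 9 * τ ^ 2 * T' + 4 * κ ^ 2)) 0 ∂(gaussianReal 0 1) ≤
      ∫ z, 3 * τ ^ 2 * sqTail T' z ∂(gaussianReal 0 1) := by
    refine integral_mono_of_nonneg (ae_of_all _ fun z => le_max_right _ _)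
      ((integrable_sqTail hT'.le).const_mul _) (ae_of_all _ fun z => ?_)
    have hs := sqTail_nonneg T' z
    refine max_le ?_ (by positivity)
    have hs' : z ^ 2 - T' ≤ sqTail T' z := le_max_left _ _
    have : 3 * τ ^ 2 * (z ^ 2 - T') ≤ 3 * τ ^ 2 * sqTail T' z := by gcongr
    nlinarith [sq_nonneg b, mul_nonneg (sq_nonneg τ) hT'.le]
  refine h1.trans ?_
  rw [integral_const_mul]
  have := integral_sqTail_le hT'
  gcongr

/-- A continuous upper approximation of the indicator that the clipped coordinate is saturated. -/
def clipRamp {N : ℕ} (θ : Fin N → ℝ) (τ b r : ℝ) (i : Fin N) (x : ℝ) : ℝ :=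
  ramp ((|clipf b (θ i + τ * x)| - (b - 2 * r)) / r)

/-- A continuous lower approximation of the indicator that the thresholded coordinate is active. -/
def etaRamp {N : ℕ} (θ : Fin N → ℝ) (τ b r : ℝ) (i : Fin N) (x : ℝ) : ℝ :=
  ramp (|eta (θ i + τ * x) b| / r)

lemma continuous_clipRamp {N : ℕ} (θ : Fin N → ℝ) (τ b r : ℝ) (i : Fin N) :
    Continuous (clipRamp θ τ b r i) := by
  have h : Continuous fun x => clipf b (θ i + τ * x) := (continuous_clipf b).comp (by fun_prop)
  exact continuous_ramp.comp ((h.abs.sub continuous_const).div_const r)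

lemma continuous_etaRamp {N : ℕ} (θ : Fin N → ℝ) (τ : ℝ) {b : ℝ} (hb : 0 ≤ b) (r : ℝ)
    (i : Fin N) : Continuous (etaRamp θ τ b r i) := by
  have h : Continuous fun x => eta (θ i + τ * x) b :=
    (continuous_eta hb).comp (show Continuous fun x => θ i + τ * x by fun_prop)
  exact continuous_ramp.comp (h.abs.div_const r)

lemma abs_ramp_le_one (x : ℝ) : |ramp x| ≤ 1 := by
  rw [abs_of_nonneg (ramp_nonneg x)]; exact ramp_le_one x

lemma integral_clipRamp_le {N : ℕ} (θ : Fin N → ℝ) {τ b r : ℝ} (hτ : 0 < τ)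
    (hr : 0 < r) (i : Fin N) :
    ∫ x, clipRamp θ τ b r i x ∂(gaussianReal 0 1) ≤
      ∫ x, eta' (θ i + τ * x) b ∂(gaussianReal 0 1) + 4 * r / τ := by
  have hs := gaussian_strip_le (θ i) (b - 2 * r) hτ (r := 2 * r) (by positivity)
  have i1 : Integrable (fun x => eta' (θ i + τ * x) b) (gaussianReal 0 1) := integrable_eta' _ _ _
  have i2 : Integrable ((strip (θ i) τ (b - 2 * r) (2 * r)).indicator (1 : ℝ → ℝ))
      (gaussianReal 0 1) := (integrable_const 1).indicator (measurableSet_strip _ _ _ _)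
  calc _ ≤ ∫ x, (eta' (θ i + τ * x) b +
        (strip (θ i) τ (b - 2 * r) (2 * r)).indicator (1 : ℝ → ℝ) x) ∂(gaussianReal 0 1) := by
        refine integral_mono (integrable_of_abs_le_const (continuous_clipRamp θ τ b r i)
          fun x => abs_ramp_le_one _) (i1.add i2) fun x => ?_
        change ramp _ ≤ eta' _ _ + Set.indicator _ _ _
        have hind : 0 ≤ (strip (θ i) τ (b - 2 * r) (2 * r)).indicator (1 : ℝ → ℝ) x :=
          Set.indicator_nonneg (fun _ _ => zero_le_one) x
        by_cases h1 : b < |θ i + τ * x|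
        · rw [eta', if_pos h1]
          have := ramp_le_one ((|clipf b (θ i + τ * x)| - (b - 2 * r)) / r)
          linarith
        · rw [eta', if_neg h1, zero_add]
          have h1 := not_lt.1 h1
          by_cases h2 : b - 2 * r ≤ |θ i + τ * x|
          · rw [Set.indicator_of_mem (show x ∈ strip (θ i) τ (b - 2 * r) (2 * r) from
              ⟨h2, by linarith⟩)]
            exact ramp_le_one _
          · refine le_trans (le_of_eq (ramp_of_nonpos ?_)) hind
            refine div_nonpos_of_nonpos_of_nonneg ?_ hr.le
            have : clipf b (θ i + τ * x) = θ i + τ * x := by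
              unfold clipf
              rw [min_eq_right (by linarith [le_abs_self (θ i + τ * x)]),
                max_eq_right (by linarith [neg_abs_le (θ i + τ * x)])]
            rw [this]
            linarith [not_le.1 h2]
    _ = ∫ x, eta' (θ i + τ * x) b ∂(gaussianReal 0 1) +
        (gaussianReal 0 1).real (strip (θ i) τ (b - 2 * r) (2 * r)) := by
      rw [integral_add i1 i2, integral_indicator_one (measurableSet_strip _ _ _ _)]
    _ ≤ _ := by
      have e : 4 * r / τ = 2 * (2 * r) / τ := by ring
      rw [e]; gcongr

lemma le_integral_etaRamp {N : ℕ} (θ : Fin N → ℝ) {τ b r : ℝ} (hτ : 0 < τ) (hb : 0 ≤ b)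
    (hr : 0 < r) (i : Fin N) :
    ∫ x, eta' (θ i + τ * x) b ∂(gaussianReal 0 1) - 2 * r / τ ≤
      ∫ x, etaRamp θ τ b r i x ∂(gaussianReal 0 1) := by
  have hs := gaussian_strip_le (θ i) b hτ hr.le
  have i1 : Integrable (fun x => eta' (θ i + τ * x) b) (gaussianReal 0 1) := integrable_eta' _ _ _
  have i2 : Integrable ((strip (θ i) τ b r).indicator (1 : ℝ → ℝ))
      (gaussianReal 0 1) := (integrable_const 1).indicator (measurableSet_strip _ _ _ _)
  calc _ ≤ ∫ x, eta' (θ i + τ * x) b ∂(gaussianReal 0 1) -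
        (gaussianReal 0 1).real (strip (θ i) τ b r) := by gcongr
    _ = ∫ x, (eta' (θ i + τ * x) b - (strip (θ i) τ b r).indicator (1 : ℝ → ℝ) x)
        ∂(gaussianReal 0 1) := by
      rw [integral_sub i1 i2, integral_indicator_one (measurableSet_strip _ _ _ _)]
    _ ≤ _ := by
        refine integral_mono (i1.sub i2) (integrable_of_abs_le_const
          (continuous_etaRamp θ τ hb r i) fun x => abs_ramp_le_one _) fun x => ?_
        change eta' _ _ - Set.indicator _ _ _ ≤ ramp _
        have hind : 0 ≤ (strip (θ i) τ b r).indicator (1 : ℝ → ℝ) x :=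
          Set.indicator_nonneg (fun _ _ => zero_le_one) x
        have h0 := ramp_nonneg (|eta (θ i + τ * x) b| / r)
        by_cases h1 : b < |θ i + τ * x|
        · rw [eta', if_pos h1]
          by_cases h2 : |θ i + τ * x| ≤ b + r
          · rw [Set.indicator_of_mem (show x ∈ strip (θ i) τ b r from ⟨h1.le, h2⟩)]
            simpa using h0
          · rw [ramp_of_one_le]
            · linarith
            · rw [one_le_div hr, abs_eta hb]
              refine le_max_of_le_left ?_
              linarith [not_le.1 h2]
        · rw [eta', if_neg h1]
          linarith

/-- The sparsity of a near-solution agrees with its state-evolution prediction. -/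
lemma abs_l0_sub_le {N : ℕ} (hN : 0 < N) {τ b b' r t D1 D2 : ℝ} (hτ : 0 < τ) (hb : 0 ≤ b)
    (hr : 0 < r) (θ u y g g' : Fin N → ℝ) (hbb : b - b' ≤ r) (hb' : 0 ≤ b')
    (hu : ∀ i, u i * y i = b' * |y i|)
    (h1 : (N : ℝ)⁻¹ * ∑ i, |u i - clipf b (θ i + τ * g' i)| ≤ D1)
    (h2 : (N : ℝ)⁻¹ * ∑ i, |y i - eta (θ i + τ * g i) b| ≤ D2)
    (t1 : |∑ i, clipRamp θ τ b r i (g' i) -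
      ∑ i, ∫ x, clipRamp θ τ b r i x ∂(gaussianReal 0 1)| ≤ t * N)
    (t2 : |∑ i, etaRamp θ τ b r i (g i) -
      ∑ i, ∫ x, etaRamp θ τ b r i x ∂(gaussianReal 0 1)| ≤ t * N) :
    |(l0 y : ℝ) - ∑ i, ∫ x, eta' (θ i + τ * x) b ∂(gaussianReal 0 1)| ≤
      N * (4 * r / τ + t + (D1 + D2) / r) := by
  have hN' : (0 : ℝ) < N := by exact_mod_cast hN
  have el : (l0 y : ℝ) = ∑ i, if y i ≠ 0 then (1 : ℝ) else 0 := by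
    rw [Finset.sum_boole]; rfl
  have h1' : ∑ i, |u i - clipf b (θ i + τ * g' i)| ≤ N * D1 := by
    rwa [← div_eq_inv_mul, div_le_iff₀ hN', mul_comm] at h1
  have h2' : ∑ i, |y i - eta (θ i + τ * g i) b| ≤ N * D2 := by
    rwa [← div_eq_inv_mul, div_le_iff₀ hN', mul_comm] at h2
  have hD1 : 0 ≤ D1 := le_trans (by positivity) h1
  have hD2 : 0 ≤ D2 := le_trans (by positivity) h2
  have up : ∑ i, (if y i ≠ 0 then (1 : ℝ) else 0) ≤
      ∑ i, clipRamp θ τ b r i (g' i) + (∑ i, |u i - clipf b (θ i + τ * g' i)|) / r := by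
    rw [Finset.sum_div, ← Finset.sum_add_distrib]
    refine Finset.sum_le_sum fun i _ => ?_
    have h0 := ramp_nonneg ((|clipf b (θ i + τ * g' i)| - (b - 2 * r)) / r)
    have h3 : 0 ≤ |u i - clipf b (θ i + τ * g' i)| / r := by positivity
    split_ifs with hy
    · have hu' : |u i| = b' := by
        have := congrArg abs (hu i)
        rw [abs_mul, abs_mul, abs_abs, abs_of_nonneg hb'] at this
        exact mul_right_cancel₀ (abs_pos.2 hy).ne' this
      have e1 : ramp ((|u i| - (b - 2 * r)) / r) = 1 := by
        refine ramp_of_one_le ?_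
        rw [one_le_div hr, hu']; linarith
      have e2 := abs_ramp_sub_le ((|u i| - (b - 2 * r)) / r)
        ((|clipf b (θ i + τ * g' i)| - (b - 2 * r)) / r)
      rw [← sub_div, sub_sub_sub_cancel_right, abs_div, abs_of_pos hr] at e2
      have e3 := abs_abs_sub_abs_le (u i) (clipf b (θ i + τ * g' i))
      have e4 : |(|u i| - |clipf b (θ i + τ * g' i)|)| / r ≤
        |u i - clipf b (θ i + τ * g' i)| / r := by gcongr
      have e5 := le_abs_self (ramp ((|u i| - (b - 2 * r)) / r) -
        ramp ((|clipf b (θ i + τ * g' i)| - (b - 2 * r)) / r))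
      unfold clipRamp
      linarith
    · exact add_nonneg h0 h3
  have lo : ∑ i, etaRamp θ τ b r i (g i) - (∑ i, |y i - eta (θ i + τ * g i) b|) / r ≤
      ∑ i, (if y i ≠ 0 then (1 : ℝ) else 0) := by
    rw [Finset.sum_div, ← Finset.sum_sub_distrib]
    refine Finset.sum_le_sum fun i _ => ?_
    have e2 := abs_ramp_sub_le (|y i| / r) (|eta (θ i + τ * g i) b| / r)
    rw [← sub_div, abs_div, abs_of_pos hr] at e2
    have e3 := abs_abs_sub_abs_le (y i) (eta (θ i + τ * g i) b)
    have e4 : |(|y i| - |eta (θ i + τ * g i) b|)| / r ≤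
      |y i - eta (θ i + τ * g i) b| / r := by gcongr
    have e5 := neg_abs_le (ramp (|y i| / r) - ramp (|eta (θ i + τ * g i) b| / r))
    have e6 : ramp (|y i| / r) ≤ if y i ≠ 0 then (1 : ℝ) else 0 := by
      split_ifs with hy
      · exact ramp_le_one _
      · rw [not_not.1 hy]; exact (ramp_of_nonpos (by simp)).le
    unfold etaRamp
    linarith
  have s1 := Finset.sum_le_sum fun i (_ : i ∈ Finset.univ) =>
    integral_clipRamp_le θ (b := b) hτ hr i
  have s2 := Finset.sum_le_sum fun i (_ : i ∈ Finset.univ) => le_integral_etaRamp θ hτ hb hr i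
  simp only [Finset.sum_add_distrib, Finset.sum_sub_distrib, Finset.sum_const, Finset.card_univ,
    Fintype.card_fin, nsmul_eq_mul] at s1 s2
  have t1' := (abs_le.1 t1).2
  have t2' := (abs_le.1 t2).1
  have d1 : (∑ i, |u i - clipf b (θ i + τ * g' i)|) / r ≤ N * D1 / r := by gcongr
  have d2 : (∑ i, |y i - eta (θ i + τ * g i) b|) / r ≤ N * D2 / r := by gcongr
  have ee : (N : ℝ) * (4 * r / τ + t + (D1 + D2) / r) =
      N * (4 * r / τ) + t * N + (N * D1 / r + N * D2 / r) := by ring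
  have ef : (N : ℝ) * (2 * r / τ) ≤ N * (4 * r / τ) := by gcongr; norm_num
  have p1 : 0 ≤ N * D1 / r := by positivity
  have p2 : 0 ≤ N * D2 / r := by positivity
  rw [el, ee, abs_le]
  constructor <;> linarith

/-- Indices of the bins of width `s` meeting `[-1/s, 1/s]`. -/
def binSet (s : ℝ) : Finset ℤ := Finset.Icc ⌊-(1 / s ^ 2)⌋ ⌊1 / s ^ 2⌋

/-- Number of cells of width `s` needed to cover `[-1/s, 1/s]`. -/
def cellNum (s : ℝ) : ℕ := ⌈2 / s ^ 2⌉₊ + 1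

lemma floor_mem_binSet {s t : ℝ} (hs : 0 < s) (ht : |t| ≤ 1 / s) : ⌊t / s⌋ ∈ binSet s := by
  have h := abs_le.1 ht
  have e : 1 / s ^ 2 = 1 / s / s := by field_simp
  refine Finset.mem_Icc.2 ⟨Int.floor_mono ?_, Int.floor_mono ?_⟩
  · rw [e, ← neg_div]; gcongr; exact h.1
  · rw [e]; gcongr; exact h.2

lemma card_binSet_le {s : ℝ} (hs : 0 < s) (hs1 : s ≤ 1) : ((binSet s).card : ℝ) ≤ 4 / s ^ 2 := by
  have h1 : 1 ≤ 1 / s ^ 2 := by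
    rw [le_div_iff₀ (by positivity), one_mul]; exact pow_le_one₀ hs.le hs1
  unfold binSet
  rw [Int.card_Icc]
  have h2 : (⌊-(1 / s ^ 2)⌋ : ℝ) > -(1 / s ^ 2) - 1 := Int.sub_one_lt_floor _
  have h3 : (⌊1 / s ^ 2⌋ : ℝ) ≤ 1 / s ^ 2 := Int.floor_le _
  have h4 : ⌊-(1 / s ^ 2)⌋ ≤ ⌊1 / s ^ 2⌋ := Int.floor_mono (by linarith)
  have h5 : (((⌊1 / s ^ 2⌋ + 1 - ⌊-(1 / s ^ 2)⌋).toNat : ℕ) : ℝ) =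
      ((⌊1 / s ^ 2⌋ + 1 - ⌊-(1 / s ^ 2)⌋ : ℤ) : ℝ) := by
    rw [← Int.cast_natCast, Int.toNat_of_nonneg (by omega)]
  rw [h5]
  push_cast
  have : 4 / s ^ 2 = 4 * (1 / s ^ 2) := by ring
  rw [this]; linarith

lemma cellNum_ge (s : ℝ) : 2 / s ^ 2 + 1 ≤ cellNum s := by
  unfold cellNum
  push_cast
  linarith [Nat.le_ceil (2 / s ^ 2)]

lemma cellNum_le {s : ℝ} (hs : 0 < s) (hs1 : s ≤ 1) : (cellNum s : ℝ) ≤ 4 / s ^ 2 := by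
  have h1 : 1 ≤ 1 / s ^ 2 := by
    rw [le_div_iff₀ (by positivity), one_mul]; exact pow_le_one₀ hs.le hs1
  unfold cellNum
  push_cast
  have h2 := (Nat.ceil_lt_add_one (show 0 ≤ 2 / s ^ 2 by positivity)).le
  have e1 : 4 / s ^ 2 = 4 * (1 / s ^ 2) := by ring
  have e2 : 2 / s ^ 2 = 2 * (1 / s ^ 2) := by ring
  rw [e2] at h2 ⊢
  rw [e1]; linarith

/-- Index set of all the test functions used at scale `s`. -/
abbrev TestIdx (s : ℝ) : Type := Fin 3 ⊕ (Fin 3 ⊕ (Bool × ↥(binSet s) × Fin (cellNum s)))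

/-- All the test functions used at scale `s`. -/
def allTest {N : ℕ} (θ : Fin N → ℝ) (τ b s : ℝ) : TestIdx s → Fin N → ℝ → ℝ :=
  Sum.elim (baseTest θ τ b) (Sum.elim
    ![fun _ => sqTail (1 / s), clipRamp θ τ b s, etaRamp θ τ b s]
    fun p => if p.1 then clipCell θ τ b s (1 / s) p.2.1 p.2.2
      else etaCell θ τ b s (1 / s) p.2.1 p.2.2)

lemma card_testIdx_le {s : ℝ} (hs : 0 < s) (hs1 : s ≤ 1) :
    (1 + Fintype.card (TestIdx s) : ℝ) ≤ 39 / s ^ 4 := by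
  have h1 : 1 ≤ 1 / s ^ 4 := by
    rw [le_div_iff₀ (by positivity), one_mul]; exact pow_le_one₀ hs.le hs1
  simp only [Fintype.card_sum, Fintype.card_prod, Fintype.card_fin, Fintype.card_bool,
    Fintype.card_coe]
  push_cast
  have h2 : ((binSet s).card : ℝ) * cellNum s ≤ 4 / s ^ 2 * (4 / s ^ 2) :=
    mul_le_mul (card_binSet_le hs hs1) (cellNum_le hs hs1) (by positivity) (by positivity)
  have e : 4 / s ^ 2 * (4 / s ^ 2) = 16 * (1 / s ^ 4) := by field_simp; norm_num
  have e2 : 39 / s ^ 4 = 39 * (1 / s ^ 4) := by ring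
  rw [e2]; linarith

lemma measurable_allTest {N : ℕ} (θ : Fin N → ℝ) (τ : ℝ) {b : ℝ} (hb : 0 ≤ b) (s : ℝ)
    (a : TestIdx s) (i : Fin N) : Measurable (allTest θ τ b s a i) := by
  rcases a with a | a | ⟨a, c, k⟩
  · exact measurable_baseTest θ τ hb a i
  · fin_cases a
    · exact (continuous_sqTail _).measurable
    · exact (continuous_clipRamp θ τ b s i).measurable
    · exact (continuous_etaRamp θ τ hb s i).measurable
  · cases a
    · exact measurable_etaCell θ τ hb s (1 / s) c k i
    · exact measurable_clipCell θ τ b s (1 / s) c k i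

lemma abs_allTest_le {N : ℕ} (θ : Fin N → ℝ) {τ b s A : ℝ} (hτ : 0 ≤ τ) (hb : 0 ≤ b) (hs : 0 < s)
    (hA : 2 * τ ^ 2 + 2 * b ^ 2 + 2 * τ + b ≤ A) (hA2 : 2 ≤ A)
    (a : TestIdx s) (i : Fin N) (x : ℝ) : |allTest θ τ b s a i x| ≤ A * (1 + x ^ 2) := by
  have h0 : 0 ≤ x ^ 2 := sq_nonneg x
  have key : ∀ v : ℝ, |v| ≤ 2 → |v| ≤ A * (1 + x ^ 2) := fun v hv => by nlinarith
  rcases a with a | a | ⟨a, c, k⟩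
  · exact abs_baseTest_le θ hτ hb hA a i x
  · fin_cases a
    · have := abs_sqTail_le (T := 1 / s) (by positivity) x
      change |sqTail (1 / s) x| ≤ _
      nlinarith
    · exact key _ ((abs_ramp_le_one _).trans (by norm_num))
    · exact key _ ((abs_ramp_le_one _).trans (by norm_num))
  · cases a
    · exact key _ (abs_etaCell_le θ τ b s (1 / s) c k i x)
    · exact key _ ((abs_clipCell_le θ τ b s (1 / s) c k i x).trans (by norm_num))

lemma typ_mono {N : ℕ} {ι : Type} {F : ι → Fin N → ℝ → ℝ} {t t' : ℝ} (h : t ≤ t') :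
    typ F t ⊆ typ F t' := fun g hg a => (hg a).trans (by gcongr)

lemma typ_allTest_base {N : ℕ} {θ : Fin N → ℝ} {τ b s t : ℝ} {g : Fin N → ℝ}
    (h : g ∈ typ (allTest θ τ b s) t) : g ∈ typ (baseTest θ τ b) t := fun a => h (Sum.inl a)

lemma mean_abs_le {N n : ℕ} {δ e : ℝ} (hN : 0 < N) (hδ : 0 < δ) (hn : (n : ℝ) = δ * N)
    (v : Fin N → ℝ) (h : l2 v ≤ e * √n) : (N : ℝ)⁻¹ * ∑ i, |v i| ≤ e * √δ := by
  have hN' : (0 : ℝ) < N := by exact_mod_cast hN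
  have h1 : ∑ i, |v i| ≤ √N * l2 v := by
    have := sum_mul_le_l2 (fun _ : Fin N => (1 : ℝ)) (fun i => |v i|)
    have e1 : l2 (fun _ : Fin N => (1 : ℝ)) = √N := by simp [l2]
    have e2 : l2 (fun i => |v i|) = l2 v := by simp [l2]
    rw [e1, e2] at this
    simpa using this
  rw [inv_mul_le_iff₀ hN']
  calc ∑ i, |v i| ≤ √N * (e * √n) := h1.trans (by gcongr)
    _ = √N * √N * (e * √δ) := by rw [hn, Real.sqrt_mul hδ.le]; ring
    _ = _ := by rw [Real.mul_self_sqrt hN'.le]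

lemma mean_sq_le {N n : ℕ} {δ e : ℝ} (hN : 0 < N) (hn : (n : ℝ) = δ * N)
    (v : Fin N → ℝ) (h : l2 v ≤ e * √n) : (N : ℝ)⁻¹ * ∑ i, v i ^ 2 ≤ e ^ 2 * δ := by
  have hN' : (0 : ℝ) < N := by exact_mod_cast hN
  have hn0 : (0 : ℝ) ≤ n := Nat.cast_nonneg n
  rw [inv_mul_le_iff₀ hN', ← l2_sq]
  calc l2 v ^ 2 ≤ (e * √n) ^ 2 := pow_le_pow_left₀ (l2_nonneg v) h 2
    _ = N * (e ^ 2 * δ) := by rw [mul_pow, Real.sq_sqrt hn0, hn]; ring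

lemma abs_inv_sub_le {q p P e : ℝ} (hP : 0 < P) (hp : 1 / P ≤ p) (hq : |q - p| ≤ e)
    (he : e ≤ 1 / (2 * P)) : |1 / q - 1 / p| ≤ 2 * P ^ 2 * e := by
  have hp0 : 0 < p := lt_of_lt_of_le (by positivity) hp
  have h1 := (abs_le.1 hq).1
  have e1 : 1 / (2 * P) = 1 / P / 2 := by field_simp
  have h2 : 1 / (2 * P) ≤ q := by rw [e1] at he ⊢; linarith
  have hq0 : 0 < q := lt_of_lt_of_le (by positivity) h2
  have e2 : 1 / q - 1 / p = -(q - p) * (1 / q * (1 / p)) := by field_simp; ring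
  have h3 : 1 / q ≤ 2 * P := by
    rw [div_le_iff₀ hq0]; rw [div_le_iff₀ (by positivity)] at h2; linarith
  have h4 : 1 / p ≤ P := by
    rw [div_le_iff₀ hp0]; rw [div_le_iff₀ hP] at hp; linarith
  rw [e2, abs_mul, abs_neg, abs_of_pos (show 0 < 1 / q * (1 / p) by positivity)]
  calc |q - p| * (1 / q * (1 / p)) ≤ e * (2 * P * P) := by gcongr; exact (abs_nonneg _).trans hq
    _ = _ := by ring

/-- Deterministic consequence of typicality: the overlap of the cell masses. -/
lemma overlap_scale {N : ℕ} (hN : 0 < N) {δ τ b b' ρ s P H Q : ℝ}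
    (hτ : 0 < τ) (hτH : τ ≤ H) (hb : 0 ≤ b) (hρ : 0 ≤ ρ)
    (hρP : ρ ≤ P) (hs : 0 < s) (hs1 : s ≤ 1) (θ u y g g' : Fin N → ℝ)
    (hQ : (N : ℝ)⁻¹ * ∑ i, θ i ^ 4 ≤ Q) (hu : ∀ i, u i * y i = b' * |y i|)
    (hbb : b' ≤ b) (hbb2 : b - b' ≤ ρ * s ^ 8)
    (h1 : (N : ℝ)⁻¹ * ∑ i, |u i - clipf b (θ i + τ * g' i)| ≤ ρ * (s ^ 4 * √δ))
    (h2 : (N : ℝ)⁻¹ * ∑ i, |y i - eta (θ i + τ * g i) b| ≤ s ^ 4 * √δ)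
    (hg : g ∈ typ (allTest θ τ b s) (s ^ 8)) (hg' : g' ∈ typ (allTest θ τ b s) (s ^ 8)) :
    1 - (9 * Q + 8 * H ^ 4 * (∫ x, x ^ 4 ∂(gaussianReal 0 1)) + 4 * P + 2 * P * √δ + 4 * √δ + 32)
        * s ^ 3 ≤
      ∑ a ∈ binSet s, ∑ c ∈ Finset.range (cellNum s),
      min ((N : ℝ)⁻¹ * ∑ i, if ⌊θ i / s⌋ = a then hat s (1 / s) c (u i + y i) else 0)
        ((N : ℝ)⁻¹ * ∑ i, if ⌊θ i / s⌋ = a then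
          ∫ z, hat s (1 / s) c (θ i + τ * z) ∂(gaussianReal 0 1) else 0) := by
  have hP : 0 ≤ P := hρ.trans hρP
  have hK : 2 * (1 / s) / s + 1 ≤ cellNum s := by
    have e : 2 * (1 / s) / s = 2 / s ^ 2 := by field_simp
    rw [e]; exact cellNum_ge s
  have h := cell_overlap (K := cellNum s) hN (κ := s) (M := 1 / s) (t := s ^ 8)
    (D0 := 4 / s * (ρ * s ^ 8)) hs (by positivity) hb θ u y g g' (binSet s)
    (fun i hi => floor_mem_binSet hs hi) hK
    (fun i => (sum_abs_hat_add_sub_le hs (1 / s) (cellNum s) (hu i)).trans (by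
      rw [abs_of_nonneg (by linarith)]; gcongr)) h1 h2
    (fun a ha c hc => hg' (Sum.inr (Sum.inr (true, ⟨a, ha⟩, ⟨c, Finset.mem_range.1 hc⟩))))
    (fun a ha c hc => hg (Sum.inr (Sum.inr (false, ⟨a, ha⟩, ⟨c, Finset.mem_range.1 hc⟩))))
  refine le_trans ?_ h
  have hI : 0 ≤ ∫ x : ℝ, x ^ 4 ∂(gaussianReal 0 1) := integral_nonneg fun x => by positivity
  generalize (∫ x : ℝ, x ^ 4 ∂(gaussianReal 0 1)) = I at hI ⊢
  have hd := Real.sqrt_nonneg δ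
  generalize √δ = d at hd ⊢
  have q0 : 0 ≤ (N : ℝ)⁻¹ * ∑ i, θ i ^ 4 := mul_nonneg (by positivity)
    (Finset.sum_nonneg fun i _ => by positivity)
  have e1 : (9 * ((N : ℝ)⁻¹ * ∑ i, θ i ^ 4) + 8 * τ ^ 4 * I) / (1 / s) ^ 4 ≤
      (9 * Q + 8 * H ^ 4 * I) * s ^ 3 := by
    rw [one_div, inv_pow, div_inv_eq_mul]
    have hQ0 := q0.trans hQ
    have hH := hτ.le.trans hτH
    refine mul_le_mul (by gcongr) (pow_le_pow_of_le_one hs.le hs1 (by norm_num)) (by positivity)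
      (by positivity)
  have e2 : 4 / s * (ρ * s ^ 8) ≤ 4 * P * s ^ 3 := by
    have : 4 / s * (ρ * s ^ 8) = 4 * ρ * s ^ 7 := by field_simp
    rw [this]
    gcongr 4 * ?_ * ?_
    exact pow_le_pow_of_le_one hs.le hs1 (by norm_num)
  have e3 : 2 / s * (ρ * (s ^ 4 * d)) ≤ 2 * P * d * s ^ 3 := by
    have : 2 / s * (ρ * (s ^ 4 * d)) = 2 * ρ * d * s ^ 3 := by field_simp
    rw [this]; gcongr
  have e4 : 4 / s * (s ^ 4 * d) = 4 * d * s ^ 3 := by field_simp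
  have e5 : 2 * (((binSet s).card : ℝ) * (cellNum s * s ^ 8)) ≤ 32 * s ^ 3 := by
    calc _ ≤ 2 * (4 / s ^ 2 * (4 / s ^ 2 * s ^ 8)) := by
          gcongr
          · exact card_binSet_le hs hs1
          · exact cellNum_le hs hs1
      _ = 32 * s ^ 4 := by field_simp; norm_num
      _ ≤ 32 * s ^ 3 := by
          gcongr 32 * ?_; exact pow_le_pow_of_le_one hs.le hs1 (by norm_num)
  rw [e4]
  linarith

/-- Deterministic consequence of typicality: the fraction of active coordinates. -/
lemma l0_scale {N n : ℕ} (hN : 0 < N) {δ τ β b b' ρ s P : ℝ} (hδ : 0 < δ)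
    (hn : (n : ℝ) = δ * N)
    (hτ : 0 < τ) (hτP : 1 / τ ≤ P) (hβP : 1 / P ≤ β / τ) (hb : 0 ≤ b) (hb' : 0 ≤ b') (hρ : 0 ≤ ρ)
    (hρP : ρ ≤ P) (hs : 0 < s) (hs1 : s ≤ 1) (hP1 : 1 ≤ P) (hsP : P * s ≤ 1)
    (hsC : (4 * P + 1 + P * √δ + √δ) / δ * s ≤ 1 / (2 * P))
    (θ u y g g' : Fin N → ℝ) (hu : ∀ i, u i * y i = b' * |y i|)
    (hbb2 : b - b' ≤ ρ * s ^ 8)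
    (hm : ∑ i, ∫ x, eta' (θ i + τ * x) b ∂(gaussianReal 0 1) = n * (1 - β / τ))
    (h1 : (N : ℝ)⁻¹ * ∑ i, |u i - clipf b (θ i + τ * g' i)| ≤ ρ * (s ^ 4 * √δ))
    (h2 : (N : ℝ)⁻¹ * ∑ i, |y i - eta (θ i + τ * g i) b| ≤ s ^ 4 * √δ)
    (hg : g ∈ typ (allTest θ τ b s) (s ^ 8)) (hg' : g' ∈ typ (allTest θ τ b s) (s ^ 8)) :
    |1 / (1 - (l0 y : ℝ) / n) - 1 / (β / τ)| ≤
      2 * P ^ 2 * ((4 * P + 1 + P * √δ + √δ) / δ * s) := by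
  have hN' : (0 : ℝ) < N := by exact_mod_cast hN
  have hn' : (0 : ℝ) < n := by rw [hn]; positivity
  have hs8 : s ^ 8 ≤ s ^ 2 := pow_le_pow_of_le_one hs.le hs1 (by norm_num)
  have hs81 : s ^ 8 ≤ s := by simpa using pow_le_pow_of_le_one hs.le hs1 (show 1 ≤ 8 by norm_num)
  have h := abs_l0_sub_le hN (r := s) (t := s ^ 8) hτ hb hs θ u y g g' (by
      calc b - b' ≤ P * s ^ 2 := hbb2.trans (by gcongr)
        _ = P * s * s := by ring
        _ ≤ 1 * s := by gcongr
        _ = s := one_mul s) hb' hu h1 h2 (hg' (Sum.inr (Sum.inl 1))) (hg (Sum.inr (Sum.inl 2)))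
  rw [hm] at h
  refine abs_inv_sub_le (by linarith) hβP ?_ hsC
  have e : 1 - (l0 y : ℝ) / n - β / τ = -(((l0 y : ℝ) - n * (1 - β / τ)) / n) := by
    field_simp; ring
  rw [e, abs_neg, abs_div, abs_of_pos hn', div_le_iff₀ hn']
  refine h.trans ?_
  have hd := Real.sqrt_nonneg δ
  have e2 : (4 * P + 1 + P * √δ + √δ) / δ * s * n =
      N * ((4 * P + 1 + P * √δ + √δ) * s) := by rw [hn]; field_simp
  rw [e2]
  gcongr
  generalize √δ = d at hd ⊢
  have e3 : 4 * s / τ ≤ 4 * P * s := by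
    calc 4 * s / τ = 4 * s * (1 / τ) := by ring
      _ ≤ 4 * s * P := by gcongr
      _ = _ := by ring
  have e4 : (ρ * (s ^ 4 * d) + s ^ 4 * d) / s ≤ (P * d + d) * s := by
    calc (ρ * (s ^ 4 * d) + s ^ 4 * d) / s = (ρ * d + d) * s ^ 3 := by field_simp
      _ ≤ (P * d + d) * s := by
          gcongr
          simpa using pow_le_pow_of_le_one hs.le hs1 (show 1 ≤ 3 by norm_num)
  linarith

set_option maxHeartbeats 1000000 in
/-- Deterministic consequence of typicality: control of the Wasserstein distance. -/
lemma W2sq_scale {N n : ℕ} (hN : 0 < N) {δ τ β τ' lam l s P H Q : ℝ} (hδ : 0 < δ)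
    (hn : (n : ℝ) = δ * N) (hτ : 0 < τ) (hβ : 0 < β) (hτH : τ ≤ H) (hlH : lam ≤ H) (hl : 0 ≤ l)
    (hτP : 1 / τ ≤ P) (hβP : τ / β ≤ P) (hP1 : 1 ≤ P) (hs : 0 < s) (hs1 : s ≤ 1) (hsP : P * s ≤ 1)
    (hsC : (4 * P + 1 + P * √δ + √δ) / δ * s ≤ 1 / (2 * P))
    (θ y ν g g' : Fin N → ℝ) (hQ : (N : ℝ)⁻¹ * ∑ i, θ i ^ 4 ≤ Q)
    (hll : l ≤ lam) (hll2 : lam ≤ l + s ^ 8)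
    (hν : ∀ i, |ν i| ≤ l ∧ ν i * y i = l * |y i|)
    (hm : ∑ i, ∫ x, eta' (θ i + τ * x) (τ * lam / β) ∂(gaussianReal 0 1) = n * (1 - β / τ))
    (h1 : l2 (ν - nv θ τ (τ * lam / β) β g') ≤ s ^ 4 * √n)
    (h2 : l2 (y - θ - wv θ τ (τ * lam / β) g) ≤ s ^ 4 * √n)
    (hg : g ∈ typ (allTest θ τ (τ * lam / β) s) (s ^ 8))
    (hg' : g' ∈ typ (allTest θ τ (τ * lam / β) s) (s ^ 8)) :
    W2sq (empDist2 (fun i => y i + ν i / (1 - (l0 y : ℝ) / n)) θ) (muStarD (empDist θ) τ') ≤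
      (3 * (5 + 2 * (36 * P ^ 2 * H ^ 2 + 9 * H ^ 2 + 4) *
        (9 * Q + 8 * H ^ 4 * (∫ x, x ^ 4 ∂(gaussianReal 0 1)) + 4 * P + 2 * P * √δ + 4 * √δ + 32) +
        (9 * δ + 9 * H ^ 2 * (1 + ∫ x, x ^ 6 ∂(gaussianReal 0 1))) +
        3 * H ^ 2 * ∫ x, x ^ 6 ∂(gaussianReal 0 1)) +
      3 * (H * (2 * P ^ 2 * ((4 * P + 1 + P * √δ + √δ) / δ))) ^ 2) * s ^ 2 +
      3 * (τ' - τ) ^ 2 := by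
  have hlam : 0 ≤ lam := hl.trans hll
  set b := τ * lam / β with hbdef
  set ρ := τ / β with hρdef
  have hρ : 0 < ρ := by positivity
  have hb : 0 ≤ b := by positivity
  have hbρ : b = ρ * lam := by rw [hbdef, hρdef]; ring
  have hbH : b ≤ P * H := by rw [hbρ]; gcongr
  have hN' : (0 : ℝ) < N := by exact_mod_cast hN
  set u : Fin N → ℝ := fun i => ρ * ν i with hudef
  have hu : ∀ i, u i * y i = ρ * l * |y i| := fun i => by
    rw [hudef, mul_assoc ρ l, ← (hν i).2]; ring
  have hub : ∀ i, |u i| ≤ ρ * l := fun i => by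
    rw [hudef, abs_mul, abs_of_pos hρ]; gcongr; exact (hν i).1
  have hbb : ρ * l ≤ b := by rw [hbρ]; gcongr
  have hbb2 : b - ρ * l ≤ ρ * s ^ 8 := by
    rw [hbρ, ← mul_sub]; gcongr; linarith
  have d1 : (N : ℝ)⁻¹ * ∑ i, |u i - clipf b (θ i + τ * g' i)| ≤ ρ * (s ^ 4 * √δ) := by
    have h := mean_abs_le hN hδ hn _ h1
    have e : ∀ i, |u i - clipf b (θ i + τ * g' i)| = ρ * |(ν - nv θ τ b β g') i| := fun i => by
      rw [show ρ * |(ν - nv θ τ b β g') i| = |ρ * (ν - nv θ τ b β g') i| by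
        rw [abs_mul, abs_of_pos hρ]]
      congr 1
      simp only [hudef, Pi.sub_apply, nv, hρdef]
      field_simp
    simp only [e]
    rw [← Finset.mul_sum]
    calc _ = ρ * ((N : ℝ)⁻¹ * ∑ i, |(ν - nv θ τ b β g') i|) := by ring
      _ ≤ _ := by gcongr
  have ey : ∀ i, (y - θ - wv θ τ b g) i = y i - eta (θ i + τ * g i) b := fun i => by
    simp only [Pi.sub_apply, wv]; ring
  have d2 : (N : ℝ)⁻¹ * ∑ i, |y i - eta (θ i + τ * g i) b| ≤ s ^ 4 * √δ := by
    have h := mean_abs_le hN hδ hn _ h2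
    simpa only [ey] using h
  have d3 : (N : ℝ)⁻¹ * ∑ i, (y i - eta (θ i + τ * g i) b) ^ 2 ≤ (s ^ 4) ^ 2 * δ := by
    have h := mean_sq_le hN hn _ h2
    simpa only [ey] using h
  have hR := overlap_scale hN hτ hτH hb hρ.le hβP hs hs1 θ u y g g' hQ hu hbb hbb2 d1 d2 hg hg'
  have hL := l0_scale hN hδ hn hτ hτP (by
      rw [div_le_div_iff₀ (by linarith) hτ]; rw [hρdef, div_le_iff₀ hβ] at hβP; linarith) hb
    (mul_nonneg hρ.le hl) hρ.le hβP hs hs1 hP1 hsP hsC θ u y g g' hu hbb2 hm d1 d2 hg hg'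
  have hT := tail_bound hN (κ := s) (T' := 1 / s) (t := s ^ 8) hτ.le hb (by positivity) θ u y g hbb
    hub d3 (hg (Sum.inr (Sum.inl 0)))
  have hT2 := gaussian_tail_bound (τ := τ) (b := b) (κ := s) (T' := 1 / s) (by positivity)
  have hI4 : 0 ≤ ∫ x : ℝ, x ^ 4 ∂(gaussianReal 0 1) := integral_nonneg fun x => by positivity
  have hI6 : 0 ≤ ∫ x : ℝ, x ^ 6 ∂(gaussianReal 0 1) := integral_nonneg fun x => by positivity
  have hQ0 : 0 ≤ Q := le_trans (mul_nonneg (by positivity)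
    (Finset.sum_nonneg fun i _ => by positivity)) hQ
  have hH : 0 < H := hτ.trans_le hτH
  have hd := Real.sqrt_nonneg δ
  have hW := W2sq_le (τ' := τ') hN hs (T := 36 * b ^ 2 + 9 * τ ^ 2 * (1 / s) + 4 * s ^ 2)
    (by positivity) (by positivity) (by positivity) (by positivity) (binSet s) θ (fun i => u i + y i)
    (fun i => y i + ν i / (1 - (l0 y : ℝ) / n)) hR hT hT2
  refine hW.trans ?_
  have hxd : (N : ℝ)⁻¹ * ∑ i, (y i + ν i / (1 - (l0 y : ℝ) / n) - (u i + y i)) ^ 2 ≤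
      (H * (2 * P ^ 2 * ((4 * P + 1 + P * √δ + √δ) / δ))) ^ 2 * s ^ 2 := by
    rw [inv_mul_le_iff₀ hN']
    calc _ ≤ ∑ _i : Fin N, (H * (2 * P ^ 2 * ((4 * P + 1 + P * √δ + √δ) / δ))) ^ 2 * s ^ 2 := by
          refine Finset.sum_le_sum fun i _ => ?_
          have e : y i + ν i / (1 - (l0 y : ℝ) / n) - (u i + y i) =
              ν i * (1 / (1 - (l0 y : ℝ) / n) - 1 / (β / τ)) := by
            simp only [hudef, hρdef, one_div_div]; ring
          rw [e, ← mul_pow, ← sq_abs, abs_mul]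
          have : |ν i| ≤ H := (hν i).1.trans (hll.trans hlH)
          calc _ ≤ (H * (2 * P ^ 2 * ((4 * P + 1 + P * √δ + √δ) / δ * s))) ^ 2 := by gcongr
            _ = _ := by ring
      _ = _ := by simp
  generalize (∫ x : ℝ, x ^ 4 ∂(gaussianReal 0 1)) = I4 at hI4 ⊢
  generalize (∫ x : ℝ, x ^ 6 ∂(gaussianReal 0 1)) = I6 at hI6 ⊢
  set C1 := 9 * Q + 8 * H ^ 4 * I4 + 4 * P + 2 * P * √δ + 4 * √δ + 32
  have hC1 : 0 ≤ C1 := by positivity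
  have s83 : s ^ 8 ≤ s ^ 2 := pow_le_pow_of_le_one hs.le hs1 (by norm_num)
  have eTR : 2 * (36 * b ^ 2 + 9 * τ ^ 2 * (1 / s) + 4 * s ^ 2) * (C1 * s ^ 3) ≤
      2 * (36 * P ^ 2 * H ^ 2 + 9 * H ^ 2 + 4) * C1 * s ^ 2 := by
    have hs3 : s ^ 3 ≤ s ^ 2 := pow_le_pow_of_le_one hs.le hs1 (by norm_num)
    have hs5 : s ^ 5 ≤ s ^ 2 := pow_le_pow_of_le_one hs.le hs1 (by norm_num)
    have e : 2 * (36 * b ^ 2 + 9 * τ ^ 2 * (1 / s) + 4 * s ^ 2) * (C1 * s ^ 3) =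
        2 * (36 * b ^ 2 * s ^ 3 + 9 * τ ^ 2 * s ^ 2 + 4 * s ^ 5) * C1 := by field_simp
    rw [e]
    calc _ ≤ 2 * (36 * (P * H) ^ 2 * s ^ 2 + 9 * H ^ 2 * s ^ 2 + 4 * s ^ 2) * C1 := by gcongr
      _ = _ := by ring
  have ea : 9 * ((s ^ 4) ^ 2 * δ) + 9 * τ ^ 2 * (s ^ 8 + I6 / (1 / s) ^ 2) ≤
      (9 * δ + 9 * H ^ 2 * (1 + I6)) * s ^ 2 := by
    have e : I6 / (1 / s) ^ 2 = I6 * s ^ 2 := by field_simp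
    have e2 : (s ^ 4) ^ 2 = s ^ 8 := by ring
    rw [e, e2]
    calc _ ≤ 9 * (s ^ 2 * δ) + 9 * H ^ 2 * (s ^ 2 + I6 * s ^ 2) := by gcongr
      _ = _ := by ring
  have ea' : 3 * τ ^ 2 * (I6 / (1 / s) ^ 2) ≤ 3 * H ^ 2 * I6 * s ^ 2 := by
    have e : I6 / (1 / s) ^ 2 = I6 * s ^ 2 := by field_simp
    rw [e]
    calc _ ≤ 3 * H ^ 2 * (I6 * s ^ 2) := by gcongr
      _ = _ := by ring
  calc _ ≤ 3 * (5 * s ^ 2 + 2 * (36 * P ^ 2 * H ^ 2 + 9 * H ^ 2 + 4) * C1 * s ^ 2 +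
        (9 * δ + 9 * H ^ 2 * (1 + I6)) * s ^ 2 + 3 * H ^ 2 * I6 * s ^ 2) +
        3 * ((H * (2 * P ^ 2 * ((4 * P + 1 + P * √δ + √δ) / δ))) ^ 2 * s ^ 2) +
        3 * (τ' - τ) ^ 2 := by gcongr
    _ = _ := by ring

/-- The Lasso solution and its dual certificate look like their Gaussian limits at scale `s`. -/
def LassoTyp (σ : ℝ) {n N : ℕ} (θ : Fin N → ℝ) (lam β τ s : ℝ)
    (ω : (Fin n → Fin N → ℝ) × (Fin n → ℝ)) (y : Fin N → ℝ) : Prop :=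
  (∃ g ∈ typ (allTest θ τ (τ * lam / β) s) (s ^ 8),
    l2 (y - θ - wv θ τ (τ * lam / β) g) ≤ s ^ 4 * √n) ∧
  (∃ g ∈ typ (allTest θ τ (τ * lam / β) s) (s ^ 8),
    l2 (resCorr ω.1 (yvec σ θ ω.1 ω.2) y - nv θ τ (τ * lam / β) β g) ≤ s ^ 4 * √n)

lemma prob_not_lassoTyp_le {δ σ lo hi : ℝ} (hδ : 0 < δ) (hlo : 0 < lo) (hlh : lo ≤ hi)
    (hhδ : 1 ≤ hi * δ) :
    ∃ c3 C c : ℝ, 0 < c3 ∧ c3 ≤ 1 ∧ 0 < C ∧ 0 < c ∧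
      ∀ (N n : ℕ) (θ : Fin N → ℝ) (lam β τ s : ℝ), 0 < N → (n : ℝ) = δ * N → lo ≤ lam → lam ≤ hi →
      StateEvo δ σ (empDist θ) lam β τ → lo ≤ β → β ≤ hi → lo ≤ τ → τ ≤ hi → lo ≤ σ → σ ≤ hi →
      penMean n θ lam β τ ≤ hi → 0 < s → s ≤ 1 →
      (∀ (X : Fin n → Fin N → ℝ) (z : Fin n → ℝ), ∃ y, IsMinOn (lassoCost X (yvec σ θ X z) lam)
        Set.univ y) →
      Pmodel n N {ω | ∃ l y, lo ≤ l ∧ l ≤ lam ∧ lam ≤ l + c3 * s ^ 8 ∧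
        IsMinOn (lassoCost ω.1 (yvec σ θ ω.1 ω.2) l) Set.univ y ∧
        ¬ LassoTyp σ θ lam β τ s ω y} ≤ ENNReal.ofReal (C / s ^ 4 * Real.exp (-c * N * s ^ 16)) := by
  obtain ⟨c2, c3, hc2, hc21, hc3, H⟩ := model_typical hlo hlh
  have hhi : 0 < hi := hlo.trans_le hlh
  set A := 2 * hi ^ 2 + 2 * (hi * hi / lo) ^ 2 + 2 * hi + hi * hi / lo + 2 with hA
  have hA0 : 0 < A := by positivity
  set ct := min (min δ (δ / hi)) 1 with hct
  have hct0 : 0 < ct := by positivity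
  have hctδ : ct ≤ δ := (min_le_left _ _).trans (min_le_left _ _)
  have hcth : ct ≤ δ / hi := (min_le_left _ _).trans (min_le_right _ _)
  have hct1 : ct ≤ 1 := min_le_right _ _
  obtain ⟨C, c, hC, hc, HC⟩ := stdPi_good_compl_le hA0 hδ hct0 hct1
  refine ⟨min c3 1, 8 * (C * 39), c * c2 ^ 2, by positivity, min_le_right _ _, by positivity,
    by positivity, ?_⟩
  intro N n θ lam β τ s hN hn hl hl' hse hβ hβ' hτ hτ' hσ hσ' hm hs hs1 hmin
  have hN' : (0 : ℝ) < N := by exact_mod_cast hN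
  have hn' : (0 : ℝ) < n := by rw [hn]; positivity
  have hn0 : 0 < n := by exact_mod_cast hn'
  have hβ0 := hlo.trans_le hβ
  have hτ0 := hlo.trans_le hτ
  have hl0 := hlo.trans_le hl
  have hb : 0 ≤ τ * lam / β := by positivity
  have hbA : τ * lam / β ≤ hi * hi / lo := by gcongr
  have hNn : (N : ℝ) ≤ hi * n := by
    rw [hn, ← mul_assoc]; exact le_mul_of_one_le_left hN'.le hhδ
  set e := c2 * (s ^ 4) ^ 2 with he
  have hs8 : (s ^ 4) ^ 2 = s ^ 8 := by ring
  have hs81 : s ^ 8 ≤ 1 := pow_le_one₀ hs.le hs1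
  have he0 : 0 < e := by positivity
  have hes : e ≤ s ^ 8 := by
    rw [he, hs8]; exact mul_le_of_le_one_left (by positivity) hc21.le
  have hte : ct * e ≤ s ^ 8 := (mul_le_of_le_one_left he0.le hct1).trans hes
  have h1 := H n N β τ σ lam (penMean n θ lam β τ) (s ^ 4) θ hn0 hNn hl hl' hβ hβ' hτ hτ' hσ hσ' hm
    (by positivity) (pow_le_one₀ hs.le hs1) hmin (typ (allTest θ τ (τ * lam / β) s) (ct * e))
  have h2 := HC n N hn0 hn (TestIdx s) (allTest θ τ (τ * lam / β) s)
    (measurable_allTest θ τ hb s) (abs_allTest_le θ hτ0.le hb hs (by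
      have h3 : τ ^ 2 ≤ hi ^ 2 := by gcongr
      have h4 : (τ * lam / β) ^ 2 ≤ (hi * hi / lo) ^ 2 := by gcongr
      rw [hA]; linarith) (by
      have h3 : 0 ≤ 2 * hi ^ 2 + 2 * (hi * hi / lo) ^ 2 + 2 * hi + hi * hi / lo := by positivity
      rw [hA]; linarith)) e he0 (hes.trans hs81)
  refine (measure_mono ?_).trans (h1.trans ((mul_le_mul_right ((measure_mono ?_).trans h2) 8).trans ?_))
  · rintro ω ⟨l, y, g1, g2, g3, g4, g5⟩
    refine ⟨l, y, g1, g2, ?_, g4, fun h => g5 ?_⟩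
    · rw [hs8]; refine g3.trans ?_; gcongr; exact min_le_left _ _
    · obtain ⟨⟨ga, ha1, ha2⟩, gb, hb1, hb2⟩ := h
      exact ⟨⟨ga, typ_mono hte ha1, ha2⟩, gb, typ_mono hte hb1, hb2⟩
  · intro ω hω
    by_contra hcon
    simp only [Set.mem_ofPred_eq, not_or, not_not] at hcon
    obtain ⟨⟨k1, k2⟩, k3⟩ := hcon
    rcases hω with hω | hω
    · refine hω (mem_goodEv_of_typ hN hδ hn hl0.le hse (t := ct * e) (by gcongr) ?_ k1 k2
        (typ_allTest_base k3))
      calc lam * (ct * e) ≤ hi * (δ / hi * e) := by gcongr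
        _ = δ * e := by field_simp
    · exact hω k3
  · rw [show (8 : ℝ≥0∞) = ENNReal.ofReal 8 by simp, ← ENNReal.ofReal_mul (by norm_num)]
    refine ENNReal.ofReal_le_ofReal ?_
    have h3 := card_testIdx_le hs hs1
    have e1 : -c * N * e ^ 2 = -(c * c2 ^ 2) * N * s ^ 16 := by rw [he]; ring
    rw [e1]
    calc _ ≤ 8 * (C * (39 / s ^ 4) * Real.exp (-(c * c2 ^ 2) * N * s ^ 16)) := by gcongr
      _ = _ := by ring

lemma l2_le_add_l2_sub {ι : Type*} [Fintype ι] (u v : ι → ℝ) : l2 u ≤ l2 (u - v) + l2 v := by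
  have h := sum_mul_le_l2 (u - v) v
  have e : l2 u ^ 2 = l2 (u - v) ^ 2 + 2 * ∑ i, (u - v) i * v i + l2 v ^ 2 := by
    rw [l2_sq, l2_sq, l2_sq, Finset.mul_sum, ← Finset.sum_add_distrib, ← Finset.sum_add_distrib]
    exact Finset.sum_congr rfl fun i _ => by simp only [Pi.sub_apply]; ring
  have h0 := l2_nonneg (u - v)
  have h1 := l2_nonneg v
  refine (pow_le_pow_iff_left₀ (l2_nonneg u) (by positivity) two_ne_zero).1 ?_
  rw [e]; linarith [add_sq (l2 (u - v)) (l2 v)]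

lemma abs_l2_sub_l2_le {ι : Type*} [Fintype ι] (u v : ι → ℝ) : |l2 u - l2 v| ≤ l2 (u - v) := by
  have h1 := l2_le_add_l2_sub u v
  have h2 := l2_le_add_l2_sub v u
  have e : l2 (v - u) = l2 (u - v) := by
    unfold l2; congr 1; exact Finset.sum_congr rfl fun i _ => by simp only [Pi.sub_apply]; ring
  rw [abs_le]; constructor <;> linarith

/-- The effective noise levels of two fixed points sharing a typical vector are close. -/
lemma abs_tau_sub_le {N n : ℕ} {δ σ lo hi : ℝ} (hδ : 0 < δ) (hlo : 0 < lo) (hN : 0 < N)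
    (hn : (n : ℝ) = δ * N) {θ : Fin N → ℝ} {lam β τ lam' β' τ' s : ℝ} (hl : 0 ≤ lam)
    (hl' : 0 ≤ lam') (h : StateEvo δ σ (empDist θ) lam β τ)
    (h' : StateEvo δ σ (empDist θ) lam' β' τ') (hτ : lo ≤ τ) (hτ' : lo ≤ τ') (hτh : τ ≤ hi)
    (hτh' : τ' ≤ hi) (hs : 0 < s) (hs1 : s ≤ 1) {ω : (Fin n → Fin N → ℝ) × (Fin n → ℝ)}
    {y : Fin N → ℝ} (hy : LassoTyp σ θ lam β τ s ω y) (hy' : LassoTyp σ θ lam' β' τ' s ω y) :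
    |τ' - τ| ≤ (4 * (1 + hi ^ 2 + 1 / δ) + 2 / δ) / (2 * lo) * s := by
  have hN' : (0 : ℝ) < N := by exact_mod_cast hN
  have hn' : (0 : ℝ) < n := by rw [hn]; positivity
  have hsn : 0 < √(n : ℝ) := Real.sqrt_pos.2 hn'
  have hs8 : s ^ 8 ≤ s := by simpa using pow_le_pow_of_le_one hs.le hs1 (show 1 ≤ 8 by norm_num)
  have hs4 : s ^ 4 ≤ s := by simpa using pow_le_pow_of_le_one hs.le hs1 (show 1 ≤ 4 by norm_num)
  have key : ∀ lam β τ : ℝ, 0 ≤ lam → StateEvo δ σ (empDist θ) lam β τ → 0 ≤ τ → τ ≤ hi →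
      LassoTyp σ θ lam β τ s ω y → ∃ a : ℝ, 0 ≤ a ∧ a ≤ 1 + hi ^ 2 + 1 / δ ∧
        |l2 (y - θ) / √n - a| ≤ s ∧ |a ^ 2 - (τ ^ 2 - σ ^ 2)| ≤ 1 / δ * s := by
    intro lam β τ hl h hτ hτh ⟨⟨g, hg, hg2⟩, _⟩
    have m1 := (state_evo_means hN hδ hn hl h).1
    have t1 := hg (Sum.inl 0)
    have e1 : ∑ i, allTest θ τ (τ * lam / β) s (Sum.inl 0) i (g i) =
        l2 (wv θ τ (τ * lam / β) g) ^ 2 := by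
      rw [l2_sq]; exact Finset.sum_congr rfl fun i _ => rfl
    have e2 : ∑ i, ∫ x, allTest θ τ (τ * lam / β) s (Sum.inl 0) i x ∂(gaussianReal 0 1) =
        n * (τ ^ 2 - σ ^ 2) := m1
    rw [e1, e2] at t1
    have k1 : |(l2 (wv θ τ (τ * lam / β) g) / √n) ^ 2 - (τ ^ 2 - σ ^ 2)| ≤ 1 / δ * s := by
      have e3 : (l2 (wv θ τ (τ * lam / β) g) / √n) ^ 2 - (τ ^ 2 - σ ^ 2) =
          (l2 (wv θ τ (τ * lam / β) g) ^ 2 - n * (τ ^ 2 - σ ^ 2)) / n := by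
        rw [div_pow, Real.sq_sqrt hn'.le]; field_simp
      rw [e3, abs_div, abs_of_pos hn', div_le_iff₀ hn']
      calc _ ≤ s * N := t1.trans (by gcongr)
        _ = _ := by rw [hn]; field_simp
    set a := l2 (wv θ τ (τ * lam / β) g) / √n with ha
    have a0 : 0 ≤ a := div_nonneg (l2_nonneg _) hsn.le
    refine ⟨a, a0, ?_, ?_, k1⟩
    · have h1 := (abs_le.1 k1).2
      have h2 : τ ^ 2 ≤ hi ^ 2 := by gcongr
      have h3 : 1 / δ * s ≤ 1 / δ := mul_le_of_le_one_right (by positivity) hs1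
      have h4 := sq_nonneg (a - 1)
      have h5 := sq_nonneg σ
      have h6 := sq_nonneg a
      linarith [sub_sq a 1]
    · rw [ha, ← sub_div, abs_div, abs_of_pos hsn, div_le_iff₀ hsn]
      exact (abs_l2_sub_l2_le _ _).trans (hg2.trans (by gcongr))
  obtain ⟨a, ha0, ha, ha1, ha2⟩ := key lam β τ hl h (hlo.le.trans hτ) hτh hy
  obtain ⟨a', ha0', ha', ha1', ha2'⟩ := key lam' β' τ' hl' h' (hlo.le.trans hτ') hτh' hy'
  set B := 1 + hi ^ 2 + 1 / δ
  have d1 : |a' - a| ≤ 2 * s := by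
    have h1 := abs_le.1 ha1
    have h2 := abs_le.1 ha1'
    rw [abs_le]; constructor <;> linarith [h1.1, h1.2, h2.1, h2.2]
  have d2 : |a' ^ 2 - a ^ 2| ≤ 4 * B * s := by
    rw [sq_sub_sq, abs_mul, abs_of_nonneg (by positivity)]
    calc (a' + a) * |a' - a| ≤ (B + B) * (2 * s) := by gcongr
      _ = _ := by ring
  have d3 : |τ' ^ 2 - τ ^ 2| ≤ (4 * B + 2 / δ) * s := by
    have h1 := abs_le.1 ha2
    have h2 := abs_le.1 ha2'
    have h3 := abs_le.1 d2
    have e : (4 * B + 2 / δ) * s = 4 * B * s + 2 * (1 / δ * s) := by ring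
    rw [e, abs_le]; constructor <;> linarith [h1.1, h1.2, h2.1, h2.2, h3.1, h3.2]
  rw [sq_sub_sq, abs_mul, abs_of_nonneg (by linarith)] at d3
  rw [div_mul_eq_mul_div, le_div_iff₀ (by positivity)]
  calc |τ' - τ| * (2 * lo) ≤ |τ' - τ| * (τ' + τ) := by gcongr; linarith
    _ ≤ _ := by rw [mul_comm]; exact d3

lemma prob_tradeoff {C c ε x : ℝ} (hC : 0 < C) (hc : 0 < c) (hε : 0 < ε) (hε1 : ε ≤ 1)
    (hx : 0 ≤ x) {p : ℝ≥0∞} (hp : p ≤ 1)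
    (h : p ≤ ENNReal.ofReal (C / ε ^ 12 * Real.exp (-c * x * ε ^ 16))) :
    p ≤ ENNReal.ofReal ((Real.exp 1 + 2 * C) / ε ^ 11 * Real.exp (-(c / 2) * x * ε ^ 17)) := by
  set y := c * x * ε ^ 16 with hy
  have hy0 : 0 ≤ y := by positivity
  have e1 : -c * x * ε ^ 16 = -y := by rw [hy]; ring
  have e2 : -(c / 2) * x * ε ^ 17 = -(y * ε / 2) := by rw [hy]; ring
  have hε11 : 1 ≤ 1 / ε ^ 11 := by
    rw [le_div_iff₀ (by positivity), one_mul]; exact pow_le_one₀ hε.le hε1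
  rw [e2]
  rw [e1] at h
  rcases le_total (y * ε) 1 with h1 | h1
  · refine hp.trans (ENNReal.one_le_ofReal.2 ?_)
    have h2 : Real.exp (-1) ≤ Real.exp (-(y * ε / 2)) := Real.exp_le_exp.2 (by linarith)
    calc (1 : ℝ) = Real.exp 1 * 1 * Real.exp (-1) := by rw [mul_one, ← Real.exp_add]; simp
      _ ≤ (Real.exp 1 + 2 * C) * (1 / ε ^ 11) * Real.exp (-(y * ε / 2)) := by
          gcongr; linarith
      _ = _ := by ring
  · refine h.trans (ENNReal.ofReal_le_ofReal ?_)
    have h2 : 1 / ε ≤ y := by rw [div_le_iff₀ hε]; exact h1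
    have h3 : y ≤ 2 * Real.exp (y / 2) := by linarith [Real.add_one_le_exp (y / 2)]
    have h4 : y * ε / 2 ≤ y / 2 := by
      have := mul_le_of_le_one_right hy0 hε1; linarith
    calc C / ε ^ 12 * Real.exp (-y) = C / ε ^ 11 * (1 / ε) * Real.exp (-y) := by
          field_simp
      _ ≤ C / ε ^ 11 * (2 * Real.exp (y / 2)) * Real.exp (-y) := by
          gcongr; exact h2.trans h3
      _ = 2 * C / ε ^ 11 * Real.exp (-(y / 2)) := by
          have : Real.exp (-(y / 2)) = Real.exp (y / 2) * Real.exp (-y) := by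
            rw [← Real.exp_add]; congr 1; ring
          rw [this]; ring
      _ ≤ _ := by
          gcongr
          linarith [Real.exp_pos 1]

/-- A finite net of `[a, b]` from above. -/
lemma exists_upper_net {a b D : ℝ} (hab : a ≤ b) (hD : 0 < D) (hD1 : D ≤ 1) :
    ∃ (K : ℕ) (f : ℕ → ℝ), (K : ℝ) ≤ (b - a + 2) / D ∧ (∀ k, f k ∈ Set.Icc a b) ∧
      ∀ x ∈ Set.Icc a b, ∃ k ∈ Finset.range K, x ≤ f k ∧ f k ≤ x + D := by
  refine ⟨⌈(b - a) / D⌉₊ + 1, fun k => min b (a + k * D), ?_, ?_, ?_⟩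
  · have h1 := (Nat.ceil_lt_add_one (show 0 ≤ (b - a) / D from
      div_nonneg (by linarith) hD.le)).le
    have h2 : 1 ≤ 1 / D := by rw [le_div_iff₀ hD]; linarith
    have e : (b - a + 2) / D = (b - a) / D + 2 * (1 / D) := by ring
    push_cast
    rw [e]; linarith
  · intro k
    exact ⟨le_min hab (le_add_of_nonneg_right (by positivity)), min_le_left _ _⟩
  · rintro x ⟨hx1, hx2⟩
    have h0 : 0 ≤ (x - a) / D := div_nonneg (by linarith) hD.le
    refine ⟨⌈(x - a) / D⌉₊, Finset.mem_range.2 (Nat.lt_succ_of_le (Nat.ceil_mono (by gcongr))),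
      le_min hx2 ?_, (min_le_right _ _).trans ?_⟩
    · have := Nat.le_ceil ((x - a) / D)
      rw [div_le_iff₀ hD] at this
      linarith
    · have h1 := (Nat.ceil_lt_add_one h0).le
      have h2 : (⌈(x - a) / D⌉₊ : ℝ) * D ≤ ((x - a) / D + 1) * D := by gcongr
      have h3 : ((x - a) / D + 1) * D = x - a + D := by field_simp
      linarith

set_option maxHeartbeats 1000000 in
/-- Theorem 3: uniform Wasserstein control of the empirical distribution of the
debiased Lasso, over θ⋆ ∈ F_4(ξ) and λ ∈ [λ_min, λ_max]. -/
theorem stmt3 (δ σ lmin lmax ξ : ℝ)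
    (hδ : 0 < δ) (hσ : 0 < σ) (hl : 0 < lmin) (hll : lmin ≤ lmax) (hξ : 0 < ξ) :
    ∃ C c : ℝ, 0 < C ∧ 0 < c ∧
      ∀ (N n : ℕ), 0 < N → (n : ℝ) = δ * N →
      ∀ θstar ∈ Fball N 4 ξ,
      ∀ βstar τstar : ℝ → ℝ,
      (∀ lam ∈ Set.Icc lmin lmax,
        StateEvo δ σ (empDist θstar) lam (βstar lam) (τstar lam)) →
      ∀ θhat : ℝ → (Fin n → Fin N → ℝ) → (Fin n → ℝ) → (Fin N → ℝ),
      (∀ lam ∈ Set.Icc lmin lmax, ∀ (X : Fin n → Fin N → ℝ) (z : Fin n → ℝ),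
        IsMinOn (lassoCost X (yvec σ θstar X z) lam) Set.univ (θhat lam X z)) →
      ∀ ε : ℝ, ε ∈ Set.Ioc (0 : ℝ) 1 →
      Pmodel n N
        {ω | ∃ lam ∈ Set.Icc lmin lmax,
          ε ≤ W2 (empDist2
                (debiased ω.1 (yvec σ θstar ω.1 ω.2) (θhat lam ω.1 ω.2)) θstar)
              (muStarD (empDist θstar) (τstar lam))}
      ≤ ENNReal.ofReal (C / ε ^ 11 * Real.exp (-c * N * ε ^ 17)) := by
  obtain ⟨lo, hi, hlo, hlh, hσlo, hσhi, hlmin, hlmax, hhδ, hhi1, hlo1, -, HS⟩ :=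
    state_evo_bounds (ξ := ξ) hδ hσ hl hll
  obtain ⟨c3, C, c, hc3, hc31, hC, hc, HP⟩ := prob_not_lassoTyp_le (σ := σ) hδ hlo hlh hhδ
  have hhi : 0 < hi := hlo.trans_le hlh
  set P := hi / lo with hPdef
  have hP1 : 1 ≤ P := (one_le_div hlo).2 hlh
  have hP0 : 0 < P := by linarith
  have hsδ := Real.sqrt_nonneg δ
  have hI4 : 0 ≤ ∫ x : ℝ, x ^ 4 ∂(gaussianReal 0 1) := integral_nonneg fun x => by positivity
  have hI6 : 0 ≤ ∫ x : ℝ, x ^ 6 ∂(gaussianReal 0 1) := integral_nonneg fun x => by positivity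
  obtain ⟨A0, hA0def⟩ : ∃ A0, A0 = (3 * (5 + 2 * (36 * P ^ 2 * hi ^ 2 + 9 * hi ^ 2 + 4) *
        (9 * ξ ^ 4 + 8 * hi ^ 4 * (∫ x, x ^ 4 ∂(gaussianReal 0 1)) + 4 * P + 2 * P * √δ +
          4 * √δ + 32) +
        (9 * δ + 9 * hi ^ 2 * (1 + ∫ x, x ^ 6 ∂(gaussianReal 0 1))) +
        3 * hi ^ 2 * ∫ x, x ^ 6 ∂(gaussianReal 0 1)) +
      3 * (hi * (2 * P ^ 2 * ((4 * P + 1 + P * √δ + √δ) / δ))) ^ 2) := ⟨_, rfl⟩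
  have hA0 : 0 ≤ A0 := by rw [hA0def]; positivity
  obtain ⟨Ct, hCtdef⟩ : ∃ Ct, Ct = (4 * (1 + hi ^ 2 + 1 / δ) + 2 / δ) / (2 * lo) := ⟨_, rfl⟩
  have hCt : 0 ≤ Ct := by rw [hCtdef]; positivity
  obtain ⟨C4, hC4def⟩ : ∃ C4, C4 = (4 * P + 1 + P * √δ + √δ) / δ := ⟨_, rfl⟩
  have hC4 : 0 < C4 := by rw [hC4def]; positivity
  set At := 1 + A0 + 3 * Ct ^ 2 with hAt
  have hAt1 : 1 ≤ At := by rw [hAt]; linarith [sq_nonneg Ct]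
  have hAt0 : 0 < At := by linarith
  obtain ⟨c4, hc4, hc41, hc4P, hc4C, hc4A⟩ : ∃ c4 : ℝ, 0 < c4 ∧ c4 ≤ 1 ∧ P * c4 ≤ 1 ∧
      C4 * c4 ≤ 1 / (2 * P) ∧ At * c4 ^ 2 ≤ 1 := by
    refine ⟨min (min 1 (1 / P)) (min (1 / (2 * P * C4)) (1 / At)), by positivity,
      (min_le_left _ _).trans (min_le_left _ _), ?_, ?_, ?_⟩
    · calc _ ≤ P * (1 / P) := by
            gcongr; exact (min_le_left _ _).trans (min_le_right _ _)
        _ = 1 := by field_simp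
    · calc _ ≤ C4 * (1 / (2 * P * C4)) := by
            gcongr; exact (min_le_right _ _).trans (min_le_left _ _)
        _ = _ := by field_simp
    · calc _ ≤ At * (1 / At) ^ 2 := by
            gcongr; exact (min_le_right _ _).trans (min_le_right _ _)
        _ = 1 / At := by field_simp
        _ ≤ 1 := by rw [div_le_one hAt0]; exact hAt1
  set L := (lmax - lmin + 2) / c3 with hL
  have hL2 : 2 ≤ L := by
    rw [hL, le_div_iff₀ hc3]; linarith
  refine ⟨Real.exp 1 + 2 * (2 * L * C / c4 ^ 12), c * c4 ^ 16 / 2, by positivity, by positivity, ?_⟩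
  intro N n hN hn θ hθ βs τs hse θhat hmin ε ⟨hε, hε1⟩
  have hN' : (0 : ℝ) < N := by exact_mod_cast hN
  have := Fball_four hN hθ
  have hQ : (N : ℝ)⁻¹ * ∑ i, θ i ^ 4 ≤ ξ ^ 4 := by rw [inv_mul_le_iff₀ hN']; linarith
  have hn' : (0 : ℝ) < n := by rw [hn]; positivity
  have hn0 : 0 < n := by exact_mod_cast hn'
  refine prob_tradeoff (by positivity) (by positivity) hε hε1 hN'.le prob_le_one ?_
  set s := c4 * ε with hs
  have hs0 : 0 < s := by positivity
  have hs1 : s ≤ 1 := mul_le_one₀ hc41 hε.le hε1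
  have hsc : s ≤ c4 := mul_le_of_le_one_right hc4.le hε1
  have hsP : P * s ≤ 1 := le_trans (by gcongr) hc4P
  have hsC : C4 * s ≤ 1 / (2 * P) := le_trans (by gcongr) hc4C
  set B := C / s ^ 4 * Real.exp (-c * N * s ^ 16) with hB
  have hB0 : 0 < B := by positivity
  set Bad : ℝ → Set ((Fin n → Fin N → ℝ) × (Fin n → ℝ)) := fun lam =>
    {ω | ∃ l y, lo ≤ l ∧ l ≤ lam ∧ lam ≤ l + c3 * s ^ 8 ∧
        IsMinOn (lassoCost ω.1 (yvec σ θ ω.1 ω.2) l) Set.univ y ∧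
        ¬ LassoTyp σ θ lam (βs lam) (τs lam) s ω y} with hBad
  have hPB : ∀ lam ∈ Set.Icc lmin lmax, Pmodel n N (Bad lam) ≤ ENNReal.ofReal B := by
    intro lam hlam
    obtain ⟨b1, b2, b3, b4, b5, -⟩ := HS N n θ lam _ _ hN hn hθ hlam.1 hlam.2 (hse lam hlam)
    exact HP N n θ lam _ _ s hN hn (hlmin.trans hlam.1) (hlam.2.trans hlmax) (hse lam hlam)
      b1 b3 b2 b4 hσlo hσhi b5 hs0 hs1 fun X z => ⟨_, hmin lam hlam X z⟩
  have hfin : 2 * L * C / c4 ^ 12 / ε ^ 12 * Real.exp (-(c * c4 ^ 16) * N * ε ^ 16) =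
      2 * (L / s ^ 8) * B := by
    have e : -(c * c4 ^ 16) * N * ε ^ 16 = -c * N * s ^ 16 := by rw [hs]; ring
    rw [e, hB, hs]; field_simp
  rw [hfin]
  have hs8 : 1 ≤ 1 / s ^ 8 := by
    rw [le_div_iff₀ (by positivity), one_mul]; exact pow_le_one₀ hs0.le hs1
  have hLs : 1 ≤ L / s ^ 8 := by rw [div_eq_mul_one_div]; nlinarith
  rcases le_or_gt 1 (2 * B) with hB1 | hB1
  · refine prob_le_one.trans (ENNReal.one_le_ofReal.2 ?_)
    calc (1 : ℝ) ≤ 2 * 1 * B := by linarith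
      _ ≤ _ := by gcongr
  have hτcmp : ∀ lam ∈ Set.Icc lmin lmax, ∀ lam' ∈ Set.Icc lmin lmax, lam ≤ lam' →
      lam' ≤ lam + c3 * s ^ 8 → |τs lam - τs lam'| ≤ Ct * s := by
    intro lam hlam lam' hlam' h1 h2
    have hlt : Pmodel n N (Bad lam ∪ Bad lam') < 1 := by
      calc _ ≤ ENNReal.ofReal B + ENNReal.ofReal B :=
            (measure_union_le _ _).trans (add_le_add (hPB lam hlam) (hPB lam' hlam'))
        _ = ENNReal.ofReal (2 * B) := by rw [← ENNReal.ofReal_add hB0.le hB0.le, two_mul]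
        _ < 1 := by rw [ENNReal.ofReal_lt_one]; exact hB1
    obtain ⟨ω, hω⟩ : ∃ ω, ω ∉ Bad lam ∪ Bad lam' := by
      by_contra hcon
      push Not at hcon
      rw [Set.eq_univ_of_forall hcon, measure_univ] at hlt
      exact lt_irrefl _ hlt
    simp only [Set.mem_union, not_or] at hω
    obtain ⟨w1, w2⟩ := hω
    have g1 : LassoTyp σ θ lam (βs lam) (τs lam) s ω (θhat lam ω.1 ω.2) := by
      by_contra hcon
      exact w1 ⟨lam, _, hlmin.trans hlam.1, le_rfl, le_add_of_nonneg_right (by positivity),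
        hmin lam hlam _ _, hcon⟩
    have g2 : LassoTyp σ θ lam' (βs lam') (τs lam') s ω (θhat lam ω.1 ω.2) := by
      by_contra hcon
      exact w2 ⟨lam, _, hlmin.trans hlam.1, h1, h2, hmin lam hlam _ _, hcon⟩
    obtain ⟨-, b2, -, b4, -, -⟩ := HS N n θ lam _ _ hN hn hθ hlam.1 hlam.2 (hse lam hlam)
    obtain ⟨-, b2', -, b4', -, -⟩ := HS N n θ lam' _ _ hN hn hθ hlam'.1 hlam'.2 (hse lam' hlam')
    rw [hCtdef]
    exact abs_tau_sub_le hδ hlo hN hn (hl.le.trans hlam'.1) (hl.le.trans hlam.1) (hse lam' hlam')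
      (hse lam hlam) b2' b2 b4' b4 hs0 hs1 g2 g1
  obtain ⟨K, f, hK, hf, hnet⟩ := exists_upper_net hll (show 0 < c3 * s ^ 8 by positivity)
    (mul_le_one₀ hc31 (by positivity) (pow_le_one₀ hs0.le hs1))
  have hsub : {ω | ∃ lam ∈ Set.Icc lmin lmax,
          ε ≤ W2 (empDist2
                (debiased ω.1 (yvec σ θ ω.1 ω.2) (θhat lam ω.1 ω.2)) θ)
              (muStarD (empDist θ) (τs lam))} ⊆ ⋃ k ∈ Finset.range K, Bad (f k) := by
    rintro ω ⟨lam, hlam, hW⟩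
    by_contra hcon
    obtain ⟨k, hk, k1, k2⟩ := hnet lam hlam
    have hg : LassoTyp σ θ (f k) (βs (f k)) (τs (f k)) s ω (θhat lam ω.1 ω.2) := by
      by_contra hc
      exact hcon (Set.mem_biUnion hk ⟨lam, _, hlmin.trans hlam.1, k1, k2, hmin lam hlam _ _, hc⟩)
    obtain ⟨⟨g, hg1, hg2⟩, g', hg1', hg2'⟩ := hg
    have hlk := hf k
    obtain ⟨b1, b2, b3, b4, -, -⟩ := HS N n θ (f k) _ _ hN hn hθ hlk.1 hlk.2 (hse _ hlk)
    have hfin := W2sq_scale (τ' := τs lam) (P := P) (H := hi) (Q := ξ ^ 4) hN hδ hn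
      (hlo.trans_le b2) (hlo.trans_le b1) b4 (hlk.2.trans hlmax) (hl.le.trans hlam.1)
      (by rw [hPdef]; gcongr) (by rw [hPdef]; gcongr) hP1 hs0 hs1 hsP (by rw [← hC4def]; exact hsC)
      θ (θhat lam ω.1 ω.2) (resCorr ω.1 (yvec σ θ ω.1 ω.2) (θhat lam ω.1 ω.2)) g g' hQ k1
      (k2.trans (by gcongr; exact mul_le_of_le_one_left (by positivity) hc31))
      (fun i => lasso_kkt hn0 (hl.le.trans hlam.1) (hmin lam hlam _ _) i)
      (state_evo_means hN hδ hn (hl.le.trans hlk.1) (hse _ hlk)).2.2 hg2' hg2 hg1 hg1'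
    rw [← hA0def] at hfin
    have hτ := hτcmp lam hlam (f k) hlk k1 k2
    have hτ2 : (τs lam - τs (f k)) ^ 2 ≤ (Ct * s) ^ 2 := by rw [← sq_abs]; gcongr
    have hW2 : ε ^ 2 ≤ W2sq (empDist2
                (debiased ω.1 (yvec σ θ ω.1 ω.2) (θhat lam ω.1 ω.2)) θ)
              (muStarD (empDist θ) (τs lam)) := (Real.le_sqrt' hε).1 hW
    have hle := hW2.trans hfin
    have h1 : At * s ^ 2 ≤ ε ^ 2 := by
      calc At * s ^ 2 = At * c4 ^ 2 * ε ^ 2 := by rw [hs]; ring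
        _ ≤ 1 * ε ^ 2 := by gcongr
        _ = _ := one_mul _
    have h2 : At * s ^ 2 = s ^ 2 + A0 * s ^ 2 + 3 * (Ct * s) ^ 2 := by rw [hAt]; ring
    have h3 : 0 < s ^ 2 := by positivity
    linarith
  calc _ ≤ ∑ k ∈ Finset.range K, Pmodel n N (Bad (f k)) :=
        (measure_mono hsub).trans (measure_biUnion_finset_le _ _)
    _ ≤ ∑ _k ∈ Finset.range K, ENNReal.ofReal B := Finset.sum_le_sum fun k _ => hPB _ (hf k)
    _ = ENNReal.ofReal (K * B) := by
        rw [Finset.sum_const, Finset.card_range, nsmul_eq_mul,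
          ENNReal.ofReal_mul (p := (K : ℝ)) (Nat.cast_nonneg _), ENNReal.ofReal_natCast]
    _ ≤ _ := by
        refine ENNReal.ofReal_le_ofReal ?_
        have e : (lmax - lmin + 2) / (c3 * s ^ 8) = L / s ^ 8 := by rw [hL, div_div]
        rw [e] at hK
        have : 0 < L / s ^ 8 := by linarith
        calc (K : ℝ) * B ≤ (L / s ^ 8) * B := by gcongr
          _ ≤ 2 * (L / s ^ 8) * B := by gcongr; linarith
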